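/- Let d ≥ 4, let m be an integer with 3 ≤ m ≤ d − 1, and let 0 < α ≤ d. Then for every β < min{ α − 1 + (d−α)(m−α)/((m−1)(2m−α−1)), α − α/m } there exists a constant C (depending on d, m, α, β) such that for every α-dimensional measure μ on ℝ^d and every R > 1, ∫_{S^{d−1}} |μ̂(Rω)|² dσ(ω) ≤ C · c_α(μ) · μ(ℝ^d) · R^{−β}. (That is, β_d(α) ≥ min{ α − 1 + (d−α)(m−α)/((m−1)(2m−α−1)), α − α/m }.) -/

import Mathlib

open MeasureTheory Metric Filter Set
open scoped ENNReal InnerProductSpace Topology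

noncomputable def sphereMeasure (d : ℕ) : Measure (EuclideanSpace ℝ (Fin d)) :=
  (μH[(d : ℝ) - 1]).restrict (sphere (0 : EuclideanSpace ℝ (Fin d)) 1)

noncomputable def cAlpha (d : ℕ) (α : ℝ) (μ : Measure (EuclideanSpace ℝ (Fin d))) : ℝ≥0∞ :=
  ⨆ (x : EuclideanSpace ℝ (Fin d)) (r : ℝ) (_ : 0 < r), μ (ball x r) / ENNReal.ofReal (r ^ α)

def IsAlphaDimensional (d : ℕ) (α : ℝ) (μ : Measure (EuclideanSpace ℝ (Fin d))) : Prop :=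
  μ (closedBall 0 1)ᶜ = 0 ∧ cAlpha d α μ ≠ ⊤

noncomputable def fourierMeasure {d : ℕ} (μ : Measure (EuclideanSpace ℝ (Fin d)))
    (ξ : EuclideanSpace ℝ (Fin d)) : ℂ :=
  (((2 * Real.pi) ^ (-(d : ℝ) / 2) : ℝ) : ℂ) *
    ∫ x, Complex.exp (-Complex.I * ((⟪x, ξ⟫_ℝ : ℝ) : ℂ)) ∂μ

/-! ### A one-dimensional band-limited kernel -/

/-- The triangle function. -/
noncomputable def triangle (x : ℝ) : ℝ := max (1 - |x|) 0

/-- The Fejér kernel, whose Fourier transform is the triangle function. -/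
noncomputable def fejer (t : ℝ) : ℝ := Real.sinc (t / 2) ^ 2 / (2 * Real.pi)

lemma continuous_triangle : Continuous triangle := by unfold triangle; fun_prop

lemma continuous_fejer : Continuous fejer := by
  unfold fejer
  have := Real.continuous_sinc
  fun_prop

lemma fejer_nonneg (t : ℝ) : 0 ≤ fejer t := by unfold fejer; positivity

lemma sinc_sq_mul_sq (u : ℝ) : Real.sinc u ^ 2 * u ^ 2 = Real.sin u ^ 2 := by
  by_cases h : u = 0
  · simp [h]
  · rw [Real.sinc_of_ne_zero h]; field_simp

lemma sinc_sq_le (u : ℝ) : Real.sinc u ^ 2 ≤ 2 / (1 + u ^ 2) := by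
  rw [le_div_iff₀ (by positivity)]
  have h1 := sinc_sq_mul_sq u
  have h2 : Real.sinc u ^ 2 ≤ 1 := by
    rw [sq_le_one_iff_abs_le_one]; exact Real.abs_sinc_le_one u
  have h3 := Real.sin_sq_le_one u
  nlinarith

lemma fejer_le (t : ℝ) : fejer t ≤ 4 / (1 + t ^ 2) := by
  unfold fejer
  have h1 := sinc_sq_le (t / 2)
  have h2 : 2 / (1 + (t / 2) ^ 2) ≤ 8 / (1 + t ^ 2) := by
    rw [div_le_div_iff₀ (by positivity) (by positivity)]; nlinarith [sq_nonneg t]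
  have h3 := Real.pi_gt_three
  rw [div_le_iff₀ (by positivity)]
  have h4 : 0 ≤ 4 / (1 + t ^ 2) := by positivity
  have h5 : 8 / (1 + t ^ 2) = 2 * (4 / (1 + t ^ 2)) := by ring
  nlinarith

lemma integrable_inv_one_add_sq' (C : ℝ) : Integrable (fun t : ℝ => C / (1 + t ^ 2)) := by
  simpa [div_eq_mul_inv] using integrable_inv_one_add_sq.const_mul C

lemma integrable_of_le_inv_one_add_sq {f : ℝ → ℝ} (hf : Continuous f) (C : ℝ)
    (h : ∀ t, |f t| ≤ C / (1 + t ^ 2)) : Integrable f :=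
  (integrable_inv_one_add_sq' C).mono' hf.aestronglyMeasurable
    (Eventually.of_forall fun t => by simpa using h t)

lemma integrable_fejer : Integrable fejer :=
  integrable_of_le_inv_one_add_sq continuous_fejer 4 fun t => by
    rw [abs_of_nonneg (fejer_nonneg t)]; exact fejer_le t

lemma integral_triangle_cos {a : ℝ} (ha : a ≠ 0) :
    ∫ x in (0 : ℝ)..1, (1 - x) * Real.cos (a * x) = (1 - Real.cos a) / a ^ 2 := by
  have : ∀ x ∈ Set.uIcc (0 : ℝ) 1, HasDerivAt
      (fun x => (1 - x) * Real.sin (a * x) / a - Real.cos (a * x) / a ^ 2)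
      ((1 - x) * Real.cos (a * x)) x := by
    intro x _
    have h1 : HasDerivAt (fun x => a * x) a x := by simpa using (hasDerivAt_id x).const_mul a
    have h2 := ((((hasDerivAt_id x).const_sub 1).mul h1.sin).div_const a).sub
      (h1.cos.div_const (a ^ 2))
    refine h2.congr_deriv ?_
    simp only [id]
    field_simp
    ring
  rw [intervalIntegral.integral_eq_sub_of_hasDerivAt this
    (Continuous.intervalIntegrable (by fun_prop) _ _)]
  simp
  field_simp
  ring

lemma triangle_eq_zero {x : ℝ} (h : 1 ≤ |x|) : triangle x = 0 := by
  unfold triangle; exact max_eq_right (by linarith)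

lemma hasCompactSupport_triangle : HasCompactSupport triangle := by
  apply HasCompactSupport.of_support_subset_isCompact (isCompact_Icc (a := (-1 : ℝ)) (b := 1))
  intro x hx
  by_contra hc
  apply hx
  apply triangle_eq_zero
  by_contra h
  push Not at h
  exact hc ⟨by linarith [abs_lt.1 h], by linarith [abs_lt.1 h]⟩

lemma integrable_triangle : Integrable triangle :=
  continuous_triangle.integrable_of_hasCompactSupport hasCompactSupport_triangle

lemma integral_triangle_mul_sin (a : ℝ) : ∫ x, triangle x * Real.sin (a * x) = 0 := by
  have h := integral_neg_eq_self (fun x => triangle x * Real.sin (a * x)) volume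
  have h2 : ∀ x : ℝ, triangle (-x) * Real.sin (a * -x) = -(triangle x * Real.sin (a * x)) := by
    intro x; simp [triangle]
  simp_rw [h2, integral_neg] at h
  linarith

lemma integral_triangle_mul_cos (a : ℝ) :
    ∫ x, triangle x * Real.cos (a * x) = Real.sinc (a / 2) ^ 2 := by
  have h1 : ∀ x : ℝ, triangle x * Real.cos (a * x)
      = (fun y => max (1 - y) 0 * Real.cos (a * y)) |x| := by
    intro x
    have : Real.cos (a * |x|) = Real.cos (a * x) := by
      rcases abs_choice x with h | h <;> simp [h]
    simp [triangle, this]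
  simp_rw [h1]
  rw [integral_comp_abs (f := fun y => max (1 - y) 0 * Real.cos (a * y))]
  have h2 : ∫ x in Ioi (0 : ℝ), max (1 - x) 0 * Real.cos (a * x)
      = ∫ x in (0 : ℝ)..1, (1 - x) * Real.cos (a * x) := by
    rw [intervalIntegral.integral_of_le zero_le_one]
    have e : ∫ x in Ioc (0 : ℝ) 1, (1 - x) * Real.cos (a * x)
        = ∫ x in Ioc (0 : ℝ) 1, max (1 - x) 0 * Real.cos (a * x) := by
      apply setIntegral_congr_fun measurableSet_Ioc
      intro x hx
      simp only
      rw [max_eq_left (by linarith [hx.2])]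
    rw [e]
    apply setIntegral_eq_of_subset_of_forall_sdiff_eq_zero measurableSet_Ioi
      (fun x hx => hx.1)
    intro x hx
    have : 1 < x := by
      by_contra hc
      exact hx.2 ⟨hx.1, by linarith⟩
    rw [max_eq_right (by linarith), zero_mul]
  rw [h2]
  by_cases ha : a = 0
  · subst ha
    simp only [zero_mul, Real.cos_zero, mul_one, zero_div, Real.sinc_zero]
    rw [intervalIntegral.integral_sub (by simp) (by simp)]
    simp
    norm_num
  · rw [integral_triangle_cos ha, Real.sinc_of_ne_zero (by positivity)]
    have : Real.sin (a / 2) ^ 2 = 1 / 2 - Real.cos a / 2 := by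
      rw [Real.sin_sq_eq_half_sub]; ring_nf
    rw [div_pow, this]
    field_simp

open FourierTransform in
lemma fourier_triangle (w : ℝ) :
    𝓕 (fun x => (triangle x : ℂ)) w = ((Real.sinc (Real.pi * w) ^ 2 : ℝ) : ℂ) := by
  rw [Real.fourier_real_eq_integral_exp_smul]
  have h1 : ∀ v : ℝ, Complex.exp (↑(-2 * Real.pi * v * w) * Complex.I) • (triangle v : ℂ)
      = ((triangle v * Real.cos (2 * Real.pi * w * v) : ℝ) : ℂ)
        - ((triangle v * Real.sin (2 * Real.pi * w * v) : ℝ) : ℂ) * Complex.I := by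
    intro v
    rw [Complex.exp_mul_I, ← Complex.ofReal_cos, ← Complex.ofReal_sin,
      show -2 * Real.pi * v * w = -(2 * Real.pi * w * v) by ring, Real.cos_neg, Real.sin_neg]
    push_cast
    simp only [smul_eq_mul]
    ring
  have hi : ∀ g : ℝ → ℝ, Continuous g → Integrable (fun v => triangle v * g v) := by
    intro g hg
    exact (continuous_triangle.mul hg).integrable_of_hasCompactSupport
      (hasCompactSupport_triangle.mul_right)
  simp_rw [h1]
  rw [integral_sub, integral_mul_const, integral_complex_ofReal, integral_complex_ofReal,
    integral_triangle_mul_sin, integral_triangle_mul_cos]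
  · simp; ring_nf
  · exact (hi (fun v => Real.cos (2 * Real.pi * w * v)) (by fun_prop)).ofReal
  · exact ((hi (fun v => Real.sin (2 * Real.pi * w * v)) (by fun_prop)).ofReal).mul_const _

open FourierTransform in
lemma integral_fejer_mul_exp (η : ℝ) :
    ∫ t, (fejer t : ℂ) * Complex.exp (Complex.I * ((η * t : ℝ) : ℂ)) = triangle η := by
  have h := Continuous.fourierInv_fourier_eq (f := fun x => (triangle x : ℂ))
    (by have := continuous_triangle; fun_prop) integrable_triangle.ofReal ?_
  swap
  · have : (𝓕 fun x => (triangle x : ℂ))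
        = fun w => ((2 * Real.pi * fejer (2 * Real.pi * w) : ℝ) : ℂ) := by
      ext w
      rw [fourier_triangle]
      congr 1
      unfold fejer
      have := Real.pi_pos
      field_simp
    rw [this]
    refine Integrable.ofReal (Integrable.const_mul ?_ _)
    exact integrable_fejer.comp_mul_left' (by positivity)
  have h2 := congrFun h η
  rw [Real.fourierInv_eq'] at h2
  rw [← h2]
  have h3 := Measure.integral_comp_mul_left
    (fun t => (fejer t : ℂ) * Complex.exp (Complex.I * ((η * t : ℝ) : ℂ))) (2 * Real.pi)
  have hp : (0 : ℝ) < 2 * Real.pi := by positivity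
  rw [abs_of_pos (inv_pos.2 hp)] at h3
  have h4 : (∫ t, (fejer t : ℂ) * Complex.exp (Complex.I * ((η * t : ℝ) : ℂ)))
    = (2 * Real.pi) • ∫ x, (fejer (2 * Real.pi * x) : ℂ)
        * Complex.exp (Complex.I * ((η * (2 * Real.pi * x) : ℝ) : ℂ)) := by
    rw [h3, smul_smul, mul_inv_cancel₀ hp.ne', one_smul]
  rw [h4, ← integral_smul]
  congr 1
  ext v
  rw [fourier_triangle]
  simp only [fejer, smul_eq_mul, Complex.real_smul, RCLike.inner_apply, conj_trivial]
  rw [show 2 * Real.pi * v / 2 = Real.pi * v by ring,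
    show ((2 * Real.pi * (η * v) : ℝ) : ℂ) * Complex.I
      = Complex.I * ((η * (2 * Real.pi * v) : ℝ) : ℂ) by push_cast; ring]
  push_cast
  have : (Real.pi : ℂ) ≠ 0 := by exact_mod_cast Real.pi_ne_zero
  field_simp

/-- A positive probability density with Fourier transform supported in `[-1, 1]`. -/
noncomputable def bandKernel (t : ℝ) : ℝ := (fejer t + fejer (t + Real.pi)) / 2

/-- A kernel whose Fourier transform is one on `[-1, 1]`. -/
noncomputable def reproKernel (t : ℝ) : ℝ := 4 * fejer (2 * t) - fejer t

lemma continuous_bandKernel : Continuous bandKernel := by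
  have := continuous_fejer
  unfold bandKernel; fun_prop

lemma continuous_reproKernel : Continuous reproKernel := by
  have := continuous_fejer
  unfold reproKernel; fun_prop

lemma bandKernel_lower (t : ℝ) : (1 / 100) / (1 + t ^ 2) ≤ bandKernel t := by
  have hp := Real.pi_gt_three
  have hp4 := Real.pi_lt_d2
  have h1 := sinc_sq_mul_sq (t / 2)
  have h2 := sinc_sq_mul_sq ((t + Real.pi) / 2)
  rw [show (t + Real.pi) / 2 = t / 2 + Real.pi / 2 by ring, Real.sin_add_pi_div_two] at h2
  rw [← show (t + Real.pi) / 2 = t / 2 + Real.pi / 2 by ring] at h2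
  have h3 := Real.sin_sq_add_cos_sq (t / 2)
  rw [div_le_iff₀ (by positivity)]
  unfold bandKernel fejer
  set A := Real.sinc (t / 2) ^ 2
  set B := Real.sinc ((t + Real.pi) / 2) ^ 2
  have hA : 0 ≤ A := sq_nonneg _
  have hB : 0 ≤ B := sq_nonneg _
  rw [show (A / (2 * Real.pi) + B / (2 * Real.pi)) / 2 * (1 + t ^ 2)
    = ((A + B) * (1 + t ^ 2)) / (4 * Real.pi) by field_simp; ring]
  rw [le_div_iff₀ (by positivity)]
  have k1 : (t / 2) ^ 2 ≤ (1 + t ^ 2) := by nlinarith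
  have k2 : ((t + Real.pi) / 2) ^ 2 ≤ 5 * (1 + t ^ 2) := by
    nlinarith [sq_nonneg (t - Real.pi), sq_nonneg t, mul_pos Real.pi_pos Real.pi_pos]
  have k3 : A * (t / 2) ^ 2 ≤ A * (1 + t ^ 2) := mul_le_mul_of_nonneg_left k1 hA
  have k4 : B * ((t + Real.pi) / 2) ^ 2 ≤ B * (5 * (1 + t ^ 2)) :=
    mul_le_mul_of_nonneg_left k2 hB
  nlinarith [mul_nonneg hA (by positivity : 0 ≤ 1 + t ^ 2)]

lemma bandKernel_pos (t : ℝ) : 0 < bandKernel t :=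
  lt_of_lt_of_le (by positivity) (bandKernel_lower t)

lemma fejer_shift_le (t : ℝ) : fejer (t + Real.pi) ≤ 100 / (1 + t ^ 2) := by
  have hp4 := Real.pi_lt_d2
  have hp := Real.pi_gt_three
  refine (fejer_le _).trans ?_
  rw [div_le_div_iff₀ (by positivity) (by positivity)]
  nlinarith [sq_nonneg (t + 2 * Real.pi), sq_nonneg t, sq_nonneg (24 * t + 25 * Real.pi),
    mul_pos Real.pi_pos Real.pi_pos]

lemma bandKernel_upper (t : ℝ) : bandKernel t ≤ 100 / (1 + t ^ 2) := by
  have h1 := fejer_le t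
  have h2 := fejer_shift_le t
  have h3 : 4 / (1 + t ^ 2) ≤ 100 / (1 + t ^ 2) := by gcongr; norm_num
  unfold bandKernel
  linarith

lemma integrable_bandKernel : Integrable bandKernel :=
  integrable_of_le_inv_one_add_sq continuous_bandKernel 100 fun t => by
    rw [abs_of_pos (bandKernel_pos t)]; exact bandKernel_upper t

lemma abs_reproKernel_le (t : ℝ) : |reproKernel t| ≤ 20 / (1 + t ^ 2) := by
  have h1 := fejer_le t
  have h2 := fejer_le (2 * t)
  have h3 : 4 / (1 + (2 * t) ^ 2) ≤ 4 / (1 + t ^ 2) := by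
    apply div_le_div_of_nonneg_left <;> nlinarith [sq_nonneg t]
  have h5 : 20 / (1 + t ^ 2) = 5 * (4 / (1 + t ^ 2)) := by ring
  have := fejer_nonneg t
  have := fejer_nonneg (2 * t)
  rw [abs_le]
  unfold reproKernel
  constructor <;> linarith

lemma peetre (s t : ℝ) : 1 / (1 + t ^ 2) ≤ 2 * (1 + s ^ 2) / (1 + (s + t) ^ 2) := by
  rw [div_le_div_iff₀ (by positivity) (by positivity)]
  nlinarith [sq_nonneg (s - t), sq_nonneg (s * t)]

lemma abs_reproKernel_le_bandKernel (s t : ℝ) :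
    |reproKernel t| ≤ 4000 * (1 + s ^ 2) * bandKernel (s + t) := by
  have h1 := abs_reproKernel_le t
  have h2 := peetre s t
  have h3 := bandKernel_lower (s + t)
  calc |reproKernel t| ≤ 20 * (1 / (1 + t ^ 2)) := by rw [mul_one_div]; exact h1
    _ ≤ 20 * (2 * (1 + s ^ 2) / (1 + (s + t) ^ 2)) := by gcongr
    _ = 4000 * (1 + s ^ 2) * ((1 / 100) / (1 + (s + t) ^ 2)) := by ring
    _ ≤ _ := by gcongr

lemma integrable_mul_exp {f : ℝ → ℝ} (hf : Integrable f) (η : ℝ) :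
    Integrable (fun t => (f t : ℂ) * Complex.exp (Complex.I * ((η * t : ℝ) : ℂ))) := by
  refine (hf.ofReal (𝕜 := ℂ)).mul_bdd (c := 1) (by fun_prop) (Eventually.of_forall fun t => ?_)
  rw [mul_comm, Complex.norm_exp_ofReal_mul_I]

lemma integral_bandKernel_mul_exp (η : ℝ) (h : 1 ≤ |η|) :
    ∫ t, (bandKernel t : ℂ) * Complex.exp (Complex.I * ((η * t : ℝ) : ℂ)) = 0 := by
  have e : ∀ t : ℝ, (bandKernel t : ℂ) * Complex.exp (Complex.I * ((η * t : ℝ) : ℂ))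
      = ((fejer t : ℂ) * Complex.exp (Complex.I * ((η * t : ℝ) : ℂ))
        + Complex.exp (-(Complex.I * ((η * Real.pi : ℝ) : ℂ))) *
          ((fejer (t + Real.pi) : ℂ) * Complex.exp (Complex.I * ((η * (t + Real.pi) : ℝ) : ℂ)))) / 2 := by
    intro t
    have : Complex.exp (Complex.I * ((η * (t + Real.pi) : ℝ) : ℂ))
      = Complex.exp (Complex.I * ((η * t : ℝ) : ℂ)) * Complex.exp (Complex.I * ((η * Real.pi : ℝ) : ℂ)) := by
      rw [← Complex.exp_add]; push_cast; ring_nf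
    rw [this, Complex.exp_neg]
    have := Complex.exp_ne_zero (Complex.I * ((η * Real.pi : ℝ) : ℂ))
    unfold bandKernel
    push_cast at *
    field_simp
  have hint := integrable_mul_exp integrable_fejer η
  simp_rw [e]
  rw [integral_div, integral_add hint ((hint.comp_add_right Real.pi).const_mul _),
    integral_const_mul,
    integral_add_right_eq_self (fun t => (fejer t : ℂ) * Complex.exp (Complex.I * ((η * t : ℝ) : ℂ))),
    integral_fejer_mul_exp, triangle_eq_zero h]
  simp

lemma integral_bandKernel : ∫ t, bandKernel t = 1 := by
  have h := integral_fejer_mul_exp 0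
  simp only [zero_mul, Complex.ofReal_zero, mul_zero, Complex.exp_zero, mul_one] at h
  have h1 : ∫ t, fejer t = 1 := by
    rw [integral_complex_ofReal] at h
    have := Complex.ofReal_injective h
    rw [this]; simp [triangle]
  unfold bandKernel
  rw [integral_div, integral_add integrable_fejer (integrable_fejer.comp_add_right _),
    integral_add_right_eq_self fejer, h1]
  norm_num

lemma integral_reproKernel_mul_exp (η : ℝ) (h : |η| ≤ 1) :
    ∫ t, (reproKernel t : ℂ) * Complex.exp (Complex.I * ((η * t : ℝ) : ℂ)) = 1 := by
  have e : ∀ t : ℝ, (reproKernel t : ℂ) * Complex.exp (Complex.I * ((η * t : ℝ) : ℂ))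
      = 4 * ((fejer (2 * t) : ℂ) * Complex.exp (Complex.I * ((η / 2 * (2 * t) : ℝ) : ℂ)))
        - (fejer t : ℂ) * Complex.exp (Complex.I * ((η * t : ℝ) : ℂ)) := by
    intro t
    rw [show η / 2 * (2 * t) = η * t by ring]
    unfold reproKernel
    push_cast
    ring
  have hint := integrable_mul_exp integrable_fejer η
  have hint2 := integrable_mul_exp integrable_fejer (η / 2)
  simp_rw [e]
  rw [integral_sub ((hint2.comp_mul_left' two_ne_zero).const_mul _) hint, integral_const_mul,
    Measure.integral_comp_mul_left
      (fun t => (fejer t : ℂ) * Complex.exp (Complex.I * ((η / 2 * t : ℝ) : ℂ))),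
    integral_fejer_mul_exp, integral_fejer_mul_exp]
  unfold triangle
  have h2 : |η / 2| = |η| / 2 := by rw [abs_div, abs_two]
  rw [h2, max_eq_left (by linarith), max_eq_left (by linarith)]
  simp
  ring

/-! ### Band measures -/

/-- The probability measure with density `bandKernel`. -/
noncomputable def bandMeasure : Measure ℝ :=
  volume.withDensity fun t => ENNReal.ofReal (bandKernel t)

lemma measurable_ofReal_bandKernel : Measurable fun t => ENNReal.ofReal (bandKernel t) :=
  continuous_bandKernel.measurable.ennreal_ofReal

instance isProbabilityMeasure_bandMeasure : IsProbabilityMeasure bandMeasure := ⟨by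
  rw [bandMeasure, withDensity_apply _ MeasurableSet.univ, Measure.restrict_univ,
    ← ofReal_integral_eq_lintegral_ofReal integrable_bandKernel
      (Eventually.of_forall fun t => (bandKernel_pos t).le), integral_bandKernel]
  simp⟩

lemma integral_bandMeasure (f : ℝ → ℂ) :
    ∫ t, f t ∂bandMeasure = ∫ t, (bandKernel t : ℂ) * f t := by
  rw [bandMeasure, integral_withDensity_eq_integral_toReal_smul measurable_ofReal_bandKernel
    (Eventually.of_forall fun t => ENNReal.ofReal_lt_top)]
  congr 1
  ext t
  rw [ENNReal.toReal_ofReal (bandKernel_pos t).le, Complex.real_smul]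

lemma integral_exp_bandMeasure {η : ℝ} (h : 1 ≤ |η|) :
    ∫ t, Complex.exp (Complex.I * ((η * t : ℝ) : ℂ)) ∂bandMeasure = 0 := by
  rw [integral_bandMeasure, integral_bandKernel_mul_exp η h]

/-- The reproducing weight relative to `bandMeasure`. -/
noncomputable def bandWeight (s t : ℝ) : ℝ := reproKernel (t - s) / bandKernel t

lemma continuous_bandWeight (s : ℝ) : Continuous (bandWeight s) :=
  (continuous_reproKernel.comp (by fun_prop)).div continuous_bandKernel
    fun t => (bandKernel_pos t).ne'

lemma abs_bandWeight_le (s t : ℝ) : |bandWeight s t| ≤ 4000 * (1 + s ^ 2) := by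
  have h := abs_reproKernel_le_bandKernel s (t - s)
  rw [add_sub_cancel] at h
  unfold bandWeight
  rwa [abs_div, abs_of_pos (bandKernel_pos t), div_le_iff₀ (bandKernel_pos t)]

lemma integral_bandWeight_mul_exp (s : ℝ) {η : ℝ} (h : |η| ≤ 1) :
    ∫ t, (bandWeight s t : ℂ) * Complex.exp (Complex.I * ((η * t : ℝ) : ℂ)) ∂bandMeasure
      = Complex.exp (Complex.I * ((η * s : ℝ) : ℂ)) := by
  rw [integral_bandMeasure]
  have e : ∀ t : ℝ, (bandKernel t : ℂ) * ((bandWeight s t : ℂ) *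
      Complex.exp (Complex.I * ((η * t : ℝ) : ℂ)))
      = Complex.exp (Complex.I * ((η * s : ℝ) : ℂ)) * ((reproKernel (t - s) : ℂ) *
        Complex.exp (Complex.I * ((η * (t - s) : ℝ) : ℂ))) := by
    intro t
    have h1 : Complex.exp (Complex.I * ((η * t : ℝ) : ℂ))
        = Complex.exp (Complex.I * ((η * s : ℝ) : ℂ)) *
          Complex.exp (Complex.I * ((η * (t - s) : ℝ) : ℂ)) := by
      rw [← Complex.exp_add]; push_cast; ring_nf
    have h2 : (bandKernel t : ℂ) ≠ 0 := by exact_mod_cast (bandKernel_pos t).ne'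
    rw [h1, bandWeight]
    push_cast
    field_simp
  simp_rw [e]
  rw [integral_const_mul, integral_sub_right_eq_self (fun t => (reproKernel t : ℂ) *
        Complex.exp (Complex.I * ((η * t : ℝ) : ℂ))), integral_reproKernel_mul_exp η h, mul_one]

lemma one_le_bandKernel {t : ℝ} (h : |t| ≤ 2) : 1 ≤ 500 * bandKernel t := by
  have h1 := bandKernel_lower t
  have h2 : t ^ 2 ≤ 4 := by rw [← sq_abs]; nlinarith [abs_nonneg t]
  have h3 : (1 / 100 : ℝ) / 5 ≤ (1 / 100) / (1 + t ^ 2) := by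
    apply div_le_div_of_nonneg_left <;> nlinarith [sq_nonneg t]
  linarith

lemma volume_restrict_le_bandMeasure :
    volume.restrict (Icc (-2 : ℝ) 2) ≤ (500 : ℝ≥0∞) • bandMeasure := by
  rw [bandMeasure, ← withDensity_smul _ measurable_ofReal_bandKernel,
    ← withDensity_indicator_one measurableSet_Icc]
  apply withDensity_mono
  refine Eventually.of_forall fun t => ?_
  by_cases ht : t ∈ Icc (-2 : ℝ) 2
  · rw [indicator_of_mem ht]
    have := one_le_bandKernel (t := t) (abs_le.2 ht)
    simp only [Pi.one_apply, Pi.smul_apply, smul_eq_mul]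
    rw [show (500 : ℝ≥0∞) = ENNReal.ofReal 500 by simp, ← ENNReal.ofReal_mul (by norm_num)]
    simpa using ENNReal.ofReal_le_ofReal this
  · rw [indicator_of_notMem ht]; exact zero_le

/-- The product of band measures. -/
noncomputable def boxMeasure (ι : Type*) [Fintype ι] : Measure (ι → ℝ) :=
  Measure.pi fun _ => bandMeasure

instance isProbabilityMeasure_boxMeasure (ι : Type*) [Fintype ι] :
    IsProbabilityMeasure (boxMeasure ι) := by unfold boxMeasure; infer_instance

/-! ### Trigonometric polynomials -/

section Trig

variable {X Y : Type*} [NormedAddCommGroup X] [NormedSpace ℝ X]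
  [NormedAddCommGroup Y] [NormedSpace ℝ Y]

/-- The character with frequency `η`. -/
noncomputable def expChar (η : X →L[ℝ] ℝ) (x : X) : ℂ :=
  Complex.exp (Complex.I * ((η x : ℝ) : ℂ))

lemma expChar_add (η : X →L[ℝ] ℝ) (x y : X) : expChar η (x + y) = expChar η x * expChar η y := by
  simp [expChar, ← Complex.exp_add, mul_add]

lemma expChar_mul (η ξ : X →L[ℝ] ℝ) (x : X) : expChar (η + ξ) x = expChar η x * expChar ξ x := by
  simp [expChar, ← Complex.exp_add, mul_add]

lemma norm_expChar (η : X →L[ℝ] ℝ) (x : X) : ‖expChar η x‖ = 1 := by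
  rw [expChar, mul_comm, Complex.norm_exp_ofReal_mul_I]

lemma continuous_expChar (η : X →L[ℝ] ℝ) : Continuous (expChar η) := by
  unfold expChar; fun_prop

lemma conj_expChar (η : X →L[ℝ] ℝ) (x : X) :
    (starRingEnd ℂ) (expChar η x) = expChar (-η) x := by
  simp [expChar, ← Complex.exp_conj]

/-- Trigonometric polynomials with frequencies in `S`. -/
noncomputable def trigSpan (S : Set (X →L[ℝ] ℝ)) : Submodule ℂ (X → ℂ) :=
  Submodule.span ℂ (expChar '' S)

lemma expChar_mem {S : Set (X →L[ℝ] ℝ)} {η : X →L[ℝ] ℝ} (h : η ∈ S) : expChar η ∈ trigSpan S :=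
  Submodule.subset_span ⟨η, h, rfl⟩

lemma trigSpan_mono {S T : Set (X →L[ℝ] ℝ)} (h : S ⊆ T) : trigSpan S ≤ trigSpan T :=
  Submodule.span_mono (image_mono h)

lemma trigSpan_induction {S : Set (X →L[ℝ] ℝ)} {P : (X → ℂ) → Prop}
    (he : ∀ η ∈ S, P (expChar η)) (h0 : P 0) (ha : ∀ f g, f ∈ trigSpan S → g ∈ trigSpan S →
      P f → P g → P (f + g)) (hs : ∀ (c : ℂ) f, f ∈ trigSpan S → P f → P (c • f))
    {f : X → ℂ} (hf : f ∈ trigSpan S) : P f := by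
  refine Submodule.span_induction (p := fun f _ => P f) ?_ h0 (fun f g hf hg => ha f g hf hg)
    (fun c f hf => hs c f hf) hf
  rintro _ ⟨η, hη, rfl⟩
  exact he η hη

lemma continuous_of_mem_trigSpan {S : Set (X →L[ℝ] ℝ)} {f : X → ℂ} (hf : f ∈ trigSpan S) :
    Continuous f :=
  trigSpan_induction (fun η _ => continuous_expChar η) continuous_const
    (fun _ _ _ _ h1 h2 => h1.add h2) (fun _ _ _ h => h.const_smul _) hf

lemma bounded_of_mem_trigSpan {S : Set (X →L[ℝ] ℝ)} {f : X → ℂ} (hf : f ∈ trigSpan S) :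
    ∃ C, ∀ x, ‖f x‖ ≤ C := by
  refine trigSpan_induction (P := fun f => ∃ C, ∀ x, ‖f x‖ ≤ C)
    (fun η _ => ⟨1, fun x => (norm_expChar η x).le⟩) ⟨0, by simp⟩ ?_ ?_ hf
  · rintro f g - - ⟨C, hC⟩ ⟨D, hD⟩
    exact ⟨C + D, fun x => (norm_add_le _ _).trans (add_le_add (hC x) (hD x))⟩
  · rintro c f - ⟨C, hC⟩
    refine ⟨‖c‖ * C, fun x => ?_⟩
    rw [Pi.smul_apply, norm_smul]
    exact mul_le_mul_of_nonneg_left (hC x) (norm_nonneg _)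

lemma comp_mem_trigSpan {S : Set (X →L[ℝ] ℝ)} {f : X → ℂ} (hf : f ∈ trigSpan S)
    (A : Y →L[ℝ] X) (b : X) :
    (fun y => f (b + A y)) ∈ trigSpan ((fun η => η.comp A) '' S) := by
  refine trigSpan_induction (P := fun f => (fun y => f (b + A y)) ∈ trigSpan _) ?_ ?_ ?_ ?_ hf
  · intro η hη
    have : (fun y => expChar η (b + A y)) = expChar η b • expChar (η.comp A) := by
      ext y; rw [expChar_add]; rfl
    rw [this]
    exact Submodule.smul_mem _ _ (expChar_mem ⟨η, hη, rfl⟩)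
  · exact Submodule.zero_mem _
  · intro f g _ _ h1 h2
    exact Submodule.add_mem _ h1 h2
  · intro c f _ h
    exact Submodule.smul_mem _ c h

lemma integrable_of_continuous_bounded {E : Type*} [MeasurableSpace E] [TopologicalSpace E]
    [OpensMeasurableSpace E] (Ω : Measure E) [IsFiniteMeasure Ω] {f : E → ℂ}
    (hf : Continuous f) {C : ℝ} (hC : ∀ x, ‖f x‖ ≤ C) : Integrable f Ω :=
  Integrable.of_bound hf.measurable.aestronglyMeasurable C (Eventually.of_forall hC)

lemma integral_prod_bandWeight {ι : Type*} [Fintype ι] {S : Set (X →L[ℝ] ℝ)} {f : X → ℂ}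
    (hf : f ∈ trigSpan S) (w : ι → X) (hw : ∀ η ∈ S, ∀ l, |η (w l)| ≤ 1) (x : X) (s : ι → ℝ) :
    ∫ t, (∏ l, (bandWeight (s l) (t l) : ℂ)) * f (x + ∑ l, t l • w l) ∂boxMeasure ι
      = f (x + ∑ l, s l • w l) := by
  have hint : ∀ f ∈ trigSpan S, Integrable (fun t : ι → ℝ =>
      (∏ l, (bandWeight (s l) (t l) : ℂ)) * f (x + ∑ l, t l • w l)) (boxMeasure ι) := by
    intro f hf
    obtain ⟨C, hC⟩ := bounded_of_mem_trigSpan hf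
    have hc := continuous_of_mem_trigSpan hf
    refine integrable_of_continuous_bounded _ (C := (∏ l, (4000 * (1 + s l ^ 2))) * C) ?_ ?_
    · refine Continuous.mul ?_ (hc.comp (by fun_prop))
      refine continuous_finsetProd _ fun l _ => ?_
      exact Complex.continuous_ofReal.comp ((continuous_bandWeight _).comp (continuous_apply l))
    · intro t
      rw [norm_mul, norm_prod]
      refine mul_le_mul (Finset.prod_le_prod (fun _ _ => norm_nonneg _) fun l _ => ?_) (hC _)
        (norm_nonneg _) (Finset.prod_nonneg fun _ _ => by positivity)
      rw [Complex.norm_real, Real.norm_eq_abs]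
      exact abs_bandWeight_le _ _
  refine trigSpan_induction (S := S) (P := fun f => ∫ t,
    (∏ l, (bandWeight (s l) (t l) : ℂ)) * f (x + ∑ l, t l • w l) ∂boxMeasure ι
      = f (x + ∑ l, s l • w l)) ?_ ?_ ?_ ?_ hf
  · intro η hη
    have key : ∀ t : ι → ℝ, expChar η (x + ∑ l, t l • w l)
        = expChar η x * ∏ l, Complex.exp (Complex.I * ((η (w l) * t l : ℝ) : ℂ)) := by
      intro t
      rw [expChar_add, ← Complex.exp_sum]
      congr 1
      simp only [expChar, map_sum, map_smul, smul_eq_mul]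
      push_cast
      rw [Finset.mul_sum]
      congr 1
      exact Finset.sum_congr rfl fun l _ => by ring
    have e : ∀ t : ι → ℝ, (∏ l, (bandWeight (s l) (t l) : ℂ)) * expChar η (x + ∑ l, t l • w l)
        = expChar η x * ∏ l, ((bandWeight (s l) (t l) : ℂ) *
          Complex.exp (Complex.I * ((η (w l) * t l : ℝ) : ℂ))) := by
      intro t
      rw [key, Finset.prod_mul_distrib]; ring
    simp_rw [e]
    rw [integral_const_mul, boxMeasure, integral_fintype_prod_eq_prod (𝕜 := ℂ)
      (fun l t => (bandWeight (s l) t : ℂ) *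
          Complex.exp (Complex.I * ((η (w l) * t : ℝ) : ℂ))), key]
    congr 1
    exact Finset.prod_congr rfl fun l _ => integral_bandWeight_mul_exp _ (hw η hη l)
  · simp
  · intro f g hf hg h1 h2
    simp only [Pi.add_apply, mul_add]
    rw [integral_add (hint f hf) (hint g hg), h1, h2]
  · intro c f _ h
    simp only [Pi.smul_apply, smul_eq_mul, mul_left_comm _ c]
    rw [integral_const_mul, h]

section

variable [MeasurableSpace X] [BorelSpace X]

lemma integrable_of_mem_trigSpan {S : Set (X →L[ℝ] ℝ)} {f : X → ℂ} (hf : f ∈ trigSpan S)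
    (Ω : Measure X) [IsFiniteMeasure Ω] (x : X) : Integrable (fun v => f (x + v)) Ω := by
  obtain ⟨C, hC⟩ := bounded_of_mem_trigSpan hf
  exact integrable_of_continuous_bounded Ω
    ((continuous_of_mem_trigSpan hf).comp (continuous_const.add continuous_id)) fun v => hC _

lemma average_mem_trigSpan {S : Set (X →L[ℝ] ℝ)} {f : X → ℂ} (hf : f ∈ trigSpan S)
    (Ω : Measure X) [IsFiniteMeasure Ω] :
    (fun x => ∫ v, f (x + v) ∂Ω) ∈ trigSpan {η ∈ S | ∫ v, expChar η v ∂Ω ≠ 0} := by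
  refine trigSpan_induction (P := fun f => (fun x => ∫ v, f (x + v) ∂Ω) ∈ trigSpan _)
    ?_ ?_ ?_ ?_ hf
  · intro η hη
    have : (fun x => ∫ v, expChar η (x + v) ∂Ω) = (∫ v, expChar η v ∂Ω) • expChar η := by
      ext x
      simp_rw [expChar_add]
      rw [integral_const_mul, mul_comm]; rfl
    rw [this]
    by_cases h : ∫ v, expChar η v ∂Ω = 0
    · rw [h, zero_smul]; exact Submodule.zero_mem _
    · exact Submodule.smul_mem _ _ (expChar_mem ⟨hη, h⟩)
  · simp only [Pi.zero_apply, integral_zero]; exact Submodule.zero_mem _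
  · intro f g hf hg h1 h2
    have : (fun x => ∫ v, (f + g) (x + v) ∂Ω)
        = (fun x => ∫ v, f (x + v) ∂Ω) + fun x => ∫ v, g (x + v) ∂Ω := by
      ext x
      exact integral_add (integrable_of_mem_trigSpan hf Ω x) (integrable_of_mem_trigSpan hg Ω x)
    rw [this]
    exact Submodule.add_mem _ h1 h2
  · intro c f _ h
    have : (fun x => ∫ v, (c • f) (x + v) ∂Ω) = c • fun x => ∫ v, f (x + v) ∂Ω := by
      ext x
      exact integral_const_mul _ _
    rw [this]
    exact Submodule.smul_mem _ _ h

end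

/-- A nonnegative trigonometric polynomial with frequencies in `S`. -/
structure IsNTP (S : Set (X →L[ℝ] ℝ)) (g : X → ℝ) : Prop where
  nonneg : ∀ x, 0 ≤ g x
  mem : (fun x => (g x : ℂ)) ∈ trigSpan S

namespace IsNTP

variable {S T : Set (X →L[ℝ] ℝ)} {g : X → ℝ}

lemma continuous (hg : IsNTP S g) : Continuous g :=
  Complex.isometry_ofReal.isEmbedding.continuous_iff.2 (continuous_of_mem_trigSpan hg.mem)

lemma bounded (hg : IsNTP S g) : ∃ C, ∀ x, g x ≤ C := by
  obtain ⟨C, hC⟩ := bounded_of_mem_trigSpan hg.mem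
  exact ⟨C, fun x => (le_abs_self _).trans (by simpa using hC x)⟩

lemma mono (hg : IsNTP S g) (h : S ⊆ T) : IsNTP T g := ⟨hg.nonneg, trigSpan_mono h hg.mem⟩

lemma comp (hg : IsNTP S g) (A : Y →L[ℝ] X) (b : X) :
    IsNTP ((fun η => η.comp A) '' S) (fun y => g (b + A y)) :=
  ⟨fun _ => hg.nonneg _, comp_mem_trigSpan hg.mem A b⟩

lemma integrable_comp (hg : IsNTP S g) {E : Type*} [MeasurableSpace E] [TopologicalSpace E]
    [OpensMeasurableSpace E] (Ω : Measure E) [IsFiniteMeasure Ω] {φ : E → X}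
    (hφ : Continuous φ) : Integrable (fun v => g (φ v)) Ω := by
  obtain ⟨C, hC⟩ := hg.bounded
  refine Integrable.of_bound (hg.continuous.comp hφ).measurable.aestronglyMeasurable C
    (Eventually.of_forall fun v => ?_)
  rw [Real.norm_of_nonneg (hg.nonneg _)]
  exact hC _

/-- The band inequality: a nonnegative trigonometric polynomial is controlled by its averages in
directions where its frequencies are bounded by one. -/
lemma le_average {ι : Type*} [Fintype ι] (hg : IsNTP S g) (w : ι → X)
    (hw : ∀ η ∈ S, ∀ l, |η (w l)| ≤ 1) (x : X) (s : ι → ℝ) :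
    g (x + ∑ l, s l • w l) ≤ (∏ l, 4000 * (1 + s l ^ 2)) *
      ∫ t, g (x + ∑ l, t l • w l) ∂boxMeasure ι := by
  have h := integral_prod_bandWeight hg.mem w hw x s
  have h1 : ‖(g (x + ∑ l, s l • w l) : ℂ)‖ ≤ ∫ t, (∏ l, 4000 * (1 + s l ^ 2)) *
      g (x + ∑ l, t l • w l) ∂boxMeasure ι := by
    rw [← h]
    refine norm_integral_le_of_norm_le ?_ (Eventually.of_forall fun t => ?_)
    · exact (hg.integrable_comp _ (by fun_prop)).const_mul _
    · rw [norm_mul, norm_prod, Complex.norm_real, Real.norm_of_nonneg (hg.nonneg _)]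
      refine mul_le_mul_of_nonneg_right ?_ (hg.nonneg _)
      refine Finset.prod_le_prod (fun _ _ => norm_nonneg _) fun l _ => ?_
      rw [Complex.norm_real, Real.norm_eq_abs]
      exact abs_bandWeight_le _ _
  rw [Complex.norm_real, Real.norm_of_nonneg (hg.nonneg _), integral_const_mul] at h1
  exact h1

lemma average [MeasurableSpace X] [BorelSpace X] (hg : IsNTP S g) (Ω : Measure X)
    [IsFiniteMeasure Ω] :
    IsNTP {η ∈ S | ∫ v, expChar η v ∂Ω ≠ 0} (fun x => ∫ v, g (x + v) ∂Ω) := by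
  refine ⟨fun x => integral_nonneg fun v => hg.nonneg _, ?_⟩
  have := average_mem_trigSpan hg.mem Ω
  convert this using 2 with x
  rw [integral_complex_ofReal]

end IsNTP

lemma isNTP_norm_sq {κ : Type*} (I : Finset κ) (c : κ → ℂ) (ξ : κ → X →L[ℝ] ℝ) :
    IsNTP {η | ∃ k ∈ I, ∃ l ∈ I, η = ξ k - ξ l}
      (fun x => ‖∑ k ∈ I, c k * expChar (ξ k) x‖ ^ 2) := by
  refine ⟨fun x => by positivity, ?_⟩
  have : (fun x => ((‖∑ k ∈ I, c k * expChar (ξ k) x‖ ^ 2 : ℝ) : ℂ))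
      = ∑ k ∈ I, ∑ l ∈ I, (c k * (starRingEnd ℂ) (c l)) • expChar (ξ k - ξ l) := by
    ext x
    rw [Complex.ofReal_pow, ← Complex.mul_conj', map_sum, Finset.sum_mul_sum, Finset.sum_apply]
    refine Finset.sum_congr rfl fun k _ => ?_
    rw [Finset.sum_apply]
    refine Finset.sum_congr rfl fun l _ => ?_
    rw [map_mul, conj_expChar, sub_eq_add_neg, Pi.smul_apply, expChar_mul, smul_eq_mul]
    ring
  rw [this]
  refine Submodule.sum_mem _ fun k hk => Submodule.sum_mem _ fun l hl => ?_
  exact Submodule.smul_mem _ _ (expChar_mem ⟨k, hk, l, hl, rfl⟩)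

end Trig

/-! ### Convolutions of averages -/

section Conv

variable {X E : Type*} [NormedAddCommGroup X] [MeasurableSpace X] [BorelSpace X]
  [SecondCountableTopology X] [NormedAddCommGroup E] [NormedSpace ℝ E]
  [SecondCountableTopology E]

/-- The law of the sum of two independent vectors. -/
noncomputable def convMeasure (Ω Ω' : Measure X) : Measure X :=
  (Ω.prod Ω').map fun p => p.1 + p.2

instance (Ω Ω' : Measure X) [IsProbabilityMeasure Ω] [IsProbabilityMeasure Ω'] :
    IsProbabilityMeasure (convMeasure Ω Ω') :=
  Measure.isProbabilityMeasure_map (by fun_prop)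

lemma integral_convMeasure (Ω Ω' : Measure X) [IsProbabilityMeasure Ω] [IsProbabilityMeasure Ω']
    {f : X → E} (hf : Continuous f) {C : ℝ} (hC : ∀ x, ‖f x‖ ≤ C) :
    ∫ v, f v ∂convMeasure Ω Ω' = ∫ u, ∫ v, f (u + v) ∂Ω' ∂Ω := by
  rw [convMeasure, integral_map (by fun_prop) hf.aestronglyMeasurable, integral_prod]
  exact Integrable.of_bound (hf.comp (by fun_prop)).aestronglyMeasurable C
    (Eventually.of_forall fun v => hC _)

variable [NormedSpace ℝ X]

lemma integral_convMeasure_expChar (Ω Ω' : Measure X) [IsProbabilityMeasure Ω]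
    [IsProbabilityMeasure Ω'] (η : X →L[ℝ] ℝ) :
    ∫ v, expChar η v ∂convMeasure Ω Ω' = (∫ v, expChar η v ∂Ω) * ∫ v, expChar η v ∂Ω' := by
  rw [integral_convMeasure Ω Ω' (continuous_expChar η) fun x => (norm_expChar η x).le]
  simp_rw [expChar_add, integral_const_mul, integral_mul_const]

lemma IsNTP.integral_convMeasure {S : Set (X →L[ℝ] ℝ)} {g : X → ℝ} (hg : IsNTP S g)
    (Ω Ω' : Measure X) [IsProbabilityMeasure Ω] [IsProbabilityMeasure Ω'] (x : X) :
    ∫ v, g (x + v) ∂convMeasure Ω Ω' = ∫ u, ∫ v, g (x + u + v) ∂Ω' ∂Ω := by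
  obtain ⟨C, hC⟩ := hg.bounded
  rw [_root_.integral_convMeasure Ω Ω' (f := fun v => g (x + v))
    (hg.continuous.comp (by fun_prop)) (C := C) fun v => by
      rw [Real.norm_of_nonneg (hg.nonneg _)]; exact hC _]
  simp_rw [add_assoc]

end Conv

/-! ### The Loomis–Whitney inequality -/

section LoomisWhitney

variable {ι : Type*} [Fintype ι]

lemma pi_mono_measure {μ ν : ι → Measure ℝ} [∀ i, SigmaFinite (μ i)] [∀ i, SigmaFinite (ν i)]
    (h : ∀ i, μ i ≤ ν i) : Measure.pi μ ≤ Measure.pi ν := by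
  refine Measure.le_iff.2 fun s hs => ?_
  rw [Measure.pi, Measure.pi, toMeasure_apply _ _ hs, toMeasure_apply _ _ hs]
  refine (OuterMeasure.le_pi.2 fun t _ => ?_) s
  exact (OuterMeasure.pi_pi_le _ _).trans (Finset.prod_le_prod' fun i _ => h i _)

lemma volume_restrict_le_boxMeasure :
    (volume : Measure (ι → ℝ)).restrict (Icc (fun _ => -2) fun _ => 2)
      ≤ (500 : ℝ≥0∞) ^ Fintype.card ι • boxMeasure ι := by
  have h1 : (volume : Measure (ι → ℝ)).restrict (Icc (fun _ => -2) fun _ => 2)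
      = Measure.pi fun _ : ι => volume.restrict (Icc (-2 : ℝ) 2) := by
    rw [volume_pi, ← Measure.restrict_pi_pi, pi_univ_Icc]
  have : IsFiniteMeasure ((500 : ℝ≥0∞) • bandMeasure) :=
    Measure.smul_finite _ (by simp)
  have h2 : (500 : ℝ≥0∞) ^ Fintype.card ι • boxMeasure ι
      = Measure.pi fun _ : ι => (500 : ℝ≥0∞) • bandMeasure := by
    symm
    apply Measure.pi_eq
    intro s hs
    simp [boxMeasure, Measure.pi_pi, Finset.prod_mul_distrib]
  rw [h1, h2]
  exact pi_mono_measure fun _ => volume_restrict_le_bandMeasure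

variable [DecidableEq ι]

lemma loomisWhitney (hι : 2 ≤ Fintype.card ι) (f : ι → (ι → ℝ) → ℝ≥0∞)
    (hf : ∀ i, Measurable (f i)) (hfin : ∀ i, ∫⁻ x, f i x ∂boxMeasure ι ≠ ∞) :
    ∫⁻ x, ∏ i, (∫⁻ s, f i (Function.update x i s) ∂bandMeasure)
        ^ ((1 : ℝ) / ((Fintype.card ι : ℝ) - 1)) ∂boxMeasure ι
      ≤ (Fintype.card ι : ℝ≥0∞) ^ ((Fintype.card ι : ℝ) / ((Fintype.card ι : ℝ) - 1)) *
        ∏ i, (∫⁻ x, f i x ∂boxMeasure ι) ^ ((1 : ℝ) / ((Fintype.card ι : ℝ) - 1)) := by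
  set j : ℝ := (Fintype.card ι : ℝ) with hj
  have hj2 : (2 : ℝ) ≤ j := by rw [hj]; exact_mod_cast hι
  set a : ℝ := 1 / (j - 1) with ha
  have ha0 : 0 < a := by rw [ha]; apply div_pos one_pos; linarith
  have hp : Real.HolderConjugate (Fintype.card ι : ℝ) (j / (j - 1)) := by
    rw [← hj, Real.holderConjugate_iff]
    refine ⟨by linarith, ?_⟩
    have : j - 1 ≠ 0 := by linarith
    field_simp
    ring
  set A : ι → ℝ≥0∞ := fun i => ∫⁻ x, f i x ∂boxMeasure ι with hA
  have key : ∀ ε : ℝ≥0∞, ε ≠ 0 → ε ≠ ∞ →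
      ∫⁻ x, ∏ i, (∫⁻ s, f i (Function.update x i s) ∂bandMeasure) ^ a ∂boxMeasure ι
      ≤ (Fintype.card ι : ℝ≥0∞) ^ (j / (j - 1)) * ∏ i, (A i + ε) ^ a := by
    intro ε hε hε'
    have hne : ∀ i, A i + ε ≠ 0 := fun i => by simp [hε]
    have hnt : ∀ i, A i + ε ≠ ∞ := fun i => ENNReal.add_ne_top.2 ⟨hfin i, hε'⟩
    set F : (ι → ℝ) → ℝ≥0∞ := fun x => ∑ i, (A i + ε)⁻¹ * f i x with hF
    have hFm : Measurable F := by
      apply Finset.measurable_sum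
      intro i _
      exact (hf i).const_mul _
    have h1 := lintegral_prod_lintegral_pow_le (fun _ : ι => bandMeasure) hp hFm
    have h2 : ∫⁻ x, F x ∂boxMeasure ι ≤ Fintype.card ι := by
      rw [hF, lintegral_finsetSum _ fun i _ => (hf i).const_mul _]
      calc ∑ i, ∫⁻ x, (A i + ε)⁻¹ * f i x ∂boxMeasure ι ≤ ∑ i : ι, 1 := by
            refine Finset.sum_le_sum fun i _ => ?_
            rw [lintegral_const_mul _ (hf i), mul_comm, ← div_eq_mul_inv]
            exact ENNReal.div_le_of_le_mul (by rw [one_mul]; exact le_self_add)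
        _ = _ := by simp
    have h3 : ∀ x i, ∫⁻ s, f i (Function.update x i s) ∂bandMeasure
        ≤ (A i + ε) * ∫⁻ s, F (Function.update x i s) ∂bandMeasure := by
      intro x i
      have hFu : Measurable fun s => F (Function.update x i s) :=
        hFm.comp (measurable_update x (a := i))
      rw [← lintegral_const_mul _ hFu]
      refine lintegral_mono fun s => ?_
      have : (A i + ε)⁻¹ * f i (Function.update x i s) ≤ F (Function.update x i s) :=
        Finset.single_le_sum (f := fun i => (A i + ε)⁻¹ * f i (Function.update x _ s))
          (fun _ _ => zero_le) (Finset.mem_univ i)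
      calc f i (Function.update x i s)
          = (A i + ε) * ((A i + ε)⁻¹ * f i (Function.update x i s)) := by
            rw [← mul_assoc, ENNReal.mul_inv_cancel (hne i) (hnt i), one_mul]
        _ ≤ _ := by gcongr
    calc ∫⁻ x, ∏ i, (∫⁻ s, f i (Function.update x i s) ∂bandMeasure) ^ a ∂boxMeasure ι
        ≤ ∫⁻ x, (∏ i, (A i + ε) ^ a) *
            ∏ i, (∫⁻ s, F (Function.update x i s) ∂bandMeasure) ^ a ∂boxMeasure ι := by
          refine lintegral_mono fun x => ?_
          simp only
          rw [← Finset.prod_mul_distrib]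
          refine Finset.prod_le_prod' fun i _ => ?_
          rw [← ENNReal.mul_rpow_of_nonneg _ _ ha0.le]
          exact ENNReal.rpow_le_rpow (h3 x i) ha0.le
      _ = (∏ i, (A i + ε) ^ a) * ∫⁻ x,
            ∏ i, (∫⁻ s, F (Function.update x i s) ∂bandMeasure) ^ a ∂boxMeasure ι := by
          rw [lintegral_const_mul']
          exact ENNReal.prod_ne_top fun i _ => ENNReal.rpow_ne_top_of_nonneg ha0.le (hnt i)
      _ ≤ (∏ i, (A i + ε) ^ a) * (∫⁻ x, F x ∂boxMeasure ι) ^ (j / (j - 1)) := by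
          gcongr
          exact h1
      _ ≤ _ := by
          rw [mul_comm]
          gcongr
          apply div_nonneg <;> linarith
  have hlim : Tendsto (fun ε : ℝ≥0∞ => (Fintype.card ι : ℝ≥0∞) ^ (j / (j - 1)) *
      ∏ i, (A i + ε) ^ a) (𝓝[≠] 0) (𝓝 ((Fintype.card ι : ℝ≥0∞) ^ (j / (j - 1)) *
      ∏ i, (A i) ^ a)) := by
    have hcont : ∀ i, Tendsto (fun ε : ℝ≥0∞ => (A i + ε) ^ a) (𝓝[≠] 0) (𝓝 (A i ^ a)) := by
      intro i
      have : Continuous fun ε : ℝ≥0∞ => (A i + ε) ^ a :=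
        ENNReal.continuous_rpow_const.comp (continuous_const.add continuous_id)
      have h := (this.tendsto 0).mono_left (nhdsWithin_le_nhds (s := {0}ᶜ))
      rwa [add_zero] at h
    refine ENNReal.Tendsto.const_mul ?_ (Or.inr ?_)
    · exact ENNReal.tendsto_finsetProd_of_ne_top _ (fun i _ => hcont i)
        fun i _ => ENNReal.rpow_ne_top_of_nonneg ha0.le (hfin i)
    · exact ENNReal.rpow_ne_top_of_nonneg (by apply div_nonneg <;> linarith) (by simp)
  have hev : ∀ᶠ ε : ℝ≥0∞ in 𝓝[≠] 0, ε ≠ 0 ∧ ε ≠ ∞ := by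
    filter_upwards [self_mem_nhdsWithin, nhdsWithin_le_nhds
      (isOpen_Iio.mem_nhds (ENNReal.zero_lt_top : (0 : ℝ≥0∞) ∈ Iio ∞))] with ε h1 h2
    exact ⟨h1, (show ε < ∞ from h2).ne⟩
  refine ge_of_tendsto hlim (hev.mono fun ε h => key ε h.1 h.2)

end LoomisWhitney

/-! ### The multilinear estimate -/

section Multilinear

lemma IsNTP.le_average_one {X : Type*} [NormedAddCommGroup X] [NormedSpace ℝ X]
    {S : Set (X →L[ℝ] ℝ)} {g : X → ℝ} (hg : IsNTP S g) (w : X)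
    (hw : ∀ η ∈ S, |η w| ≤ 1) (x : X) (s : ℝ) :
    g (x + s • w) ≤ 4000 * (1 + s ^ 2) * ∫ t, g (x + t • w) ∂bandMeasure := by
  have h := hg.le_average (ι := Unit) (fun _ => w) (fun η hη _ => hw η hη) x fun _ => s
  have h2 : ∫ t : Unit → ℝ, g (x + t () • w) ∂boxMeasure Unit
      = ∫ t, g (x + t • w) ∂bandMeasure :=
    (measurePreserving_funUnique bandMeasure Unit).integral_comp
      (MeasurableEquiv.funUnique Unit ℝ).measurableEmbedding fun t => g (x + t • w)
  simpa [h2] using h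

variable {ι : Type*} [Fintype ι]

/-- The exponent `1 / (j - 1)` of the `j`-linear estimate. -/
noncomputable def mlExp (ι : Type*) [Fintype ι] : ℝ := 1 / ((Fintype.card ι : ℝ) - 1)

/-- The constant lost in one scale of the `j`-linear estimate. -/
noncomputable def mlConst (ι : Type*) [Fintype ι] : ℝ≥0∞ :=
  500 ^ Fintype.card ι * ((20000 ^ mlExp ι) ^ Fintype.card ι *
    (Fintype.card ι : ℝ≥0∞) ^ ((Fintype.card ι : ℝ) / ((Fintype.card ι : ℝ) - 1)))

lemma mlExp_pos (hι : 2 ≤ Fintype.card ι) : 0 < mlExp ι := by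
  have : (2 : ℝ) ≤ Fintype.card ι := by exact_mod_cast hι
  exact div_pos one_pos (by linarith)

lemma mlConst_ne_top (hι : 2 ≤ Fintype.card ι) : mlConst ι ≠ ∞ := by
  have : (2 : ℝ) ≤ Fintype.card ι := by exact_mod_cast hι
  refine ENNReal.mul_ne_top (by simp) (ENNReal.mul_ne_top (ENNReal.pow_ne_top ?_) ?_)
  · exact ENNReal.rpow_ne_top_of_nonneg (mlExp_pos hι).le (by simp)
  · exact ENNReal.rpow_ne_top_of_nonneg (by apply div_nonneg <;> linarith) (by simp)

lemma setLIntegral_cube_le (h : (ι → ℝ) → ℝ≥0∞) (hh : Measurable h) {c : ℝ} (hc0 : 0 ≤ c)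
    (hc1 : c ≤ 1) :
    ∫⁻ t in Icc (fun _ : ι => (-1 : ℝ)) fun _ => 1, h t
      ≤ ∫⁻ t in Icc (fun _ : ι => (-2 : ℝ)) fun _ => 2,
          ∫⁻ s in Icc (fun _ : ι => (-1 : ℝ)) fun _ => 1, h (t + c • s) := by
  set Q : Set (ι → ℝ) := Icc (fun _ : ι => (-1 : ℝ)) fun _ => 1 with hQ
  set Q2 : Set (ι → ℝ) := Icc (fun _ : ι => (-2 : ℝ)) fun _ => 2 with hQ2
  have hvol : 1 ≤ (volume : Measure (ι → ℝ)) Q := by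
    rw [hQ, Real.volume_Icc_pi]
    simp only [sub_neg_eq_add]
    rw [Finset.prod_const, ← ENNReal.ofReal_pow (by norm_num)]
    simp only [ENNReal.one_le_ofReal]
    exact one_le_pow₀ (by norm_num)
  rw [lintegral_lintegral_swap (by fun_prop)]
  calc ∫⁻ t in Q, h t ≤ (∫⁻ t in Q, h t) * volume Q := le_mul_of_one_le_right zero_le hvol
    _ = ∫⁻ _ in Q, ∫⁻ t in Q, h t := by rw [setLIntegral_const]
    _ ≤ _ := by
        refine setLIntegral_mono' measurableSet_Icc fun s hs => ?_
        rw [← lintegral_indicator measurableSet_Icc, ← lintegral_indicator measurableSet_Icc,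
          ← lintegral_add_right_eq_self _ (c • s)]
        refine lintegral_mono fun t => ?_
        by_cases ht : t + c • s ∈ Q
        · rw [indicator_of_mem ht, indicator_of_mem]
          constructor <;> intro l <;> have h1 := ht.1 l <;> have h2 := ht.2 l <;>
            have h3 := hs.1 l <;> have h4 := hs.2 l <;>
            simp only [Pi.add_apply, Pi.smul_apply, smul_eq_mul] at * <;> nlinarith
        · rw [indicator_of_notMem ht]; exact zero_le

variable [DecidableEq ι]

lemma multilinear_step (hι : 2 ≤ Fintype.card ι) {S : ι → Set ((ι → ℝ) →L[ℝ] ℝ)}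
    {g : ι → (ι → ℝ) → ℝ} (hg : ∀ i, IsNTP (S i) (g i)) (R : ℝ)
    (hR : ∀ i, ∀ η ∈ S i, |R * η (Pi.single i 1)| ≤ 1) (z : ι → ℝ) :
    ∫⁻ t in Icc (fun _ : ι => (-2 : ℝ)) fun _ => 2,
        ∏ i, ENNReal.ofReal (g i (z + R • t)) ^ mlExp ι
      ≤ mlConst ι * ∏ i, ENNReal.ofReal (∫ t, g i (z + R • t) ∂boxMeasure ι) ^ mlExp ι := by
  have ha := mlExp_pos hι
  have hcont : ∀ i, Continuous (g i) := fun i => (hg i).continuous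
  set f : ι → (ι → ℝ) → ℝ≥0∞ := fun i t => ENNReal.ofReal (g i (z + R • t)) with hf
  have hfm : ∀ i, Measurable (f i) := fun i =>
    ((hcont i).comp (by fun_prop)).measurable.ennreal_ofReal
  have hA : ∀ i, ENNReal.ofReal (∫ t, g i (z + R • t) ∂boxMeasure ι)
      = ∫⁻ t, f i t ∂boxMeasure ι := fun i =>
    ofReal_integral_eq_lintegral_ofReal ((hg i).integrable_comp _ (by fun_prop))
      (Eventually.of_forall fun t => (hg i).nonneg _)
  have hpt : ∀ t ∈ Icc (fun _ : ι => (-2 : ℝ)) fun _ => 2, ∀ i,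
      f i t ≤ 20000 * ∫⁻ s, f i (Function.update t i s) ∂bandMeasure := by
    intro t ht i
    have h1 := (hg i).le_average_one (R • Pi.single i 1)
      (fun η hη => by simpa using hR i η hη) (z + R • Function.update t i 0) (t i)
    have e : ∀ s : ℝ, z + R • Function.update t i 0 + s • R • (Pi.single i 1 : ι → ℝ)
        = z + R • Function.update t i s := by
      intro s
      ext l
      by_cases hl : l = i
      · subst hl; simp [mul_comm]
      · simp [hl]
    simp_rw [e] at h1
    rw [Function.update_eq_self] at h1
    have h2 : (t i) ^ 2 ≤ 4 := by nlinarith [ht.1 i, ht.2 i]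
    have h3 : g i (z + R • t) ≤ 20000 * ∫ s, g i (z + R • Function.update t i s) ∂bandMeasure := by
      refine h1.trans ?_
      refine mul_le_mul_of_nonneg_right (by linarith) (integral_nonneg fun s => (hg i).nonneg _)
    have h4 : ENNReal.ofReal (∫ s, g i (z + R • Function.update t i s) ∂bandMeasure)
        = ∫⁻ s, f i (Function.update t i s) ∂bandMeasure :=
      ofReal_integral_eq_lintegral_ofReal ((hg i).integrable_comp _
        (by have : Continuous fun s => Function.update t i s := continuous_const.update i continuous_id
            fun_prop))
        (Eventually.of_forall fun t => (hg i).nonneg _)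
    rw [← h4, show (20000 : ℝ≥0∞) = ENNReal.ofReal 20000 by simp,
      ← ENNReal.ofReal_mul (by norm_num)]
    exact ENNReal.ofReal_le_ofReal h3
  have hfin : ∀ i, ∫⁻ x, f i x ∂boxMeasure ι ≠ ∞ := fun i => by
    rw [← hA]; exact ENNReal.ofReal_ne_top
  have hLW := loomisWhitney hι f hfm hfin
  calc ∫⁻ t in Icc (fun _ : ι => (-2 : ℝ)) fun _ => 2, ∏ i, f i t ^ mlExp ι
      ≤ ∫⁻ t in Icc (fun _ : ι => (-2 : ℝ)) fun _ => 2, (20000 ^ mlExp ι) ^ Fintype.card ι *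
          ∏ i, (∫⁻ s, f i (Function.update t i s) ∂bandMeasure) ^ mlExp ι := by
        refine setLIntegral_mono' measurableSet_Icc fun t ht => ?_
        rw [← Finset.card_univ, ← Finset.prod_const, ← Finset.prod_mul_distrib]
        refine Finset.prod_le_prod' fun i _ => ?_
        rw [← ENNReal.mul_rpow_of_nonneg _ _ ha.le]
        exact ENNReal.rpow_le_rpow (hpt t ht i) ha.le
    _ ≤ ∫⁻ t, (20000 ^ mlExp ι) ^ Fintype.card ι *
          ∏ i, (∫⁻ s, f i (Function.update t i s) ∂bandMeasure) ^ mlExp ι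
          ∂((500 : ℝ≥0∞) ^ Fintype.card ι • boxMeasure ι) :=
        lintegral_mono' volume_restrict_le_boxMeasure le_rfl
    _ = 500 ^ Fintype.card ι * ((20000 ^ mlExp ι) ^ Fintype.card ι *
          ∫⁻ t, ∏ i, (∫⁻ s, f i (Function.update t i s) ∂bandMeasure) ^ mlExp ι
          ∂boxMeasure ι) := by
        rw [lintegral_smul_measure, lintegral_const_mul']
        · rfl
        · exact ENNReal.pow_ne_top (ENNReal.rpow_ne_top_of_nonneg ha.le (by simp))
    _ ≤ _ := by
        simp_rw [hA]
        rw [mlConst, mul_assoc, mul_assoc]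
        gcongr
        exact hLW

/-- The band measure spread over the directions `w`. -/
noncomputable def dirMeasure {X : Type*} [NormedAddCommGroup X] [NormedSpace ℝ X]
    [MeasurableSpace X] {ι : Type*} [Fintype ι] (w : ι → X) : Measure X :=
  (boxMeasure ι).map fun t => ∑ l, t l • w l

section Dir

variable {X E : Type*} [NormedAddCommGroup X] [NormedSpace ℝ X] [MeasurableSpace X] [BorelSpace X]
  {ι : Type*} [Fintype ι] (w : ι → X) [NormedAddCommGroup E] [NormedSpace ℝ E]

instance : IsProbabilityMeasure (dirMeasure w) :=
  Measure.isProbabilityMeasure_map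
    (by fun_prop : Continuous fun t : ι → ℝ => ∑ l, t l • w l).measurable.aemeasurable

lemma integral_dirMeasure [SecondCountableTopology E] {f : X → E} (hf : Continuous f) :
    ∫ v, f v ∂dirMeasure w = ∫ t, f (∑ l, t l • w l) ∂boxMeasure ι :=
  integral_map (by fun_prop : Continuous fun t : ι → ℝ => ∑ l, t l • w l).measurable.aemeasurable
    hf.aestronglyMeasurable

lemma integral_expChar_dirMeasure {η : X →L[ℝ] ℝ} {l : ι} (h : 1 ≤ |η (w l)|) :
    ∫ v, expChar η v ∂dirMeasure w = 0 := by
  rw [integral_dirMeasure w (continuous_expChar η)]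
  have key : ∀ t : ι → ℝ, expChar η (∑ l, t l • w l)
      = ∏ l, Complex.exp (Complex.I * ((η (w l) * t l : ℝ) : ℂ)) := by
    intro t
    rw [← Complex.exp_sum, expChar]
    congr 1
    simp only [map_sum, map_smul, smul_eq_mul]
    push_cast
    rw [Finset.mul_sum]
    exact Finset.sum_congr rfl fun l _ => by ring
  simp_rw [key]
  rw [boxMeasure, integral_fintype_prod_eq_prod (𝕜 := ℂ)
    (fun l t => Complex.exp (Complex.I * ((η (w l) * t : ℝ) : ℂ)))]
  exact Finset.prod_eq_zero (Finset.mem_univ l) (integral_exp_bandMeasure h)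

end Dir

lemma sum_smul_single (R : ℝ) (t : ι → ℝ) :
    ∑ l, t l • R • (Pi.single l 1 : ι → ℝ) = R • t := by
  ext i
  simp [Finset.sum_apply, Pi.single_apply, mul_comm]

theorem multilinear (hι : 2 ≤ Fintype.card ι) {D : ℝ} (hD : 1 ≤ D) (N : ℕ) :
    ∃ Ω : Measure (ι → ℝ), IsProbabilityMeasure Ω ∧
      (∀ (η : (ι → ℝ) →L[ℝ] ℝ) (l : ι), 1 ≤ |D ^ N * η (Pi.single l 1)| →
        ∫ v, expChar η v ∂Ω = 0) ∧
      ∀ (S : ι → Set ((ι → ℝ) →L[ℝ] ℝ)) (g : ι → (ι → ℝ) → ℝ), (∀ i, IsNTP (S i) (g i)) →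
        (∀ i, ∀ η ∈ S i, |η (Pi.single i 1)| ≤ 1) →
        (∀ i, ∀ η ∈ S i, ∀ m < N, (∀ l, |D ^ m * η (Pi.single l 1)| ≤ 1) →
          |D ^ (m + 1) * η (Pi.single i 1)| ≤ 1) →
        ∀ z : ι → ℝ, ∫⁻ t in Icc (fun _ : ι => (-1 : ℝ)) fun _ => 1,
            ∏ i, ENNReal.ofReal (g i (z + D ^ N • t)) ^ mlExp ι
          ≤ mlConst ι ^ (N + 1) *
            ∏ i, ENNReal.ofReal (∫ v, g i (z + v) ∂Ω) ^ mlExp ι := by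
  have hbox : ∀ (R : ℝ) (S : Set ((ι → ℝ) →L[ℝ] ℝ)) (g : (ι → ℝ) → ℝ), IsNTP S g → ∀ z,
      ∫ v, g (z + v) ∂dirMeasure (fun l : ι => R • (Pi.single l 1 : ι → ℝ))
        = ∫ t, g (z + R • t) ∂boxMeasure ι := by
    intro R S g hg z
    have := hg.continuous
    rw [integral_dirMeasure (f := fun v => g (z + v)) _ (by fun_prop)]
    simp_rw [sum_smul_single]
  have hsub : Icc (fun _ : ι => (-1 : ℝ)) (fun _ => 1)
      ⊆ Icc (fun _ : ι => (-2 : ℝ)) fun _ => 2 :=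
    Icc_subset_Icc (fun _ => by norm_num) fun _ => by norm_num
  induction N with
  | zero =>
    refine ⟨dirMeasure (fun l : ι => (1 : ℝ) • (Pi.single l 1 : ι → ℝ)), inferInstance, ?_, ?_⟩
    · intro η l h
      refine integral_expChar_dirMeasure _ (l := l) ?_
      simpa using h
    · intro S g hg h1 _ z
      simp_rw [hbox 1 _ _ (hg _)]
      rw [pow_zero, zero_add, pow_one]
      exact (lintegral_mono_set hsub).trans
        (multilinear_step hι hg 1 (by simpa using h1) z)
  | succ N ih =>
    obtain ⟨Ω, hΩ, hΩ0, ih⟩ := ih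
    set Ω' := dirMeasure (fun l : ι => D ^ (N + 1) • (Pi.single l 1 : ι → ℝ)) with hΩ'
    refine ⟨convMeasure Ω' Ω, inferInstance, ?_, ?_⟩
    · intro η l h
      rw [integral_convMeasure_expChar, integral_expChar_dirMeasure _ (l := l), zero_mul]
      simpa using h
    · intro S g hg h1 h2 z
      have hcont : ∀ i, Continuous (g i) := fun i => (hg i).continuous
      have ih' := ih S g hg h1 fun i η hη m hm => h2 i η hη m (by omega)
      set G : ι → (ι → ℝ) → ℝ := fun i x => ∫ v, g i (x + v) ∂Ω with hG
      have hGn : ∀ i, IsNTP {η ∈ S i | ∫ v, expChar η v ∂Ω ≠ 0} (G i) := fun i =>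
        (hg i).average Ω
      have hstep := multilinear_step hι hGn (D ^ (N + 1)) (by
        rintro i η ⟨hη, hne⟩
        refine h2 i η hη N (by omega) fun l => ?_
        by_contra hc
        exact hne (hΩ0 η l (by linarith))) z
      have hD0 : (0 : ℝ) < D := by linarith
      have hc := setLIntegral_cube_le (ι := ι)
        (fun t => ∏ i, ENNReal.ofReal (g i (z + D ^ (N + 1) • t)) ^ mlExp ι)
        (by fun_prop) (c := D⁻¹) (by positivity) (inv_le_one_of_one_le₀ hD)
      have e : ∀ t s : ι → ℝ, z + D ^ (N + 1) • (t + D⁻¹ • s)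
          = z + D ^ (N + 1) • t + D ^ N • s := by
        intro t s
        rw [smul_add, smul_smul, pow_succ, mul_assoc, mul_inv_cancel₀ hD0.ne', mul_one, add_assoc]
      simp_rw [e] at hc
      refine hc.trans ?_
      calc _ ≤ ∫⁻ t in Icc (fun _ : ι => (-2 : ℝ)) fun _ => 2, mlConst ι ^ (N + 1) *
            ∏ i, ENNReal.ofReal (G i (z + D ^ (N + 1) • t)) ^ mlExp ι := by
              exact lintegral_mono fun t => ih' _
        _ = mlConst ι ^ (N + 1) * ∫⁻ t in Icc (fun _ : ι => (-2 : ℝ)) fun _ => 2,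
            ∏ i, ENNReal.ofReal (G i (z + D ^ (N + 1) • t)) ^ mlExp ι := by
              rw [lintegral_const_mul' _ _ (ENNReal.pow_ne_top (mlConst_ne_top hι))]
        _ ≤ _ := by
              rw [pow_succ _ (N + 1), mul_assoc]
              gcongr
              refine hstep.trans (le_of_eq ?_)
              congr 1
              refine Finset.prod_congr rfl fun i _ => ?_
              rw [(hg i).integral_convMeasure, ← hbox _ _ _ (hGn i)]

end Multilinear

/-! ### Wave families -/

/-- Space-time points. -/
abbrev SpaceTime (n : ℕ) : Type := (Fin n → ℝ) × ℝ

/-- The coordinate directions of space-time. -/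
noncomputable def coordDir (n : ℕ) : Fin n ⊕ Unit → SpaceTime n :=
  Sum.elim (fun i => (Pi.single i 1, 0)) fun _ => (0, 1)

/-- The coordinates of a point. -/
def stCoord {n : ℕ} (x : SpaceTime n) : Fin n ⊕ Unit → ℝ :=
  Sum.elim x.1 fun _ => x.2

lemma abs_stCoord_le {n : ℕ} (x : SpaceTime n) (b : Fin n ⊕ Unit) : |stCoord x b| ≤ ‖x‖ := by
  rcases b with i | u
  · exact (norm_le_pi_norm x.1 i).trans (norm_fst_le x)
  · exact norm_snd_le x

lemma sum_stCoord_smul {n : ℕ} (x : SpaceTime n) : ∑ b, stCoord x b • coordDir n b = x := by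
  rw [Fintype.sum_sum_type]
  ext i
  · simp [stCoord, coordDir, Prod.fst_sum, Finset.sum_apply, Pi.single_apply]
  · simp [stCoord, coordDir, Prod.snd_sum]

lemma norm_coordDir_le (n : ℕ) (b : Fin n ⊕ Unit) : ‖coordDir n b‖ ≤ 1 := by
  rcases b with i | u
  · simp only [coordDir, Sum.elim_inl, Prod.norm_mk, norm_zero]
    refine max_le ((pi_norm_le_iff_of_nonneg zero_le_one).2 fun j => ?_) zero_le_one
    by_cases h : j = i
    · subst h; simp
    · simp [h]
  · simp [coordDir, Prod.norm_mk]

/-- The band measure at scale `R` in all coordinate directions. -/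
noncomputable def coordMeasure (n : ℕ) (R : ℝ) : Measure (SpaceTime n) :=
  dirMeasure fun b => R • coordDir n b

instance (n : ℕ) (R : ℝ) : IsProbabilityMeasure (coordMeasure n R) := by
  unfold coordMeasure; infer_instance

lemma IsNTP.le_coord_average {n : ℕ} {S : Set (SpaceTime n →L[ℝ] ℝ)} {g : SpaceTime n → ℝ}
    (hg : IsNTP S g) {R H : ℝ} (hR : 0 < R) (hS : ∀ η ∈ S, ‖η‖ * R ≤ 1) {x z : SpaceTime n}
    (hxz : ‖x - z‖ ≤ H * R) :
    g x ≤ (4000 * (1 + H ^ 2)) ^ (n + 1) * ∫ v, g (z + v) ∂coordMeasure n R := by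
  have h := hg.le_average (fun b => R • coordDir n b) (fun η hη b => by
    have h1 := η.le_opNorm (R • coordDir n b)
    rw [norm_smul, Real.norm_of_nonneg hR.le] at h1
    have h2 := mul_le_mul_of_nonneg_left (norm_coordDir_le n b)
      (mul_nonneg (norm_nonneg η) hR.le)
    rw [Real.norm_eq_abs] at h1
    linarith [hS η hη]) z fun b => stCoord (x - z) b / R
  have h1 : z + ∑ b, (stCoord (x - z) b / R) • R • coordDir n b = x := by
    simp_rw [smul_smul, div_mul_cancel₀ _ hR.ne']
    rw [sum_stCoord_smul]; abel
  rw [h1] at h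
  have := hg.continuous
  rw [coordMeasure, integral_dirMeasure (f := fun v => g (z + v)) _ (by fun_prop)]
  refine h.trans (mul_le_mul_of_nonneg_right ?_ (integral_nonneg fun _ => hg.nonneg _))
  calc ∏ b, 4000 * (1 + (stCoord (x - z) b / R) ^ 2)
      ≤ ∏ _b : Fin n ⊕ Unit, 4000 * (1 + H ^ 2) := by
        refine Finset.prod_le_prod (fun _ _ => by positivity) fun b _ => ?_
        have h3 : |stCoord (x - z) b / R| ≤ H := by
          rw [abs_div, abs_of_pos hR, div_le_iff₀ hR]
          exact (abs_stCoord_le _ b).trans hxz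
        have : (stCoord (x - z) b / R) ^ 2 ≤ H ^ 2 := sq_le_sq' (abs_le.1 h3).1 (abs_le.1 h3).2
        linarith
    _ = _ := by simp

/-- Frequencies and normals of a finite family of plane waves. -/
structure WaveFamily (n : ℕ) (κ : Type) where
  /-- horizontal frequency -/
  y : κ → Fin n → ℝ
  /-- vertical frequency -/
  σ : κ → ℝ
  /-- slope of the frequency surface -/
  p : κ → Fin n → ℝ

lemma abs_dotProduct_le {n : ℕ} (a b : Fin n → ℝ) : |a ⬝ᵥ b| ≤ n * ‖a‖ * ‖b‖ := by
  calc |a ⬝ᵥ b| ≤ ∑ i, |a i * b i| := Finset.abs_sum_le_sum_abs _ _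
    _ ≤ ∑ _i : Fin n, ‖a‖ * ‖b‖ := by
        refine Finset.sum_le_sum fun i _ => ?_
        rw [abs_mul]
        exact mul_le_mul (norm_le_pi_norm a i) (norm_le_pi_norm b i) (abs_nonneg _) (norm_nonneg _)
    _ = _ := by simp [mul_assoc]

namespace WaveFamily

variable {n : ℕ} {κ : Type} (W : WaveFamily n κ)

/-- The frequency functional of a wave. -/
noncomputable def freq (k : κ) : SpaceTime n →L[ℝ] ℝ :=
  LinearMap.toContinuousLinearMap
    { toFun := fun x => W.y k ⬝ᵥ x.1 + W.σ k * x.2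
      map_add' := fun x z => by simp [dotProduct_add]; ring
      map_smul' := fun c x => by simp; ring }

lemma freq_apply (k : κ) (x : SpaceTime n) : W.freq k x = W.y k ⬝ᵥ x.1 + W.σ k * x.2 := rfl

/-- The normal direction of a wave. -/
def normal (k : κ) : SpaceTime n := (-W.p k, 1)

lemma freq_sub_normal (k l m : κ) :
    (W.freq k - W.freq l) (W.normal m) = W.σ k - W.σ l - W.p m ⬝ᵥ (W.y k - W.y l) := by
  simp only [sub_apply, freq_apply, normal, dotProduct_neg,
    dotProduct_comm (W.p m), sub_dotProduct]
  ring

/-- The superposition of the waves in `I` with coefficients `c`. -/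
noncomputable def wave (c : κ → ℂ) (I : Finset κ) (x : SpaceTime n) : ℂ :=
  ∑ k ∈ I, c k * expChar (W.freq k) x

/-- Quantitative uniform convexity of the frequency surface over `s`. -/
structure IsConv (A : ℝ) (s : Finset κ) : Prop where
  norm_y_le : ∀ k ∈ s, ‖W.y k‖ ≤ 1
  norm_p_le : ∀ k ∈ s, ‖W.p k‖ ≤ A
  norm_p_sub_le : ∀ k ∈ s, ∀ l ∈ s, ‖W.p k - W.p l‖ ≤ A * ‖W.y k - W.y l‖
  convex_lower : ∀ k ∈ s, ∀ l ∈ s,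
    A⁻¹ * ‖W.y k - W.y l‖ ^ 2 ≤ W.σ k - W.σ l - W.p l ⬝ᵥ (W.y k - W.y l)
  convex_upper : ∀ k ∈ s, ∀ l ∈ s,
    W.σ k - W.σ l - W.p l ⬝ᵥ (W.y k - W.y l) ≤ A * ‖W.y k - W.y l‖ ^ 2

/-- The Lipschitz constant of the frequency functional. -/
noncomputable def freqConst (n : ℕ) (A : ℝ) : ℝ := n + n * A + 2 * A + 1

lemma freqConst_ge_one {n : ℕ} {A : ℝ} (hA : 0 ≤ A) : 1 ≤ freqConst n A := by
  unfold freqConst; nlinarith [(Nat.cast_nonneg n : (0 : ℝ) ≤ n), mul_nonneg (Nat.cast_nonneg n : (0 : ℝ) ≤ n) hA]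

variable {W} {A : ℝ} {s : Finset κ}

lemma IsConv.norm_y_sub_le (h : W.IsConv A s) {k l : κ} (hk : k ∈ s) (hl : l ∈ s) :
    ‖W.y k - W.y l‖ ≤ 2 := by
  have := norm_sub_le (W.y k) (W.y l)
  linarith [h.norm_y_le k hk, h.norm_y_le l hl]

lemma IsConv.norm_freq_sub_le (h : W.IsConv A s) (hA : 0 < A) {k l : κ} (hk : k ∈ s)
    (hl : l ∈ s) : ‖W.freq k - W.freq l‖ ≤ freqConst n A * ‖W.y k - W.y l‖ := by
  set u := ‖W.y k - W.y l‖ with hu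
  have hu0 : 0 ≤ u := norm_nonneg _
  have hn : (0 : ℝ) ≤ n := Nat.cast_nonneg n
  refine ContinuousLinearMap.opNorm_le_bound _ (by have := freqConst_ge_one (n := n) hA.le; positivity) fun x => ?_
  have e : (W.freq k - W.freq l) x = (W.y k - W.y l) ⬝ᵥ x.1 + (W.σ k - W.σ l) * x.2 := by
    simp only [sub_apply, freq_apply, sub_dotProduct]; ring
  have h1 := abs_dotProduct_le (W.y k - W.y l) x.1
  have h2 := abs_dotProduct_le (W.p l) (W.y k - W.y l)
  have h3 := h.convex_lower k hk l hl
  have h4 := h.convex_upper k hk l hl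
  have h5 := h.norm_y_sub_le hk hl
  have h6 := h.norm_p_le l hl
  have hσ : |W.σ k - W.σ l| ≤ (n * A + 2 * A) * u := by
    have h7 : (n : ℝ) * ‖W.p l‖ * u ≤ n * A * u := by gcongr
    have h8 : A * u ^ 2 ≤ 2 * A * u := by nlinarith [mul_nonneg hA.le hu0]
    have h9 : 0 ≤ A⁻¹ * u ^ 2 := by positivity
    rw [abs_le]
    have := abs_le.1 h2
    constructor <;> nlinarith
  rw [Real.norm_eq_abs, e]
  have hx1 := norm_fst_le x
  have hx2 := norm_snd_le x
  rw [Real.norm_eq_abs] at hx2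
  calc |(W.y k - W.y l) ⬝ᵥ x.1 + (W.σ k - W.σ l) * x.2|
      ≤ |(W.y k - W.y l) ⬝ᵥ x.1| + |W.σ k - W.σ l| * |x.2| := by
        rw [← abs_mul]; exact abs_add_le _ _
    _ ≤ n * u * ‖x‖ + (n * A + 2 * A) * u * ‖x‖ := by
        gcongr
        exact h1.trans (by gcongr)
    _ ≤ freqConst n A * u * ‖x‖ := by
        unfold freqConst
        nlinarith [mul_nonneg hu0 (norm_nonneg x)]

lemma IsConv.norm_normal_le (h : W.IsConv A s) (hA : 1 ≤ A) {k : κ} (hk : k ∈ s) :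
    ‖W.normal k‖ ≤ A := by
  simp only [normal, Prod.norm_mk, norm_neg, norm_one]
  exact max_le (h.norm_p_le k hk) hA

lemma norm_normal_sub (k l : κ) : ‖W.normal k - W.normal l‖ = ‖W.p k - W.p l‖ := by
  simp only [normal, Prod.mk_sub_mk, sub_self, Prod.norm_mk, norm_zero]
  rw [max_eq_left (norm_nonneg _), ← neg_sub', norm_neg]

lemma isNTP_wave_sq (c : κ → ℂ) (I : Finset κ) :
    IsNTP {η | ∃ k ∈ I, ∃ l ∈ I, η = W.freq k - W.freq l} (fun x => ‖W.wave c I x‖ ^ 2) :=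
  isNTP_norm_sq I c W.freq

lemma continuous_wave (c : κ → ℂ) (I : Finset κ) : Continuous (W.wave c I) := by
  unfold wave
  exact continuous_finsetSum _ fun k _ => continuous_const.mul (continuous_expChar _)

end WaveFamily

/-- Quantitative linear independence. -/
def IsIndep {X ι : Type*} [NormedAddCommGroup X] [NormedSpace ℝ X] [Fintype ι] (A : ℝ)
    (v : ι → X) : Prop :=
  ∀ a : ι → ℝ, ∑ l, |a l| ≤ A * ‖∑ l, a l • v l‖

namespace WaveFamily

variable {n : ℕ} {κ : Type} {W : WaveFamily n κ} {A : ℝ} {s : Finset κ}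

lemma le_of_quadratic {A P Q u μ : ℝ} (hA : 0 < A) (hP : 0 ≤ P) (hQ : 0 ≤ Q) (hμ : 0 ≤ μ)
    (h : A⁻¹ * u ^ 2 ≤ P * u * μ + Q * μ ^ 2) : u ≤ (A * (P + Q) + 1) * μ := by
  by_contra hc
  push Not at hc
  have hk : 0 ≤ A * (P + Q) := by positivity
  have h1 : μ ≤ u := by nlinarith
  have hu : 0 ≤ u := hμ.trans h1
  have h2 : Q * μ ^ 2 ≤ Q * (u * μ) := by
    apply mul_le_mul_of_nonneg_left _ hQ; nlinarith
  have h3 : u ^ 2 ≤ A * (P + Q) * (u * μ) := by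
    have : u ^ 2 = A * (A⁻¹ * u ^ 2) := by field_simp
    rw [this, mul_assoc]
    apply mul_le_mul_of_nonneg_left _ hA.le
    linarith
  by_cases hu0 : u = 0
  · subst hu0; nlinarith [mul_nonneg hk hμ]
  · have : 0 < u := lt_of_le_of_ne hu (Ne.symm hu0)
    have h4 : u ≤ A * (P + Q) * μ := by
      have : u * u ≤ u * (A * (P + Q) * μ) := by nlinarith
      exact le_of_mul_le_mul_left this ‹0 < u›
    linarith

/-- Waves whose normals are close to a fixed subspace are separated by the frequencies measured
along that subspace. -/
lemma IsConv.norm_y_sub_le_of_near (h : W.IsConv A s) (hA : 1 ≤ A) {ι : Type*} [Fintype ι]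
    {A' C₁ δ : ℝ} (hA' : 0 ≤ A') (hC₁ : 0 ≤ C₁) (hδ : 0 ≤ δ)
    (hδA : A' * A * freqConst n A * δ ≤ A⁻¹) {v w : ι → SpaceTime n} (hv : IsIndep A' v)
    (hvw : ∀ l, ‖v l - w l‖ ≤ δ) {K μ : ℝ} (hK : 0 < K) (hKμ : 1 / K ≤ μ) {k k' : κ}
    (hk : k ∈ s) (hk' : k' ∈ s) (hn : ∃ b : ι → ℝ, ‖W.normal k - ∑ l, b l • v l‖ ≤ C₁ / K)
    (hn' : ∃ b : ι → ℝ, ‖W.normal k' - ∑ l, b l • v l‖ ≤ C₁ / K)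
    (hμ : ∀ l, |(W.freq k - W.freq k') (w l)| ≤ μ) :
    ‖W.y k - W.y k'‖ ≤ (A * ((A' * A + 2 * A' * C₁ * freqConst n A * δ
      + 2 * freqConst n A * C₁) + 2 * A' * C₁) + 1) * μ := by
  obtain ⟨b, hb⟩ := hn
  obtain ⟨b', hb'⟩ := hn'
  set C := freqConst n A with hC
  have hC1 : 1 ≤ C := freqConst_ge_one (by linarith)
  set u := ‖W.y k - W.y k'‖ with hu
  have hu0 : 0 ≤ u := norm_nonneg _
  have hμ0 : 0 ≤ μ := le_trans (by positivity) hKμ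
  have hA0 : 0 < A := by linarith
  set ξ := W.freq k - W.freq k' with hξ
  have hξn : ‖ξ‖ ≤ C * u := h.norm_freq_sub_le hA0 hk hk'
  set err := (W.normal k' - ∑ l, b' l • v l) - (W.normal k - ∑ l, b l • v l) with herr
  have hCK : C₁ / K ≤ C₁ * μ := by
    rw [div_eq_mul_one_div]; exact mul_le_mul_of_nonneg_left hKμ hC₁
  have herrn : ‖err‖ ≤ 2 * C₁ * μ := by
    have := norm_sub_le (W.normal k' - ∑ l, b' l • v l) (W.normal k - ∑ l, b l • v l)
    linarith
  have hdec : W.normal k' - W.normal k = ∑ l, (b' l - b l) • v l + err := by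
    simp only [herr, sub_smul, Finset.sum_sub_distrib]; abel
  have hlow : 2 * A⁻¹ * u ^ 2 ≤ ξ (W.normal k' - W.normal k) := by
    rw [map_sub, hξ, freq_sub_normal, freq_sub_normal]
    have h1 := h.convex_lower k hk k' hk'
    have h2 := h.convex_lower k' hk' k hk
    rw [norm_sub_rev, ← neg_sub (W.y k) (W.y k'), dotProduct_neg] at h2
    linarith
  have hcoef : ∑ l, |b' l - b l| ≤ A' * (A * u + 2 * C₁ * μ) := by
    refine (hv fun l => b' l - b l).trans (mul_le_mul_of_nonneg_left ?_ hA')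
    rw [show ∑ l, (b' l - b l) • v l = (W.normal k' - W.normal k) - err by rw [hdec]; abel]
    refine (norm_sub_le _ _).trans (add_le_add ?_ herrn)
    rw [norm_normal_sub, hu, norm_sub_rev (W.y k)]
    exact h.norm_p_sub_le k' hk' k hk
  have hξv : ∀ l, |ξ (v l)| ≤ μ + C * u * δ := by
    intro l
    have h1 : ξ (v l) = ξ (w l) + ξ (v l - w l) := by rw [map_sub]; ring
    rw [h1]
    refine (abs_add_le _ _).trans (add_le_add (hμ l) ?_)
    rw [← Real.norm_eq_abs]
    exact (ξ.le_opNorm _).trans (mul_le_mul hξn (hvw l) (norm_nonneg _) (by positivity))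
  have hup : ξ (W.normal k' - W.normal k)
      ≤ A' * (A * u + 2 * C₁ * μ) * (μ + C * u * δ) + C * u * (2 * C₁ * μ) := by
    rw [hdec, map_add, map_sum]
    refine add_le_add ?_ ?_
    · calc ∑ l, ξ ((b' l - b l) • v l) ≤ ∑ l, |b' l - b l| * (μ + C * u * δ) := by
            refine Finset.sum_le_sum fun l _ => ?_
            rw [map_smul, smul_eq_mul]
            refine (le_abs_self _).trans ?_
            rw [abs_mul]
            exact mul_le_mul_of_nonneg_left (hξv l) (abs_nonneg _)
        _ = (∑ l, |b' l - b l|) * (μ + C * u * δ) := by rw [Finset.sum_mul]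
        _ ≤ _ := mul_le_mul_of_nonneg_right hcoef (by positivity)
    · refine (le_abs_self _).trans ?_
      rw [← Real.norm_eq_abs]
      exact (ξ.le_opNorm _).trans (mul_le_mul hξn herrn (norm_nonneg _) (by positivity))
  apply le_of_quadratic hA0 (by positivity) (by positivity) hμ0
  have h5 : A' * A * C * δ * u ^ 2 ≤ A⁻¹ * u ^ 2 := mul_le_mul_of_nonneg_right hδA (sq_nonneg _)
  nlinarith

/-- The frequency differences of a small cap are almost constant along its normal. -/
lemma IsConv.abs_freq_sub_normal_le (h : W.IsConv A s) (hA : 1 ≤ A) {k k' a : κ} {δ : ℝ}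
    (hk : k ∈ s) (hk' : k' ∈ s) (ha : a ∈ s) (h1 : ‖W.y k - W.y a‖ ≤ δ)
    (h2 : ‖W.y k' - W.y a‖ ≤ δ) :
    |(W.freq k - W.freq k') (W.normal a)| ≤ (2 + n) * A * δ * ‖W.y k - W.y k'‖ := by
  set u := ‖W.y k - W.y k'‖ with hu
  have hu0 : 0 ≤ u := norm_nonneg _
  have hu2 : u ≤ 2 * δ := by
    have := norm_sub_le_norm_sub_add_norm_sub (W.y k) (W.y a) (W.y k')
    rw [norm_sub_rev (W.y a)] at this
    linarith
  rw [freq_sub_normal]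
  have e : W.σ k - W.σ k' - W.p a ⬝ᵥ (W.y k - W.y k')
      = (W.σ k - W.σ k' - W.p k' ⬝ᵥ (W.y k - W.y k'))
        + (W.p k' - W.p a) ⬝ᵥ (W.y k - W.y k') := by
    rw [sub_dotProduct]; ring
  have h3 := h.convex_lower k hk k' hk'
  have h4 := h.convex_upper k hk k' hk'
  have h5 := abs_dotProduct_le (W.p k' - W.p a) (W.y k - W.y k')
  have h6 := h.norm_p_sub_le k' hk' a ha
  have h7 : 0 ≤ A⁻¹ * u ^ 2 := by positivity
  rw [e]
  refine (abs_add_le _ _).trans ?_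
  rw [abs_of_nonneg (h7.trans h3)]
  have h8 : (n : ℝ) * ‖W.p k' - W.p a‖ * u ≤ n * (A * δ) * u := by
    gcongr
    exact h6.trans (mul_le_mul_of_nonneg_left h2 (by linarith))
  have h9 : A * u ^ 2 ≤ A * (2 * δ * u) := by
    apply mul_le_mul_of_nonneg_left _ (by linarith); nlinarith
  rw [← hu] at h4 h5
  nlinarith

end WaveFamily

/-! ### Almost orthogonality -/

lemma integral_norm_sq_sum_le {X Q : Type*} [MeasurableSpace X] [TopologicalSpace X]
    [OpensMeasurableSpace X] (Ω : Measure X) [IsProbabilityMeasure Ω] (J : Finset Q)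
    (f : Q → X → ℂ) (hf : ∀ q, Continuous (f q)) (hb : ∀ q, ∃ C, ∀ x, ‖f q x‖ ≤ C)
    (rel : Q → Q → Prop) [∀ q r, Decidable (rel q r)] (hsymm : ∀ q r, rel q r → rel r q)
    {M : ℝ} (hM : ∀ q ∈ J, ((J.filter (rel q)).card : ℝ) ≤ M)
    (h0 : ∀ q ∈ J, ∀ r ∈ J, ¬ rel q r → ∫ x, f q x * (starRingEnd ℂ) (f r x) ∂Ω = 0) :
    ∫ x, ‖∑ q ∈ J, f q x‖ ^ 2 ∂Ω ≤ M * ∑ q ∈ J, ∫ x, ‖f q x‖ ^ 2 ∂Ω := by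
  have hint : ∀ q r, Integrable (fun x => f q x * (starRingEnd ℂ) (f r x)) Ω := by
    intro q r
    obtain ⟨C, hC⟩ := hb q
    obtain ⟨C', hC'⟩ := hb r
    have := hf q
    have := hf r
    refine Integrable.of_bound (C := C * C') (by fun_prop) (ae_of_all _ fun x => ?_)
    rw [norm_mul, RCLike.norm_conj]
    exact mul_le_mul (hC x) (hC' x) (norm_nonneg _) ((norm_nonneg _).trans (hC x))
  have hint2 : ∀ q, Integrable (fun x => ‖f q x‖ ^ 2) Ω := by
    intro q
    obtain ⟨C, hC⟩ := hb q
    have := hf q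
    refine Integrable.of_bound (C := C ^ 2) (by fun_prop) (ae_of_all _ fun x => ?_)
    rw [norm_pow, norm_norm]
    exact pow_le_pow_left₀ (norm_nonneg _) (hC x) 2
  set a : Q → ℝ := fun q => ∫ x, ‖f q x‖ ^ 2 ∂Ω with ha
  have ha0 : ∀ q, 0 ≤ a q := fun q => integral_nonneg fun x => by positivity
  have hpair : ∀ q r, ‖∫ x, f q x * (starRingEnd ℂ) (f r x) ∂Ω‖ ≤ (a q + a r) / 2 := by
    intro q r
    refine (norm_integral_le_integral_norm _).trans ?_
    rw [ha, ← integral_add (hint2 q) (hint2 r), ← integral_div]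
    refine integral_mono (hint q r).norm (((hint2 q).add (hint2 r)).div_const 2) fun x => ?_
    simp only [norm_mul, RCLike.norm_conj]
    nlinarith [sq_nonneg (‖f q x‖ - ‖f r x‖)]
  have hcomplex : ((∫ x, ‖∑ q ∈ J, f q x‖ ^ 2 ∂Ω : ℝ) : ℂ)
      = ∑ q ∈ J, ∑ r ∈ J, ∫ x, f q x * (starRingEnd ℂ) (f r x) ∂Ω := by
    rw [← integral_complex_ofReal]
    simp_rw [← integral_finsetSum _ fun r (_ : r ∈ J) => hint _ r]
    rw [← integral_finsetSum _ fun q _ => integrable_finsetSum _ fun r _ => hint q r]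
    congr 1 with x
    rw [← Finset.sum_mul_sum, ← map_sum, RCLike.mul_conj]
    push_cast
    rfl
  calc ∫ x, ‖∑ q ∈ J, f q x‖ ^ 2 ∂Ω
      = ‖((∫ x, ‖∑ q ∈ J, f q x‖ ^ 2 ∂Ω : ℝ) : ℂ)‖ := by
        rw [Complex.norm_real, Real.norm_of_nonneg (integral_nonneg fun x => by positivity)]
    _ ≤ ∑ q ∈ J, ∑ r ∈ J, ‖∫ x, f q x * (starRingEnd ℂ) (f r x) ∂Ω‖ := by
        rw [hcomplex]
        exact (norm_sum_le _ _).trans (Finset.sum_le_sum fun q _ => norm_sum_le _ _)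
    _ ≤ ∑ q ∈ J, ∑ r ∈ J, if rel q r then (a q + a r) / 2 else 0 := by
        refine Finset.sum_le_sum fun q hq => Finset.sum_le_sum fun r hr => ?_
        split_ifs with h
        · exact hpair q r
        · rw [h0 q hq r hr h, norm_zero]
    _ = ∑ q ∈ J, ∑ r ∈ J, (if rel q r then a q else 0) := by
        have e1 : ∑ q ∈ J, ∑ r ∈ J, (if rel q r then a r else 0)
            = ∑ q ∈ J, ∑ r ∈ J, (if rel q r then a q else 0) := by
          rw [Finset.sum_comm]
          refine Finset.sum_congr rfl fun q _ => Finset.sum_congr rfl fun r _ => ?_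
          simp only [show rel r q ↔ rel q r from ⟨hsymm r q, hsymm q r⟩]
        have e2 : ∀ q r, (if rel q r then (a q + a r) / 2 else 0)
            = (if rel q r then a q else 0) / 2 + (if rel q r then a r else 0) / 2 := by
          intro q r; split_ifs <;> ring
        simp_rw [e2, Finset.sum_add_distrib, ← Finset.sum_div]
        rw [e1]; ring
    _ ≤ ∑ q ∈ J, M * a q := by
        refine Finset.sum_le_sum fun q hq => ?_
        rw [← Finset.sum_filter, Finset.sum_const, nsmul_eq_mul]
        exact mul_le_mul_of_nonneg_right (hM q hq) (ha0 q)
    _ = _ := by rw [Finset.mul_sum]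

namespace WaveFamily

variable {n : ℕ} {κ : Type} {W : WaveFamily n κ} {A : ℝ} {s : Finset κ}

lemma norm_wave_le (c : κ → ℂ) (I : Finset κ) (x : SpaceTime n) :
    ‖W.wave c I x‖ ≤ ∑ k ∈ I, ‖c k‖ := by
  refine (norm_sum_le _ _).trans (Finset.sum_le_sum fun k _ => ?_)
  rw [norm_mul, norm_expChar, mul_one]

/-- Translating a superposition of waves only changes the phases of the coefficients. -/
lemma wave_add (c : κ → ℂ) (I : Finset κ) (x v : SpaceTime n) :
    W.wave c I (x + v) = W.wave (fun k => c k * expChar (W.freq k) v) I x := by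
  unfold wave
  refine Finset.sum_congr rfl fun k _ => ?_
  rw [expChar_add]; ring

lemma wave_fiberwise {Q : Type*} [DecidableEq Q] (c : κ → ℂ) (I : Finset κ) (τ : κ → Q)
    {J : Finset Q} (hJ : ∀ k ∈ I, τ k ∈ J) (x : SpaceTime n) :
    W.wave c I x = ∑ q ∈ J, W.wave c (I.filter fun k => τ k = q) x :=
  (Finset.sum_fiberwise_of_maps_to hJ _).symm

lemma integral_wave_mul_conj (c : κ → ℂ) (I I' : Finset κ) (z : SpaceTime n)
    (Ω : Measure (SpaceTime n)) [IsProbabilityMeasure Ω]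
    (h : ∀ k ∈ I, ∀ l ∈ I', ∫ v, expChar (W.freq k - W.freq l) v ∂Ω = 0) :
    ∫ v, W.wave c I (z + v) * (starRingEnd ℂ) (W.wave c I' (z + v)) ∂Ω = 0 := by
  have hcont : ∀ k, Continuous fun v : SpaceTime n => expChar (W.freq k) (z + v) := fun k =>
    (continuous_expChar _).comp (by fun_prop)
  have e : ∀ v, W.wave c I (z + v) * (starRingEnd ℂ) (W.wave c I' (z + v))
      = ∑ k ∈ I, ∑ l ∈ I', (c k * (starRingEnd ℂ) (c l) * expChar (W.freq k - W.freq l) z)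
        * expChar (W.freq k - W.freq l) v := by
    intro v
    unfold wave
    rw [map_sum, Finset.sum_mul_sum]
    refine Finset.sum_congr rfl fun k _ => Finset.sum_congr rfl fun l _ => ?_
    rw [map_mul, conj_expChar, mul_assoc _ (expChar _ z), ← expChar_add, sub_eq_add_neg,
      expChar_mul]
    ring
  simp_rw [e]
  have hint : ∀ η : SpaceTime n →L[ℝ] ℝ, Integrable (expChar η) Ω := fun η =>
    Integrable.of_bound (C := 1) (continuous_expChar η).aestronglyMeasurable
      (ae_of_all _ fun x => (norm_expChar η x).le)
  rw [integral_finsetSum _ fun k _ => integrable_finsetSum _ fun l _ => (hint _).const_mul _]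
  refine Finset.sum_eq_zero fun k hk => ?_
  rw [integral_finsetSum _ fun l _ => (hint _).const_mul _]
  refine Finset.sum_eq_zero fun l hl => ?_
  rw [integral_const_mul, h k hk l hl, mul_zero]

/-- Almost orthogonality of the pieces of a superposition under a frequency cut-off. -/
lemma integral_wave_sq_le {Q : Type*} [DecidableEq Q] (c : κ → ℂ) (I : Finset κ) (τ : κ → Q)
    (rel : Q → Q → Prop) [∀ q r, Decidable (rel q r)] (hsymm : ∀ q r, rel q r → rel r q)
    {M : ℝ} (hM : ∀ q ∈ I.image τ, (((I.image τ).filter (rel q)).card : ℝ) ≤ M)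
    (Ω : Measure (SpaceTime n)) [IsProbabilityMeasure Ω]
    (h : ∀ k ∈ I, ∀ l ∈ I, ¬ rel (τ k) (τ l) → ∫ v, expChar (W.freq k - W.freq l) v ∂Ω = 0)
    (z : SpaceTime n) :
    ∫ v, ‖W.wave c I (z + v)‖ ^ 2 ∂Ω
      ≤ M * ∑ q ∈ I.image τ, ∫ v, ‖W.wave c (I.filter fun k => τ k = q) (z + v)‖ ^ 2 ∂Ω := by
  simp_rw [wave_fiberwise c I τ fun k hk => Finset.mem_image_of_mem τ hk]
  refine integral_norm_sq_sum_le Ω _ _ (fun q => (continuous_wave _ _).comp (by fun_prop))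
    (fun q => ⟨_, fun x => norm_wave_le _ _ _⟩) rel hsymm hM fun q _ r _ hqr => ?_
  refine integral_wave_mul_conj _ _ _ _ _ fun k hk l hl => ?_
  rw [Finset.mem_filter] at hk hl
  refine h k hk.1 l hl.1 ?_
  rwa [hk.2, hl.2]

lemma integral_wave_sq_le_coeff (c : κ → ℂ) (I : Finset κ) (rel : κ → κ → Prop)
    [∀ q r, Decidable (rel q r)] (hsymm : ∀ q r, rel q r → rel r q)
    {M : ℝ} (hM : ∀ q ∈ I, ((I.filter (rel q)).card : ℝ) ≤ M)
    (Ω : Measure (SpaceTime n)) [IsProbabilityMeasure Ω]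
    (h : ∀ k ∈ I, ∀ l ∈ I, ¬ rel k l → ∫ v, expChar (W.freq k - W.freq l) v ∂Ω = 0)
    (z : SpaceTime n) :
    ∫ v, ‖W.wave c I (z + v)‖ ^ 2 ∂Ω ≤ M * ∑ k ∈ I, ‖c k‖ ^ 2 := by
  classical
  have := integral_wave_sq_le (W := W) c I (fun k => k) rel hsymm (M := M) (by simpa using hM)
    Ω h z
  simp only [Finset.image_id'] at this
  refine this.trans_eq ?_
  congr 1
  refine Finset.sum_congr rfl fun k hk => ?_
  have e : (I.filter fun x => x = k) = {k} := by
    ext x; simp only [Finset.mem_filter, Finset.mem_singleton]; aesop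
  rw [e]
  simp [wave, norm_expChar]

variable (W) in
/-- The index of the cap of side `1 / K` containing a frequency. -/
noncomputable def cap (K : ℝ) (k : κ) : Fin n → ℤ := fun i => ⌊K * W.y k i⌋

lemma norm_y_sub_le_of_cap_eq {K : ℝ} (hK : 0 < K) {k l : κ} (h : W.cap K k = W.cap K l) :
    ‖W.y k - W.y l‖ ≤ 1 / K := by
  refine (pi_norm_le_iff_of_nonneg (by positivity)).2 fun i => ?_
  have h1 : |K * W.y k i - K * W.y l i| < 1 := Int.abs_sub_lt_one_of_floor_eq_floor (congrFun h i)
  rw [Pi.sub_apply, Real.norm_eq_abs, le_div_iff₀ hK, ← abs_of_pos hK, ← abs_mul,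
    sub_mul, mul_comm _ K, mul_comm _ K]
  exact h1.le

lemma abs_floor_sub_floor_le {a b : ℝ} {L : ℕ} (h : |a - b| ≤ L) : |⌊a⌋ - ⌊b⌋| ≤ (L : ℤ) := by
  have h1 := Int.floor_le a
  have h2 := Int.lt_floor_add_one a
  have h3 := Int.floor_le b
  have h4 := Int.lt_floor_add_one b
  rw [abs_le] at h ⊢
  have h5 : (⌊a⌋ : ℝ) - ⌊b⌋ < L + 1 := by linarith
  have h6 : (⌊b⌋ : ℝ) - ⌊a⌋ < L + 1 := by linarith
  have h7 : ⌊a⌋ - ⌊b⌋ < L + 1 := by exact_mod_cast h5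
  have h8 : ⌊b⌋ - ⌊a⌋ < L + 1 := by exact_mod_cast h6
  omega

lemma card_filter_abs_sub_le (J : Finset (Fin n → ℤ)) (L : ℕ) (q : Fin n → ℤ) :
    (J.filter fun r => ∀ i, |q i - r i| ≤ (L : ℤ)).card ≤ (2 * L + 1) ^ n := by
  calc _ ≤ (Finset.Icc (fun i => q i - L) (fun i => q i + L)).card := by
        refine Finset.card_le_card fun r hr => ?_
        rw [Finset.mem_filter] at hr
        rw [Finset.mem_Icc]
        refine ⟨fun i => ?_, fun i => ?_⟩ <;>
        · have := abs_le.1 (hr.2 i)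
          simp only
          omega
    _ = _ := by
        rw [Pi.card_Icc]
        have : ∀ i, q i + (L : ℤ) + 1 - (q i - L) = 2 * L + 1 := fun i => by ring
        simp only [Int.card_Icc, this]
        rw [Finset.prod_const, Finset.card_univ, Fintype.card_fin]
        congr 1

lemma integral_wave_sq_le_caps (c : κ → ℂ) (I : Finset κ) {K : ℝ} (hK : 0 < K) (L : ℕ)
    (Ω : Measure (SpaceTime n)) [IsProbabilityMeasure Ω]
    (h : ∀ k ∈ I, ∀ l ∈ I, L < K * ‖W.y k - W.y l‖ →
      ∫ v, expChar (W.freq k - W.freq l) v ∂Ω = 0)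
    (z : SpaceTime n) :
    ∫ v, ‖W.wave c I (z + v)‖ ^ 2 ∂Ω ≤ (2 * L + 1) ^ n *
      ∑ q ∈ I.image (W.cap K), ∫ v, ‖W.wave c (I.filter fun k => W.cap K k = q) (z + v)‖ ^ 2 ∂Ω := by
  classical
  refine integral_wave_sq_le c I (W.cap K) (fun q r => ∀ i, |q i - r i| ≤ (L : ℤ))
    (fun q r hqr i => by rw [abs_sub_comm]; exact hqr i) (fun q _ => ?_) Ω
    (fun k hk l hl hr => h k hk l hl ?_) z
  · exact_mod_cast card_filter_abs_sub_le _ L q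
  · by_contra hc
    push Not at hc
    refine hr fun i => abs_floor_sub_floor_le ?_
    rw [← mul_sub, abs_mul, abs_of_pos hK]
    exact (mul_le_mul_of_nonneg_left (norm_le_pi_norm (W.y k - W.y l) i) hK.le).trans hc

end WaveFamily

/-! ### The multilinear estimate on a ball -/

lemma volume_closedBall_spaceTime {n : ℕ} (z : SpaceTime n) {r : ℝ} (hr : 0 ≤ r) :
    volume (closedBall z r) = ENNReal.ofReal ((2 * r) ^ (n + 1)) := by
  rw [← Prod.mk.eta (p := z), ← closedBall_prod_same, Measure.volume_eq_prod, Measure.prod_prod,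
    Real.volume_pi_closedBall _ hr, Real.volume_closedBall, Fintype.card_fin,
    ← ENNReal.ofReal_mul (by positivity), pow_succ]

instance isAddRightInvariant_volume_spaceTime (n : ℕ) :
    (volume : Measure (SpaceTime n)).IsAddRightInvariant := by
  have : (volume : Measure (SpaceTime n)).IsAddHaarMeasure :=
    Measure.prod.instIsAddHaarMeasure _ _
  infer_instance

/-- Passing from a sparse weighted sum to a Lebesgue integral. -/
lemma sum_le_setLIntegral {n : ℕ} {π : Type*} (P : Finset π) (pos : π → SpaceTime n) (w : π → ℝ)
    (hw : ∀ x ∈ P, 0 ≤ w x) (hw1 : ∀ y, ∑ x ∈ P with ‖pos x - y‖ ≤ 1, w x ≤ 1) {h : π → ℝ≥0∞}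
    {Φ : SpaceTime n → ℝ≥0∞} (hΦ : Measurable Φ)
    (hh : ∀ x ∈ P, ∀ y, ‖pos x - y‖ ≤ 1 → h x ≤ Φ y) {U : Set (SpaceTime n)}
    (hU : MeasurableSet U) (hPU : ∀ x ∈ P, closedBall (pos x) 1 ⊆ U) :
    ∑ x ∈ P, ENNReal.ofReal (w x) * h x ≤ ∫⁻ y in U, Φ y := by
  have hmem : ∀ x y, y ∈ closedBall (pos x) 1 ↔ ‖pos x - y‖ ≤ 1 := fun x y => by
    rw [mem_closedBall, dist_comm, dist_eq_norm]
  have h1 : ∀ x ∈ P, h x ≤ ∫⁻ y, (closedBall (pos x) 1).indicator Φ y := by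
    intro x hx
    rw [lintegral_indicator measurableSet_closedBall]
    calc h x = h x * 1 := (mul_one _).symm
      _ ≤ h x * volume (closedBall (pos x) 1) := by
          gcongr
          rw [volume_closedBall_spaceTime _ zero_le_one, ← ENNReal.ofReal_one]
          exact ENNReal.ofReal_le_ofReal (one_le_pow₀ (by norm_num))
      _ = ∫⁻ _y in closedBall (pos x) 1, h x := by rw [setLIntegral_const]
      _ ≤ _ := setLIntegral_mono hΦ fun y hy => hh x hx y ((hmem x y).1 hy)
  calc ∑ x ∈ P, ENNReal.ofReal (w x) * h x
      ≤ ∑ x ∈ P, ENNReal.ofReal (w x) * ∫⁻ y, (closedBall (pos x) 1).indicator Φ y :=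
        Finset.sum_le_sum fun x hx => by gcongr; exact h1 x hx
    _ = ∫⁻ y, ∑ x ∈ P, ENNReal.ofReal (w x) * (closedBall (pos x) 1).indicator Φ y := by
        rw [lintegral_finsetSum]
        · refine Finset.sum_congr rfl fun x _ => ?_
          rw [lintegral_const_mul _ (hΦ.indicator measurableSet_closedBall)]
        · exact fun x _ => (hΦ.indicator measurableSet_closedBall).const_mul _
    _ ≤ ∫⁻ y, U.indicator Φ y := by
        refine lintegral_mono fun y => ?_
        calc ∑ x ∈ P, ENNReal.ofReal (w x) * (closedBall (pos x) 1).indicator Φ y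
            = ∑ x ∈ P with ‖pos x - y‖ ≤ 1, ENNReal.ofReal (w x) * U.indicator Φ y := by
              rw [Finset.sum_filter]
              refine Finset.sum_congr rfl fun x hx => ?_
              split_ifs with hc
              · have hy := (hmem x y).2 hc
                rw [indicator_of_mem hy, indicator_of_mem (hPU x hx hy)]
              · rw [indicator_of_notMem (fun hy => hc ((hmem x y).1 hy)), mul_zero]
          _ = ENNReal.ofReal (∑ x ∈ P with ‖pos x - y‖ ≤ 1, w x) * U.indicator Φ y := by
              rw [ENNReal.ofReal_sum_of_nonneg fun x hx => hw x (Finset.mem_filter.1 hx).1,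
                Finset.sum_mul]
          _ ≤ 1 * U.indicator Φ y := by
              gcongr
              exact ENNReal.ofReal_le_one.2 (hw1 y)
          _ = _ := one_mul _
    _ = _ := lintegral_indicator hU _

/-- An integral over a set is controlled by integrals over translates of a parallelepiped. -/
lemma setLIntegral_le_of_translates {n : ℕ} {ι : Type*} [Fintype ι] {Φ : SpaceTime n → ℝ≥0∞}
    (hΦ : Measurable Φ) (Λ : (ι → ℝ) → SpaceTime n) (hΛ : Measurable Λ) {U U' : Set (SpaceTime n)}
    (hU : MeasurableSet U) (hU' : MeasurableSet U')
    (hΛU : ∀ t ∈ Icc (fun _ : ι => (-1 : ℝ)) (fun _ => 1), ∀ y, y + Λ t ∈ U → y ∈ U')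
    {B : ℝ≥0∞} (hB : ∀ y ∈ U',
      ∫⁻ t in Icc (fun _ : ι => (-1 : ℝ)) (fun _ => 1), Φ (y + Λ t) ≤ B) :
    ∫⁻ y in U, Φ y ≤ B * volume U' := by
  set Q := Icc (fun _ : ι => (-1 : ℝ)) (fun _ => (1 : ℝ)) with hQ
  have hQv : 1 ≤ volume Q := by
    rw [hQ, Real.volume_Icc_pi, ← ENNReal.ofReal_prod_of_nonneg (by norm_num),
      ← ENNReal.ofReal_one]
    refine ENNReal.ofReal_le_ofReal ?_
    rw [Finset.prod_const]
    exact one_le_pow₀ (by norm_num)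
  have hshift : ∀ t ∈ Q, ∫⁻ y in U, Φ y ≤ ∫⁻ y in U', Φ (y + Λ t) := by
    intro t ht
    rw [← lintegral_indicator hU, ← lintegral_indicator hU',
      ← lintegral_add_right_eq_self _ (Λ t)]
    refine lintegral_mono fun y => ?_
    by_cases hy : y + Λ t ∈ U
    · rw [indicator_of_mem hy, indicator_of_mem (hΛU t ht y hy)]
    · rw [indicator_of_notMem hy]; positivity
  calc ∫⁻ y in U, Φ y ≤ (∫⁻ y in U, Φ y) * volume Q := le_mul_of_one_le_right' hQv
    _ = ∫⁻ _t in Q, ∫⁻ y in U, Φ y := by rw [setLIntegral_const]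
    _ ≤ ∫⁻ t in Q, ∫⁻ y in U', Φ (y + Λ t) := setLIntegral_mono' measurableSet_Icc hshift
    _ = ∫⁻ y in U', ∫⁻ t in Q, Φ (y + Λ t) := by
        refine lintegral_lintegral_swap ?_
        exact (hΦ.comp (measurable_snd.add (hΛ.comp measurable_fst))).aemeasurable
    _ ≤ ∫⁻ _y in U', B := setLIntegral_mono' hU' hB
    _ = _ := by rw [setLIntegral_const]

lemma setLIntegral_closedBall_le {n : ℕ} {ι : Type*} [Fintype ι] {Φ : SpaceTime n → ℝ≥0∞}
    (hΦ : Measurable Φ) (Λ : (ι → ℝ) → SpaceTime n) (hΛ : Measurable Λ) {z : SpaceTime n}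
    {r ρ : ℝ} (hr : 0 ≤ r) (hρ : 0 ≤ ρ)
    (hΛρ : ∀ t ∈ Icc (fun _ : ι => (-1 : ℝ)) (fun _ => 1), ‖Λ t‖ ≤ ρ) {B : ℝ≥0∞}
    (hB : ∀ y ∈ closedBall z (r + ρ),
      ∫⁻ t in Icc (fun _ : ι => (-1 : ℝ)) (fun _ => 1), Φ (y + Λ t) ≤ B) :
    ∫⁻ y in closedBall z r, Φ y ≤ B * ENNReal.ofReal ((2 * (r + ρ)) ^ (n + 1)) := by
  rw [← volume_closedBall_spaceTime z (by positivity)]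
  refine setLIntegral_le_of_translates hΦ Λ hΛ measurableSet_closedBall measurableSet_closedBall
    (fun t ht y hy => ?_) hB
  rw [mem_closedBall, dist_eq_norm] at hy ⊢
  calc ‖y - z‖ = ‖(y + Λ t - z) - Λ t‖ := by congr 1; abel
    _ ≤ _ := (norm_sub_le _ _).trans (add_le_add hy (hΛρ t ht))

namespace WaveFamily

variable {n : ℕ} {κ : Type} {W : WaveFamily n κ} {A : ℝ} {s : Finset κ}

/-- The sum over the caps of side `1 / K` of the averages of the localised waves. -/
noncomputable def capSum (W : WaveFamily n κ) (c : κ → ℂ) (K : ℝ) (I : Finset κ)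
    (Ω : Measure (SpaceTime n)) (z : SpaceTime n) : ℝ :=
  ∑ q ∈ I.image (W.cap K), ∫ v, ‖W.wave c (I.filter fun k => W.cap K k = q) (z + v)‖ ^ 2 ∂Ω

lemma capSum_nonneg (c : κ → ℂ) (K : ℝ) (I : Finset κ) (Ω : Measure (SpaceTime n))
    (z : SpaceTime n) : 0 ≤ W.capSum c K I Ω z :=
  Finset.sum_nonneg fun _ _ => integral_nonneg fun _ => by positivity

lemma isNTP_average_wave (c : κ → ℂ) (I : Finset κ) (Ω : Measure (SpaceTime n))
    [IsProbabilityMeasure Ω] :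
    IsNTP {η | ∃ k ∈ I, ∃ l ∈ I, η = W.freq k - W.freq l}
      (fun x => ∫ v, ‖W.wave c I (x + v)‖ ^ 2 ∂Ω) :=
  ((isNTP_wave_sq c I).average Ω).mono fun _ h => h.1

lemma average_average_wave (c : κ → ℂ) (I : Finset κ) (Ω Ω' : Measure (SpaceTime n))
    [IsProbabilityMeasure Ω] [IsProbabilityMeasure Ω'] (x : SpaceTime n) :
    ∫ u, ∫ v, ‖W.wave c I (x + u + v)‖ ^ 2 ∂Ω' ∂Ω
      = ∫ v, ‖W.wave c I (x + v)‖ ^ 2 ∂convMeasure Ω Ω' :=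
  ((isNTP_wave_sq (W := W) c I).integral_convMeasure Ω Ω' x).symm

/-- The frequencies in each `I i` are separated by their values on the directions `w`, and almost
constant along the direction `w i`. -/
structure IsTransversal {ι : Type} (W : WaveFamily n κ) (I : ι → Finset κ) (w : ι → SpaceTime n)
    (K Cs τ : ℝ) : Prop where
  sep : ∀ i, ∀ k ∈ I i, ∀ k' ∈ I i, ∀ μ : ℝ, 1 / K ≤ μ →
    (∀ l, |(W.freq k - W.freq k') (w l)| ≤ μ) → ‖W.y k - W.y k'‖ ≤ Cs * μ
  small : ∀ i, ∀ k ∈ I i, ∀ k' ∈ I i, |(W.freq k - W.freq k') (w i)| ≤ τ * ‖W.y k - W.y k'‖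

lemma exists_transversal_measure {ι : Type} [Fintype ι] (hι : 2 ≤ Fintype.card ι) (D : ℕ)
    (hD : 1 ≤ D) (hA : 1 ≤ A) (N : ℕ) (w : ι → SpaceTime n) (hw : ∀ l, ‖w l‖ ≤ A) :
    ∃ Ω : Measure (SpaceTime n), IsProbabilityMeasure Ω ∧
      (∀ (η : SpaceTime n →L[ℝ] ℝ) (l : ι),
        2 * freqConst n A * A ≤ (D : ℝ) ^ N * |η (w l)| → ∫ v, expChar η v ∂Ω = 0) ∧
      ∀ (κ : Type) (W : WaveFamily n κ) (s : Finset κ), W.IsConv A s →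
      ∀ (I : ι → Finset κ), (∀ i, I i ⊆ s) →
      ∀ Cs τ : ℝ, 0 ≤ Cs → 0 ≤ τ → τ * Cs * D ≤ 1 → W.IsTransversal I w ((D : ℝ) ^ N) Cs τ →
      ∀ g : ι → SpaceTime n → ℝ,
        (∀ i, IsNTP {η | ∃ k ∈ I i, ∃ l ∈ I i, η = W.freq k - W.freq l} (g i)) →
      ∀ (r H : ℝ), 0 ≤ r → r ≤ H * (D : ℝ) ^ N → ∀ z,
      ∫⁻ y in closedBall z r, ∏ i, ENNReal.ofReal (g i y) ^ mlExp ι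
        ≤ mlConst ι ^ (N + 1) * ENNReal.ofReal ((2 * (H + Fintype.card ι)) ^ (n + 1)
            * ((D : ℝ) ^ N) ^ (n + 1)) *
          ∏ i, ENNReal.ofReal ((4000 * (1 + ((H + Fintype.card ι) * freqConst n A
            * (Cs * (2 * freqConst n A * A) + 1)) ^ 2)) ^ (n + 1) *
            ∫ u, ∫ v, g i (z + u + v) ∂Ω
              ∂coordMeasure n ((D : ℝ) ^ N / (freqConst n A
                * (Cs * (2 * freqConst n A * A) + 1)))) ^ mlExp ι := by
  classical
  have hD' : (1 : ℝ) ≤ D := by exact_mod_cast hD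
  have hD0 : (0 : ℝ) < D := by linarith
  obtain ⟨Ωm, hΩm, hkill, hml⟩ := multilinear hι hD' N
  set C := freqConst n A with hC
  have hC1 : 1 ≤ C := freqConst_ge_one (by linarith)
  set b := 2 * C * A with hb
  have hb1 : 1 ≤ b := by nlinarith
  have hb0 : 0 < b := by linarith
  set K := (D : ℝ) ^ N with hK
  have hK1 : 1 ≤ K := one_le_pow₀ hD'
  set Λ : (ι → ℝ) →L[ℝ] SpaceTime n := LinearMap.toContinuousLinearMap
    (∑ l, (LinearMap.proj l : (ι → ℝ) →ₗ[ℝ] ℝ).smulRight (b⁻¹ • w l)) with hΛ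
  have hΛ_apply : ∀ t, Λ t = ∑ l, t l • b⁻¹ • w l := by
    intro t
    simp [hΛ]
  have hΛ_single : ∀ l, Λ (Pi.single l 1) = b⁻¹ • w l := by
    intro l
    rw [hΛ_apply, Finset.sum_eq_single l]
    · simp
    · intro m _ hm; simp [hm]
    · simp
  have hη : ∀ (η : SpaceTime n →L[ℝ] ℝ) l, (η.comp Λ) (Pi.single l 1) = b⁻¹ * η (w l) := by
    intro η l
    rw [ContinuousLinearMap.comp_apply, hΛ_single, map_smul, smul_eq_mul]
  have hexp : ∀ η : SpaceTime n →L[ℝ] ℝ, ∫ v, expChar η v ∂(Ωm.map Λ)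
      = ∫ t, expChar (η.comp Λ) t ∂Ωm := by
    intro η
    rw [integral_map Λ.continuous.measurable.aemeasurable
      (continuous_expChar η).aestronglyMeasurable]
    rfl
  have hprob : IsProbabilityMeasure (Ωm.map Λ) :=
    Measure.isProbabilityMeasure_map Λ.continuous.measurable.aemeasurable
  have hkill' : ∀ (η : SpaceTime n →L[ℝ] ℝ) (l : ι),
      b ≤ K * |η (w l)| → ∫ v, expChar η v ∂(Ωm.map Λ) = 0 := by
    intro η l h
    rw [hexp]
    refine hkill _ l ?_
    rw [hη, abs_mul, abs_mul, abs_of_pos (inv_pos.2 hb0), abs_of_pos (by linarith : 0 < K)]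
    calc (1 : ℝ) = b⁻¹ * b := (inv_mul_cancel₀ hb0.ne').symm
      _ ≤ b⁻¹ * (K * |η (w l)|) := by gcongr
      _ = _ := by ring
  refine ⟨Ωm.map Λ, hprob, hkill', ?_⟩
  intro κ W s hs I hI Cs τ hCs hτ hτD ⟨hsep, hτI⟩ g hg r H hr hrH z
  set j : ℝ := (Fintype.card ι : ℝ) with hj
  have hj0 : 0 ≤ j := Nat.cast_nonneg _
  have hC0 : 0 < C := by linarith
  have hcb : 0 < C * (Cs * b + 1) := by positivity
  have hH0 : 0 ≤ H := by
    by_contra hneg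
    push Not at hneg
    nlinarith
  have hfreq2 : ∀ i, ∀ k ∈ I i, ∀ k' ∈ I i, ∀ l, |b⁻¹ * (W.freq k - W.freq k') (w l)| ≤ 1 := by
    intro i k hk k' hk' l
    rw [abs_mul, abs_of_pos (inv_pos.2 hb0)]
    have h1 := (W.freq k - W.freq k').le_opNorm (w l)
    rw [Real.norm_eq_abs] at h1
    have h2 := hs.norm_freq_sub_le (by linarith) (hI i hk) (hI i hk')
    have h3 := hs.norm_y_sub_le (hI i hk) (hI i hk')
    have h4 : ‖W.freq k - W.freq k'‖ * ‖w l‖ ≤ (C * 2) * A := by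
      refine mul_le_mul (h2.trans ?_) (hw l) (norm_nonneg _) (by positivity)
      exact mul_le_mul_of_nonneg_left h3 hC0.le
    calc b⁻¹ * |(W.freq k - W.freq k') (w l)| ≤ b⁻¹ * b := by
          refine mul_le_mul_of_nonneg_left ?_ (inv_pos.2 hb0).le
          rw [hb]; linarith
      _ = 1 := inv_mul_cancel₀ hb0.ne'
  have hwb : ∀ l, ‖b⁻¹ • w l‖ ≤ 1 := by
    intro l
    rw [norm_smul, Real.norm_of_nonneg (inv_pos.2 hb0).le]
    calc b⁻¹ * ‖w l‖ ≤ b⁻¹ * b := by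
          refine mul_le_mul_of_nonneg_left ((hw l).trans ?_) (inv_pos.2 hb0).le
          rw [hb]; nlinarith
      _ = 1 := inv_mul_cancel₀ hb0.ne'
  have hgc : ∀ i, Continuous (g i) := fun i => (hg i).continuous
  have hmeas : Measurable fun y => ∏ i, ENNReal.ofReal (g i y) ^ mlExp ι :=
    Finset.measurable_prod _ fun i _ => ((hgc i).measurable.ennreal_ofReal).pow_const _
  have key : ∀ y ∈ closedBall z (r + j * K),
      ∫⁻ t in Icc (fun _ : ι => (-1 : ℝ)) (fun _ => 1),
        ∏ i, ENNReal.ofReal (g i (y + Λ (K • t))) ^ mlExp ι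
      ≤ mlConst ι ^ (N + 1) * ∏ i, ENNReal.ofReal ((4000 * (1 + ((H + j) * C
            * (Cs * b + 1)) ^ 2)) ^ (n + 1) *
            ∫ u, ∫ v, g i (z + u + v) ∂(Ωm.map Λ)
              ∂coordMeasure n (K / (C * (Cs * b + 1)))) ^ mlExp ι := by
    intro y hy
    have h1 := hml (fun i => (fun η => η.comp Λ) '' {η | ∃ k ∈ I i, ∃ l ∈ I i, η = W.freq k - W.freq l})
      (fun i t => g i (y + Λ t)) (fun i => (hg i).comp Λ y) ?_ ?_ 0
    · simp only [zero_add] at h1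
      refine h1.trans ?_
      gcongr with i
      · exact (mlExp_pos hι).le
      have e : ∫ t, g i (y + Λ t) ∂Ωm = ∫ v, g i (y + v) ∂(Ωm.map Λ) := by
        have := hgc i
        rw [integral_map Λ.continuous.measurable.aemeasurable
          (by fun_prop : Continuous fun v => g i (y + v)).aestronglyMeasurable]
      rw [e]
      have hK0 : 0 < K := by linarith
      have h2 := ((hg i).average (Ωm.map Λ)).le_coord_average (R := K / (C * (Cs * b + 1)))
        (H := (H + j) * C * (Cs * b + 1)) (by positivity) ?_ (x := y) (z := z) ?_
      · exact h2
      · rintro η ⟨⟨k, hk, l, hl, rfl⟩, hne⟩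
        have h3 : ∀ m, |(W.freq k - W.freq l) (w m)| ≤ b / K := by
          intro m
          by_contra hc
          push Not at hc
          refine hne (hkill' _ m ?_)
          rw [div_lt_iff₀ hK0] at hc
          linarith
        have h4 := hsep i k hk l hl (b / K) (by gcongr) h3
        have h5 := hs.norm_freq_sub_le (by linarith) (hI i hk) (hI i hl)
        rw [mul_div_assoc', div_le_one hcb]
        calc ‖W.freq k - W.freq l‖ * K ≤ (C * (Cs * (b / K))) * K := by
              gcongr
              exact h5.trans (mul_le_mul_of_nonneg_left h4 hC0.le)
          _ = C * (Cs * b) := by field_simp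
          _ ≤ _ := by nlinarith
      · rw [mem_closedBall, dist_eq_norm] at hy
        refine hy.trans ?_
        have : (H + j) * C * (Cs * b + 1) * (K / (C * (Cs * b + 1))) = (H + j) * K := by
          field_simp
        rw [this, add_mul]
        gcongr
    · rintro i _ ⟨η, ⟨k, hk, l, hl, rfl⟩, rfl⟩
      rw [hη]
      exact hfreq2 i k hk l hl i
    · rintro i _ ⟨η, ⟨k, hk, l, hl, rfl⟩, rfl⟩ m hm hall
      simp only [hη] at hall ⊢
      have hDm : 0 < (D : ℝ) ^ m := by positivity
      have h3 : ∀ l', |(W.freq k - W.freq l) (w l')| ≤ b / (D : ℝ) ^ m := by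
        intro l'
        have := hall l'
        rw [abs_mul, abs_mul, abs_of_pos (inv_pos.2 hb0), abs_of_pos hDm] at this
        rw [le_div_iff₀ hDm]
        calc |(W.freq k - W.freq l) (w l')| * (D : ℝ) ^ m
            = b * ((D : ℝ) ^ m * (b⁻¹ * |(W.freq k - W.freq l) (w l')|)) := by field_simp
          _ ≤ b * 1 := by gcongr
          _ = b := mul_one b
      have h4 := hsep i k hk l hl (b / (D : ℝ) ^ m) ?_ h3
      · have h5 := hτI i k hk l hl
        rw [abs_mul, abs_mul, abs_of_pos (inv_pos.2 hb0), abs_of_pos (by positivity)]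
        calc (D : ℝ) ^ (m + 1) * (b⁻¹ * |(W.freq k - W.freq l) (w i)|)
            ≤ (D : ℝ) ^ (m + 1) * (b⁻¹ * (τ * (Cs * (b / (D : ℝ) ^ m)))) := by
              gcongr
              exact h5.trans (mul_le_mul_of_nonneg_left h4 hτ)
          _ = τ * Cs * D := by field_simp; ring
          _ ≤ 1 := hτD
      · have : (D : ℝ) ^ m ≤ K := pow_le_pow_right₀ hD' hm.le
        gcongr
  have hK0 : 0 ≤ K := by linarith
  have h1 := setLIntegral_closedBall_le hmeas (fun t => Λ (K • t)) (by fun_prop) (z := z) hr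
    (ρ := j * K) (by positivity) ?_ key
  · refine h1.trans ?_
    rw [mul_right_comm]
    gcongr
    rw [← mul_pow]
    have : r + j * K ≤ (H + j) * K := by rw [add_mul]; gcongr
    refine pow_le_pow_left₀ (by positivity) ?_ _
    linarith
  · intro t ht
    rw [map_smul, norm_smul, Real.norm_of_nonneg hK0, mul_comm]
    gcongr
    rw [hΛ_apply]
    calc ‖∑ l, t l • b⁻¹ • w l‖ ≤ ∑ _l : ι, (1 : ℝ) := by
          refine (norm_sum_le _ _).trans (Finset.sum_le_sum fun l _ => ?_)
          rw [norm_smul]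
          refine mul_le_one₀ ?_ (norm_nonneg _) (hwb l)
          rw [Real.norm_eq_abs, abs_le]
          exact ⟨ht.1 l, ht.2 l⟩
      _ = j := by simp [hj]

/-- A finite version of the constant of the multilinear estimate. -/
noncomputable def mlReal (ι : Type*) [Fintype ι] : ℝ := max 1 (mlConst ι).toReal

lemma one_le_mlReal (ι : Type*) [Fintype ι] : 1 ≤ mlReal ι := le_max_left _ _

lemma freq_sub_norm_mul_le (h : W.IsConv A s) (hA : 1 ≤ A) {I : Finset κ} (hI : I ⊆ s) :
    ∀ η ∈ {η | ∃ k ∈ I, ∃ l ∈ I, η = W.freq k - W.freq l},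
      ‖η‖ * (1 / (2 * freqConst n A)) ≤ 1 := by
  rintro _ ⟨k, hk, l, hl, rfl⟩
  have hC : 0 < freqConst n A := by linarith [freqConst_ge_one (n := n) (A := A) (by linarith)]
  have h1 := h.norm_freq_sub_le (by linarith) (hI hk) (hI hl)
  have h2 := h.norm_y_sub_le (hI hk) (hI hl)
  rw [mul_one_div, div_le_one (by positivity)]
  nlinarith

/-- The constant of the smoothing at unit scale. -/
noncomputable def unitConst (n : ℕ) (A : ℝ) : ℝ :=
  (4000 * (1 + (2 * freqConst n A) ^ 2)) ^ (n + 1)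

lemma le_unit_average (h : W.IsConv A s) (hA : 1 ≤ A) {I : Finset κ} (hI : I ⊆ s)
    {g : SpaceTime n → ℝ} (hg : IsNTP {η | ∃ k ∈ I, ∃ l ∈ I, η = W.freq k - W.freq l} g)
    {x y : SpaceTime n} (hxy : ‖x - y‖ ≤ 1) :
    g x ≤ unitConst n A * ∫ v, g (y + v) ∂coordMeasure n (1 / (2 * freqConst n A)) := by
  have hC : 0 < freqConst n A := by linarith [freqConst_ge_one (n := n) (A := A) (by linarith)]
  refine hg.le_coord_average (by positivity) (freq_sub_norm_mul_le h hA hI) ?_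
  rwa [mul_one_div_cancel (by positivity)]

set_option maxHeartbeats 1600000 in
lemma level_bound_multi {ι : Type} [Fintype ι] (hι : 2 ≤ Fintype.card ι) (D : ℕ) (hD : 1 ≤ D)
    (hA : 1 ≤ A) {Cs : ℝ} (hCs : 0 ≤ Cs) : ∃ B : ℝ, 0 < B ∧
    ∀ (N : ℕ) (w : ι → SpaceTime n), (∀ l, ‖w l‖ ≤ A) →
    ∀ (Ω₀ : Measure (SpaceTime n)) [IsProbabilityMeasure Ω₀],
    ∃ Ω : Measure (SpaceTime n), IsProbabilityMeasure Ω ∧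
    ∀ (κ : Type) (W : WaveFamily n κ) (s : Finset κ), W.IsConv A s →
    ∀ I : ι → Finset κ, (∀ i, I i ⊆ s) →
    ∀ τ : ℝ, 0 ≤ τ → τ * Cs * D ≤ 1 → W.IsTransversal I w ((D : ℝ) ^ N) Cs τ →
    ∀ (c : κ → ℂ) (z : SpaceTime n) (π : Type) (P : Finset π) (pos : π → SpaceTime n)
      (wt : π → ℝ), (∀ x ∈ P, 0 ≤ wt x) → (∀ x ∈ P, ‖pos x - z‖ ≤ 2 * (D : ℝ) ^ N) →
      (∀ y, ∑ x ∈ P with ‖pos x - y‖ ≤ 1, wt x ≤ 1) →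
      ∑ x ∈ P, wt x * ∏ i, (∫ v, ‖W.wave c (I i) (pos x + v)‖ ^ 2 ∂Ω₀) ^ (1 / Fintype.card ι : ℝ)
      ≤ B * mlReal ι ^ (N + 1) * (∑ x ∈ P, wt x) ^ (1 / Fintype.card ι : ℝ)
        * ((D : ℝ) ^ N) ^ ((n + 1) * (1 - 1 / Fintype.card ι) : ℝ)
        * ∑ i, W.capSum c ((D : ℝ) ^ N) (I i) Ω z := by
  classical
  set j : ℝ := (Fintype.card ι : ℝ) with hj
  have hj2 : 2 ≤ j := by rw [hj]; exact_mod_cast hι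
  set C := freqConst n A with hC
  have hC1 : 1 ≤ C := freqConst_ge_one (by linarith)
  set c₁ := unitConst n A with hc₁
  have hc₁1 : 1 ≤ c₁ := one_le_pow₀ (by nlinarith)
  set c₂ := (2 * (3 + j)) ^ (n + 1) with hc₂
  have hc₂1 : 1 ≤ c₂ := one_le_pow₀ (by nlinarith)
  set R₂ := C * (Cs * (2 * C * A) + 1) with hR₂
  set c₃ := (4000 * (1 + ((3 + j) * R₂) ^ 2)) ^ (n + 1) with hc₃
  have hc₃1 : 1 ≤ c₃ := one_le_pow₀ (by nlinarith)
  set L := ⌈Cs * (2 * C * A)⌉₊ with hL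
  have ha : 0 < mlExp ι := mlExp_pos hι
  have haj : mlExp ι = 1 / (j - 1) := rfl
  have ha1 : mlExp ι * (1 - 1 / j) = 1 / j := by
    have : j - 1 ≠ 0 := by linarith
    rw [haj]; field_simp
  have hj1 : 0 ≤ 1 - 1 / j := by rw [sub_nonneg, div_le_one (by linarith)]; linarith
  set B₀ := (c₁ ^ mlExp ι) ^ Fintype.card ι * c₂ * (c₃ ^ mlExp ι) ^ Fintype.card ι with hB₀
  have hB₀1 : 1 ≤ B₀ := by
    have h1 : 1 ≤ c₁ ^ mlExp ι := Real.one_le_rpow hc₁1 ha.le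
    have h3 : 1 ≤ c₃ ^ mlExp ι := Real.one_le_rpow hc₃1 ha.le
    exact one_le_mul_of_one_le_of_one_le (one_le_mul_of_one_le_of_one_le (one_le_pow₀ h1) hc₂1)
      (one_le_pow₀ h3)
  refine ⟨B₀ * (2 * L + 1) ^ n, by positivity, ?_⟩
  intro N w hw Ω₀ _
  obtain ⟨Ωm, hΩm, hkill, hmain⟩ := exists_transversal_measure hι D hD hA N w hw
  set K := (D : ℝ) ^ N with hK
  have hK1 : 1 ≤ K := one_le_pow₀ (by exact_mod_cast hD)
  set Ω₁ := convMeasure (coordMeasure n (1 / (2 * C))) Ω₀ with hΩ₁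
  set Ω := convMeasure (coordMeasure n (K / R₂)) (convMeasure Ωm Ω₁) with hΩ
  refine ⟨Ω, inferInstance, ?_⟩
  intro κ W s hs I hI τ hτ hτD htr c z π P pos wt hwt hP hunit
  set G : ι → SpaceTime n → ℝ := fun i x => ∫ v, ‖W.wave c (I i) (x + v)‖ ^ 2 ∂Ω₀ with hG
  set G₁ : ι → SpaceTime n → ℝ := fun i x => ∫ v, ‖W.wave c (I i) (x + v)‖ ^ 2 ∂Ω₁ with hG₁
  set X : ι → ℝ := fun i => ∫ v, ‖W.wave c (I i) (z + v)‖ ^ 2 ∂Ω with hX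
  have hG0 : ∀ i x, 0 ≤ G i x := fun i x => integral_nonneg fun _ => by positivity
  have hX0 : ∀ i, 0 ≤ X i := fun i => integral_nonneg fun _ => by positivity
  have hGG : ∀ i x y, ‖x - y‖ ≤ 1 → G i x ≤ c₁ * G₁ i y := by
    intro i x y hxy
    have := le_unit_average hs hA (hI i) (isNTP_average_wave c (I i) Ω₀) hxy
    rwa [average_average_wave] at this
  have hXG : ∀ i, ∫ u, ∫ v, G₁ i (z + u + v) ∂Ωm ∂coordMeasure n (K / R₂) = X i := by
    intro i
    have e : ∀ u, ∫ v, G₁ i (z + u + v) ∂Ωm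
        = ∫ v, ‖W.wave c (I i) (z + u + v)‖ ^ 2 ∂convMeasure Ωm Ω₁ := fun u =>
      average_average_wave c (I i) Ωm Ω₁ (z + u)
    simp_rw [e]
    exact average_average_wave c (I i) _ _ z
  set S := ∑ x ∈ P, wt x * ∏ i, G i (pos x) ^ mlExp ι with hS
  have hSle : S ≤ B₀ * (mlReal ι ^ (N + 1) * K ^ (n + 1) * ∏ i, X i ^ mlExp ι) := by
    have hprod0 : ∀ x, 0 ≤ ∏ i, G i x ^ mlExp ι := fun x =>
      Finset.prod_nonneg fun i _ => Real.rpow_nonneg (hG0 i x) _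
    have hR0 : 0 ≤ mlReal ι := zero_le_one.trans (one_le_mlReal ι)
    have hprodX : 0 ≤ ∏ i, X i ^ mlExp ι :=
      Finset.prod_nonneg fun i _ => Real.rpow_nonneg (hX0 i) _
    rw [← ENNReal.ofReal_le_ofReal_iff (by positivity), hS,
      ENNReal.ofReal_sum_of_nonneg fun x hx => mul_nonneg (hwt x hx) (hprod0 _)]
    have h1 : ∀ x ∈ P, ENNReal.ofReal (wt x * ∏ i, G i (pos x) ^ mlExp ι)
        = ENNReal.ofReal (wt x) * ∏ i, ENNReal.ofReal (G i (pos x)) ^ mlExp ι := by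
      intro x hx
      rw [ENNReal.ofReal_mul (hwt x hx),
        ENNReal.ofReal_prod_of_nonneg fun i _ => Real.rpow_nonneg (hG0 i _) _]
      simp_rw [ENNReal.ofReal_rpow_of_nonneg (hG0 _ _) ha.le]
    rw [Finset.sum_congr rfl h1]
    have hG₁c : ∀ i, Continuous (G₁ i) := fun i => (isNTP_average_wave c (I i) Ω₁).continuous
    have hm : Measurable fun y => ∏ i, ENNReal.ofReal (G₁ i y) ^ mlExp ι :=
      Finset.measurable_prod _ fun i _ => ((hG₁c i).measurable.ennreal_ofReal).pow_const _
    refine (sum_le_setLIntegral P pos wt hwt hunit (h := fun x =>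
      ∏ i, ENNReal.ofReal (G i (pos x)) ^ mlExp ι) (hm.const_mul
        ((ENNReal.ofReal c₁ ^ mlExp ι) ^ Fintype.card ι)) ?_ (U := closedBall z (3 * K))
        measurableSet_closedBall ?_).trans ?_
    · intro x hx y hxy
      rw [← Finset.card_univ, ← Finset.prod_const, ← Finset.prod_mul_distrib]
      refine Finset.prod_le_prod' fun i _ => ?_
      rw [← ENNReal.mul_rpow_of_nonneg _ _ ha.le, ← ENNReal.ofReal_mul (by linarith)]
      exact ENNReal.rpow_le_rpow (ENNReal.ofReal_le_ofReal (hGG i _ _ hxy)) ha.le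
    · intro x hx
      refine closedBall_subset_closedBall' ?_
      rw [dist_eq_norm]
      linarith [hP x hx]
    · rw [lintegral_const_mul _ hm]
      have h2 := hmain κ W s hs I hI Cs τ hCs hτ hτD htr G₁
        (fun i => isNTP_average_wave c (I i) Ω₁) (3 * K) 3 (by positivity) le_rfl z
      have h3 : ∀ i, ENNReal.ofReal ((4000 * (1 + ((3 + j) * C * (Cs * (2 * C * A) + 1)) ^ 2))
          ^ (n + 1) * ∫ u, ∫ v, G₁ i (z + u + v) ∂Ωm ∂coordMeasure n (K / R₂))
          = ENNReal.ofReal (c₃ * X i) := by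
        intro i
        rw [hXG, hc₃, hR₂, mul_assoc (3 + j)]
      rw [← hj, ← hC, ← hR₂] at h2
      simp_rw [h3] at h2
      have h4 : ∏ i, ENNReal.ofReal (c₃ * X i) ^ mlExp ι
          = ENNReal.ofReal ((c₃ ^ mlExp ι) ^ Fintype.card ι * ∏ i, X i ^ mlExp ι) := by
        rw [← Finset.card_univ, ← Finset.prod_const, ← Finset.prod_mul_distrib,
          ENNReal.ofReal_prod_of_nonneg fun i _ =>
            mul_nonneg (by positivity) (Real.rpow_nonneg (hX0 i) _)]
        refine Finset.prod_congr rfl fun i _ => ?_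
        rw [← Real.mul_rpow (by linarith) (hX0 i),
          ENNReal.ofReal_rpow_of_nonneg (mul_nonneg (by linarith) (hX0 i)) ha.le]
      have h5 : mlConst ι ^ (N + 1) ≤ ENNReal.ofReal (mlReal ι ^ (N + 1)) := by
        rw [ENNReal.ofReal_pow hR0]
        refine pow_le_pow_left' ?_ _
        rw [← ENNReal.ofReal_toReal (mlConst_ne_top hι)]
        exact ENNReal.ofReal_le_ofReal (le_max_right _ _)
      rw [h4] at h2
      calc _ ≤ ENNReal.ofReal ((c₁ ^ mlExp ι) ^ Fintype.card ι) *
            (ENNReal.ofReal (mlReal ι ^ (N + 1)) * ENNReal.ofReal (c₂ * K ^ (n + 1)) *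
              ENNReal.ofReal ((c₃ ^ mlExp ι) ^ Fintype.card ι * ∏ i, X i ^ mlExp ι)) := by
            refine mul_le_mul' (le_of_eq ?_) (h2.trans ?_)
            · rw [ENNReal.ofReal_pow (by positivity), ENNReal.ofReal_rpow_of_nonneg (by linarith) ha.le]
            · gcongr
        _ = _ := by
            rw [← ENNReal.ofReal_mul (by positivity), ← ENNReal.ofReal_mul (by positivity),
              ← ENNReal.ofReal_mul (by positivity), hB₀]
            congr 1; ring
  have hHolder := Real.inner_le_weight_mul_Lp_of_nonneg P (p := j / (j - 1))
    (by rw [le_div_iff₀ (by linarith)]; linarith) (fun x => if x ∈ P then wt x else 0)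
    (fun x => ∏ i, G i (pos x) ^ (1 / j))
    (fun x => by split_ifs with h; exacts [hwt x h, le_rfl])
    (fun x => Finset.prod_nonneg fun i _ => Real.rpow_nonneg (hG0 i _) _)
  have hp1 : (j / (j - 1))⁻¹ = 1 - 1 / j := by
    have : j - 1 ≠ 0 := by linarith
    field_simp
  have hp2 : ∀ x, (∏ i, G i (pos x) ^ (1 / j)) ^ (j / (j - 1)) = ∏ i, G i (pos x) ^ mlExp ι := by
    intro x
    rw [← Real.finsetProd_rpow _ _ fun i _ => Real.rpow_nonneg (hG0 i _) _]
    refine Finset.prod_congr rfl fun i _ => ?_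
    rw [← Real.rpow_mul (hG0 i _), haj]
    congr 1
    have : j - 1 ≠ 0 := by linarith
    field_simp
  simp_rw [hp2] at hHolder
  rw [hp1, sub_sub_cancel] at hHolder
  have hite : ∀ f : π → ℝ, ∑ x ∈ P, (if x ∈ P then wt x else 0) * f x = ∑ x ∈ P, wt x * f x :=
    fun f => Finset.sum_congr rfl fun x hx => by rw [if_pos hx]
  rw [hite, hite, Finset.sum_congr rfl fun x hx => if_pos hx] at hHolder
  refine hHolder.trans ?_
  have hV0 : 0 ≤ (∑ x ∈ P, wt x) ^ (1 / j) := Real.rpow_nonneg (Finset.sum_nonneg hwt) _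
  have hS0 : 0 ≤ S := Finset.sum_nonneg fun x hx => mul_nonneg (hwt x hx)
    (Finset.prod_nonneg fun i _ => Real.rpow_nonneg (hG0 i _) _)
  have hR1 := one_le_mlReal ι
  have hXprod : 0 ≤ ∏ i, X i ^ mlExp ι :=
    Finset.prod_nonneg fun i _ => Real.rpow_nonneg (hX0 i) _
  have hSpow : S ^ (1 - 1 / j) ≤ B₀ * mlReal ι ^ (N + 1) * K ^ ((n + 1) * (1 - 1 / j))
      * ∏ i, X i ^ (1 / j) := by
    calc S ^ (1 - 1 / j)
        ≤ (B₀ * (mlReal ι ^ (N + 1) * K ^ (n + 1) * ∏ i, X i ^ mlExp ι)) ^ (1 - 1 / j) :=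
          Real.rpow_le_rpow hS0 hSle hj1
      _ = (B₀ * mlReal ι ^ (N + 1)) ^ (1 - 1 / j) * K ^ ((n + 1) * (1 - 1 / j))
            * ∏ i, X i ^ (1 / j) := by
          rw [show B₀ * (mlReal ι ^ (N + 1) * K ^ (n + 1) * ∏ i, X i ^ mlExp ι)
            = (B₀ * mlReal ι ^ (N + 1)) * K ^ (n + 1) * ∏ i, X i ^ mlExp ι by ring,
            Real.mul_rpow (by positivity) hXprod, Real.mul_rpow (by positivity) (by positivity)]
          congr 1
          · congr 1
            rw [← Real.rpow_natCast, ← Real.rpow_mul (by linarith)]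
            push_cast
            rfl
          · rw [← Real.finsetProd_rpow _ _ fun i _ => Real.rpow_nonneg (hX0 i) _]
            refine Finset.prod_congr rfl fun i _ => ?_
            rw [← Real.rpow_mul (hX0 i), ha1]
      _ ≤ _ := by
          have : (B₀ * mlReal ι ^ (N + 1)) ^ (1 - 1 / j) ≤ (B₀ * mlReal ι ^ (N + 1)) ^ (1 : ℝ) := by
            refine Real.rpow_le_rpow_of_exponent_le
              (one_le_mul_of_one_le_of_one_le hB₀1 (one_le_pow₀ hR1)) ?_
            have : 0 < 1 / j := by positivity
            linarith
          rw [Real.rpow_one] at this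
          have h0 : 0 ≤ ∏ i, X i ^ (1 / j) :=
            Finset.prod_nonneg fun i _ => Real.rpow_nonneg (hX0 i) _
          gcongr
  have hAMGM : ∏ i, X i ^ (1 / j) ≤ ∑ i, X i := by
    have h1 := Real.geom_mean_le_arith_mean_weighted Finset.univ (fun _ : ι => 1 / j) X
      (fun _ _ => by positivity) (by simp [← hj]; field_simp) fun i _ => hX0 i
    refine h1.trans (Finset.sum_le_sum fun i _ => ?_)
    have : 1 / j ≤ 1 := by rw [div_le_one (by linarith)]; linarith
    nlinarith [hX0 i]
  have hcap : ∀ i, X i ≤ (2 * L + 1) ^ n * W.capSum c K (I i) Ω z := by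
    intro i
    refine integral_wave_sq_le_caps c (I i) (by linarith) L Ω (fun k hk l hl hkl => ?_) z
    by_contra hne
    rw [hΩ, integral_convMeasure_expChar, integral_convMeasure_expChar] at hne
    have hne' : ∫ v, expChar (W.freq k - W.freq l) v ∂Ωm ≠ 0 := by
      intro h0; exact hne (by rw [h0, zero_mul, mul_zero])
    have h3 : ∀ m, |(W.freq k - W.freq l) (w m)| ≤ 2 * C * A / K := by
      intro m
      by_contra hc
      push Not at hc
      refine hne' (hkill _ m ?_)
      rw [div_lt_iff₀ (by linarith)] at hc
      linarith
    have h4 := htr.sep i k hk l hl _ (by gcongr; nlinarith) h3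
    have h5 := Nat.le_ceil (Cs * (2 * C * A))
    have h6 : K * ‖W.y k - W.y l‖ ≤ K * (Cs * (2 * C * A / K)) :=
      mul_le_mul_of_nonneg_left h4 (by linarith)
    have h7 : K * (Cs * (2 * C * A / K)) = Cs * (2 * C * A) := by field_simp
    rw [← hL] at h5
    linarith
  calc (∑ x ∈ P, wt x) ^ (1 / j) * S ^ (1 - 1 / j)
      ≤ (∑ x ∈ P, wt x) ^ (1 / j) * (B₀ * mlReal ι ^ (N + 1) * K ^ ((n + 1) * (1 - 1 / j))
        * ∑ i, (2 * L + 1) ^ n * W.capSum c K (I i) Ω z) := by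
        gcongr
        exact hSpow.trans (mul_le_mul_of_nonneg_left
          (hAMGM.trans (Finset.sum_le_sum fun i _ => hcap i)) (by positivity))
    _ = _ := by rw [← Finset.mul_sum]; ring

lemma level_bound_single {ι : Type} [Fintype ι] (hι : Fintype.card ι = 1) (D : ℕ) (hD : 2 ≤ D)
    (hA : 1 ≤ A) {Cs : ℝ} (hCs : 0 ≤ Cs) : ∃ B : ℝ, 0 < B ∧
    ∀ (N : ℕ) (Ω₀ : Measure (SpaceTime n)) [IsProbabilityMeasure Ω₀],
    ∃ Ω : Measure (SpaceTime n), IsProbabilityMeasure Ω ∧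
    ∀ (κ : Type) (W : WaveFamily n κ) (s : Finset κ), W.IsConv A s →
    ∀ I : ι → Finset κ, (∀ i, I i ⊆ s) →
    ∀ τ : ℝ, 0 ≤ τ → τ * Cs * D ≤ 1 → ∀ w : ι → SpaceTime n,
      W.IsTransversal I w ((D : ℝ) ^ N) Cs τ →
    ∀ (c : κ → ℂ) (z x : SpaceTime n), ‖x - z‖ ≤ 2 * (D : ℝ) ^ N →
      ∀ i, ∫ v, ‖W.wave c (I i) (x + v)‖ ^ 2 ∂Ω₀ ≤ B * W.capSum c ((D : ℝ) ^ N) (I i) Ω z := by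
  set C := freqConst n A with hC
  have hC1 : 1 ≤ C := freqConst_ge_one (by linarith)
  set H := 2 * (C * Cs + 1) with hH
  set L := ⌈Cs⌉₊ with hL
  refine ⟨(4000 * (1 + H ^ 2)) ^ (n + 1) * (2 * L + 1) ^ n, by positivity, ?_⟩
  intro N Ω₀ _
  set K := (D : ℝ) ^ N with hK
  have hD2 : (2 : ℝ) ≤ D := by exact_mod_cast hD
  have hK1 : 1 ≤ K := one_le_pow₀ (by linarith)
  refine ⟨convMeasure (coordMeasure n (K / (C * Cs + 1))) Ω₀, inferInstance, ?_⟩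
  intro κ W s hs I hI τ hτ hτD w htr c z x hx i
  have hall : ∀ l, l = i := by
    obtain ⟨a, ha⟩ := Fintype.card_eq_one_iff.1 hι
    intro l; rw [ha l, ha i]
  have hsmall : ∀ k ∈ I i, ∀ k' ∈ I i, ‖W.y k - W.y k'‖ ≤ Cs / K := by
    intro k hk k' hk'
    set u := ‖W.y k - W.y k'‖ with hu
    have hu0 : 0 ≤ u := norm_nonneg _
    have h1 := htr.sep i k hk k' hk' (max (1 / K) (τ * u)) (le_max_left _ _) fun l => by
      rw [hall l]; exact (htr.small i k hk k' hk').trans (le_max_right _ _)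
    rcases le_total (τ * u) (1 / K) with h | h
    · rw [max_eq_left h, ← hu] at h1
      rwa [mul_one_div] at h1
    · rw [max_eq_right h, ← hu] at h1
      have h2 : u * 2 ≤ u := by
        have : τ * Cs * 2 ≤ 1 := le_trans (by gcongr) hτD
        nlinarith
      have h3 : u = 0 := by linarith
      rw [h3]; positivity
  have h1 := (isNTP_average_wave (W := W) c (I i) Ω₀).le_coord_average (R := K / (C * Cs + 1))
    (H := H) (by positivity) ?_ (x := x) (z := z) ?_
  · rw [average_average_wave] at h1
    refine h1.trans ?_
    rw [mul_assoc]
    refine mul_le_mul_of_nonneg_left ?_ (by positivity)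
    refine integral_wave_sq_le_caps c (I i) (by linarith) L _ (fun k hk l hl hkl => ?_) z
    have h3 := hsmall k hk l hl
    rw [le_div_iff₀ (by linarith)] at h3
    have := Nat.le_ceil Cs
    rw [← hL] at this
    linarith
  · rintro _ ⟨k, hk, l, hl, rfl⟩
    have h2 := hs.norm_freq_sub_le (by linarith) (hI i hk) (hI i hl)
    have h3 := hsmall k hk l hl
    rw [mul_div_assoc', div_le_one (by positivity)]
    calc ‖W.freq k - W.freq l‖ * K ≤ C * (Cs / K) * K := by
          gcongr
          exact h2.trans (by gcongr)
      _ = C * Cs := by field_simp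
      _ ≤ _ := by linarith
  · refine hx.trans (le_of_eq ?_)
    rw [hH]; field_simp

/-- The multilinear estimate on a ball of radius comparable to `D ^ N`. -/
lemma level_bound {ι : Type} [Fintype ι] (hι : 1 ≤ Fintype.card ι) (D : ℕ) (hD : 2 ≤ D)
    (hA : 1 ≤ A) {Cs : ℝ} (hCs : 0 ≤ Cs) : ∃ B : ℝ, 0 < B ∧
    ∀ (N : ℕ) (w : ι → SpaceTime n), (∀ l, ‖w l‖ ≤ A) →
    ∀ (Ω₀ : Measure (SpaceTime n)) [IsProbabilityMeasure Ω₀],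
    ∃ Ω : Measure (SpaceTime n), IsProbabilityMeasure Ω ∧
    ∀ (κ : Type) (W : WaveFamily n κ) (s : Finset κ), W.IsConv A s →
    ∀ I : ι → Finset κ, (∀ i, I i ⊆ s) →
    ∀ τ : ℝ, 0 ≤ τ → τ * Cs * D ≤ 1 → W.IsTransversal I w ((D : ℝ) ^ N) Cs τ →
    ∀ (c : κ → ℂ) (z : SpaceTime n) (π : Type) (P : Finset π) (pos : π → SpaceTime n)
      (wt : π → ℝ), (∀ x ∈ P, 0 ≤ wt x) → (∀ x ∈ P, ‖pos x - z‖ ≤ 2 * (D : ℝ) ^ N) →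
      (∀ y, ∑ x ∈ P with ‖pos x - y‖ ≤ 1, wt x ≤ 1) →
      ∑ x ∈ P, wt x * ∏ i, (∫ v, ‖W.wave c (I i) (pos x + v)‖ ^ 2 ∂Ω₀) ^ (1 / Fintype.card ι : ℝ)
      ≤ B * mlReal ι ^ (N + 1) * (∑ x ∈ P, wt x) ^ (1 / Fintype.card ι : ℝ)
        * ((D : ℝ) ^ N) ^ ((n + 1) * (1 - 1 / Fintype.card ι) : ℝ)
        * ∑ i, W.capSum c ((D : ℝ) ^ N) (I i) Ω z := by
  rcases Nat.lt_or_ge 1 (Fintype.card ι) with h | h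
  · exact level_bound_multi h D (by omega) hA hCs
  · have h1 : Fintype.card ι = 1 := by omega
    obtain ⟨B, hB, hmain⟩ := level_bound_single (n := n) (ι := ι) h1 D hD hA hCs
    refine ⟨B, hB, ?_⟩
    intro N w hw Ω₀ _
    obtain ⟨Ω, hΩ, hmain⟩ := hmain N Ω₀
    refine ⟨Ω, hΩ, ?_⟩
    intro κ W s hs I hI τ hτ hτD htr c z π P pos wt hwt hP _
    obtain ⟨hu⟩ := Fintype.card_eq_one_iff_nonempty_unique.1 h1
    rw [h1]
    simp only [Nat.cast_one, div_one, Real.rpow_one, sub_self, mul_zero, Real.rpow_zero, mul_one]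
    have hb : ∀ x ∈ P, wt x * ∏ i, ∫ v, ‖W.wave c (I i) (pos x + v)‖ ^ 2 ∂Ω₀
        ≤ wt x * (B * ∑ i, W.capSum c ((D : ℝ) ^ N) (I i) Ω z) := by
      intro x hx
      refine mul_le_mul_of_nonneg_left ?_ (hwt x hx)
      rw [Fintype.prod_eq_single default fun i hi => absurd (Subsingleton.elim i default) hi,
        Fintype.sum_eq_single default fun i hi => absurd (Subsingleton.elim i default) hi]
      exact hmain κ W s hs I hI τ hτ hτD w htr c z (pos x) (hP x hx) default
    refine (Finset.sum_le_sum hb).trans ?_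
    rw [← Finset.sum_mul]
    have h2 : 0 ≤ ∑ i, W.capSum c ((D : ℝ) ^ N) (I i) Ω z :=
      Finset.sum_nonneg fun i _ => capSum_nonneg _ _ _ _ _
    have h3 : 0 ≤ ∑ x ∈ P, wt x := Finset.sum_nonneg hwt
    have h4 : 1 ≤ mlReal ι ^ (N + 1) := one_le_pow₀ (one_le_mlReal ι)
    calc (∑ x ∈ P, wt x) * (B * ∑ i, W.capSum c ((D : ℝ) ^ N) (I i) Ω z)
        = B * 1 * (∑ x ∈ P, wt x) * ∑ i, W.capSum c ((D : ℝ) ^ N) (I i) Ω z := by ring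
      _ ≤ _ := by gcongr

/-- The separation constant of waves with normals close to a subspace. -/
noncomputable def sepConst (n : ℕ) (A A' C₁ : ℝ) : ℝ :=
  A * ((A' * A + 2 * A' * C₁ * freqConst n A + 2 * freqConst n A * C₁) + 2 * A' * C₁) + 1

lemma sepConst_nonneg {A' C₁ : ℝ} (hA : 1 ≤ A) (hA' : 0 ≤ A') (hC₁ : 0 ≤ C₁) :
    0 ≤ sepConst n A A' C₁ := by
  have := freqConst_ge_one (n := n) (A := A) (by linarith)
  unfold sepConst
  positivity

lemma IsConv.isTransversal (h : W.IsConv A s) (hA : 1 ≤ A) {ι : Type} [Fintype ι]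
    {A' C₁ δ : ℝ} (hA' : 0 ≤ A') (hC₁ : 0 ≤ C₁) (hδ : 0 ≤ δ) (hδ1 : A * δ ≤ 1)
    (hδA : A' * A * freqConst n A * (A * δ) ≤ A⁻¹) {v : ι → SpaceTime n} (hv : IsIndep A' v)
    {a : ι → κ} (ha : ∀ i, a i ∈ s) (hva : ∀ i, ‖v i - W.normal (a i)‖ ≤ A * δ)
    {K : ℝ} (hK : 0 < K) {I : ι → Finset κ} (hI : ∀ i, I i ⊆ s)
    (hIa : ∀ i, ∀ k ∈ I i, ‖W.y k - W.y (a i)‖ ≤ δ)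
    (hnear : ∀ i, ∀ k ∈ I i, ∃ b : ι → ℝ, ‖W.normal k - ∑ l, b l • v l‖ ≤ C₁ / K) :
    W.IsTransversal I (fun i => W.normal (a i)) K (sepConst n A A' C₁) ((2 + n) * A * δ) := by
  refine ⟨fun i k hk k' hk' μ hμ hall => ?_, fun i k hk k' hk' =>
    h.abs_freq_sub_normal_le hA (hI i hk) (hI i hk') (ha i) (hIa i k hk) (hIa i k' hk')⟩
  have hC := freqConst_ge_one (n := n) (A := A) (by linarith)
  refine (h.norm_y_sub_le_of_near hA hA' hC₁ (by positivity) hδA hv hva hK hμ (hI i hk)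
    (hI i hk') (hnear i k hk) (hnear i k' hk') hall).trans ?_
  have hμ0 : 0 ≤ μ := le_trans (by positivity) hμ
  refine mul_le_mul_of_nonneg_right ?_ hμ0
  unfold sepConst
  have : 2 * A' * C₁ * freqConst n A * (A * δ) ≤ 2 * A' * C₁ * freqConst n A :=
    mul_le_of_le_one_right (by positivity) hδ1
  gcongr

end WaveFamily

lemma IsIndep.snoc {X : Type*} [NormedAddCommGroup X] [NormedSpace ℝ X] {j : ℕ} {A' K H : ℝ}
    (hA' : 0 ≤ A') (hK : 0 < K) {v : Fin j → X} (hv : IsIndep A' v) {u : X} (hu : ‖u‖ ≤ H)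
    (hfar : ∀ b : Fin j → ℝ, 1 / K ≤ ‖u - ∑ l, b l • v l‖) :
    IsIndep (A' * (1 + K * H) + K) (Fin.snoc v u : Fin (j + 1) → X) := by
  intro a
  rw [Fin.sum_univ_castSucc, Fin.sum_univ_castSucc]
  simp only [Fin.snoc_castSucc, Fin.snoc_last]
  set b := a (Fin.last j) with hb
  set V := ∑ l : Fin j, a l.castSucc • v l with hV
  have h1 : |b| ≤ K * ‖V + b • u‖ := by
    by_cases hb0 : b = 0
    · rw [hb0, abs_zero]; positivity
    have h2 := hfar fun l => -(a l.castSucc / b)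
    have h3 : b • (u - ∑ l : Fin j, (-(a l.castSucc / b)) • v l) = V + b • u := by
      rw [smul_sub, Finset.smul_sum, hV, sub_eq_add_neg, ← Finset.sum_neg_distrib, add_comm]
      congr 1
      refine Finset.sum_congr rfl fun l _ => ?_
      rw [smul_smul, ← neg_smul]
      congr 1
      field_simp
    rw [← h3, norm_smul, Real.norm_eq_abs]
    rw [div_le_iff₀ hK] at h2
    nlinarith [abs_nonneg b]
  have h4 := hv fun l => a l.castSucc
  have h5 : ‖V‖ ≤ ‖V + b • u‖ + |b| * H := by
    calc ‖V‖ = ‖(V + b • u) - b • u‖ := by rw [add_sub_cancel_right]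
      _ ≤ ‖V + b • u‖ + ‖b • u‖ := norm_sub_le _ _
      _ ≤ _ := by rw [norm_smul, Real.norm_eq_abs]; gcongr
  have hH : 0 ≤ H := (norm_nonneg u).trans hu
  have h6 : A' * ‖V‖ ≤ A' * (‖V + b • u‖ + (K * ‖V + b • u‖) * H) := by
    gcongr; exact h5.trans (by gcongr)
  rw [← hV] at h4
  linarith

lemma IsIndep.perturb {X ι : Type*} [NormedAddCommGroup X] [NormedSpace ℝ X] [Fintype ι]
    {A' δ : ℝ} (hA' : 0 ≤ A') (hδ : 2 * A' * δ ≤ 1) {v w : ι → X} (hv : IsIndep A' v)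
    (hvw : ∀ i, ‖v i - w i‖ ≤ δ) : IsIndep (2 * A') w := by
  intro a
  have h1 : ‖∑ l, a l • v l‖ ≤ ‖∑ l, a l • w l‖ + (∑ l, |a l|) * δ := by
    have h2 : ∑ l, a l • v l = ∑ l, a l • w l + ∑ l, a l • (v l - w l) := by
      rw [← Finset.sum_add_distrib]
      exact Finset.sum_congr rfl fun l _ => by rw [smul_sub]; abel
    rw [h2, Finset.sum_mul]
    refine (norm_add_le _ _).trans (add_le_add le_rfl ((norm_sum_le _ _).trans ?_))
    refine Finset.sum_le_sum fun l _ => ?_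
    rw [norm_smul, Real.norm_eq_abs]
    exact mul_le_mul_of_nonneg_left (hvw l) (abs_nonneg _)
  have h3 := (hv a).trans (mul_le_mul_of_nonneg_left h1 hA')
  have h4 : 0 ≤ ∑ l, |a l| := Finset.sum_nonneg fun _ _ => abs_nonneg _
  nlinarith

/-- A quantitatively independent family of full cardinality spans. -/
lemma IsIndep.exists_sum_smul {n : ℕ} {A' : ℝ} {v : Fin (n + 1) → SpaceTime n}
    (hv : IsIndep A' v) (x : SpaceTime n) : ∃ b : Fin (n + 1) → ℝ, ∑ l, b l • v l = x := by
  have hli : LinearIndependent ℝ v := by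
    rw [Fintype.linearIndependent_iff]
    intro g hg i
    have h1 := hv g
    rw [hg, norm_zero, mul_zero] at h1
    have h2 : |g i| ≤ ∑ l, |g l| :=
      Finset.single_le_sum (f := fun l => |g l|) (fun _ _ => abs_nonneg _) (Finset.mem_univ i)
    exact abs_eq_zero.1 (le_antisymm (h2.trans h1) (abs_nonneg _))
  have hspan := hli.span_eq_top_of_card_eq_finrank' (by simp)
  have hx : x ∈ Submodule.span ℝ (range v) := by rw [hspan]; trivial
  obtain ⟨b, hb⟩ := (Submodule.mem_span_range_iff_exists_fun ℝ).1 hx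
  exact ⟨b, hb⟩

/-! ### Weighted point configurations -/

/-- A finite superposition of waves together with a weighted point configuration. -/
structure Cfg (n : ℕ) where
  /-- indices of the waves -/
  κ : Type
  /-- indices of the points -/
  π : Type
  /-- the frequencies -/
  W : WaveFamily n κ
  /-- the waves in use -/
  s : Finset κ
  /-- the coefficients -/
  c : κ → ℂ
  /-- the points in use -/
  P : Finset π
  /-- the positions of the points -/
  pos : π → SpaceTime n
  /-- the weights of the points -/
  wt : π → ℝ

namespace Cfg

variable {n : ℕ}

/-- The weighted square sum of the superposition. -/
noncomputable def total (X : Cfg n) : ℝ := ∑ x ∈ X.P, X.wt x * ‖X.W.wave X.c X.s (X.pos x)‖ ^ 2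

/-- The square sum of the coefficients. -/
noncomputable def energy (X : Cfg n) : ℝ := ∑ k ∈ X.s, ‖X.c k‖ ^ 2

lemma energy_nonneg (X : Cfg n) : 0 ≤ X.energy := Finset.sum_nonneg fun _ _ => by positivity

/-- Convexity, separation of the frequencies, and sparsity of the points at unit scale. -/
structure PreAdm (X : Cfg n) (A A₀ R T : ℝ) : Prop where
  conv : X.W.IsConv A X.s
  mult : ∀ k ∈ X.s, ∀ J ⊆ X.s, (∀ l ∈ J, ‖X.W.y l - X.W.y k‖ ≤ 1 / R) → (J.card : ℝ) ≤ A₀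
  one_le : 1 ≤ R
  wt_nonneg : ∀ x ∈ X.P, 0 ≤ X.wt x
  pos_fst : ∀ x ∈ X.P, ‖(X.pos x).1‖ ≤ R
  pos_snd : ∀ x ∈ X.P, |(X.pos x).2| ≤ T
  unit : ∀ y, ∀ J ⊆ X.P, (∀ x ∈ J, ‖X.pos x - y‖ ≤ 1) → ∑ x ∈ J, X.wt x ≤ 1

/-- Configurations satisfying a Frostman condition of dimension `α`. -/
structure Adm (X : Cfg n) (A A₀ α c₀ R T : ℝ) : Prop extends PreAdm X A A₀ R T where
  le : T ≤ R
  one_le_c : 1 ≤ c₀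
  frost : ∀ y r, 1 ≤ r → ∀ J ⊆ X.P, (∀ x ∈ J, ‖X.pos x - y‖ ≤ r) → ∑ x ∈ J, X.wt x ≤ c₀ * r ^ α

/-- The estimate to be proved. -/
def Bound (n : ℕ) (A A₀ α θ T M : ℝ) : Prop :=
  ∀ (X : Cfg n) (c₀ R : ℝ), X.Adm A A₀ α c₀ R T → X.total ≤ M * c₀ ^ θ * R ^ n * X.energy

lemma norm_freq_apply_single_ge {κ : Type} (W : WaveFamily n κ) (k l : κ) :
    ∃ i : Option (Fin n), (i = none → ‖W.y k - W.y l‖ = 0) ∧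
      ∀ m, i = some m → ∀ ρ : ℝ, 0 ≤ ρ →
        |(W.freq k - W.freq l) (ρ • ((Pi.single m 1, 0) : SpaceTime n))| = ρ * ‖W.y k - W.y l‖ := by
  rcases isEmpty_or_nonempty (Fin n) with h | h
  · exact ⟨none, fun _ => by rw [Subsingleton.elim (W.y k - W.y l) 0, norm_zero], by simp⟩
  obtain ⟨m, hm⟩ := Finite.exists_max fun i => ‖(W.y k - W.y l) i‖
  refine ⟨some m, by simp, ?_⟩
  rintro m' ⟨⟩ ρ hρ
  have h1 : ‖W.y k - W.y l‖ = ‖(W.y k - W.y l) m‖ :=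
    le_antisymm ((pi_norm_le_iff_of_nonneg (norm_nonneg _)).2 hm) (norm_le_pi_norm _ _)
  rw [h1, map_smul, smul_eq_mul, abs_mul, abs_of_nonneg hρ, Real.norm_eq_abs]
  congr 2
  simp [sub_apply, WaveFamily.freq_apply]

/-- The horizontal band measure. -/
lemma integral_horizontal_le {A A₀ R T : ℝ} {X : Cfg n} (hX : X.PreAdm A A₀ R T)
    (Ω : Measure (SpaceTime n)) [IsProbabilityMeasure Ω] (y : SpaceTime n) :
    ∫ v, ‖X.W.wave X.c X.s (y + v)‖ ^ 2
      ∂convMeasure (dirMeasure fun i : Fin n => R • ((Pi.single i 1, 0) : SpaceTime n)) Ω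
      ≤ A₀ * X.energy := by
  classical
  have hR : 0 < R := by linarith [hX.one_le]
  refine WaveFamily.integral_wave_sq_le_coeff X.c X.s
    (fun k l => ‖X.W.y l - X.W.y k‖ ≤ 1 / R) (fun k l h => by rwa [norm_sub_rev])
    (fun k hk => hX.mult k hk _ (Finset.filter_subset _ _)
      fun l hl => (Finset.mem_filter.1 hl).2) _ (fun k hk l hl hkl => ?_) y
  push Not at hkl
  obtain ⟨i, hi1, hi2⟩ := norm_freq_apply_single_ge X.W k l
  rw [norm_sub_rev] at hkl
  rcases i with _ | m
  · rw [hi1 rfl] at hkl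
    exact absurd hkl (not_lt.2 (by positivity))
  · rw [integral_convMeasure_expChar, integral_expChar_dirMeasure _ (l := m), zero_mul]
    rw [hi2 m rfl R hR.le]
    rw [div_lt_iff₀ hR] at hkl
    linarith

/-- The trivial estimate. -/
lemma PreAdm.total_le {A A₀ : ℝ} (hA : 1 ≤ A) (hA₀ : 0 ≤ A₀) : ∃ C : ℝ, 0 ≤ C ∧ ∀ (X : Cfg n)
    (R T : ℝ), 0 ≤ T → X.PreAdm A A₀ R T → X.total ≤ C * (1 + T) * R ^ n * X.energy := by
  have hc₁ : 0 ≤ WaveFamily.unitConst n A := by unfold WaveFamily.unitConst; positivity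
  set c₁ := WaveFamily.unitConst n A with hc₁'
  refine ⟨500 ^ n * c₁ * A₀ * (6 ^ n * 2), by positivity, ?_⟩
  intro X R T hT hX
  have hR := hX.one_le
  have hE := X.energy_nonneg
  set Ω₁ := coordMeasure n (1 / (2 * WaveFamily.freqConst n A)) with hΩ₁
  set g : SpaceTime n → ℝ := fun y => ∫ v, ‖X.W.wave X.c X.s (y + v)‖ ^ 2 ∂Ω₁ with hg
  have hgN := WaveFamily.isNTP_average_wave (W := X.W) X.c X.s Ω₁
  have hgc : Continuous g := hgN.continuous
  have hU : ∀ a b : ℝ, MeasurableSet (closedBall (0 : Fin n → ℝ) a ×ˢ closedBall (0 : ℝ) b) :=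
    fun a b => measurableSet_closedBall.prod measurableSet_closedBall
  rw [← ENNReal.ofReal_le_ofReal_iff (by positivity), total,
    ENNReal.ofReal_sum_of_nonneg fun x hx => mul_nonneg (hX.wt_nonneg x hx) (by positivity)]
  have h1 : ∀ x ∈ X.P, ENNReal.ofReal (X.wt x * ‖X.W.wave X.c X.s (X.pos x)‖ ^ 2)
      = ENNReal.ofReal (X.wt x) * ENNReal.ofReal (‖X.W.wave X.c X.s (X.pos x)‖ ^ 2) :=
    fun x hx => ENNReal.ofReal_mul (hX.wt_nonneg x hx)
  rw [Finset.sum_congr rfl h1]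
  have hΦ : Measurable fun y => ENNReal.ofReal (c₁ * g y) := by fun_prop
  refine (sum_le_setLIntegral X.P X.pos X.wt hX.wt_nonneg (fun y => hX.unit y _
    (Finset.filter_subset _ _) fun x hx => (Finset.mem_filter.1 hx).2)
    (h := fun x => ENNReal.ofReal (‖X.W.wave X.c X.s (X.pos x)‖ ^ 2)) hΦ
    (fun x hx y hxy => ENNReal.ofReal_le_ofReal (WaveFamily.le_unit_average hX.conv hA
      subset_rfl (WaveFamily.isNTP_wave_sq X.c X.s) hxy)) (hU (R + 1) (T + 1)) ?_).trans ?_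
  · intro x hx y hy
    rw [mem_closedBall, dist_eq_norm] at hy
    have e1 := (norm_fst_le _).trans hy
    have e2 := (norm_snd_le _).trans hy
    rw [mem_prod, mem_closedBall_zero_iff, mem_closedBall_zero_iff]
    have e3 := norm_sub_norm_le y.1 (X.pos x).1
    have e4 := norm_sub_norm_le y.2 (X.pos x).2
    have e5 := hX.pos_fst x hx
    have e6 := hX.pos_snd x hx
    rw [← Real.norm_eq_abs] at e6
    simp only [Prod.fst_sub, Prod.snd_sub] at e1 e2
    constructor <;> linarith
  · refine (setLIntegral_le_of_translates hΦ
      (fun t : Fin n → ℝ => ∑ i, t i • R • ((Pi.single i 1, 0) : SpaceTime n)) (by fun_prop)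
      (hU _ _) (hU (2 * R + 1) (T + 1)) ?_
      (B := 500 ^ n * ENNReal.ofReal (c₁ * (A₀ * X.energy))) ?_).trans ?_
    · intro t ht y hy
      have e : ∑ i, t i • R • ((Pi.single i 1, 0) : SpaceTime n) = (R • t, 0) := by
        ext i
        · simp [Prod.fst_sum, Finset.sum_apply, Pi.single_apply, mul_comm]
        · simp [Prod.snd_sum]
      rw [e, mem_prod, mem_closedBall_zero_iff, mem_closedBall_zero_iff] at hy
      rw [mem_prod, mem_closedBall_zero_iff, mem_closedBall_zero_iff]
      simp only [Prod.fst_add, Prod.snd_add, add_zero] at hy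
      refine ⟨?_, hy.2⟩
      have h3 : ‖R • t‖ ≤ R := by
        rw [norm_smul, Real.norm_of_nonneg (by linarith)]
        refine mul_le_of_le_one_right (by linarith)
          ((pi_norm_le_iff_of_nonneg zero_le_one).2 fun i => ?_)
        rw [Real.norm_eq_abs, abs_le]
        exact ⟨ht.1 i, ht.2 i⟩
      have h4 : ‖y.1‖ ≤ ‖y.1 + R • t‖ + ‖R • t‖ := by
        calc ‖y.1‖ = ‖(y.1 + R • t) - R • t‖ := by rw [add_sub_cancel_right]
          _ ≤ _ := norm_sub_le _ _
      linarith [hy.1]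
    · intro y _
      have hm : Measure.restrict (volume : Measure (Fin n → ℝ)) (Icc (fun _ => -1) fun _ => 1)
          ≤ (500 : ℝ≥0∞) ^ n • boxMeasure (Fin n) := by
        have := volume_restrict_le_boxMeasure (ι := Fin n)
        rw [Fintype.card_fin] at this
        exact (Measure.restrict_mono (Icc_subset_Icc (fun _ => by norm_num)
          fun _ => by norm_num) le_rfl).trans this
      refine (lintegral_mono' hm le_rfl).trans ?_
      rw [lintegral_smul_measure, smul_eq_mul]
      gcongr
      have hint : Integrable (fun t : Fin n → ℝ =>
          c₁ * g (y + ∑ i, t i • R • ((Pi.single i 1, 0) : SpaceTime n))) (boxMeasure (Fin n)) := by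
        obtain ⟨B, hB⟩ := hgN.bounded
        refine (Integrable.of_bound (C := B) (by fun_prop : Continuous fun t : Fin n → ℝ =>
          g (y + ∑ i, t i • R • ((Pi.single i 1, 0) : SpaceTime n))).aestronglyMeasurable
          (Eventually.of_forall fun t => ?_)).const_mul _
        rw [Real.norm_of_nonneg (hgN.nonneg _)]
        exact hB _
      rw [← ofReal_integral_eq_lintegral_ofReal hint
        (Eventually.of_forall fun t => mul_nonneg hc₁ (hgN.nonneg _)), integral_const_mul]
      refine ENNReal.ofReal_le_ofReal (mul_le_mul_of_nonneg_left ?_ hc₁)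
      rw [← integral_dirMeasure (f := fun v => g (y + v)) _ (by fun_prop)]
      have := integral_horizontal_le hX Ω₁ y
      rw [← WaveFamily.average_average_wave] at this
      exact this
    · rw [Measure.volume_eq_prod, Measure.prod_prod, Real.volume_pi_closedBall _ (by linarith),
        Real.volume_closedBall, Fintype.card_fin, ← ENNReal.ofReal_mul (by positivity)]
      have h500 : (500 : ℝ≥0∞) ^ n = ENNReal.ofReal (500 ^ n) := by
        rw [ENNReal.ofReal_pow (by norm_num)]; norm_num
      rw [h500, ← ENNReal.ofReal_mul (by positivity), ← ENNReal.ofReal_mul (by positivity)]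
      refine ENNReal.ofReal_le_ofReal ?_
      have h6 : (2 * (2 * R + 1)) ^ n ≤ 6 ^ n * R ^ n := by
        rw [← mul_pow]
        exact pow_le_pow_left₀ (by linarith) (by linarith) n
      calc 500 ^ n * (c₁ * (A₀ * X.energy)) * ((2 * (2 * R + 1)) ^ n * (2 * (T + 1)))
          ≤ 500 ^ n * (c₁ * (A₀ * X.energy)) * (6 ^ n * R ^ n * (2 * (T + 1))) := by
            gcongr
        _ = _ := by ring

end Cfg

/-! ### Cells and parabolic rescaling -/

lemma card_le_of_floor {J : Finset ℤ} {a b : ℝ} (hb : 0 ≤ b)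
    (h : ∀ t ∈ J, ∃ s : ℝ, |s - a| ≤ b ∧ t = ⌊s⌋) : (J.card : ℝ) ≤ 2 * b + 2 := by
  have h1 : J ⊆ Finset.Icc ⌊a - b⌋ ⌊a + b⌋ := by
    intro t ht
    obtain ⟨s, hs, rfl⟩ := h t ht
    rw [abs_le] at hs
    exact Finset.mem_Icc.2 ⟨Int.floor_le_floor (by linarith), Int.floor_le_floor (by linarith)⟩
  have h2 : ((Finset.Icc ⌊a - b⌋ ⌊a + b⌋).card : ℤ) = ⌊a + b⌋ + 1 - ⌊a - b⌋ := by
    rw [Int.card_Icc, Int.toNat_of_nonneg]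
    have := Int.floor_le_floor (show a - b ≤ a + b by linarith)
    omega
  have h3 : ((Finset.Icc ⌊a - b⌋ ⌊a + b⌋).card : ℝ) = ⌊a + b⌋ + 1 - ⌊a - b⌋ := by
    exact_mod_cast h2
  have h4 : (J.card : ℝ) ≤ (Finset.Icc ⌊a - b⌋ ⌊a + b⌋).card := by
    exact_mod_cast Finset.card_le_card h1
  have := Int.floor_le (a + b)
  have := Int.lt_floor_add_one (a - b)
  linarith

lemma card_le_of_floor_pi {n : ℕ} {J : Finset (Fin n → ℤ)} {a : Fin n → ℝ} {b : ℝ} (hb : 0 ≤ b)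
    (h : ∀ t ∈ J, ∀ i, ∃ s : ℝ, |s - a i| ≤ b ∧ t i = ⌊s⌋) :
    (J.card : ℝ) ≤ (2 * b + 2) ^ n := by
  classical
  have h1 : J ⊆ Fintype.piFinset fun i => J.image fun t => t i := fun t ht =>
    Fintype.mem_piFinset.2 fun i => Finset.mem_image_of_mem _ ht
  have h2 := Finset.card_le_card h1
  rw [Fintype.card_piFinset] at h2
  calc (J.card : ℝ) ≤ ∏ i, ((J.image fun t => t i).card : ℝ) := by exact_mod_cast h2
    _ ≤ ∏ _i : Fin n, (2 * b + 2) := by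
        refine Finset.prod_le_prod (fun _ _ => by positivity) fun i _ => ?_
        refine card_le_of_floor (a := a i) hb fun t ht => ?_
        obtain ⟨t', ht', rfl⟩ := Finset.mem_image.1 ht
        exact h t' ht' i
    _ = _ := by simp

/-- The index of the cell of side `K` containing a point. -/
noncomputable def cell {n : ℕ} (K : ℝ) (x : SpaceTime n) : (Fin n → ℤ) × ℤ :=
  (fun i => ⌊x.1 i / K⌋, ⌊x.2 / K⌋)

lemma norm_sub_le_of_cell_eq {n : ℕ} {K : ℝ} (hK : 0 < K) {x y : SpaceTime n}
    (h : cell K x = cell K y) : ‖x - y‖ ≤ K := by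
  have key : ∀ a b : ℝ, ⌊a / K⌋ = ⌊b / K⌋ → |a - b| ≤ K := by
    intro a b hab
    have := Int.abs_sub_lt_one_of_floor_eq_floor hab
    rw [← sub_div, abs_div, abs_of_pos hK, div_lt_one hK] at this
    exact this.le
  rw [Prod.norm_def]
  refine max_le ((pi_norm_le_iff_of_nonneg hK.le).2 fun i => ?_) ?_
  · exact key _ _ (congrFun (congrArg Prod.fst h) i)
  · exact key _ _ (congrArg Prod.snd h)

/-- Parabolic rescaling of space-time adapted to the slope `p₀`. -/
noncomputable def rescalePos {n : ℕ} (K : ℝ) (p₀ : Fin n → ℝ) (x : SpaceTime n) : SpaceTime n :=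
  (K⁻¹ • (x.1 + x.2 • p₀), x.2 / K ^ 2)

lemma card_rescale_le {n : ℕ} {K A : ℝ} (hK : 0 < K) (hA : 0 ≤ A) {p₀ : Fin n → ℝ}
    (hp : ‖p₀‖ ≤ A) {π : Type} {J : Finset π} {pos : π → SpaceTime n}
    (hinj : Set.InjOn (fun x => cell K (pos x)) J) {V : Finset ℤ}
    (hV : ∀ x ∈ J, (cell K (pos x)).2 ∈ V) {u : SpaceTime n}
    (hu : ∀ x ∈ J, ‖rescalePos K p₀ (pos x) - u‖ ≤ 1) :
    (J.card : ℝ) ≤ (2 * A + 4) ^ n * V.card := by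
  classical
  have h1 : J.card = ∑ m ∈ V, (J.filter fun x => (cell K (pos x)).2 = m).card :=
    Finset.card_eq_sum_card_fiberwise hV
  rw [h1]
  push_cast
  calc ∑ m ∈ V, ((J.filter fun x => (cell K (pos x)).2 = m).card : ℝ)
      ≤ ∑ _m ∈ V, (2 * A + 4) ^ n := by
        refine Finset.sum_le_sum fun m _ => ?_
        rw [← Finset.card_image_of_injOn (f := fun x => (cell K (pos x)).1)]
        · rw [show 2 * A + 4 = 2 * (1 + A) + 2 by ring]
          refine card_le_of_floor_pi (a := fun i => u.1 i - m * p₀ i) (by linarith) ?_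
          intro t ht i
          obtain ⟨x, hx, rfl⟩ := Finset.mem_image.1 ht
          obtain ⟨hxJ, hxm⟩ := Finset.mem_filter.1 hx
          refine ⟨(pos x).1 i / K, ?_, rfl⟩
          have e1 := (norm_le_pi_norm _ i).trans ((norm_fst_le _).trans (hu x hxJ))
          simp only [rescalePos, Prod.fst_sub, Pi.sub_apply, Pi.smul_apply, Pi.add_apply,
            smul_eq_mul, Real.norm_eq_abs] at e1
          have e2 : |(pos x).2 / K - m| ≤ 1 := by
            have f1 := Int.floor_le ((pos x).2 / K)
            have f2 := Int.lt_floor_add_one ((pos x).2 / K)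
            have f3 : ⌊(pos x).2 / K⌋ = m := hxm
            rw [f3] at f1 f2
            rw [abs_le]
            constructor <;> linarith
          have e3 : (pos x).1 i / K - (u.1 i - m * p₀ i)
              = (K⁻¹ * ((pos x).1 i + (pos x).2 * p₀ i) - u.1 i)
                - ((pos x).2 / K - m) * p₀ i := by field_simp; ring
          rw [e3]
          refine (abs_sub _ _).trans (add_le_add e1 ?_)
          rw [abs_mul]
          have e4 : |p₀ i| ≤ A := (norm_le_pi_norm p₀ i).trans hp
          nlinarith [abs_nonneg (p₀ i), abs_nonneg ((pos x).2 / K - m)]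
        · intro x hx y hy hxy
          have hx' := Finset.mem_filter.1 (Finset.mem_coe.1 hx)
          have hy' := Finset.mem_filter.1 (Finset.mem_coe.1 hy)
          exact hinj hx'.1 hy'.1 (Prod.ext hxy (hx'.2.trans hy'.2.symm))
    _ = _ := by rw [Finset.sum_const, nsmul_eq_mul, mul_comm]

namespace WaveFamily

variable {n : ℕ} {κ : Type} (W : WaveFamily n κ)

/-- Parabolic rescaling of the frequencies about the wave `k₀`. -/
noncomputable def rescale (K : ℝ) (k₀ : κ) : WaveFamily n κ where
  y k := K • (W.y k - W.y k₀)
  σ k := K ^ 2 * (W.σ k - W.σ k₀ - W.p k₀ ⬝ᵥ (W.y k - W.y k₀))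
  p k := K • (W.p k - W.p k₀)

lemma freq_rescale {K : ℝ} (hK : K ≠ 0) (k₀ k : κ) (x : SpaceTime n) :
    (W.rescale K k₀).freq k (rescalePos K (W.p k₀) x) = W.freq k x - W.freq k₀ x := by
  simp only [freq_apply, rescale, rescalePos, smul_dotProduct, dotProduct_smul, smul_eq_mul,
    dotProduct_add, sub_dotProduct, dotProduct_sub]
  rw [dotProduct_comm (W.p k₀) (W.y k), dotProduct_comm (W.p k₀) (W.y k₀)]
  field_simp
  ring

lemma norm_wave_rescale {K : ℝ} (hK : K ≠ 0) (k₀ : κ) (c : κ → ℂ) (I : Finset κ)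
    (x : SpaceTime n) :
    ‖(W.rescale K k₀).wave c I (rescalePos K (W.p k₀) x)‖ = ‖W.wave c I x‖ := by
  have h : W.wave c I x
      = expChar (W.freq k₀) x * (W.rescale K k₀).wave c I (rescalePos K (W.p k₀) x) := by
    unfold wave
    rw [Finset.mul_sum]
    refine Finset.sum_congr rfl fun k _ => ?_
    simp only [expChar, W.freq_rescale hK]
    rw [mul_left_comm, ← Complex.exp_add]
    congr 2
    push_cast
    ring
  rw [h, norm_mul, norm_expChar, one_mul]

lemma IsConv.rescale {W : WaveFamily n κ} {A K : ℝ} {s : Finset κ} (h : W.IsConv A s)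
    (hA : 0 ≤ A) (hK : 0 < K) {k₀ : κ} (hk₀ : k₀ ∈ s) {I : Finset κ} (hI : I ⊆ s)
    (hcap : ∀ k ∈ I, W.cap K k = W.cap K k₀) : (W.rescale K k₀).IsConv A I := by
  have hy : ∀ k ∈ I, ‖W.y k - W.y k₀‖ ≤ 1 / K := fun k hk =>
    W.norm_y_sub_le_of_cap_eq hK (hcap k hk)
  have hns : ∀ v : Fin n → ℝ, ‖K • v‖ = K * ‖v‖ := fun v => by
    rw [norm_smul, Real.norm_of_nonneg hK.le]
  have hdy : ∀ k l, (W.rescale K k₀).y k - (W.rescale K k₀).y l = K • (W.y k - W.y l) := by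
    intro k l; simp only [WaveFamily.rescale]; rw [← smul_sub]; congr 1; abel
  have hdp : ∀ k l, (W.rescale K k₀).p k - (W.rescale K k₀).p l = K • (W.p k - W.p l) := by
    intro k l; simp only [WaveFamily.rescale]; rw [← smul_sub]; congr 1; abel
  have hσ : ∀ k l, (W.rescale K k₀).σ k - (W.rescale K k₀).σ l
      - (W.rescale K k₀).p l ⬝ᵥ ((W.rescale K k₀).y k - (W.rescale K k₀).y l)
      = K ^ 2 * (W.σ k - W.σ l - W.p l ⬝ᵥ (W.y k - W.y l)) := by
    intro k l
    rw [hdy]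
    simp only [WaveFamily.rescale, smul_dotProduct, dotProduct_smul, smul_eq_mul,
      sub_dotProduct, dotProduct_sub]
    ring
  constructor
  · intro k hk
    change ‖K • (W.y k - W.y k₀)‖ ≤ 1
    rw [hns]
    calc K * ‖W.y k - W.y k₀‖ ≤ K * (1 / K) := by gcongr; exact hy k hk
      _ = 1 := by field_simp
  · intro k hk
    change ‖K • (W.p k - W.p k₀)‖ ≤ A
    rw [hns]
    calc K * ‖W.p k - W.p k₀‖ ≤ K * (A * (1 / K)) := by
          gcongr
          exact (h.norm_p_sub_le k (hI hk) k₀ hk₀).trans (by gcongr; exact hy k hk)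
      _ = A := by field_simp
  · intro k hk l hl
    rw [hdp, hdy, hns, hns]
    calc K * ‖W.p k - W.p l‖ ≤ K * (A * ‖W.y k - W.y l‖) := by
          gcongr; exact h.norm_p_sub_le k (hI hk) l (hI hl)
      _ = _ := by ring
  · intro k hk l hl
    rw [hσ, hdy, hns]
    calc A⁻¹ * (K * ‖W.y k - W.y l‖) ^ 2 = K ^ 2 * (A⁻¹ * ‖W.y k - W.y l‖ ^ 2) := by ring
      _ ≤ _ := by gcongr; exact h.convex_lower k (hI hk) l (hI hl)
  · intro k hk l hl
    rw [hσ, hdy, hns]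
    calc K ^ 2 * (W.σ k - W.σ l - W.p l ⬝ᵥ (W.y k - W.y l))
        ≤ K ^ 2 * (A * ‖W.y k - W.y l‖ ^ 2) := by
          gcongr; exact h.convex_upper k (hI hk) l (hI hl)
      _ = _ := by ring

end WaveFamily

namespace Cfg

variable {n : ℕ} {A A₀ α θ c₀ R T K : ℝ} {X : Cfg n}

/-- Parabolic rescaling of part of a configuration, with constant weights. -/
noncomputable def rescale (X : Cfg n) (K : ℝ) (k₀ : X.κ) (c : X.κ → ℂ) (I : Finset X.κ)
    (Z : Finset X.π) (w₀ : ℝ) : Cfg n where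
  κ := X.κ
  π := X.π
  W := X.W.rescale K k₀
  s := I
  c := c
  P := Z
  pos x := rescalePos K (X.W.p k₀) (X.pos x)
  wt _ := w₀

lemma total_rescale (hK : K ≠ 0) (k₀ : X.κ) (c : X.κ → ℂ) (I : Finset X.κ)
    (Z : Finset X.π) (w₀ : ℝ) : (X.rescale K k₀ c I Z w₀).total
      = w₀ * ∑ x ∈ Z, ‖X.W.wave c I (X.pos x)‖ ^ 2 := by
  rw [Finset.mul_sum]
  exact Finset.sum_congr rfl fun x _ => by
    simp only [rescale, X.W.norm_wave_rescale hK]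

lemma PreAdm.rescale (hX : X.PreAdm A A₀ R T) (hA : 1 ≤ A) (hK : 1 ≤ K) (hKR : K ≤ R)
    (hTR : T ≤ R) {k₀ : X.κ} (hk₀ : k₀ ∈ X.s) {I : Finset X.κ} (hI : I ⊆ X.s)
    (hcap : ∀ k ∈ I, X.W.cap K k = X.W.cap K k₀) {Z : Finset X.π} (hZ : Z ⊆ X.P)
    (hinj : Set.InjOn (fun x => cell K (X.pos x)) Z) {Nv : ℝ} (hNv : 0 < Nv)
    (hV : ∀ u, ∀ J ⊆ Z, (∀ x ∈ J, ‖rescalePos K (X.W.p k₀) (X.pos x) - u‖ ≤ 1) →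
      ∃ V : Finset ℤ, (∀ x ∈ J, (cell K (X.pos x)).2 ∈ V) ∧ (V.card : ℝ) ≤ Nv)
    (c : X.κ → ℂ) :
    (X.rescale K k₀ c I Z ((2 * A + 4) ^ n * Nv)⁻¹).PreAdm A A₀ ((1 + A) * R / K) (T / K ^ 2) where
  conv := hX.conv.rescale (by linarith) (by linarith) hk₀ hI hcap
  mult := by
    intro k hk J hJ hJk
    refine hX.mult k (hI hk) J (hJ.trans hI) fun l hl => ?_
    have h := hJk l hl
    have e : (X.W.rescale K k₀).y l - (X.W.rescale K k₀).y k = K • (X.W.y l - X.W.y k) := by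
      simp only [WaveFamily.rescale]; rw [← smul_sub]; congr 1; abel
    change ‖(X.W.rescale K k₀).y l - (X.W.rescale K k₀).y k‖ ≤ _ at h
    have hR : 0 < R := by linarith
    have hK0 : 0 < K := by linarith
    rw [e, norm_smul, Real.norm_of_nonneg hK0.le, one_div_div] at h
    have h2 : ‖X.W.y l - X.W.y k‖ ≤ 1 / ((1 + A) * R) := by
      have h3 : K * ‖X.W.y l - X.W.y k‖ ≤ K * (1 / ((1 + A) * R)) := by
        rw [mul_one_div]; exact h
      exact le_of_mul_le_mul_left h3 hK0
    refine h2.trans (one_div_le_one_div_of_le hR ?_)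
    nlinarith
  one_le := by
    rw [le_div_iff₀ (by linarith)]
    nlinarith
  wt_nonneg := fun x _ => by
    simp only [Cfg.rescale]; positivity
  pos_fst := by
    intro x hx
    have h1 := hX.pos_fst x (hZ hx)
    have h2 := hX.pos_snd x (hZ hx)
    have h3 := hX.conv.norm_p_le k₀ hk₀
    simp only [Cfg.rescale, rescalePos]
    rw [norm_smul, norm_inv, Real.norm_of_nonneg (by linarith : 0 ≤ K), ← div_eq_inv_mul]
    refine div_le_div_of_nonneg_right ((norm_add_le _ _).trans ?_) (by linarith)
    rw [norm_smul, Real.norm_eq_abs]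
    nlinarith [abs_nonneg (X.pos x).2, norm_nonneg (X.W.p k₀)]
  pos_snd := by
    intro x hx
    have h2 := hX.pos_snd x (hZ hx)
    simp only [Cfg.rescale, rescalePos]
    rw [abs_div, abs_of_nonneg (sq_nonneg K)]
    gcongr
  unit := by
    intro u (J : Finset X.π) hJ hJu
    obtain ⟨V, hV1, hV2⟩ := hV u J hJ hJu
    have h := card_rescale_le (by linarith) (by linarith) (hX.conv.norm_p_le k₀ hk₀)
      (hinj.mono (by exact_mod_cast hJ)) hV1 hJu
    change ∑ _x ∈ J, ((2 * A + 4) ^ n * Nv)⁻¹ ≤ 1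
    rw [Finset.sum_const, nsmul_eq_mul, ← div_eq_mul_inv, div_le_one (by positivity)]
    exact h.trans (by gcongr)

/-- The mass of the cell of a point. -/
noncomputable def mass (X : Cfg n) (K : ℝ) (z : X.π) : ℝ :=
  open Classical in ∑ x ∈ X.P with cell K (X.pos x) = cell K (X.pos z), X.wt x

lemma PreAdm.mass_nonneg (hX : X.PreAdm A A₀ R T) (z : X.π) : 0 ≤ X.mass K z :=
  Finset.sum_nonneg fun x hx => hX.wt_nonneg x (Finset.mem_filter.1 hx).1

lemma Adm.mass_le (hX : X.Adm A A₀ α c₀ R T) (hK : 1 ≤ K) (z : X.π) :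
    X.mass K z ≤ c₀ * K ^ α :=
  hX.frost (X.pos z) K hK _ (Finset.filter_subset _ _) fun _ hx =>
    norm_sub_le_of_cell_eq (by linarith) (Finset.mem_filter.1 hx).2

lemma sum_mass_le (hK : 0 < K) {J : Finset X.π}
    (hinj : Set.InjOn (fun x => cell K (X.pos x)) J) {y : SpaceTime n} {r B : ℝ}
    (hJ : ∀ z ∈ J, ‖X.pos z - y‖ ≤ r)
    (hB : ∀ J' ⊆ X.P, (∀ x ∈ J', ‖X.pos x - y‖ ≤ r + K) → ∑ x ∈ J', X.wt x ≤ B) :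
    ∑ z ∈ J, X.mass K z ≤ B := by
  classical
  unfold mass
  rw [← Finset.sum_biUnion]
  · refine hB _ ?_ ?_
    · intro x hx
      obtain ⟨z, _, hz⟩ := Finset.mem_biUnion.1 hx
      exact (Finset.mem_filter.1 hz).1
    · intro x hx
      obtain ⟨z, hz, hz'⟩ := Finset.mem_biUnion.1 hx
      have h1 := norm_sub_le_of_cell_eq hK (Finset.mem_filter.1 hz').2
      have h2 := hJ z hz
      calc ‖X.pos x - y‖ = ‖(X.pos x - X.pos z) + (X.pos z - y)‖ := by rw [sub_add_sub_cancel]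
        _ ≤ _ := norm_add_le _ _
        _ ≤ r + K := by linarith
  · intro z hz z' hz' hzz'
    refine Finset.disjoint_left.2 fun x hx hx' => hzz' (hinj hz hz' ?_)
    exact (Finset.mem_filter.1 hx).2.symm.trans (Finset.mem_filter.1 hx').2

/-- The Frostman condition after rescaling. -/
lemma Adm.card_le (hX : X.Adm A A₀ α c₀ R T) (hA : 1 ≤ A) (hK : 1 ≤ K) {p₀ : Fin n → ℝ}
    (hp : ‖p₀‖ ≤ A) {lam : ℝ} (hlam : 0 < lam) {J : Finset X.π}
    (hmass : ∀ z ∈ J, lam ≤ X.mass K z)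
    (hinj : Set.InjOn (fun x => cell K (X.pos x)) J) {u : SpaceTime n} {r : ℝ} (hr : 1 ≤ r)
    (hJ : ∀ z ∈ J, ‖rescalePos K p₀ (X.pos z) - u‖ ≤ r) :
    (J.card : ℝ) ≤ (2 * K + 2) * (c₀ * ((2 + A) * K) ^ α / lam * r ^ α) := by
  classical
  have hK0 : 0 < K := by linarith
  have hr0 : 0 < r := by linarith
  have hKr : 0 < K * r := by positivity
  have hc₀ := hX.one_le_c
  set V := J.image fun z => ⌊(X.pos z).2 / (K * r)⌋ with hV
  have hVc : (V.card : ℝ) ≤ 2 * K + 2 := by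
    refine card_le_of_floor (a := K * u.2 / r) hK0.le fun t ht => ?_
    obtain ⟨z, hz, rfl⟩ := Finset.mem_image.1 ht
    refine ⟨_, ?_, rfl⟩
    have h := (norm_snd_le _).trans (hJ z hz)
    simp only [rescalePos, Prod.snd_sub, Real.norm_eq_abs] at h
    have e : (X.pos z).2 / (K * r) - K * u.2 / r = K / r * ((X.pos z).2 / K ^ 2 - u.2) := by
      field_simp
    rw [e, abs_mul, abs_of_pos (by positivity)]
    calc K / r * |(X.pos z).2 / K ^ 2 - u.2| ≤ K / r * r := by gcongr
      _ = K := by field_simp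
  have hfib : ∀ t ∈ V, ((J.filter fun z => ⌊(X.pos z).2 / (K * r)⌋ = t).card : ℝ)
      ≤ c₀ * ((2 + A) * K) ^ α / lam * r ^ α := by
    intro t _
    set J' := J.filter fun z => ⌊(X.pos z).2 / (K * r)⌋ = t with hJ'
    have hJJ : J' ⊆ J := Finset.filter_subset _ _
    have h1 : ∑ z ∈ J', X.mass K z ≤ c₀ * ((2 + A) * K * r) ^ α := by
      refine sum_mass_le hK0 (hinj.mono (by exact_mod_cast hJJ))
        (y := (K • u.1 - (t * (K * r)) • p₀, t * (K * r))) (r := (1 + A) * (K * r))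
        (fun z hz => ?_) fun J₂ hJ₂ hJ₂' => hX.frost _ ((2 + A) * K * r) ?_ J₂ hJ₂
          fun x hx => (hJ₂' x hx).trans ?_
      · obtain ⟨hz1, hz2⟩ := Finset.mem_filter.1 hz
        have f1 := Int.floor_le ((X.pos z).2 / (K * r))
        have f2 := Int.lt_floor_add_one ((X.pos z).2 / (K * r))
        rw [hz2] at f1 f2
        rw [le_div_iff₀ hKr] at f1
        rw [div_lt_iff₀ hKr] at f2
        have f3 : |(X.pos z).2 - t * (K * r)| ≤ K * r := by
          rw [abs_le]; constructor <;> nlinarith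
        rw [Prod.norm_def]
        refine max_le ?_ ?_
        · have h := (norm_fst_le _).trans (hJ z hz1)
          simp only [rescalePos, Prod.fst_sub] at h
          have e : (X.pos z).1 - (K • u.1 - (t * (K * r)) • p₀)
              = K • (K⁻¹ • ((X.pos z).1 + (X.pos z).2 • p₀) - u.1)
                - ((X.pos z).2 - t * (K * r)) • p₀ := by
            rw [smul_sub, smul_smul, mul_inv_cancel₀ hK0.ne', one_smul, sub_smul]
            abel
          simp only [Prod.fst_sub]
          rw [e]
          refine (norm_sub_le _ _).trans ?_
          rw [norm_smul, norm_smul, Real.norm_of_nonneg hK0.le, Real.norm_eq_abs]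
          have g1 : K * ‖K⁻¹ • ((X.pos z).1 + (X.pos z).2 • p₀) - u.1‖ ≤ K * r := by gcongr
          have g2 : |(X.pos z).2 - t * (K * r)| * ‖p₀‖ ≤ K * r * A := by gcongr
          linarith
        · simp only [Prod.snd_sub, Real.norm_eq_abs]
          nlinarith
      · nlinarith [mul_le_mul hK hr zero_le_one hK0.le]
      · nlinarith
    have h2 : (J'.card : ℝ) * lam ≤ ∑ z ∈ J', X.mass K z := by
      rw [← nsmul_eq_mul]
      exact Finset.card_nsmul_le_sum _ _ _ fun z hz => hmass z (hJJ hz)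
    rw [Real.mul_rpow (by positivity) hr0.le] at h1
    rw [div_mul_eq_mul_div, le_div_iff₀ hlam]
    linarith
  rw [Finset.card_eq_sum_card_image (fun z => ⌊(X.pos z).2 / (K * r)⌋) J]
  push_cast
  refine (Finset.sum_le_sum hfib).trans ?_
  rw [Finset.sum_const, nsmul_eq_mul]
  gcongr

/-- The inductive estimate for the waves in a cap, after rescaling. -/
lemma Adm.sum_cap_le (hX : X.Adm A A₀ α c₀ R T) (hA : 1 ≤ A) (hα : 0 ≤ α) (hK : 1 ≤ K) (hKR : K ≤ R)
    {M : ℝ} (hM : 0 ≤ M) (hB : Bound n A A₀ α θ (T / K ^ 2) M) (c : X.κ → ℂ) (q : Fin n → ℤ)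
    {lam : ℝ} (hlam : 0 < lam) {Z : Finset X.π} (hZ : Z ⊆ X.P)
    (hinj : Set.InjOn (fun x => cell K (X.pos x)) Z) (hmass : ∀ z ∈ Z, lam ≤ X.mass K z) :
    ∑ z ∈ Z, ‖X.W.wave c (X.s.filter fun k => X.W.cap K k = q) (X.pos z)‖ ^ 2
      ≤ (2 * A + 4) ^ n * (2 * K + 2) * (M * (c₀ * ((2 + A) * K) ^ α / lam) ^ θ
        * ((1 + A) * R / K) ^ n * ∑ k ∈ X.s with X.W.cap K k = q, ‖c k‖ ^ 2) := by
  have hK0 : 0 < K := by linarith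
  have hc₀ := hX.one_le_c
  have hR := hX.one_le
  set I := X.s.filter fun k => X.W.cap K k = q with hIdef
  have hrhs : 0 ≤ (2 * A + 4) ^ n * (2 * K + 2) * (M * (c₀ * ((2 + A) * K) ^ α / lam) ^ θ
        * ((1 + A) * R / K) ^ n * ∑ k ∈ I, ‖c k‖ ^ 2) := by positivity
  rcases I.eq_empty_or_nonempty with h | ⟨k₀, hk₀⟩
  · rw [h] at hrhs ⊢
    simp [WaveFamily.wave]
  rcases Z.eq_empty_or_nonempty with h | ⟨z₀, hz₀⟩
  · rw [h]; simpa using hrhs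
  obtain ⟨hk₀s, hk₀q⟩ := Finset.mem_filter.1 hk₀
  set N := (2 * A + 4) ^ n * (2 * K + 2) with hN
  have hN1 : 1 ≤ (2 * A + 4) ^ n := one_le_pow₀ (by linarith)
  have hN0 : 0 < N := by positivity
  have hpre := hX.toPreAdm.rescale hA hK hKR hX.le hk₀s (Finset.filter_subset _ _)
    (I := I) (fun k hk => ((Finset.mem_filter.1 hk).2).trans hk₀q.symm) hZ hinj
    (Nv := 2 * K + 2) (by linarith) (fun u J _ hJu => by
      classical
      refine ⟨J.image fun z => (cell K (X.pos z)).2, fun x hx => Finset.mem_image_of_mem _ hx, ?_⟩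
      refine card_le_of_floor (a := K * u.2) hK0.le fun t ht => ?_
      obtain ⟨z, hz, rfl⟩ := Finset.mem_image.1 ht
      refine ⟨_, ?_, rfl⟩
      have h := (norm_snd_le _).trans (hJu z hz)
      simp only [rescalePos, Prod.snd_sub, Real.norm_eq_abs] at h
      have e : (X.pos z).2 / K - K * u.2 = K * ((X.pos z).2 / K ^ 2 - u.2) := by
        field_simp
      rw [e, abs_mul, abs_of_pos hK0]
      calc K * |(X.pos z).2 / K ^ 2 - u.2| ≤ K * 1 := by gcongr
        _ = K := mul_one K) c
  have hadm : (X.rescale K k₀ c I Z N⁻¹).Adm A A₀ α (c₀ * ((2 + A) * K) ^ α / lam)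
      ((1 + A) * R / K) (T / K ^ 2) := by
    refine { toPreAdm := hpre, le := ?_, one_le_c := ?_, frost := ?_ }
    · have h1 : T / K ^ 2 ≤ R / K ^ 2 := by gcongr; exact hX.le
      have h2 : R / K ^ 2 ≤ (1 + A) * R / K := by
        rw [div_le_div_iff₀ (by positivity) hK0]
        nlinarith [mul_le_mul hK hK zero_le_one hK0.le, mul_pos hK0 (by linarith : 0 < R),
          mul_le_mul_of_nonneg_left hK (mul_pos hK0 (by linarith : 0 < R)).le,
          mul_nonneg (by linarith : 0 ≤ A) (mul_pos (pow_pos hK0 2) (by linarith : 0 < R)).le]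
      exact h1.trans h2
    · rw [le_div_iff₀ hlam, one_mul]
      refine (hmass z₀ hz₀).trans ((hX.mass_le hK z₀).trans ?_)
      gcongr
      nlinarith
    · intro u r hr (J : Finset X.π) hJ hJu
      have hcard := hX.card_le hA hK (hX.conv.norm_p_le k₀ hk₀s) hlam
        (fun z hz => hmass z (hJ hz)) (hinj.mono (by exact_mod_cast hJ)) hr hJu
      change ∑ _x ∈ J, N⁻¹ ≤ _
      rw [Finset.sum_const, nsmul_eq_mul, ← div_eq_mul_inv, div_le_iff₀ hN0]
      refine hcard.trans ?_
      rw [mul_comm, hN, ← mul_assoc]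
      refine mul_le_mul_of_nonneg_right ?_ (by linarith)
      have : 0 ≤ c₀ * ((2 + A) * K) ^ α / lam * r ^ α := by positivity
      nlinarith
  have h := hB _ _ _ hadm
  rw [total_rescale hK0.ne'] at h
  rw [inv_mul_le_iff₀ hN0] at h
  exact h

end Cfg

/-- A weak-type bound on superlevel sets implies a strong-type bound. -/
lemma sum_rpow_mul_le {π : Type} (Z : Finset π) (ν g : π → ℝ) {a θ H Λ : ℝ} (hθ : 0 ≤ θ)
    (ha : θ < a) (hΛ : 0 ≤ Λ) (hν : ∀ z ∈ Z, 0 ≤ ν z) (hνΛ : ∀ z ∈ Z, ν z ≤ Λ)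
    (hH : ∀ lam, 0 < lam → ∑ z ∈ Z with lam ≤ ν z, g z ≤ H * lam ^ (-θ)) :
    ∑ z ∈ Z, ν z ^ a * g z ≤ a / (a - θ) * H * Λ ^ (a - θ) := by
  have ha0 : 0 < a := by linarith
  have hint : ∀ s : ℝ, -1 < s → ∀ x : ℝ, 0 ≤ x →
      IntegrableOn (fun lam : ℝ => lam ^ s) (Ioc 0 x) := fun s hs x hx =>
    (intervalIntegrable_iff_integrableOn_Ioc_of_le hx).1 (intervalIntegral.intervalIntegrable_rpow' hs)
  have hval : ∀ s : ℝ, -1 < s → ∀ x : ℝ, 0 ≤ x →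
      ∫ lam in Ioc 0 x, lam ^ s = x ^ (s + 1) / (s + 1) := by
    intro s hs x hx
    rw [← intervalIntegral.integral_of_le hx, integral_rpow (Or.inl hs),
      Real.zero_rpow (by linarith), sub_zero]
  have h1 : ∀ z ∈ Z, ν z ^ a * g z
      = ∫ lam in Ioc 0 Λ, (Iic (ν z)).indicator (fun lam => a * lam ^ (a - 1) * g z) lam := by
    intro z hz
    rw [setIntegral_indicator measurableSet_Iic, Ioc_inter_Iic, min_eq_right (hνΛ z hz),
      integral_mul_const, integral_const_mul, hval _ (by linarith) _ (hν z hz)]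
    rw [sub_add_cancel, mul_div_cancel₀ _ ha0.ne']
  have h2 : ∀ z ∈ Z, IntegrableOn
      ((Iic (ν z)).indicator (fun lam => a * lam ^ (a - 1) * g z)) (Ioc 0 Λ) := fun z _ =>
    (((hint (a - 1) (by linarith) Λ hΛ).const_mul a).mul_const (g z)).indicator measurableSet_Iic
  rw [Finset.sum_congr rfl h1, ← integral_finsetSum _ h2]
  have h3 : ∫ lam in Ioc 0 Λ, a * H * lam ^ (a - 1 - θ) = a / (a - θ) * H * Λ ^ (a - θ) := by
    rw [integral_const_mul, hval _ (by linarith) _ hΛ, show a - 1 - θ + 1 = a - θ by ring]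
    field_simp
  rw [← h3]
  refine setIntegral_mono_on (integrable_finsetSum _ h2)
    ((hint (a - 1 - θ) (by linarith) Λ hΛ).const_mul _) measurableSet_Ioc fun lam hlam => ?_
  have h4 : ∑ z ∈ Z, (Iic (ν z)).indicator (fun lam => a * lam ^ (a - 1) * g z) lam
      = a * lam ^ (a - 1) * ∑ z ∈ Z with lam ≤ ν z, g z := by
    rw [Finset.sum_filter, Finset.mul_sum]
    refine Finset.sum_congr rfl fun z _ => ?_
    by_cases h : lam ≤ ν z
    · rw [indicator_of_mem (by exact h), if_pos h]
    · rw [indicator_of_notMem (by exact h), if_neg h, mul_zero]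
  rw [h4]
  have hl := hlam.1
  calc a * lam ^ (a - 1) * ∑ z ∈ Z with lam ≤ ν z, g z
      ≤ a * lam ^ (a - 1) * (H * lam ^ (-θ)) :=
        mul_le_mul_of_nonneg_left (hH lam hl) (by positivity)
    _ = a * H * lam ^ (a - 1 - θ) := by
        rw [sub_eq_add_neg (a - 1) θ, Real.rpow_add hl]; ring

namespace Cfg

variable {n : ℕ} {A A₀ α θ c₀ R T K : ℝ} {X : Cfg n}

lemma PreAdm.mass_le (hX : X.PreAdm A A₀ R T) (hK : 1 ≤ K) (z : X.π) :
    X.mass K z ≤ (4 * K) ^ (n + 1) := by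
  classical
  have hK0 : 0 < K := by linarith
  unfold mass
  set J := X.P.filter fun x => cell K (X.pos x) = cell K (X.pos z) with hJ
  have hJ' : ∀ x ∈ J, ‖X.pos x - X.pos z‖ ≤ K := fun x hx =>
    norm_sub_le_of_cell_eq hK0 (Finset.mem_filter.1 hx).2
  have key : ∀ a b : ℝ, |a - b| ≤ K → |a / 1 - b| ≤ K := fun a b h => by rwa [div_one]
  have h1 : ((J.image fun x => cell 1 (X.pos x)).card : ℝ) ≤ (2 * K + 2) ^ (n + 1) := by
    have e : J.image (fun x => cell 1 (X.pos x)) ⊆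
        (J.image fun x => (cell 1 (X.pos x)).1) ×ˢ J.image fun x => (cell 1 (X.pos x)).2 := by
      intro t ht
      obtain ⟨x, hx, rfl⟩ := Finset.mem_image.1 ht
      exact Finset.mem_product.2 ⟨Finset.mem_image_of_mem _ hx, Finset.mem_image_of_mem _ hx⟩
    have e1 : ((J.image fun x => (cell 1 (X.pos x)).1).card : ℝ) ≤ (2 * K + 2) ^ n := by
      refine card_le_of_floor_pi (a := (X.pos z).1) hK0.le fun t ht i => ?_
      obtain ⟨x, hx, rfl⟩ := Finset.mem_image.1 ht
      refine ⟨_, key _ _ ?_, rfl⟩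
      have := (norm_le_pi_norm _ i).trans ((norm_fst_le _).trans (hJ' x hx))
      simpa using this
    have e2 : ((J.image fun x => (cell 1 (X.pos x)).2).card : ℝ) ≤ 2 * K + 2 := by
      refine card_le_of_floor (a := (X.pos z).2) hK0.le fun t ht => ?_
      obtain ⟨x, hx, rfl⟩ := Finset.mem_image.1 ht
      refine ⟨_, key _ _ ?_, rfl⟩
      simpa using (norm_snd_le _).trans (hJ' x hx)
    calc ((J.image fun x => cell 1 (X.pos x)).card : ℝ)
        ≤ (J.image fun x => (cell 1 (X.pos x)).1).card
          * (J.image fun x => (cell 1 (X.pos x)).2).card := by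
            exact_mod_cast (Finset.card_le_card e).trans_eq (Finset.card_product _ _)
      _ ≤ (2 * K + 2) ^ n * (2 * K + 2) := by gcongr
      _ = _ := (pow_succ _ _).symm
  rw [← Finset.sum_fiberwise_of_maps_to (g := fun x => cell 1 (X.pos x))
    (t := J.image fun x => cell 1 (X.pos x)) fun x hx => Finset.mem_image_of_mem _ hx]
  calc ∑ t ∈ J.image fun x => cell 1 (X.pos x), ∑ x ∈ J with cell 1 (X.pos x) = t, X.wt x
      ≤ ∑ _t ∈ J.image fun x => cell 1 (X.pos x), (1 : ℝ) := by
        refine Finset.sum_le_sum fun t ht => ?_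
        obtain ⟨x, _, rfl⟩ := Finset.mem_image.1 ht
        refine hX.unit (X.pos x) _ ((Finset.filter_subset _ _).trans (Finset.filter_subset _ _))
          fun x' hx' => norm_sub_le_of_cell_eq one_pos (Finset.mem_filter.1 hx').2
    _ ≤ (2 * K + 2) ^ (n + 1) := by simpa using h1
    _ ≤ _ := by gcongr; linarith

/-- Reduction of a sum of averages over caps to a single cap and a fixed translation. -/
lemma sum_capSum_le (Z : Finset X.π) (b : X.π → ℝ) {H : ℝ}
    (hH : ∀ (c : X.κ → ℂ) (q : Fin n → ℤ),
      ∑ z ∈ Z, b z * ‖X.W.wave c (X.s.filter fun k => X.W.cap K k = q) (X.pos z)‖ ^ 2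
        ≤ H * ∑ k ∈ X.s with X.W.cap K k = q, ‖c k‖ ^ 2)
    (Ω : Measure (SpaceTime n)) [IsProbabilityMeasure Ω] :
    ∑ z ∈ Z, b z * X.W.capSum X.c K X.s Ω (X.pos z) ≤ H * X.energy := by
  classical
  unfold WaveFamily.capSum
  have hint : ∀ z q, Integrable (fun v => ‖X.W.wave X.c (X.s.filter fun k => X.W.cap K k = q)
      (X.pos z + v)‖ ^ 2) Ω := by
    intro z q
    have hN := WaveFamily.isNTP_wave_sq (W := X.W) X.c (X.s.filter fun k => X.W.cap K k = q)
    have hc := hN.continuous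
    obtain ⟨B, hB⟩ := hN.bounded
    refine Integrable.of_bound (C := B) (hc.comp (continuous_const.add continuous_id)).aestronglyMeasurable
      (Eventually.of_forall fun v => ?_)
    rw [Real.norm_of_nonneg (hN.nonneg _)]
    exact hB _
  simp_rw [Finset.mul_sum]
  rw [Finset.sum_comm]
  have hE : X.energy = ∑ q ∈ X.s.image (X.W.cap K), ∑ k ∈ X.s with X.W.cap K k = q, ‖X.c k‖ ^ 2 :=
    (Finset.sum_fiberwise_of_maps_to (fun k hk => Finset.mem_image_of_mem _ hk) _).symm
  rw [hE, Finset.mul_sum]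
  refine Finset.sum_le_sum fun q _ => ?_
  simp_rw [← integral_const_mul]
  rw [← integral_finsetSum _ fun z _ => (hint z q).const_mul _]
  refine (integral_mono (integrable_finsetSum _ fun z _ => (hint z q).const_mul _)
    (integrable_const (H * ∑ k ∈ X.s with X.W.cap K k = q, ‖X.c k‖ ^ 2)) fun v => ?_).trans_eq ?_
  · have h := hH (fun k => X.c k * expChar (X.W.freq k) v) q
    simp only [norm_mul, norm_expChar, mul_one] at h
    simpa only [WaveFamily.wave_add] using h
  · simp

/-- The estimate for the sum of averages over caps, from the inductive hypothesis. -/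
lemma Adm.narrow_le (n : ℕ) {a : ℝ} (A₀ : ℝ) (hA : 1 ≤ A) (hα : 0 ≤ α) (hθ : 0 ≤ θ) (ha : θ < a) :
    ∃ C : ℝ, 0 < C ∧ ∀ (X : Cfg n) (c₀ R T K M : ℝ), X.Adm A A₀ α c₀ R T → 1 ≤ K → K ≤ R → 0 ≤ M →
      Bound n A A₀ α θ (T / K ^ 2) M → ∀ Z ⊆ X.P, Set.InjOn (fun x => cell K (X.pos x)) Z →
      ∀ (Ω : Measure (SpaceTime n)) [IsProbabilityMeasure Ω],
      K ^ ((n + 1) * (1 - a)) * ∑ z ∈ Z, X.mass K z ^ a * X.W.capSum X.c K X.s Ω (X.pos z)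
        ≤ C * K ^ (2 - θ * (n + 1 - α)) * M * c₀ ^ θ * R ^ n * X.energy := by
  have ha0 : 0 < a := by linarith
  have haθ : 0 < a - θ := by linarith
  refine ⟨a / (a - θ) * ((2 * A + 4) ^ n * 4) * ((2 + A) ^ α) ^ θ * (1 + A) ^ n
    * ((4 : ℝ) ^ (n + 1)) ^ (a - θ), by positivity, ?_⟩
  intro X c₀ R T K M hX hK hKR hM hB Z hZ hinj Ω _
  have hK0 : 0 < K := by linarith
  have hc₀ := hX.one_le_c
  have hR := hX.one_le
  set H := (2 * A + 4) ^ n * (2 * K + 2) * (M * (c₀ * ((2 + A) * K) ^ α) ^ θ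
        * ((1 + A) * R / K) ^ n) with hH
  have hE := X.energy_nonneg
  have h := sum_capSum_le (K := K) Z (fun z => X.mass K z ^ a)
    (H := a / (a - θ) * H * ((4 * K) ^ (n + 1)) ^ (a - θ)) (fun c q => by
      refine (sum_rpow_mul_le Z (X.mass K) (fun z => ‖X.W.wave c
        (X.s.filter fun k => X.W.cap K k = q) (X.pos z)‖ ^ 2) hθ ha (by positivity)
        (H := H * ∑ k ∈ X.s with X.W.cap K k = q, ‖c k‖ ^ 2)
        (fun z _ => hX.mass_nonneg z) (fun z _ => hX.toPreAdm.mass_le hK z) ?_).trans_eq (by ring)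
      intro lam hlam
      refine (hX.sum_cap_le hA hα hK hKR hM hB c q hlam ((Finset.filter_subset _ _).trans hZ)
        (hinj.mono (by exact_mod_cast Finset.filter_subset _ _))
        fun z hz => (Finset.mem_filter.1 hz).2).trans_eq ?_
      rw [Real.div_rpow (by positivity) hlam.le, Real.rpow_neg hlam.le, hH]
      field_simp) Ω
  calc _ ≤ K ^ ((n + 1) * (1 - a)) * (a / (a - θ) * H * ((4 * K) ^ (n + 1)) ^ (a - θ) * X.energy) := by
        gcongr
    _ ≤ K ^ ((n + 1) * (1 - a)) * (a / (a - θ) * ((2 * A + 4) ^ n * (4 * K)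
          * (M * (c₀ * ((2 + A) * K) ^ α) ^ θ * ((1 + A) * R / K) ^ n))
          * ((4 * K) ^ (n + 1)) ^ (a - θ) * X.energy) := by
        rw [hH]; gcongr; linarith
    _ = _ := by
        have e1 : (c₀ * ((2 + A) * K) ^ α) ^ θ = c₀ ^ θ * ((2 + A) ^ α) ^ θ * K ^ (α * θ) := by
          rw [Real.mul_rpow (by positivity) (by positivity), Real.mul_rpow (by positivity) hK0.le,
            Real.mul_rpow (by positivity) (by positivity), Real.rpow_mul hK0.le]
          ring
        have e2 : ((4 * K) ^ (n + 1)) ^ (a - θ)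
            = ((4 : ℝ) ^ (n + 1)) ^ (a - θ) * K ^ ((n + 1) * (a - θ)) := by
          rw [mul_pow, Real.mul_rpow (by positivity) (by positivity), Real.rpow_mul hK0.le]
          congr 2
          exact_mod_cast (Real.rpow_natCast K (n + 1)).symm
        have e3 : K ^ (2 - θ * (n + 1 - α)) = K ^ ((n + 1) * (1 - a)) * K * K ^ (α * θ)
            * K ^ (-n : ℝ) * K ^ ((n + 1) * (a - θ)) := by
          nth_rewrite 3 [← Real.rpow_one K]
          rw [← Real.rpow_add hK0, ← Real.rpow_add hK0, ← Real.rpow_add hK0, ← Real.rpow_add hK0]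
          congr 1
          ring
        have e4 : ((1 + A) * R / K) ^ n = (1 + A) ^ n * R ^ n * K ^ (-n : ℝ) := by
          rw [div_pow, mul_pow, Real.rpow_neg hK0.le, Real.rpow_natCast, div_eq_mul_inv]
        rw [e1, e2, e3, e4]
        ring

/-- The estimate for the sum of averages over caps at the final scale. -/
lemma Adm.final_le (n : ℕ) {a A₀ : ℝ} (hA : 1 ≤ A) (hA₀ : 0 ≤ A₀) (ha : 0 ≤ a) :
    ∃ C : ℝ, 0 < C ∧ ∀ (X : Cfg n) (c₀ R T : ℝ), X.Adm A A₀ α c₀ R T → 1 ≤ T →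
      ∀ Z ⊆ X.P, Set.InjOn (fun x => cell T (X.pos x)) Z →
      ∀ (Ω : Measure (SpaceTime n)) [IsProbabilityMeasure Ω],
      T ^ n * ∑ z ∈ Z, X.mass T z ^ a * X.W.capSum X.c T X.s Ω (X.pos z)
        ≤ C * (c₀ * T ^ α) ^ a * R ^ n * X.energy := by
  classical
  obtain ⟨C₁, hC₁, htriv⟩ := PreAdm.total_le (n := n) hA hA₀
  refine ⟨(2 * A + 4) ^ n * 4 * (C₁ * 2) * (1 + A) ^ n + 1, by positivity, ?_⟩
  intro X c₀ R T hX hT Z hZ hinj Ω _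
  have hT0 : 0 < T := by linarith
  have hc₀ := hX.one_le_c
  have hR := hX.one_le
  have hE := X.energy_nonneg
  set N := (2 * A + 4) ^ n * 4 with hN
  have hN0 : 0 < N := by positivity
  have h := sum_capSum_le (K := T) Z (fun z => X.mass T z ^ a)
    (H := (c₀ * T ^ α) ^ a * (N * (C₁ * 2 * ((1 + A) * R / T) ^ n))) (fun c q => ?_) Ω
  · calc _ ≤ T ^ n * ((c₀ * T ^ α) ^ a * (N * (C₁ * 2 * ((1 + A) * R / T) ^ n)) * X.energy) := by
          gcongr
      _ = N * (C₁ * 2) * (1 + A) ^ n * (c₀ * T ^ α) ^ a * R ^ n * X.energy := by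
          rw [div_pow, mul_pow]; field_simp
      _ ≤ _ := by gcongr; linarith
  · set I := X.s.filter fun k => X.W.cap T k = q with hI
    have hsum : ∑ z ∈ Z, ‖X.W.wave c I (X.pos z)‖ ^ 2
        ≤ N * (C₁ * 2 * ((1 + A) * R / T) ^ n) * ∑ k ∈ I, ‖c k‖ ^ 2 := by
      rcases I.eq_empty_or_nonempty with h | ⟨k₀, hk₀⟩
      · rw [h]; simp [WaveFamily.wave]
      obtain ⟨hk₀s, hk₀q⟩ := Finset.mem_filter.1 hk₀
      have hpre := hX.toPreAdm.rescale hA hT hX.le hX.le hk₀s (Finset.filter_subset _ _)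
        (I := I) (fun k hk => ((Finset.mem_filter.1 hk).2).trans hk₀q.symm) hZ hinj
        (Nv := 4) (by norm_num) (fun u J hJ _ => by
          refine ⟨J.image fun z => (cell T (X.pos z)).2,
            fun x hx => Finset.mem_image_of_mem _ hx, ?_⟩
          refine (card_le_of_floor (a := 0) zero_le_one fun t ht => ?_).trans_eq (by norm_num)
          obtain ⟨z, hz, rfl⟩ := Finset.mem_image.1 ht
          refine ⟨_, ?_, rfl⟩
          rw [sub_zero, abs_div, abs_of_pos hT0, div_le_one hT0]
          exact hX.pos_snd z (hZ (hJ hz))) c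
      have h1 := htriv _ _ _ (by positivity) hpre
      rw [total_rescale hT0.ne', inv_mul_le_iff₀ hN0] at h1
      refine h1.trans ?_
      have h2 : 1 + T / T ^ 2 ≤ 2 := by
        have : T / T ^ 2 ≤ 1 := by
          rw [div_le_one (by positivity)]; nlinarith
        linarith
      have h3 : (0 : ℝ) ≤ (X.rescale T k₀ c I Z N⁻¹).energy := energy_nonneg _
      calc N * (C₁ * (1 + T / T ^ 2) * ((1 + A) * R / T) ^ n * (X.rescale T k₀ c I Z N⁻¹).energy)
          ≤ N * (C₁ * 2 * ((1 + A) * R / T) ^ n * (X.rescale T k₀ c I Z N⁻¹).energy) := by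
            gcongr
        _ = _ := (mul_assoc _ _ _).symm
    calc ∑ z ∈ Z, X.mass T z ^ a * ‖X.W.wave c I (X.pos z)‖ ^ 2
        ≤ ∑ z ∈ Z, (c₀ * T ^ α) ^ a * ‖X.W.wave c I (X.pos z)‖ ^ 2 := by
          gcongr with z hz
          · exact hX.mass_nonneg z
          · exact hX.mass_le hT z
      _ = (c₀ * T ^ α) ^ a * ∑ z ∈ Z, ‖X.W.wave c I (X.pos z)‖ ^ 2 := (Finset.mul_sum _ _ _).symm
      _ ≤ _ := by
          rw [mul_assoc]
          gcongr

/-- A set of points representing every cell exactly once. -/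
lemma exists_representatives (X : Cfg n) (K : ℝ) (P' : Finset X.π) :
    ∃ Z ⊆ P', Set.InjOn (fun x => cell K (X.pos x)) Z ∧
      ∀ f : X.π → ℝ, ∑ x ∈ P', f x
        = open Classical in ∑ z ∈ Z, ∑ x ∈ P' with cell K (X.pos x) = cell K (X.pos z), f x := by
  classical
  obtain ⟨Z, hZ, hinj, himg⟩ := Finset.exists_subset_injOn_image_eq_of_surjOn P'
    (P'.image fun x => cell K (X.pos x)) (f := fun x => cell K (X.pos x)) (by
      rw [Finset.coe_image]; exact Set.surjOn_image _ _)
  refine ⟨Z, hZ, hinj, fun f => ?_⟩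
  rw [← Finset.sum_fiberwise_of_maps_to (g := fun x => cell K (X.pos x))
    (t := P'.image fun x => cell K (X.pos x)) (fun x hx => Finset.mem_image_of_mem _ hx) f,
    ← himg, Finset.sum_image hinj]

end Cfg

namespace WaveFamily

variable {n : ℕ} {κ : Type} {W : WaveFamily n κ} {A : ℝ} {s : Finset κ}

lemma cap_eq_of_cap_mul_eq {K : ℝ} {m : ℕ} (hm : 0 < m) {k l : κ}
    (h : W.cap (m * K) k = W.cap (m * K) l) : W.cap K k = W.cap K l := by
  have key : ∀ k : κ, ∀ i, W.cap K k i = W.cap (m * K) k i / m := by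
    intro k i
    unfold cap
    rw [← Int.floor_div_natCast]
    congr 1
    field_simp
  funext i
  rw [key, key, h]

lemma IsConv.card_image_cap_le (h : W.IsConv A s) {K : ℝ} (hK : 0 ≤ K) :
    ((s.image (W.cap K)).card : ℝ) ≤ (2 * K + 2) ^ n := by
  refine card_le_of_floor_pi (a := fun _ => 0) hK fun t ht i => ?_
  obtain ⟨k, hk, rfl⟩ := Finset.mem_image.1 ht
  refine ⟨_, ?_, rfl⟩
  rw [sub_zero, abs_mul, abs_of_nonneg hK]
  have h1 := (norm_le_pi_norm (W.y k) i).trans (h.norm_y_le k hk)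
  rw [Real.norm_eq_abs] at h1
  nlinarith

/-- The loss when averages of waves are moved by distance `K`. -/
noncomputable def shiftConst (n : ℕ) (A K : ℝ) : ℝ :=
  (4000 * (1 + (K * (2 * freqConst n A)) ^ 2)) ^ (n + 1)

lemma shiftConst_pos (A K : ℝ) : 0 < shiftConst n A K := by unfold shiftConst; positivity

/-- Averaging at unit scale. -/
noncomputable def smear (n : ℕ) (A : ℝ) (Ω : Measure (SpaceTime n)) : Measure (SpaceTime n) :=
  convMeasure (coordMeasure n (1 / (2 * freqConst n A))) Ω

instance (A : ℝ) (Ω : Measure (SpaceTime n)) [IsProbabilityMeasure Ω] :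
    IsProbabilityMeasure (smear n A Ω) := by
  unfold smear; infer_instance

lemma IsConv.average_le_smear (h : W.IsConv A s) (hA : 1 ≤ A) {I : Finset κ} (hI : I ⊆ s)
    (c : κ → ℂ) (Ω : Measure (SpaceTime n)) [IsProbabilityMeasure Ω] {K : ℝ} {x z : SpaceTime n}
    (hxz : ‖x - z‖ ≤ K) :
    ∫ v, ‖W.wave c I (x + v)‖ ^ 2 ∂Ω
      ≤ shiftConst n A K * ∫ v, ‖W.wave c I (z + v)‖ ^ 2 ∂smear n A Ω := by
  have hC : 0 < freqConst n A := by linarith [freqConst_ge_one (n := n) (A := A) (by linarith)]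
  unfold smear
  rw [← average_average_wave]
  refine (isNTP_average_wave (W := W) c I Ω).le_coord_average (by positivity)
    (freq_sub_norm_mul_le h hA hI) ?_
  rwa [mul_assoc, mul_one_div_cancel (by positivity), mul_one]

lemma integrable_wave_sq (c : κ → ℂ) (I : Finset κ) (Ω : Measure (SpaceTime n))
    [IsProbabilityMeasure Ω] (z : SpaceTime n) :
    Integrable (fun v => ‖W.wave c I (z + v)‖ ^ 2) Ω := by
  have hN := isNTP_wave_sq (W := W) c I
  have hc := hN.continuous
  obtain ⟨B, hB⟩ := hN.bounded
  refine Integrable.of_bound (C := B) (hc.comp (continuous_const.add continuous_id)).aestronglyMeasurable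
    (Eventually.of_forall fun v => ?_)
  rw [Real.norm_of_nonneg (hN.nonneg _)]
  exact hB _

/-- One of the caps carries a large portion of the average, uniformly near `z`. -/
lemma IsConv.exists_large_cap (h : W.IsConv A s) (hA : 1 ≤ A) {I : Finset κ} (hI : I ⊆ s)
    (hne : I.Nonempty) (c : κ → ℂ) (Ω : Measure (SpaceTime n)) [IsProbabilityMeasure Ω]
    {K K' N : ℝ} (hN : ((s.image (W.cap K')).card : ℝ) ≤ N)
    (hcap : ∀ k ∈ I, ∀ l ∈ s, W.cap K' l = W.cap K' k → l ∈ I) (z : SpaceTime n) :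
    ∃ k ∈ I, ∀ x, ‖x - z‖ ≤ K → ∫ v, ‖W.wave c I (x + v)‖ ^ 2 ∂Ω
      ≤ N ^ 2 * shiftConst n A K ^ 2
        * ∫ v, ‖W.wave c (s.filter fun l => W.cap K' l = W.cap K' k) (x + v)‖ ^ 2
          ∂smear n A (smear n A Ω) := by
  classical
  set F : (Fin n → ℤ) → Finset κ := fun q => s.filter fun l => W.cap K' l = q with hF
  obtain ⟨k, hk, hmax⟩ := Finset.exists_max_image I
    (fun k => ∫ v, ‖W.wave c (F (W.cap K' k)) (z + v)‖ ^ 2 ∂smear n A Ω) hne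
  refine ⟨k, hk, fun x hx => ?_⟩
  set H := ∫ v, ‖W.wave c (F (W.cap K' k)) (z + v)‖ ^ 2 ∂smear n A Ω with hH
  have hS := shiftConst_pos (n := n) A K
  set S := shiftConst n A K with hSdef
  have hH0 : 0 ≤ H := integral_nonneg fun _ => by positivity
  set J := I.image (W.cap K') with hJ
  have hJN : (J.card : ℝ) ≤ N :=
    le_trans (by exact_mod_cast Finset.card_le_card (Finset.image_subset_image hI)) hN
  have h1 : ∀ v, ‖W.wave c I (x + v)‖ ^ 2 ≤ J.card * ∑ q ∈ J, ‖W.wave c (F q) (x + v)‖ ^ 2 := by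
    intro v
    rw [wave_fiberwise c I (W.cap K') (J := J) (fun k hk => Finset.mem_image_of_mem _ hk)]
    have e : ∀ q ∈ J, I.filter (fun l => W.cap K' l = q) = F q := by
      intro q hq
      obtain ⟨k', hk', rfl⟩ := Finset.mem_image.1 hq
      ext l
      simp only [hF, Finset.mem_filter]
      exact ⟨fun hl => ⟨hI hl.1, hl.2⟩, fun hl => ⟨hcap k' hk' l hl.1 hl.2, hl.2⟩⟩
    calc ‖∑ q ∈ J, W.wave c (I.filter fun l => W.cap K' l = q) (x + v)‖ ^ 2
        ≤ (∑ q ∈ J, ‖W.wave c (F q) (x + v)‖) ^ 2 := by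
          gcongr
          refine (norm_sum_le _ _).trans (le_of_eq (Finset.sum_congr rfl fun q hq => ?_))
          rw [e q hq]
      _ ≤ _ := sq_sum_le_card_mul_sum_sq
  calc ∫ v, ‖W.wave c I (x + v)‖ ^ 2 ∂Ω
      ≤ ∫ v, (J.card : ℝ) * ∑ q ∈ J, ‖W.wave c (F q) (x + v)‖ ^ 2 ∂Ω :=
        integral_mono (integrable_wave_sq c I Ω x)
          ((integrable_finsetSum _ fun q _ => integrable_wave_sq c (F q) Ω x).const_mul _) h1
    _ = J.card * ∑ q ∈ J, ∫ v, ‖W.wave c (F q) (x + v)‖ ^ 2 ∂Ω := by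
        rw [integral_const_mul, integral_finsetSum _ fun q _ => integrable_wave_sq c (F q) Ω x]
    _ ≤ J.card * ∑ _q ∈ J, S * H := by
        gcongr with q hq
        obtain ⟨k', hk', rfl⟩ := Finset.mem_image.1 hq
        refine (h.average_le_smear hA (Finset.filter_subset _ _) c Ω hx).trans ?_
        exact mul_le_mul_of_nonneg_left (hmax k' hk') hS.le
    _ = (J.card : ℝ) ^ 2 * (S * H) := by rw [Finset.sum_const, nsmul_eq_mul]; ring
    _ ≤ N ^ 2 * (S * (S * ∫ v, ‖W.wave c (F (W.cap K' k)) (x + v)‖ ^ 2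
          ∂smear n A (smear n A Ω))) := by
        gcongr
        refine h.average_le_smear hA (Finset.filter_subset _ _) c (smear n A Ω) ?_
        rwa [norm_sub_rev]
    _ = _ := by ring

/-- Quantitative independence of the normals over a tuple of caps. -/
def IsGood (W : WaveFamily n κ) (s : Finset κ) (K A' : ℝ) {j : ℕ} (Q : Fin j → Fin n → ℤ) : Prop :=
  ∀ k : Fin j → κ, (∀ i, k i ∈ s ∧ W.cap K (k i) = Q i) → IsIndep A' fun i => W.normal (k i)

/-- The point `k` lies in a cap of side `1 / K` whose normals come close to the span of `v`. -/
def IsNear (W : WaveFamily n κ) (s : Finset κ) (K : ℝ) {j : ℕ} (v : Fin j → SpaceTime n)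
    (k : κ) : Prop :=
  ∃ l ∈ s, W.cap K l = W.cap K k ∧ ∃ b : Fin j → ℝ, ‖W.normal l - ∑ i, b i • v i‖ ≤ 1 / K

open Classical in
/-- The part of a cap lying near the span of `v`. -/
noncomputable def nearSet (W : WaveFamily n κ) (s : Finset κ) (K₀ K : ℝ) {j : ℕ}
    (v : Fin j → SpaceTime n) (q : Fin n → ℤ) : Finset κ :=
  (s.filter fun k => W.cap K₀ k = q).filter fun k => W.IsNear s K v k

/-- The constant of independence at the next stage. -/
noncomputable def nextConst (A A' K : ℝ) : ℝ := 2 * (A' * (1 + K * A) + K)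

/-- Either the waves near the span of `j` normals dominate, or `j + 1` independent caps do. -/
lemma IsConv.near_or_far (h : W.IsConv A s) (hA : 1 ≤ A) {A' K₀ K K' N : ℝ} (hA' : 0 ≤ A')
    (hK : 0 < K) {m₁ m₂ : ℕ} (hm₁ : 0 < m₁) (hm₂ : 0 < m₂) (hKm : K = m₁ * K₀)
    (hK'm : K' = m₂ * K) (hK'A : nextConst A A' K * (A / K') ≤ 1)
    (hN : ((s.image (W.cap K')).card : ℝ) ≤ N) {j : ℕ} {Q : Fin j → Fin n → ℤ}
    (hQ : W.IsGood s K₀ A' Q) (hne : ∀ i, ∃ k ∈ s, W.cap K₀ k = Q i)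
    (Ω : Measure (SpaceTime n)) [IsProbabilityMeasure Ω] (c : κ → ℂ) (z : SpaceTime n) :
    ∃ a : Fin j → κ, (∀ i, a i ∈ s ∧ W.cap K₀ (a i) = Q i) ∧ ∀ (x : SpaceTime n) (Θ : ℝ), 0 ≤ Θ →
      ‖x - z‖ ≤ K →
      (∀ i, ‖W.wave c s x‖ ^ 2
        ≤ Θ * ∫ v, ‖W.wave c (s.filter fun k => W.cap K₀ k = Q i) (x + v)‖ ^ 2 ∂Ω) →
      (∀ i, ∫ v, ‖W.wave c (s.filter fun k => W.cap K₀ k = Q i) (x + v)‖ ^ 2 ∂Ω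
        ≤ 4 * ∫ v, ‖W.wave c (W.nearSet s K₀ K (fun i => W.normal (a i)) (Q i)) (x + v)‖ ^ 2 ∂Ω) ∨
      ∃ Q' : Fin (j + 1) → Fin n → ℤ, (∀ i, Q' i ∈ s.image (W.cap K')) ∧
        W.IsGood s K' (nextConst A A' K) Q' ∧ ∀ i, ‖W.wave c s x‖ ^ 2
          ≤ Θ * (4 * (N ^ 2 * shiftConst n A K ^ 2))
            * ∫ v, ‖W.wave c (s.filter fun k => W.cap K' k = Q' i) (x + v)‖ ^ 2
              ∂smear n A (smear n A Ω) := by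
  classical
  have hK'0 : 0 < K' := by rw [hK'm]; positivity
  have href : ∀ k l, W.cap K' k = W.cap K' l → W.cap K k = W.cap K l := fun k l hkl =>
    cap_eq_of_cap_mul_eq hm₂ (by rw [← hK'm]; exact hkl)
  have href₀ : ∀ k l, W.cap K k = W.cap K l → W.cap K₀ k = W.cap K₀ l := fun k l hkl =>
    cap_eq_of_cap_mul_eq hm₁ (by rw [← hKm]; exact hkl)
  set S2 := N ^ 2 * shiftConst n A K ^ 2 with hS2
  have hS20 : 0 ≤ S2 := by positivity
  choose a ha hamax using fun i => h.exists_large_cap hA (I := s.filter fun k => W.cap K₀ k = Q i)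
    (Finset.filter_subset _ _) (by
      obtain ⟨k, hk, hkq⟩ := hne i
      exact ⟨k, Finset.mem_filter.2 ⟨hk, hkq⟩⟩) c Ω (K := K) hN
    (fun k hk l hl hlk => Finset.mem_filter.2 ⟨hl, (href₀ _ _ (href _ _ hlk)).trans
      (Finset.mem_filter.1 hk).2⟩) z
  have ha' : ∀ i, a i ∈ s ∧ W.cap K₀ (a i) = Q i := fun i => Finset.mem_filter.1 (ha i)
  set v : Fin j → SpaceTime n := fun i => W.normal (a i) with hv
  have hvind : IsIndep A' v := hQ a ha'
  refine ⟨a, ha', ?_⟩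
  set far : Fin j → Finset κ := fun i =>
    (s.filter fun k => W.cap K₀ k = Q i).filter fun k => ¬ W.IsNear s K v k with hfar
  have hfars : ∀ i, far i ⊆ s := fun i => (Finset.filter_subset _ _).trans (Finset.filter_subset _ _)
  have hfarcap : ∀ i, ∀ k ∈ far i, ∀ l ∈ s, W.cap K' l = W.cap K' k → l ∈ far i := by
    intro i k hk l hl hlk
    obtain ⟨hk1, hk2⟩ := Finset.mem_filter.1 hk
    refine Finset.mem_filter.2 ⟨Finset.mem_filter.2 ⟨hl, (href₀ _ _ (href _ _ hlk)).trans
      (Finset.mem_filter.1 hk1).2⟩, fun hn => hk2 ?_⟩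
    obtain ⟨l', hl', hll, hb⟩ := hn
    exact ⟨l', hl', hll.trans (href _ _ hlk), hb⟩
  have hlarge : ∀ i, ∃ k : κ, (far i).Nonempty → k ∈ far i ∧ ∀ x, ‖x - z‖ ≤ K →
      ∫ v, ‖W.wave c (far i) (x + v)‖ ^ 2 ∂Ω ≤ S2
        * ∫ v, ‖W.wave c (s.filter fun l => W.cap K' l = W.cap K' k) (x + v)‖ ^ 2
          ∂smear n A (smear n A Ω) := by
    intro i
    by_cases hi : (far i).Nonempty
    · obtain ⟨k, hk, hk'⟩ := h.exists_large_cap hA (hfars i) hi c Ω (K := K) hN (hfarcap i) z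
      exact ⟨k, fun _ => ⟨hk, hk'⟩⟩
    · exact ⟨a i, fun hi' => absurd hi' hi⟩
  choose b hb using hlarge
  intro x Θ hΘ hx hxQ
  by_cases hnear : ∀ i, ∫ v, ‖W.wave c (s.filter fun k => W.cap K₀ k = Q i) (x + v)‖ ^ 2 ∂Ω
        ≤ 4 * ∫ u, ‖W.wave c (W.nearSet s K₀ K v (Q i)) (x + u)‖ ^ 2 ∂Ω
  · exact Or.inl hnear
  right
  push Not at hnear
  obtain ⟨i, hi⟩ := hnear
  have hsplit : ∫ v, ‖W.wave c (s.filter fun k => W.cap K₀ k = Q i) (x + v)‖ ^ 2 ∂Ω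
      ≤ 2 * ∫ u, ‖W.wave c (W.nearSet s K₀ K v (Q i)) (x + u)‖ ^ 2 ∂Ω
        + 2 * ∫ u, ‖W.wave c (far i) (x + u)‖ ^ 2 ∂Ω := by
    rw [← integral_const_mul, ← integral_const_mul, ← integral_add
      ((integrable_wave_sq c _ Ω x).const_mul _) ((integrable_wave_sq c _ Ω x).const_mul _)]
    refine integral_mono (integrable_wave_sq c _ Ω x) (((integrable_wave_sq c _ Ω x).const_mul _).add
      ((integrable_wave_sq c _ Ω x).const_mul _)) fun u => ?_
    have e : W.wave c (s.filter fun k => W.cap K₀ k = Q i) (x + u)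
        = W.wave c (W.nearSet s K₀ K v (Q i)) (x + u) + W.wave c (far i) (x + u) :=
      (Finset.sum_filter_add_sum_filter_not _ _ _).symm
    simp only [e]
    have h1 := norm_add_le (W.wave c (W.nearSet s K₀ K v (Q i)) (x + u)) (W.wave c (far i) (x + u))
    have h2 := sq_nonneg (‖W.wave c (W.nearSet s K₀ K v (Q i)) (x + u)‖ - ‖W.wave c (far i) (x + u)‖)
    nlinarith [norm_nonneg (W.wave c (W.nearSet s K₀ K v (Q i)) (x + u) + W.wave c (far i) (x + u))]
  have hfari : ∫ v, ‖W.wave c (s.filter fun k => W.cap K₀ k = Q i) (x + v)‖ ^ 2 ∂Ω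
      ≤ 4 * ∫ u, ‖W.wave c (far i) (x + u)‖ ^ 2 ∂Ω := by linarith
  have hfne : (far i).Nonempty := by
    rw [Finset.nonempty_iff_ne_empty]
    intro he
    have h0 : 0 ≤ ∫ u, ‖W.wave c (W.nearSet s K₀ K v (Q i)) (x + u)‖ ^ 2 ∂Ω :=
      integral_nonneg fun _ => by positivity
    rw [he] at hsplit
    simp only [wave, Finset.sum_empty, norm_zero, ne_eq, OfNat.ofNat_ne_zero, not_false_eq_true,
      zero_pow, integral_zero, mul_zero, add_zero] at hsplit hi h0
    linarith
  obtain ⟨hbf, hblarge⟩ := hb i hfne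
  have hbs : b i ∈ s := hfars i hbf
  refine ⟨Fin.snoc (fun l => W.cap K' (a l)) (W.cap K' (b i)), ?_, ?_, ?_⟩
  · intro l
    refine Fin.lastCases ?_ (fun l => ?_) l
    · simpa only [Fin.snoc_last] using Finset.mem_image_of_mem _ hbs
    · simpa only [Fin.snoc_castSucc] using Finset.mem_image_of_mem _ (ha' l).1
  · intro k hk
    have hlast := hk (Fin.last j)
    simp only [Fin.snoc_last] at hlast
    have hkfar := hfarcap i _ hbf _ hlast.1 hlast.2
    have hnot := (Finset.mem_filter.1 hkfar).2
    have hind := hvind.snoc hA' hK (h.norm_normal_le hA hlast.1) fun b' => by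
      by_contra hc
      exact hnot ⟨_, hlast.1, rfl, b', (not_le.1 hc).le⟩
    refine hind.perturb (δ := A / K') (by positivity) (by
      unfold nextConst at hK'A; exact hK'A) fun l => ?_
    refine Fin.lastCases ?_ (fun l => ?_) l
    · simp only [Fin.snoc_last, sub_self, norm_zero]; positivity
    · have hkl := hk l.castSucc
      simp only [Fin.snoc_castSucc] at hkl ⊢
      rw [hv, norm_normal_sub]
      refine (h.norm_p_sub_le _ (ha' l).1 _ hkl.1).trans ?_
      rw [div_eq_mul_one_div]
      gcongr
      exact W.norm_y_sub_le_of_cap_eq hK'0 hkl.2.symm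
  · intro l
    refine Fin.lastCases ?_ (fun l => ?_) l
    · simp only [Fin.snoc_last]
      calc ‖W.wave c s x‖ ^ 2 ≤ Θ * (4 * (S2 * _)) :=
            (hxQ i).trans (mul_le_mul_of_nonneg_left (hfari.trans
              (mul_le_mul_of_nonneg_left (hblarge x hx) (by norm_num))) hΘ)
        _ = _ := by ring
    · simp only [Fin.snoc_castSucc]
      have h0 : 0 ≤ ∫ u, ‖W.wave c (s.filter fun k => W.cap K' k = W.cap K' (a l)) (x + u)‖ ^ 2
          ∂smear n A (smear n A Ω) := integral_nonneg fun _ => by positivity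
      calc ‖W.wave c s x‖ ^ 2 ≤ Θ * (S2 * _) :=
            (hxQ l).trans (mul_le_mul_of_nonneg_left (hamax l x hx) hΘ)
        _ ≤ Θ * (4 * (S2 * _)) := by
            refine mul_le_mul_of_nonneg_left ?_ hΘ
            linarith [mul_nonneg hS20 h0]
        _ = _ := by ring

lemma capSum_le_of_saturated (c : κ → ℂ) (K : ℝ) {I : Finset κ} (hI : I ⊆ s)
    (hsat : ∀ k ∈ I, ∀ l ∈ s, W.cap K l = W.cap K k → l ∈ I) (Ω : Measure (SpaceTime n))
    (z : SpaceTime n) : W.capSum c K I Ω z ≤ W.capSum c K s Ω z := by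
  classical
  unfold capSum
  have h1 : ∀ q ∈ I.image (W.cap K), (I.filter fun k => W.cap K k = q)
      = s.filter fun k => W.cap K k = q := by
    intro q hq
    obtain ⟨k, hk, rfl⟩ := Finset.mem_image.1 hq
    ext l
    simp only [Finset.mem_filter]
    exact ⟨fun h => ⟨hI h.1, h.2⟩, fun h => ⟨hsat k hk l h.1 h.2, h.2⟩⟩
  rw [Finset.sum_congr rfl fun q hq => by rw [h1 q hq]]
  exact Finset.sum_le_sum_of_subset_of_nonneg (Finset.image_subset_image hI)
    fun _ _ _ => integral_nonneg fun _ => by positivity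

end WaveFamily

namespace Cfg

variable {n : ℕ}

/-- The multilinear estimate at scale `D ^ e`, summed over the cells. -/
lemma exists_sum_cells_le (n : ℕ) {A A' : ℝ} (hA : 1 ≤ A) (hA' : 0 ≤ A') {j : ℕ} (hj : 1 ≤ j)
    (D : ℕ) (hD : 2 ≤ D) : ∃ B : ℝ, 0 < B ∧ ∃ f₀ : ℕ, ∀ f ≥ f₀, ∀ e : ℕ,
    ∀ (X : Cfg n) (A₀ R T : ℝ), X.PreAdm A A₀ R T → ∀ Q : Fin j → Fin n → ℤ,
    X.W.IsGood X.s ((D : ℝ) ^ f) A' Q → (∀ i, ∃ k ∈ X.s, X.W.cap ((D : ℝ) ^ f) k = Q i) →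
    ∀ (Ω₀ : Measure (SpaceTime n)) [IsProbabilityMeasure Ω₀],
    ∃ Ω : Measure (SpaceTime n), IsProbabilityMeasure Ω ∧
    ∀ Z ⊆ X.P, ∀ I : X.π → Fin j → Finset X.κ,
      (∀ z ∈ Z, ∃ a : Fin j → X.κ, (∀ i, a i ∈ X.s ∧ X.W.cap ((D : ℝ) ^ f) (a i) = Q i) ∧
        ∀ i, ∀ k ∈ I z i, k ∈ X.s ∧ X.W.cap ((D : ℝ) ^ f) k = Q i ∧
          (∃ b : Fin j → ℝ, ‖X.W.normal k - ∑ l, b l • X.W.normal (a l)‖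
            ≤ (1 + A) / (D : ℝ) ^ e) ∧
          ∀ l ∈ X.s, X.W.cap ((D : ℝ) ^ e) l = X.W.cap ((D : ℝ) ^ e) k → l ∈ I z i) →
      ∀ P' : X.π → Finset X.π, (∀ z ∈ Z, P' z ⊆ X.P) →
      (∀ z ∈ Z, ∀ x ∈ P' z, cell ((D : ℝ) ^ e) (X.pos x) = cell ((D : ℝ) ^ e) (X.pos z)) →
      ∑ z ∈ Z, ∑ x ∈ P' z, X.wt x
          * ∏ i, (∫ v, ‖X.W.wave X.c (I z i) (X.pos x + v)‖ ^ 2 ∂Ω₀) ^ (1 / j : ℝ)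
        ≤ B * WaveFamily.mlReal (Fin j) ^ (e + 1) * (((D : ℝ) ^ e) ^ ((n + 1) * (1 - 1 / j) : ℝ)
          * ∑ z ∈ Z, X.mass ((D : ℝ) ^ e) z ^ (1 / j : ℝ)
            * X.W.capSum X.c ((D : ℝ) ^ e) X.s Ω (X.pos z)) := by
  classical
  have hCs := WaveFamily.sepConst_nonneg (n := n) hA hA' (C₁ := 1 + A) (by linarith)
  set Cs := WaveFamily.sepConst n A A' (1 + A) with hCs'
  obtain ⟨B, hB, hlev⟩ := WaveFamily.level_bound (n := n) (A := A) (ι := Fin j)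
    (by simpa using hj) D hD hA hCs
  have hD1 : (1 : ℝ) < D := by exact_mod_cast hD
  have hFC := WaveFamily.freqConst_ge_one (n := n) (A := A) (by linarith)
  obtain ⟨f₀, hf₀⟩ := ((tendsto_pow_atTop_atTop_of_one_lt hD1).eventually_ge_atTop
    (A + A' * A * WaveFamily.freqConst n A * A * A + (2 + n) * A * Cs * D)).exists
  have hn0 : (0 : ℝ) ≤ n := Nat.cast_nonneg n
  have t1 : 0 ≤ A' * A * WaveFamily.freqConst n A * A * A := by positivity
  have t2 : 0 ≤ (2 + n) * A * Cs * D := by positivity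
  refine ⟨B * j, by positivity, f₀, ?_⟩
  intro f hf e X A₀ R T hX Q hQ hne Ω₀ _
  choose b hbs hbQ using hne
  have hf1 : A + A' * A * WaveFamily.freqConst n A * A * A + (2 + n) * A * Cs * D ≤ (D : ℝ) ^ f :=
    hf₀.trans (pow_le_pow_right₀ hD1.le hf)
  have hDf : (0 : ℝ) < (D : ℝ) ^ f := by positivity
  obtain ⟨Ω, hΩ, hlev⟩ := hlev e (fun i => X.W.normal (b i))
    (fun i => hX.conv.norm_normal_le hA (hbs i)) Ω₀
  refine ⟨Ω, hΩ, ?_⟩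
  intro Z hZ I hI P' hP' hcell
  have hcap : ∀ k l, X.W.cap ((D : ℝ) ^ f) k = X.W.cap ((D : ℝ) ^ f) l →
      ‖X.W.y k - X.W.y l‖ ≤ 1 / (D : ℝ) ^ f := fun k l => WaveFamily.norm_y_sub_le_of_cap_eq hDf
  have hmain : ∀ z ∈ Z, ∑ x ∈ P' z, X.wt x
          * ∏ i, (∫ v, ‖X.W.wave X.c (I z i) (X.pos x + v)‖ ^ 2 ∂Ω₀) ^ (1 / j : ℝ)
      ≤ B * WaveFamily.mlReal (Fin j) ^ (e + 1) * X.mass ((D : ℝ) ^ e) z ^ (1 / j : ℝ)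
        * ((D : ℝ) ^ e) ^ ((n + 1) * (1 - 1 / j) : ℝ)
        * (j * X.W.capSum X.c ((D : ℝ) ^ e) X.s Ω (X.pos z)) := by
    intro z hz
    obtain ⟨a, ha, hIa⟩ := hI z hz
    have htr := hX.conv.isTransversal (δ := 1 / (D : ℝ) ^ f) hA (I := I z) hA' (by linarith : 0 ≤ 1 + A)
      (by positivity) (by rw [mul_one_div, div_le_one hDf]; linarith)
      (by
        rw [← one_div, mul_one_div, ← mul_div_assoc, div_le_div_iff₀ hDf (by linarith)]
        nlinarith) (hQ a ha) hbs
      (fun i => by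
        rw [WaveFamily.norm_normal_sub]
        refine (hX.conv.norm_p_sub_le _ (ha i).1 _ (hbs i)).trans
          (mul_le_mul_of_nonneg_left (hcap _ _ ((ha i).2.trans (hbQ i).symm)) (by linarith)))
      (K := (D : ℝ) ^ e) (by positivity) (fun i k hk => (hIa i k hk).1)
      (fun i k hk => hcap _ _ ((hIa i k hk).2.1.trans (hbQ i).symm))
      (fun i k hk => (hIa i k hk).2.2.1)
    have h1 := hlev X.κ X.W X.s hX.conv (I z) (fun i k hk => (hIa i k hk).1) _ (by positivity)
      (by
        rw [mul_one_div, div_mul_eq_mul_div, div_mul_eq_mul_div, div_le_one hDf]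
        linarith) htr X.c (X.pos z) X.π (P' z) X.pos X.wt
      (fun x hx => hX.wt_nonneg x (hP' z hz hx))
      (fun x hx => (norm_sub_le_of_cell_eq (by positivity) (hcell z hz x hx)).trans
        (by linarith [show (0 : ℝ) < (D : ℝ) ^ e by positivity]))
      (fun y => hX.unit y _ ((Finset.filter_subset _ _).trans (hP' z hz))
        fun x hx => (Finset.mem_filter.1 hx).2)
    rw [Fintype.card_fin] at h1
    refine h1.trans ?_
    have hml := WaveFamily.one_le_mlReal (Fin j)
    have hwt : ∑ x ∈ P' z, X.wt x ≤ X.mass ((D : ℝ) ^ e) z := by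
      unfold mass
      refine Finset.sum_le_sum_of_subset_of_nonneg (fun x hx => Finset.mem_filter.2
        ⟨hP' z hz hx, hcell z hz x hx⟩) fun x hx _ => hX.wt_nonneg x (Finset.mem_filter.1 hx).1
    have hwt0 : 0 ≤ ∑ x ∈ P' z, X.wt x :=
      Finset.sum_nonneg fun x hx => hX.wt_nonneg x (hP' z hz hx)
    have hsum : ∑ i, X.W.capSum X.c ((D : ℝ) ^ e) (I z i) Ω (X.pos z)
        ≤ j * X.W.capSum X.c ((D : ℝ) ^ e) X.s Ω (X.pos z) := by
      refine (Finset.sum_le_card_nsmul _ _ _ fun i _ => X.W.capSum_le_of_saturated X.c _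
        (fun k hk => (hIa i k hk).1) (fun k hk l hl h => (hIa i k hk).2.2.2 l hl h) Ω _).trans_eq ?_
      simp
    have hs0 : 0 ≤ ∑ i, X.W.capSum X.c ((D : ℝ) ^ e) (I z i) Ω (X.pos z) :=
      Finset.sum_nonneg fun i _ => X.W.capSum_nonneg _ _ _ _ _
    have hm0 := hwt0.trans hwt
    gcongr
  refine (Finset.sum_le_sum hmain).trans_eq ?_
  rw [Finset.mul_sum, Finset.mul_sum]
  exact Finset.sum_congr rfl fun z _ => by ring

end Cfg

lemma le_mul_prod_rpow {j : ℕ} (hj : 1 ≤ j) {u Θ : ℝ} (hu : 0 ≤ u) (hΘ : 0 ≤ Θ) {g : Fin j → ℝ}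
    (hg : ∀ i, 0 ≤ g i) (h : ∀ i, u ≤ Θ * g i) : u ≤ Θ * ∏ i, g i ^ (1 / j : ℝ) := by
  have hj0 : (j : ℝ) ≠ 0 := by positivity
  have key : ∀ w : ℝ, 0 ≤ w → ∏ _i : Fin j, w ^ (1 / j : ℝ) = w := by
    intro w hw
    rw [Finset.prod_const, Finset.card_univ, Fintype.card_fin, ← Real.rpow_natCast,
      ← Real.rpow_mul hw, one_div_mul_cancel hj0, Real.rpow_one]
  calc u = ∏ _i : Fin j, u ^ (1 / j : ℝ) := (key u hu).symm
    _ ≤ ∏ i : Fin j, (Θ * g i) ^ (1 / j : ℝ) := Finset.prod_le_prod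
        (fun i _ => by positivity) fun i _ => Real.rpow_le_rpow hu (h i) (by positivity)
    _ = _ := by
      rw [Finset.prod_congr rfl fun i _ => Real.mul_rpow hΘ (hg i), Finset.prod_mul_distrib, key Θ hΘ]

namespace Cfg

variable {n : ℕ}

open Classical in
/-- The points at which each cap of the tuple `Q` carries a portion of the superposition. -/
noncomputable def stageSet (X : Cfg n) (K Θ : ℝ) (Ω : Measure (SpaceTime n)) {j : ℕ}
    (Q : Fin j → Fin n → ℤ) : Finset X.π :=
  X.P.filter fun x => ∀ i, ‖X.W.wave X.c X.s (X.pos x)‖ ^ 2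
    ≤ Θ * ∫ v, ‖X.W.wave X.c (X.s.filter fun k => X.W.cap K k = Q i) (X.pos x + v)‖ ^ 2 ∂Ω

/-- The estimate for the part of the square sum over the points of a stage. -/
def StageBound (n : ℕ) (A A₀ α θ γ : ℝ) (D j : ℕ) (A' : ℝ) (f : ℕ) (Θ η E : ℝ) : Prop :=
  ∀ (t : ℕ) (M : ℝ), 0 ≤ M →
    (∀ t' < t, Bound n A A₀ α θ ((D : ℝ) ^ t') (M * ((D : ℝ) ^ t') ^ γ)) →
    ∀ (X : Cfg n) (c₀ R : ℝ), X.Adm A A₀ α c₀ R ((D : ℝ) ^ t) →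
    ∀ (Ω : Measure (SpaceTime n)) [IsProbabilityMeasure Ω] (Q : Fin j → Fin n → ℤ),
    X.W.IsGood X.s ((D : ℝ) ^ f) A' Q →
    ∑ x ∈ X.stageSet ((D : ℝ) ^ f) Θ Ω Q, X.wt x * ‖X.W.wave X.c X.s (X.pos x)‖ ^ 2
      ≤ (η * M + E) * ((D : ℝ) ^ t) ^ γ * c₀ ^ θ * R ^ n * X.energy

/-- The conclusion of a stage of the induction. -/
def StageClaim (n : ℕ) (A A₀ α θ γ : ℝ) (D j : ℕ) : Prop :=
  ∀ A', 0 ≤ A' → ∃ f₀ : ℕ, ∀ f ≥ f₀, ∀ Θ, 0 ≤ Θ → ∀ η, 0 < η →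
    ∃ E, 0 ≤ E ∧ StageBound n A A₀ α θ γ D j A' f Θ η E

lemma stageSet_subset (X : Cfg n) (K Θ : ℝ) (Ω : Measure (SpaceTime n)) {j : ℕ}
    (Q : Fin j → Fin n → ℤ) : X.stageSet K Θ Ω Q ⊆ X.P := by
  classical
  exact Finset.filter_subset _ _

lemma mem_stageSet {X : Cfg n} {K Θ : ℝ} {Ω : Measure (SpaceTime n)} {j : ℕ}
    {Q : Fin j → Fin n → ℤ} {x : X.π} : x ∈ X.stageSet K Θ Ω Q ↔ x ∈ X.P ∧
      ∀ i, ‖X.W.wave X.c X.s (X.pos x)‖ ^ 2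
        ≤ Θ * ∫ v, ‖X.W.wave X.c (X.s.filter fun k => X.W.cap K k = Q i) (X.pos x + v)‖ ^ 2 ∂Ω := by
  classical
  exact Finset.mem_filter

lemma sum_stageSet_of_empty {X : Cfg n} {K Θ : ℝ} {Ω : Measure (SpaceTime n)} {j : ℕ}
    {Q : Fin j → Fin n → ℤ} (h : ¬ ∀ i, ∃ k ∈ X.s, X.W.cap K k = Q i) :
    ∑ x ∈ X.stageSet K Θ Ω Q, X.wt x * ‖X.W.wave X.c X.s (X.pos x)‖ ^ 2 = 0 := by
  push Not at h
  obtain ⟨i, hi⟩ := h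
  refine Finset.sum_eq_zero fun x hx => ?_
  have h1 := (mem_stageSet.1 hx).2 i
  rw [Finset.filter_false_of_mem hi] at h1
  simp only [WaveFamily.wave, Finset.sum_empty, norm_zero] at h1
  have h2 : ‖∑ k ∈ X.s, X.c k * expChar (X.W.freq k) (X.pos x)‖ ^ 2 = 0 := by
    refine le_antisymm (h1.trans_eq (by simp)) (by positivity)
  rw [WaveFamily.wave, h2, mul_zero]

lemma PreAdm.sum_le_total {A A₀ R T : ℝ} {X : Cfg n} (hX : X.PreAdm A A₀ R T) {S : Finset X.π}
    (hS : S ⊆ X.P) : ∑ x ∈ S, X.wt x * ‖X.W.wave X.c X.s (X.pos x)‖ ^ 2 ≤ X.total :=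
  Finset.sum_le_sum_of_subset_of_nonneg hS fun x hx _ =>
    mul_nonneg (hX.wt_nonneg x hx) (by positivity)

variable {A A₀ α θ γ : ℝ}

lemma exists_sum_le_of_lt (n : ℕ) (α : ℝ) (hA : 1 ≤ A) (hA₀ : 0 ≤ A₀) (hθ : 0 ≤ θ) (hγ : 0 ≤ γ) {D : ℕ}
    (hD : 2 ≤ D) (t₀ : ℕ) : ∃ E : ℝ, 0 ≤ E ∧ ∀ t < t₀, ∀ (X : Cfg n) (c₀ R : ℝ),
      X.Adm A A₀ α c₀ R ((D : ℝ) ^ t) → ∀ S ⊆ X.P,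
      ∑ x ∈ S, X.wt x * ‖X.W.wave X.c X.s (X.pos x)‖ ^ 2
        ≤ E * ((D : ℝ) ^ t) ^ γ * c₀ ^ θ * R ^ n * X.energy := by
  obtain ⟨C, hC, h⟩ := PreAdm.total_le (n := n) hA hA₀
  have hD1 : (1 : ℝ) ≤ D := by exact_mod_cast (by omega : 1 ≤ D)
  refine ⟨C * (1 + (D : ℝ) ^ t₀), by positivity, ?_⟩
  intro t ht X c₀ R hX S hS
  have hE := X.energy_nonneg
  have hR := hX.one_le
  refine (hX.toPreAdm.sum_le_total hS).trans ((h X R _ (by positivity) hX.toPreAdm).trans ?_)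
  have h1 : (1 : ℝ) ≤ ((D : ℝ) ^ t) ^ γ := Real.one_le_rpow (one_le_pow₀ hD1) hγ
  have h2 : 1 ≤ c₀ ^ θ := Real.one_le_rpow hX.one_le_c hθ
  have h3 : (D : ℝ) ^ t ≤ (D : ℝ) ^ t₀ := pow_le_pow_right₀ hD1 ht.le
  calc C * (1 + (D : ℝ) ^ t) * R ^ n * X.energy
      ≤ C * (1 + (D : ℝ) ^ t₀) * R ^ n * X.energy := by gcongr
    _ = C * (1 + (D : ℝ) ^ t₀) * 1 * 1 * R ^ n * X.energy := by ring
    _ ≤ C * (1 + (D : ℝ) ^ t₀) * ((D : ℝ) ^ t) ^ γ * c₀ ^ θ * R ^ n * X.energy := by gcongr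

lemma cap_pow_le {X : Cfg n} {D f e : ℕ} (hD : 2 ≤ D) (hfe : f ≤ e) {k l : X.κ}
    (h : X.W.cap ((D : ℝ) ^ e) k = X.W.cap ((D : ℝ) ^ e) l) :
    X.W.cap ((D : ℝ) ^ f) k = X.W.cap ((D : ℝ) ^ f) l := by
  refine WaveFamily.cap_eq_of_cap_mul_eq (m := D ^ (e - f)) (by positivity) ?_
  rw [Nat.cast_pow, ← pow_add, Nat.sub_add_cancel hfe]
  exact h

/-- The last stage, at which the caps are fully transversal. -/
lemma stageClaim_last (hA : 1 ≤ A) (hA₀ : 0 ≤ A₀) (hγ : 0 ≤ γ) {D : ℕ} (hD : 2 ≤ D)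
    (hθ : 1 / (n + 1 : ℝ) ≤ θ)
    (hml : WaveFamily.mlReal (Fin (n + 1)) * (D : ℝ) ^ (α / (n + 1) - γ) ≤ 1) :
    StageClaim n A A₀ α θ γ D (n + 1) := by
  classical
  intro A' hA'
  have hθ0 : 0 ≤ θ := le_trans (by positivity) hθ
  obtain ⟨B, hB, f₀, hcells⟩ := exists_sum_cells_le n hA hA' (j := n + 1) (by omega) D hD
  refine ⟨f₀, fun f hf Θ hΘ η hη => ?_⟩
  obtain ⟨C, hC, hfinal⟩ := Adm.final_le (α := α) n (a := 1 / (n + 1 : ℝ)) hA hA₀ (by positivity)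
  obtain ⟨E, hE, htriv⟩ := exists_sum_le_of_lt n α hA hA₀ hθ0 hγ hD f
  have hml1 := WaveFamily.one_le_mlReal (Fin (n + 1))
  have hD1 : (1 : ℝ) ≤ D := by exact_mod_cast (by omega : 1 ≤ D)
  have hD0 : (0 : ℝ) < D := by linarith
  refine ⟨E + Θ * B * WaveFamily.mlReal (Fin (n + 1)) * C, by positivity, ?_⟩
  intro t M hM _ X c₀ R hX Ω₀ _ Q hQ
  have hEn := X.energy_nonneg
  have hR := hX.one_le
  have hc₀ := hX.one_le_c
  have hRHS : 0 ≤ ((D : ℝ) ^ t) ^ γ * c₀ ^ θ * R ^ n * X.energy := by positivity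
  rcases lt_or_ge t f with htf | htf
  · refine (htriv t htf X c₀ R hX _ (X.stageSet_subset _ _ _ _)).trans ?_
    have : E ≤ η * M + (E + Θ * B * WaveFamily.mlReal (Fin (n + 1)) * C) := by
      have : 0 ≤ η * M := by positivity
      have : 0 ≤ Θ * B * WaveFamily.mlReal (Fin (n + 1)) * C := by positivity
      linarith
    nlinarith [mul_le_mul_of_nonneg_right this hRHS]
  by_cases hne : ∀ i, ∃ k ∈ X.s, X.W.cap ((D : ℝ) ^ f) k = Q i
  swap
  · rw [sum_stageSet_of_empty hne]
    positivity
  obtain ⟨Ω, hΩ, hcells⟩ := hcells f hf t X A₀ R _ hX.toPreAdm Q hQ hne Ω₀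
  choose b hbs hbQ using hne
  set S := X.stageSet ((D : ℝ) ^ f) Θ Ω₀ Q with hS
  obtain ⟨Z, hZ, hinj, hrep⟩ := X.exists_representatives ((D : ℝ) ^ t) S
  have hSP : S ⊆ X.P := X.stageSet_subset _ _ _ _
  have h1 := hcells Z (hZ.trans hSP)
    (fun _ i => X.s.filter fun k => X.W.cap ((D : ℝ) ^ f) k = Q i)
    (fun z _ => ⟨b, fun i => ⟨hbs i, hbQ i⟩, fun i k hk => by
      obtain ⟨hk1, hk2⟩ := Finset.mem_filter.1 hk
      refine ⟨hk1, hk2, ?_, fun l hl hlk => Finset.mem_filter.2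
        ⟨hl, (cap_pow_le hD htf hlk).trans hk2⟩⟩
      obtain ⟨β, hβ⟩ := (hQ b fun i => ⟨hbs i, hbQ i⟩).exists_sum_smul (X.W.normal k)
      refine ⟨β, ?_⟩
      rw [hβ, sub_self, norm_zero]
      positivity⟩)
    (fun z => S.filter fun x => cell ((D : ℝ) ^ t) (X.pos x) = cell ((D : ℝ) ^ t) (X.pos z))
    (fun z _ => (Finset.filter_subset _ _).trans hSP)
    (fun z _ x hx => (Finset.mem_filter.1 hx).2)
  have h2 := hfinal X c₀ R _ hX (one_le_pow₀ hD1) Z (hZ.trans hSP) hinj Ω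
  rw [show ((n + 1 : ℝ) * (1 - 1 / ((n + 1 : ℕ) : ℝ))) = n by push_cast; field_simp; ring,
    Real.rpow_natCast] at h1
  have h3 : ∑ x ∈ S, X.wt x * ‖X.W.wave X.c X.s (X.pos x)‖ ^ 2
      ≤ Θ * ∑ z ∈ Z, ∑ x ∈ S with cell ((D : ℝ) ^ t) (X.pos x) = cell ((D : ℝ) ^ t) (X.pos z),
        X.wt x * ∏ i, (∫ v, ‖X.W.wave X.c (X.s.filter fun k => X.W.cap ((D : ℝ) ^ f) k = Q i)
          (X.pos x + v)‖ ^ 2 ∂Ω₀) ^ (1 / ((n + 1 : ℕ) : ℝ)) := by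
    rw [← hrep, Finset.mul_sum]
    refine Finset.sum_le_sum fun x hx => ?_
    rw [mul_left_comm]
    refine mul_le_mul_of_nonneg_left ?_ (hX.wt_nonneg x (hSP hx))
    exact le_mul_prod_rpow (by omega) (by positivity) hΘ
      (fun i => integral_nonneg fun _ => by positivity) (mem_stageSet.1 hx).2
  refine h3.trans ((mul_le_mul_of_nonneg_left h1 hΘ).trans ?_)
  have hα : ((D : ℝ) ^ t) ^ α = ((D : ℝ) ^ α) ^ t := by
    rw [← Real.rpow_natCast, ← Real.rpow_mul hD0.le, mul_comm, Real.rpow_mul hD0.le,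
      Real.rpow_natCast]
  have h4 : WaveFamily.mlReal (Fin (n + 1)) ^ t * (c₀ * ((D : ℝ) ^ t) ^ α) ^ (1 / (n + 1 : ℝ))
      ≤ ((D : ℝ) ^ t) ^ γ * c₀ ^ θ := by
    have e1 : (((D : ℝ) ^ t) ^ α) ^ (1 / (n + 1 : ℝ)) = ((D : ℝ) ^ (α / (n + 1) - γ)) ^ t
        * ((D : ℝ) ^ t) ^ γ := by
      rw [← Real.rpow_mul (by positivity), ← Real.rpow_natCast, ← Real.rpow_natCast,
        ← Real.rpow_mul hD0.le, ← Real.rpow_mul hD0.le, ← Real.rpow_mul hD0.le,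
        ← Real.rpow_add hD0]
      congr 1
      ring
    have e2 : c₀ ^ (1 / (n + 1 : ℝ)) ≤ c₀ ^ θ := Real.rpow_le_rpow_of_exponent_le hc₀ hθ
    have e3 : (WaveFamily.mlReal (Fin (n + 1)) * (D : ℝ) ^ (α / (n + 1) - γ)) ^ t ≤ 1 :=
      pow_le_one₀ (by positivity) hml
    rw [Real.mul_rpow (by linarith) (by positivity), e1]
    calc _ = (WaveFamily.mlReal (Fin (n + 1)) * (D : ℝ) ^ (α / (n + 1) - γ)) ^ t
          * (((D : ℝ) ^ t) ^ γ * c₀ ^ (1 / (n + 1 : ℝ))) := by rw [mul_pow]; ring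
      _ ≤ 1 * (((D : ℝ) ^ t) ^ γ * c₀ ^ θ) := by gcongr
      _ = _ := one_mul _
  push_cast
  calc _ ≤ Θ * (B * WaveFamily.mlReal (Fin (n + 1)) ^ (t + 1)
        * (C * (c₀ * ((D : ℝ) ^ t) ^ α) ^ (1 / (n + 1 : ℝ)) * R ^ n * X.energy)) := by gcongr
    _ = Θ * B * WaveFamily.mlReal (Fin (n + 1)) * C * (WaveFamily.mlReal (Fin (n + 1)) ^ t
        * (c₀ * ((D : ℝ) ^ t) ^ α) ^ (1 / (n + 1 : ℝ))) * R ^ n * X.energy := by ring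
    _ ≤ Θ * B * WaveFamily.mlReal (Fin (n + 1)) * C * (((D : ℝ) ^ t) ^ γ * c₀ ^ θ)
        * R ^ n * X.energy := by gcongr
    _ = (Θ * B * WaveFamily.mlReal (Fin (n + 1)) * C)
        * (((D : ℝ) ^ t) ^ γ * c₀ ^ θ * R ^ n * X.energy) := by ring
    _ ≤ (η * M + (E + Θ * B * WaveFamily.mlReal (Fin (n + 1)) * C))
        * (((D : ℝ) ^ t) ^ γ * c₀ ^ θ * R ^ n * X.energy) := by
      refine mul_le_mul_of_nonneg_right ?_ hRHS
      have : 0 ≤ η * M := by positivity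
      linarith
    _ = _ := by ring

end Cfg

namespace Cfg

variable {n : ℕ} {A A₀ α θ γ : ℝ}

/-- An intermediate stage: either the waves near the span of the normals dominate and one can
rescale, or a further transversal cap appears. -/
lemma StageClaim.step (hA : 1 ≤ A) (hA₀ : 0 ≤ A₀) (hα : 0 ≤ α) (hθ : 0 ≤ θ) (hγ : 0 ≤ γ) {D : ℕ}
    (hD : 2 ≤ D) {j : ℕ} (hj : 1 ≤ j) (hθj : θ < 1 / j)
    (hml : WaveFamily.mlReal (Fin j) * (D : ℝ) ^ (2 - θ * (n + 1 - α) - 2 * γ) < 1)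
    (hnext : StageClaim n A A₀ α θ γ D (j + 1)) : StageClaim n A A₀ α θ γ D j := by
  classical
  intro A' hA'
  obtain ⟨B, hB, f₀, hcells⟩ := exists_sum_cells_le n hA hA' hj D hD
  refine ⟨f₀, fun f hf Θ hΘ η hη => ?_⟩
  obtain ⟨C, hC, hnarrow⟩ := Adm.narrow_le (α := α) n (a := 1 / j) A₀ hA hα hθ hθj
  have hml1 := WaveFamily.one_le_mlReal (Fin j)
  set ml := WaveFamily.mlReal (Fin j) with hml'
  have hDn : 0 < D := by omega
  have hD2 : (2 : ℝ) ≤ D := by exact_mod_cast hD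
  have hD1 : (1 : ℝ) < D := by linarith
  have hD0 : (0 : ℝ) < D := by linarith
  set ρ := ml * (D : ℝ) ^ (2 - θ * (n + 1 - α) - 2 * γ) with hρ
  have hρ0 : 0 ≤ ρ := by positivity
  obtain ⟨e, hρe, hfe⟩ : ∃ e : ℕ, 4 * Θ * B * ml * C * ρ ^ e ≤ η / 2 ∧ f + 1 ≤ e := by
    have h1 : Tendsto (fun e : ℕ => 4 * Θ * B * ml * C * ρ ^ e) atTop (𝓝 0) := by
      simpa using (tendsto_pow_atTop_nhds_zero_of_lt_one hρ0 hml).const_mul (4 * Θ * B * ml * C)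
    exact ((h1.eventually (ge_mem_nhds (half_pos hη))).and (eventually_ge_atTop (f + 1))).exists
  have hKpos : (0 : ℝ) < (D : ℝ) ^ e := by positivity
  have hK1 : (1 : ℝ) ≤ (D : ℝ) ^ e := one_le_pow₀ hD1.le
  set K := (D : ℝ) ^ e with hK
  have hA'' : 0 ≤ WaveFamily.nextConst A A' K := by
    unfold WaveFamily.nextConst; positivity
  obtain ⟨f₁, hf₁⟩ := hnext _ hA''
  obtain ⟨f', hf'1, hf'2, hf'3⟩ : ∃ f' : ℕ, WaveFamily.nextConst A A' K * A ≤ (D : ℝ) ^ f' ∧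
      f₁ ≤ f' ∧ e ≤ f' :=
    (((tendsto_pow_atTop_atTop_of_one_lt hD1).eventually_ge_atTop _).and
      ((eventually_ge_atTop f₁).and (eventually_ge_atTop e))).exists
  set K' := (D : ℝ) ^ f' with hK'
  have hK'pos : 0 < K' := by positivity
  set N : ℝ := (2 * K' + 2) ^ n with hN
  have hNpos : 0 < N := by positivity
  set Θ' := Θ * (4 * (N ^ 2 * WaveFamily.shiftConst n A K ^ 2)) with hΘ'
  have hΘ'0 : 0 ≤ Θ' := by
    have := WaveFamily.shiftConst_pos (n := n) A K
    positivity
  obtain ⟨E', hE', hfar⟩ := hf₁ f' hf'2 Θ' hΘ'0 (η / (2 * N ^ (j + 1))) (by positivity)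
  obtain ⟨E, hE, htriv⟩ := exists_sum_le_of_lt n α hA hA₀ hθ hγ hD (2 * e)
  refine ⟨E + N ^ (j + 1) * E', by positivity, ?_⟩
  intro t M hM hBd X c₀ R hX Ω₀ _ Q hQ
  have hEn := X.energy_nonneg
  have hR := hX.one_le
  have hc₀ := hX.one_le_c
  have hRHS : 0 ≤ ((D : ℝ) ^ t) ^ γ * c₀ ^ θ * R ^ n * X.energy := by positivity
  rcases lt_or_ge t (2 * e) with hte | hte
  · refine (htriv t hte X c₀ R hX _ (X.stageSet_subset _ _ _ _)).trans ?_
    have : E ≤ η * M + (E + N ^ (j + 1) * E') := by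
      have : 0 ≤ η * M := by positivity
      have : 0 ≤ N ^ (j + 1) * E' := by positivity
      linarith
    nlinarith [mul_le_mul_of_nonneg_right this hRHS]
  by_cases hne : ∀ i, ∃ k ∈ X.s, X.W.cap ((D : ℝ) ^ f) k = Q i
  swap
  · rw [sum_stageSet_of_empty hne]
    positivity
  obtain ⟨Ω, hΩ, hcells⟩ := hcells f hf e X A₀ R _ hX.toPreAdm Q hQ hne Ω₀
  set S := X.stageSet ((D : ℝ) ^ f) Θ Ω₀ Q with hS
  obtain ⟨Z, hZ, hinj, hrep⟩ := X.exists_representatives K S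
  have hSP : S ⊆ X.P := X.stageSet_subset _ _ _ _
  have hcardN : ((X.s.image (X.W.cap K')).card : ℝ) ≤ N :=
    hX.conv.card_image_cap_le hK'pos.le
  have hnf := fun z : X.π => hX.conv.near_or_far (K₀ := (D : ℝ) ^ f) (K := K) (K' := K') (N := N)
    hA hA' hKpos (m₁ := D ^ (e - f)) (m₂ := D ^ (f' - e)) (by positivity) (by positivity)
    (by rw [hK, Nat.cast_pow, ← pow_add, Nat.sub_add_cancel (by omega)])
    (by rw [hK', hK, Nat.cast_pow, ← pow_add, Nat.sub_add_cancel hf'3])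
    (by rw [mul_div_assoc', div_le_one hK'pos]; exact hf'1) hcardN hQ hne Ω₀ X.c (X.pos z)
  choose a ha hnf using hnf
  set I : X.π → Fin j → Finset X.κ := fun z i =>
    X.W.nearSet X.s ((D : ℝ) ^ f) K (fun l => X.W.normal (a z l)) (Q i) with hI
  set near : X.π → X.π → Prop := fun z x => ∀ i,
    ∫ v, ‖X.W.wave X.c (X.s.filter fun k => X.W.cap ((D : ℝ) ^ f) k = Q i) (X.pos x + v)‖ ^ 2 ∂Ω₀
      ≤ 4 * ∫ v, ‖X.W.wave X.c (I z i) (X.pos x + v)‖ ^ 2 ∂Ω₀ with hnear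
  set F : X.π → ℝ := fun x => X.wt x * ‖X.W.wave X.c X.s (X.pos x)‖ ^ 2 with hF
  have hF0 : ∀ x ∈ X.P, 0 ≤ F x := fun x hx => mul_nonneg (hX.wt_nonneg x hx) (by positivity)
  set Ω₁ := WaveFamily.smear n A (WaveFamily.smear n A Ω₀) with hΩ₁
  set G : Finset (Fin (j + 1) → Fin n → ℤ) := (Fintype.piFinset fun _ => X.s.image (X.W.cap K')).filter
    fun Q' => X.W.IsGood X.s K' (WaveFamily.nextConst A A' K) Q' with hG
  have hGcard : (G.card : ℝ) ≤ N ^ (j + 1) := by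
    have h1 : G.card ≤ (X.s.image (X.W.cap K')).card ^ (j + 1) := by
      refine (Finset.card_filter_le _ _).trans_eq ?_
      rw [Fintype.card_piFinset, Finset.prod_const, Finset.card_univ, Fintype.card_fin]
    calc (G.card : ℝ) ≤ ((X.s.image (X.W.cap K')).card : ℝ) ^ (j + 1) := by exact_mod_cast h1
      _ ≤ _ := by gcongr
  set g : X.π → ℝ := fun x => ∑ Q' ∈ G, if x ∈ X.stageSet K' Θ' Ω₁ Q' then F x else 0 with hg
  have hg0 : ∀ x ∈ X.P, 0 ≤ g x := fun x hx => Finset.sum_nonneg fun Q' _ => by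
    split_ifs
    exacts [hF0 x hx, le_rfl]
  have hgS : ∑ x ∈ S, g x ≤ N ^ (j + 1) * ((η / (2 * N ^ (j + 1)) * M + E')
      * ((D : ℝ) ^ t) ^ γ * c₀ ^ θ * R ^ n * X.energy) := by
    calc ∑ x ∈ S, g x ≤ ∑ x ∈ X.P, g x :=
          Finset.sum_le_sum_of_subset_of_nonneg hSP fun x hx _ => hg0 x hx
      _ = ∑ Q' ∈ G, ∑ x ∈ X.stageSet K' Θ' Ω₁ Q', F x := by
        rw [hg, Finset.sum_comm]
        refine Finset.sum_congr rfl fun Q' _ => ?_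
        rw [← Finset.sum_filter]
        refine Finset.sum_congr ?_ fun _ _ => rfl
        ext x
        simp only [Finset.mem_filter]
        exact ⟨fun h => h.2, fun h => ⟨X.stageSet_subset _ _ _ _ h, h⟩⟩
      _ ≤ ∑ _Q' ∈ G, ((η / (2 * N ^ (j + 1)) * M + E')
          * ((D : ℝ) ^ t) ^ γ * c₀ ^ θ * R ^ n * X.energy) :=
        Finset.sum_le_sum fun Q' hQ' =>
          hfar t M hM hBd X c₀ R hX Ω₁ Q' (Finset.mem_filter.1 hQ').2
      _ ≤ _ := by
        rw [Finset.sum_const, nsmul_eq_mul]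
        gcongr
  have hsplit : ∀ z ∈ Z, ∀ x ∈ S, cell K (X.pos x) = cell K (X.pos z) →
      F x ≤ (if near z x then F x else 0) + g x := by
    intro z hz x hx hxz
    have hxP := hSP hx
    rcases hnf z (X.pos x) Θ hΘ (norm_sub_le_of_cell_eq hKpos hxz) (mem_stageSet.1 hx).2
      with h | ⟨Q', hQ'1, hQ'2, hQ'3⟩
    · rw [if_pos h]
      linarith [hg0 x hxP]
    · have h1 : F x ≤ g x := by
        have hmem : x ∈ X.stageSet K' Θ' Ω₁ Q' := mem_stageSet.2 ⟨hxP, hQ'3⟩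
        calc F x = if x ∈ X.stageSet K' Θ' Ω₁ Q' then F x else 0 := (if_pos hmem).symm
          _ ≤ g x := Finset.single_le_sum
            (f := fun Q' => if x ∈ X.stageSet K' Θ' Ω₁ Q' then F x else 0)
            (fun Q' _ => by
              split_ifs
              exacts [hF0 x hxP, le_rfl])
            (Finset.mem_filter.2 ⟨Fintype.mem_piFinset.2 hQ'1, hQ'2⟩)
      have h2 : 0 ≤ if near z x then F x else 0 := by
        split_ifs
        exacts [hF0 x hxP, le_rfl]
      linarith
  set P' : X.π → Finset X.π := fun z =>
    (S.filter fun x => cell K (X.pos x) = cell K (X.pos z)).filter fun x => near z x with hP'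
  have hP'S : ∀ z, P' z ⊆ S := fun z => (Finset.filter_subset _ _).trans (Finset.filter_subset _ _)
  have hsum : ∑ x ∈ S, F x ≤ ∑ z ∈ Z, ∑ x ∈ P' z, F x + ∑ x ∈ S, g x := by
    rw [hrep F, hrep g, ← Finset.sum_add_distrib]
    refine Finset.sum_le_sum fun z hz => ?_
    have e1 : ∑ x ∈ P' z, F x = ∑ x ∈ S with cell K (X.pos x) = cell K (X.pos z),
        if near z x then F x else 0 := Finset.sum_filter _ _
    rw [e1, ← Finset.sum_add_distrib]
    refine Finset.sum_le_sum fun x hx => ?_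
    obtain ⟨h1, h2⟩ := Finset.mem_filter.1 hx
    exact hsplit z hz x h1 h2
  have h1 := hcells Z (hZ.trans hSP) I
    (fun z _ => ⟨a z, ha z, fun i k hk => by
      obtain ⟨hk1, l, hl, hlk, β, hβ⟩ := Finset.mem_filter.1 hk
      obtain ⟨hks, hkQ⟩ := Finset.mem_filter.1 hk1
      refine ⟨hks, hkQ, ⟨β, ?_⟩, fun l' hl' hl'k => Finset.mem_filter.2 ⟨Finset.mem_filter.2
        ⟨hl', (cap_pow_le hD (by omega) hl'k).trans hkQ⟩, l, hl, hlk.trans hl'k.symm, β, hβ⟩⟩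
      have e1 : ‖X.W.normal k - X.W.normal l‖ ≤ A * (1 / K) := by
        rw [WaveFamily.norm_normal_sub]
        refine (hX.conv.norm_p_sub_le _ hks _ hl).trans (mul_le_mul_of_nonneg_left
          (WaveFamily.norm_y_sub_le_of_cap_eq hKpos hlk.symm) (by linarith))
      calc _ = ‖(X.W.normal k - X.W.normal l)
            + (X.W.normal l - ∑ i, β i • X.W.normal (a z i))‖ := by congr 1; abel
        _ ≤ A * (1 / K) + 1 / K := (norm_add_le _ _).trans (add_le_add e1 hβ)
        _ = _ := by ring⟩)
    P' (fun z _ => (hP'S z).trans hSP)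
    (fun z _ x hx => (Finset.mem_filter.1 (Finset.mem_filter.1 hx).1).2)
  have hsq : (D : ℝ) ^ t / K ^ 2 = (D : ℝ) ^ (t - 2 * e) := by
    rw [hK, ← pow_mul, mul_comm e 2, div_eq_iff (by positivity), ← pow_add, Nat.sub_add_cancel hte]
  have h2 := hnarrow X c₀ R _ K (M * ((D : ℝ) ^ (t - 2 * e)) ^ γ) hX hK1
    ((pow_le_pow_right₀ hD1.le (by omega : e ≤ t)).trans hX.le) (by positivity)
    (by rw [hsq]; exact hBd (t - 2 * e) (by omega)) Z (hZ.trans hSP) hinj Ω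
  have h3 : ∑ z ∈ Z, ∑ x ∈ P' z, F x ≤ 4 * Θ * ∑ z ∈ Z, ∑ x ∈ P' z, X.wt x
      * ∏ i, (∫ v, ‖X.W.wave X.c (I z i) (X.pos x + v)‖ ^ 2 ∂Ω₀) ^ (1 / j : ℝ) := by
    rw [Finset.mul_sum]
    refine Finset.sum_le_sum fun z _ => ?_
    rw [Finset.mul_sum]
    refine Finset.sum_le_sum fun x hx => ?_
    rw [mul_left_comm]
    refine mul_le_mul_of_nonneg_left ?_ (hX.wt_nonneg x (hSP (hP'S z hx)))
    refine le_mul_prod_rpow hj (by positivity) (by positivity)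
      (fun i => integral_nonneg fun _ => by positivity) fun i => ?_
    refine ((mem_stageSet.1 (hP'S z hx)).2 i).trans ?_
    calc _ ≤ Θ * (4 * ∫ v, ‖X.W.wave X.c (I z i) (X.pos x + v)‖ ^ 2 ∂Ω₀) :=
          mul_le_mul_of_nonneg_left ((Finset.mem_filter.1 hx).2 i) hΘ
      _ = _ := by ring
  have hpow : ml ^ e * K ^ (2 - θ * (n + 1 - α)) * ((D : ℝ) ^ (t - 2 * e)) ^ γ
      = ρ ^ e * ((D : ℝ) ^ t) ^ γ := by
    have e1 : ((D : ℝ) ^ t) ^ γ = ((D : ℝ) ^ (t - 2 * e)) ^ γ * (D : ℝ) ^ (2 * γ * e) := by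
      rw [← Nat.sub_add_cancel hte, pow_add, Real.mul_rpow (by positivity) (by positivity),
        Nat.add_sub_cancel]
      congr 1
      rw [← Real.rpow_natCast, ← Real.rpow_mul hD0.le]
      congr 1
      push_cast
      ring
    have e2 : K ^ (2 - θ * (n + 1 - α)) = (D : ℝ) ^ ((2 - θ * (n + 1 - α)) * e) := by
      rw [hK, ← Real.rpow_natCast, ← Real.rpow_mul hD0.le, mul_comm]
    have e3 : (D : ℝ) ^ ((2 - θ * (n + 1 - α)) * e)
        = ((D : ℝ) ^ (2 - θ * (n + 1 - α) - 2 * γ)) ^ e * (D : ℝ) ^ (2 * γ * e) := by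
      rw [← Real.rpow_natCast, ← Real.rpow_mul hD0.le, ← Real.rpow_add hD0]
      congr 1
      ring
    rw [e1, e2, e3, hρ, mul_pow]
    ring
  have h4 : ∑ z ∈ Z, ∑ x ∈ P' z, F x
      ≤ η / 2 * M * ((D : ℝ) ^ t) ^ γ * c₀ ^ θ * R ^ n * X.energy := by
    refine h3.trans ((mul_le_mul_of_nonneg_left h1 (by positivity)).trans ?_)
    calc _ ≤ 4 * Θ * (B * ml ^ (e + 1) * (C * K ^ (2 - θ * (n + 1 - α))
          * (M * ((D : ℝ) ^ (t - 2 * e)) ^ γ) * c₀ ^ θ * R ^ n * X.energy)) := by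
          gcongr
      _ = 4 * Θ * B * ml * C * (ml ^ e * K ^ (2 - θ * (n + 1 - α))
          * ((D : ℝ) ^ (t - 2 * e)) ^ γ) * M * c₀ ^ θ * R ^ n * X.energy := by ring
      _ = 4 * Θ * B * ml * C * ρ ^ e * M * ((D : ℝ) ^ t) ^ γ * c₀ ^ θ * R ^ n * X.energy := by
        rw [hpow]; ring
      _ ≤ _ := by gcongr
  have h5 : N ^ (j + 1) * ((η / (2 * N ^ (j + 1)) * M + E')
      * ((D : ℝ) ^ t) ^ γ * c₀ ^ θ * R ^ n * X.energy)
      = (η / 2 * M + N ^ (j + 1) * E') * ((D : ℝ) ^ t) ^ γ * c₀ ^ θ * R ^ n * X.energy := by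
    field_simp
  rw [h5] at hgS
  have h6 : 0 ≤ E * (((D : ℝ) ^ t) ^ γ * c₀ ^ θ * R ^ n * X.energy) := by positivity
  calc ∑ x ∈ S, F x ≤ _ := hsum.trans (add_le_add h4 hgS)
    _ ≤ _ := by linarith

lemma exists_cap_norm_le {κ : Type} {W : WaveFamily n κ} {s : Finset κ} (hs : s.Nonempty) {K N : ℝ}
    (hN : ((s.image (W.cap K)).card : ℝ) ≤ N) (c : κ → ℂ) (x : SpaceTime n) :
    ∃ q ∈ s.image (W.cap K), ‖W.wave c s x‖ ^ 2
      ≤ N ^ 2 * ‖W.wave c (s.filter fun k => W.cap K k = q) x‖ ^ 2 := by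
  classical
  obtain ⟨q, hq, hmax⟩ := (s.image (W.cap K)).exists_max_image
    (fun q => ‖W.wave c (s.filter fun k => W.cap K k = q) x‖) (hs.image _)
  refine ⟨q, hq, ?_⟩
  rw [← mul_pow]
  refine pow_le_pow_left₀ (norm_nonneg _) ?_ 2
  have h1 : W.wave c s x = ∑ q ∈ s.image (W.cap K), W.wave c (s.filter fun k => W.cap K k = q) x := by
    unfold WaveFamily.wave
    exact (Finset.sum_fiberwise_of_maps_to (fun k hk => Finset.mem_image_of_mem _ hk) _).symm
  rw [h1]
  refine (norm_sum_le_of_le _ hmax).trans ?_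
  rw [Finset.sum_const, nsmul_eq_mul]
  gcongr

lemma isGood_one {κ : Type} (W : WaveFamily n κ) (s : Finset κ) (K : ℝ) (Q : Fin 1 → Fin n → ℤ) :
    W.IsGood s K 1 Q := by
  intro k _ a
  rw [Fin.sum_univ_one, Fin.sum_univ_one, one_mul, norm_smul, Real.norm_eq_abs]
  refine le_mul_of_one_le_right (abs_nonneg _) ?_
  refine le_trans ?_ (norm_snd_le _)
  simp [WaveFamily.normal]

lemma StageClaim.exists_bound {D : ℕ} (h : StageClaim n A A₀ α θ γ D 1) :
    ∃ C : ℝ, 0 ≤ C ∧ ∀ t : ℕ, Bound n A A₀ α θ ((D : ℝ) ^ t) (C * ((D : ℝ) ^ t) ^ γ) := by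
  classical
  obtain ⟨f, hf⟩ := h 1 zero_le_one
  set K := (D : ℝ) ^ f with hK
  have hK0 : 0 ≤ K := by positivity
  set N : ℝ := (2 * K + 2) ^ n with hN
  have hN0 : 0 < N := by positivity
  obtain ⟨E, hE, hst⟩ := hf f le_rfl (N ^ 2) (by positivity) (1 / (2 * N)) (by positivity)
  refine ⟨2 * N * E, by positivity, fun t => ?_⟩
  induction t using Nat.strong_induction_on with
  | _ t ih =>
  intro X c₀ R hX
  have hEn := X.energy_nonneg
  have hR := hX.one_le
  have hc₀ := hX.one_le_c
  rcases X.s.eq_empty_or_nonempty with hs | hs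
  · have : X.total = 0 := Finset.sum_eq_zero fun x _ => by simp [WaveFamily.wave, hs]
    rw [this]
    positivity
  have hcard := hX.conv.card_image_cap_le hK0
  have h1 := fun q : Fin n → ℤ => hst t _ (by positivity) ih X c₀ R hX (Measure.dirac 0)
    (fun _ : Fin 1 => q) (isGood_one X.W X.s _ _)
  set F : X.π → ℝ := fun x => X.wt x * ‖X.W.wave X.c X.s (X.pos x)‖ ^ 2 with hF
  have hF0 : ∀ x ∈ X.P, 0 ≤ F x := fun x hx => mul_nonneg (hX.wt_nonneg x hx) (by positivity)
  have h2 : X.total ≤ ∑ q ∈ X.s.image (X.W.cap K),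
      ∑ x ∈ X.stageSet K (N ^ 2) (Measure.dirac 0) (fun _ : Fin 1 => q), F x := by
    have e1 : ∀ q, ∑ x ∈ X.stageSet K (N ^ 2) (Measure.dirac 0) (fun _ : Fin 1 => q), F x
        = ∑ x ∈ X.P, if x ∈ X.stageSet K (N ^ 2) (Measure.dirac 0) (fun _ : Fin 1 => q)
          then F x else 0 := by
      intro q
      rw [← Finset.sum_filter]
      refine Finset.sum_congr ?_ fun _ _ => rfl
      ext x
      simp only [Finset.mem_filter]
      exact ⟨fun h => ⟨X.stageSet_subset _ _ _ _ h, h⟩, fun h => h.2⟩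
    rw [Finset.sum_congr rfl fun q _ => e1 q, Finset.sum_comm]
    refine Finset.sum_le_sum fun x hx => ?_
    obtain ⟨q, hq, hxq⟩ := exists_cap_norm_le hs hcard X.c (X.pos x)
    have hmem : x ∈ X.stageSet K (N ^ 2) (Measure.dirac 0) (fun _ : Fin 1 => q) := by
      refine mem_stageSet.2 ⟨hx, fun _ => ?_⟩
      rw [integral_dirac, add_zero]
      exact hxq
    calc F x = if x ∈ X.stageSet K (N ^ 2) (Measure.dirac 0) (fun _ : Fin 1 => q)
          then F x else 0 := (if_pos hmem).symm
      _ ≤ _ := Finset.single_le_sum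
        (f := fun q => if x ∈ X.stageSet K (N ^ 2) (Measure.dirac 0) (fun _ : Fin 1 => q)
          then F x else 0) (fun q _ => by
            split_ifs
            exacts [hF0 x hx, le_rfl]) hq
  refine h2.trans ((Finset.sum_le_sum fun q _ => h1 q).trans ?_)
  rw [Finset.sum_const, nsmul_eq_mul]
  have h3 : 0 ≤ (1 / (2 * N) * (2 * N * E) + E) * ((D : ℝ) ^ t) ^ γ * c₀ ^ θ * R ^ n * X.energy := by
    positivity
  refine (mul_le_mul_of_nonneg_right hcard h3).trans_eq ?_
  rw [one_div, inv_mul_eq_div, mul_div_right_comm]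
  field_simp
  ring

/-- The estimate at the scales `D ^ t`, for some base `D`. -/
lemma exists_bound (hn : 1 ≤ n) (hA : 1 ≤ A) (hA₀ : 0 ≤ A₀) (hα : 0 ≤ α) (hγ : 0 ≤ γ)
    (hθ : 1 / (n + 1 : ℝ) ≤ θ) (hθn : θ < 1 / n) (hγ1 : 2 - θ * (n + 1 - α) < 2 * γ)
    (hγ2 : α / (n + 1) < γ) : ∃ D : ℕ, 2 ≤ D ∧ ∃ C : ℝ, 0 ≤ C ∧
      ∀ t : ℕ, Bound n A A₀ α θ ((D : ℝ) ^ t) (C * ((D : ℝ) ^ t) ^ γ) := by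
  have hlim : ∀ (j : ℕ) (r : ℝ), r < 0 →
      ∀ᶠ D : ℕ in atTop, WaveFamily.mlReal (Fin j) * (D : ℝ) ^ r < 1 := by
    intro j r hr
    have h1 : Tendsto (fun D : ℕ => WaveFamily.mlReal (Fin j) * (D : ℝ) ^ r) atTop (𝓝 0) := by
      have h2 := (tendsto_rpow_neg_atTop (neg_pos.2 hr)).comp (tendsto_natCast_atTop_atTop (R := ℝ))
      simpa using h2.const_mul (WaveFamily.mlReal (Fin j))
    exact h1.eventually (gt_mem_nhds one_pos)
  have hall : ∀ᶠ D : ℕ in atTop, ∀ j ∈ Finset.range (n + 1),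
      WaveFamily.mlReal (Fin j) * (D : ℝ) ^ (2 - θ * (n + 1 - α) - 2 * γ) < 1 :=
    (Filter.eventually_all_finset _).2 fun j _ => hlim j _ (by linarith)
  obtain ⟨D, ⟨h1, h2⟩, hD⟩ := ((hall.and (hlim (n + 1) _ (sub_neg.2 hγ2))).and
    (eventually_ge_atTop 2)).exists
  have hθ0 : 0 ≤ θ := le_trans (by positivity) hθ
  refine ⟨D, hD, StageClaim.exists_bound ?_⟩
  suffices H : ∀ i j : ℕ, 1 ≤ j → j + i = n + 1 → StageClaim n A A₀ α θ γ D j from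
    H n 1 le_rfl (by omega)
  intro i
  induction i with
  | zero =>
    intro j hj hij
    obtain rfl : j = n + 1 := by omega
    exact stageClaim_last hA hA₀ hγ hD hθ h2.le
  | succ i ih =>
    intro j hj hij
    refine StageClaim.step hA hA₀ hα hθ0 hγ hD hj (hθn.trans_le ?_)
      (h1 j (Finset.mem_range.2 (by omega))) (ih (j + 1) (by omega) (by omega))
    have : (j : ℝ) ≤ n := by exact_mod_cast (by omega : j ≤ n)
    exact one_div_le_one_div_of_le (by exact_mod_cast hj) this

end Cfg

/-- Replacing an integral by a sum over representatives of the pieces of a partition. -/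
lemma exists_integral_le_sum {X ι : Type*} [MeasurableSpace X] {ν : Measure X} [IsFiniteMeasure ν]
    {φ : X → ι} (hφ : ∀ q, MeasurableSet (φ ⁻¹' {q})) {G : Set X} (hG : MeasurableSet G)
    (hνG : ν Gᶜ = 0) (J : Finset ι) (hJ : ∀ x ∈ G, φ x ∈ J) {f : X → ℝ} (hf : Integrable f ν) :
    ∃ s : Finset X, ↑s ⊆ G ∧ Set.InjOn φ s ∧
      ∫ x, f x ∂ν ≤ ∑ x ∈ s, ν.real (φ ⁻¹' {φ x} ∩ G) * f x := by
  classical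
  rcases isEmpty_or_nonempty X with hX | hX
  · exact ⟨∅, by simp, by simp, by simp [Measure.eq_zero_of_isEmpty ν]⟩
  set S : ι → Set X := fun q => φ ⁻¹' {q} ∩ G
  have hSm : ∀ q, MeasurableSet (S q) := fun q => (hφ q).inter hG
  have h1 : ∫ x, f x ∂ν = ∑ q ∈ J, ∫ x in S q, f x ∂ν := by
    rw [← integral_biUnion_finset J (fun q _ => hSm q) ?_ fun q _ => hf.integrableOn]
    · have : (⋃ q ∈ J, S q) = G := by
        ext x
        simp only [mem_iUnion, S, mem_inter_iff, mem_preimage, mem_singleton_iff]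
        exact ⟨fun ⟨_, _, _, h⟩ => h, fun h => ⟨φ x, hJ x h, rfl, h⟩⟩
      rw [this, ← setIntegral_univ]
      refine setIntegral_congr_set ?_
      exact (eventuallyEq_univ.2 (mem_ae_iff.2 hνG)).symm
    · intro a _ b _ hab
      refine Set.disjoint_left.2 fun x hx hx' => hab ?_
      exact hx.1.symm.trans hx'.1
  have h2 : ∀ q, ν (S q) ≠ 0 → ∃ x ∈ S q, ∫ x in S q, f x ∂ν ≤ ν.real (S q) * f x := by
    intro q hq
    obtain ⟨x, hx, h⟩ := exists_setAverage_le hq (measure_ne_top ν _) hf.integrableOn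
    refine ⟨x, hx, ?_⟩
    have hpos : 0 < ν.real (S q) := ENNReal.toReal_pos hq (measure_ne_top ν _)
    rw [setAverage_eq, smul_eq_mul, inv_mul_le_iff₀ hpos] at h
    exact h
  choose! p hp hpf using h2
  set J' := J.filter fun q => ν (S q) ≠ 0
  have hpq : ∀ q ∈ J', φ (p q) = q ∧ p q ∈ G := fun q hq => hp q (Finset.mem_filter.1 hq).2
  have hinj : Set.InjOn p J' := fun a ha b hb h => by
    rw [← (hpq a ha).1, ← (hpq b hb).1, h]
  refine ⟨J'.image p, ?_, ?_, ?_⟩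
  · intro x hx
    obtain ⟨q, hq, rfl⟩ := Finset.mem_image.1 (Finset.mem_coe.1 hx)
    exact (hpq q hq).2
  · intro x hx x' hx' h
    obtain ⟨q, hq, rfl⟩ := Finset.mem_image.1 (Finset.mem_coe.1 hx)
    obtain ⟨q', hq', rfl⟩ := Finset.mem_image.1 (Finset.mem_coe.1 hx')
    rw [(hpq q hq).1, (hpq q' hq').1] at h
    rw [h]
  · rw [h1, Finset.sum_image hinj, ← Finset.sum_filter_add_sum_filter_not J fun q => ν (S q) ≠ 0]
    have h3 : ∑ q ∈ J.filter (fun q => ¬ ν (S q) ≠ 0), ∫ x in S q, f x ∂ν = 0 := by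
      refine Finset.sum_eq_zero fun q hq => ?_
      exact setIntegral_measure_zero _ (not_not.1 (Finset.mem_filter.1 hq).2)
    rw [h3, add_zero]
    refine Finset.sum_le_sum fun q hq => ?_
    rw [(hpq q hq).1]
    exact hpf q (Finset.mem_filter.1 hq).2

namespace SphereChart

variable {n : ℕ}

/-- The part of the unit sphere on which the coordinate `i` is large with sign `ε`. -/
def chart (i : Fin (n + 1)) (ε : ℝ) : Set (EuclideanSpace ℝ (Fin (n + 1))) :=
  {ω | ‖ω‖ = 1 ∧ 1 / (n + 1 : ℝ) ≤ ε * ω i}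

/-- The frequencies on the sphere, as a wave family. -/
noncomputable def waves (i : Fin (n + 1)) (ε : ℝ) :
    WaveFamily n (EuclideanSpace ℝ (Fin (n + 1))) where
  y ω j := ω (i.succAbove j)
  σ ω := -(ε * ω i)
  p ω j := ω (i.succAbove j) / (ε * ω i)

/-- The position of a point in the coordinates adapted to a chart. -/
def place (i : Fin (n + 1)) (ε : ℝ) (x : EuclideanSpace ℝ (Fin (n + 1))) : SpaceTime n :=
  (fun j => -x (i.succAbove j), ε * x i)

variable {i : Fin (n + 1)} {ε : ℝ}

lemma isClosed_chart (i : Fin (n + 1)) (ε : ℝ) : IsClosed (chart i ε) := by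
  refine IsClosed.and ?_ ?_
  · exact isClosed_eq continuous_norm continuous_const
  · exact isClosed_le continuous_const (by fun_prop)

lemma chart_subset (i : Fin (n + 1)) (ε : ℝ) : chart i ε ⊆ sphere 0 1 := fun ω h => by
  simpa using h.1

lemma sphere_subset (n : ℕ) : sphere (0 : EuclideanSpace ℝ (Fin (n + 1))) 1 ⊆
    ⋃ a ∈ (Finset.univ : Finset (Fin (n + 1))) ×ˢ ({1, -1} : Finset ℝ), chart a.1 a.2 := by
  intro ω hω
  have h1 : ‖ω‖ = 1 := by simpa using hω
  have hsum : ∑ j, ω j ^ 2 = 1 := by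
    have := EuclideanSpace.norm_sq_eq ω
    rw [h1] at this
    simpa using this.symm
  obtain ⟨i, hi⟩ : ∃ i, 1 / (n + 1 : ℝ) ≤ |ω i| := by
    by_contra! h
    have : ∑ j, ω j ^ 2 < ∑ _j : Fin (n + 1), 1 / (n + 1 : ℝ) := by
      refine Finset.sum_lt_sum_of_nonempty Finset.univ_nonempty fun j _ => ?_
      have h2 : 1 / (n + 1 : ℝ) ≤ 1 := by
        rw [div_le_one (by positivity)]
        linarith [(Nat.cast_nonneg n : (0 : ℝ) ≤ n)]
      rw [← sq_abs]
      nlinarith [h j, abs_nonneg (ω j)]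
    rw [hsum] at this
    simp at this
    rw [mul_inv_cancel₀ (by positivity)] at this
    exact lt_irrefl _ this
  simp only [mem_iUnion]
  rcases abs_cases (ω i) with h | h
  · exact ⟨(i, 1), by simp, h1, hi.trans (by rw [h.1, one_mul])⟩
  · exact ⟨(i, -1), by simp, h1, hi.trans (by rw [h.1, neg_one_mul])⟩

lemma freq_place (hε : ε ^ 2 = 1) (x ω : EuclideanSpace ℝ (Fin (n + 1))) :
    (waves i ε).freq ω (place i ε x) = -⟪x, ω⟫_ℝ := by
  rw [WaveFamily.freq_apply, PiLp.inner_apply, Fin.sum_univ_succAbove _ i]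
  simp only [waves, place, dotProduct, RCLike.inner_apply, conj_trivial, neg_add_rev,
    Finset.sum_neg_distrib, mul_neg]
  linear_combination (-(ω i * x i)) * hε

lemma sum_sq_succAbove {ω : EuclideanSpace ℝ (Fin (n + 1))} (h : ‖ω‖ = 1) (i : Fin (n + 1)) :
    ω i ^ 2 + ∑ j, ω (i.succAbove j) ^ 2 = 1 := by
  have := EuclideanSpace.norm_sq_eq ω
  rw [h, Fin.sum_univ_succAbove _ i] at this
  simpa using this.symm

lemma waves_convex (hε : ε ^ 2 = 1) {ω η : EuclideanSpace ℝ (Fin (n + 1))} (hω : ω ∈ chart i ε)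
    (hη : η ∈ chart i ε) :
    (waves i ε).σ ω - (waves i ε).σ η - (waves i ε).p η ⬝ᵥ ((waves i ε).y ω - (waves i ε).y η) =
      ((ω i - η i) ^ 2 + ∑ j, (ω (i.succAbove j) - η (i.succAbove j)) ^ 2) / (2 * (ε * η i)) := by
  have h0 : 0 < ε * η i := lt_of_lt_of_le (by positivity) hη.2
  have h1 := sum_sq_succAbove hω.1 i
  have h2 := sum_sq_succAbove hη.1 i
  have e : ∑ j, (ω (i.succAbove j) - η (i.succAbove j)) ^ 2 =
      ∑ j, ω (i.succAbove j) ^ 2 + ∑ j, η (i.succAbove j) ^ 2 -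
        2 * ∑ j, η (i.succAbove j) * ω (i.succAbove j) := by
    rw [Finset.mul_sum, ← Finset.sum_add_distrib, ← Finset.sum_sub_distrib]
    exact Finset.sum_congr rfl fun j _ => by ring
  have e2 : (waves i ε).p η ⬝ᵥ ((waves i ε).y ω - (waves i ε).y η) =
      (∑ j, η (i.succAbove j) * ω (i.succAbove j) - ∑ j, η (i.succAbove j) ^ 2) / (ε * η i) := by
    simp only [waves, dotProduct, Pi.sub_apply]
    rw [← Finset.sum_sub_distrib, Finset.sum_div]
    exact Finset.sum_congr rfl fun j _ => by ring
  rw [e, e2]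
  simp only [waves]
  rw [eq_div_iff (by positivity), sub_mul, div_mul_eq_mul_div, sub_eq_iff_eq_add,
    ← sub_eq_iff_eq_add', eq_div_iff h0.ne']
  linear_combination (ε * η i) * ((-1) * h1 - h2 + 2 * h2) + (ε * η i) * (2 * η i ^ 2 - 2 * ω i * η i) * hε

end SphereChart

namespace SphereChart

variable {n : ℕ} {i : Fin (n + 1)} {ε : ℝ}

/-- The regularity constant of the charts. -/
noncomputable def chartConst (n : ℕ) : ℝ := 2 * (n + 1 : ℝ) ^ 5

lemma one_le_chartConst (n : ℕ) : 1 ≤ chartConst n := by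
  have : 1 ≤ (n + 1 : ℝ) ^ 5 := one_le_pow₀ (by linarith [(Nat.cast_nonneg n : (0 : ℝ) ≤ n)])
  unfold chartConst
  linarith

lemma abs_apply_le {ω : EuclideanSpace ℝ (Fin (n + 1))} (h : ‖ω‖ = 1) (j : Fin (n + 1)) :
    |ω j| ≤ 1 := by
  simpa [h] using PiLp.norm_apply_le ω j

lemma height_pos {ω : EuclideanSpace ℝ (Fin (n + 1))} (hω : ω ∈ chart i ε) : 0 < ε * ω i :=
  lt_of_lt_of_le (by positivity) hω.2

lemma abs_div_height_le {ω : EuclideanSpace ℝ (Fin (n + 1))} (hω : ω ∈ chart i ε) (x : ℝ) :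
    |x / (ε * ω i)| ≤ (n + 1) * |x| := by
  have h0 := height_pos hω
  have h1 := hω.2
  rw [abs_div, abs_of_pos h0, div_le_iff₀ h0]
  rw [div_le_iff₀ (by positivity)] at h1
  nlinarith [abs_nonneg x]

lemma abs_height_sub_le (hε : ε ^ 2 = 1) {ω η : EuclideanSpace ℝ (Fin (n + 1))}
    (hω : ω ∈ chart i ε) (hη : η ∈ chart i ε) :
    |ω i - η i| ≤ n * (n + 1) * ‖(waves i ε).y ω - (waves i ε).y η‖ := by
  set Δ := ‖(waves i ε).y ω - (waves i ε).y η‖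
  have hΔ : ∀ j, |ω (i.succAbove j) - η (i.succAbove j)| ≤ Δ := fun j =>
    norm_le_pi_norm ((waves i ε).y ω - (waves i ε).y η) j
  have h1 := sum_sq_succAbove hω.1 i
  have h2 := sum_sq_succAbove hη.1 i
  have h3 : |ω i ^ 2 - η i ^ 2| ≤ n * (2 * Δ) := by
    have e : ω i ^ 2 - η i ^ 2 = ∑ j, (η (i.succAbove j) ^ 2 - ω (i.succAbove j) ^ 2) := by
      rw [Finset.sum_sub_distrib]
      linarith
    rw [e]
    refine (Finset.abs_sum_le_sum_abs _ _).trans ?_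
    refine (Finset.sum_le_card_nsmul _ _ (2 * Δ) fun j _ => ?_).trans_eq (by simp)
    rw [sq_sub_sq, abs_mul, abs_sub_comm (η _)]
    have h4 := abs_add_le (η (i.succAbove j)) (ω (i.succAbove j))
    have h5 := abs_apply_le hω.1 (i.succAbove j)
    have h6 := abs_apply_le hη.1 (i.succAbove j)
    exact mul_le_mul (by linarith) (hΔ j) (abs_nonneg _) (by norm_num)
  have h4 : |ω i ^ 2 - η i ^ 2| = (ε * ω i + ε * η i) * |ω i - η i| := by
    have h0 : 0 ≤ ε * ω i + ε * η i := (add_pos (height_pos hω) (height_pos hη)).le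
    have hε1 : |ε| = 1 := by
      rw [← abs_one, ← sq_eq_sq_iff_abs_eq_abs, hε, one_pow]
    rw [← abs_of_nonneg h0, ← mul_add, abs_mul, hε1, one_mul, ← abs_mul]
    congr 1
    ring
  have hN : (0 : ℝ) < n + 1 := by positivity
  have h5 : 2 ≤ (n + 1) * (ε * ω i + ε * η i) := by
    have := hω.2
    have := hη.2
    rw [div_le_iff₀ hN] at *
    linarith
  have h6 : 2 * |ω i - η i| ≤ (n + 1) * (n * (2 * Δ)) := by
    calc 2 * |ω i - η i| ≤ ((n + 1) * (ε * ω i + ε * η i)) * |ω i - η i| :=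
          mul_le_mul_of_nonneg_right h5 (abs_nonneg _)
      _ = (n + 1) * |ω i ^ 2 - η i ^ 2| := by rw [h4]; ring
      _ ≤ _ := mul_le_mul_of_nonneg_left h3 hN.le
  linarith

lemma isConv_waves (hε : ε ^ 2 = 1) {s : Finset (EuclideanSpace ℝ (Fin (n + 1)))}
    (hs : ↑s ⊆ chart i ε) : (waves i ε).IsConv (chartConst n) s := by
  have hn : (0 : ℝ) ≤ n := Nat.cast_nonneg n
  have hN : (1 : ℝ) ≤ n + 1 := by linarith
  have hp : ∀ a b : ℕ, a ≤ b → (n + 1 : ℝ) ^ a ≤ (n + 1 : ℝ) ^ b := fun a b h =>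
    pow_le_pow_right₀ hN h
  have hA := one_le_chartConst n
  have hε1 : |ε| = 1 := by
    rw [← abs_one, ← sq_eq_sq_iff_abs_eq_abs, hε, one_pow]
  have hh : ∀ ω ∈ s, ε * ω i ≤ 1 := fun ω hω => by
    refine (le_abs_self _).trans ?_
    rw [abs_mul, hε1, one_mul]
    exact abs_apply_le (hs hω).1 i
  refine ⟨fun k hk => ?_, fun k hk => ?_, fun k hk l hl => ?_, fun k hk l hl => ?_,
    fun k hk l hl => ?_⟩
  · refine (pi_norm_le_iff_of_nonneg one_pos.le).2 fun j => ?_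
    exact abs_apply_le (hs hk).1 _
  · refine (pi_norm_le_iff_of_nonneg (by linarith)).2 fun j => ?_
    refine (abs_div_height_le (hs hk) _).trans ?_
    have := abs_apply_le (hs hk).1 (i.succAbove j)
    have := hp 1 5 (by norm_num)
    unfold chartConst
    nlinarith
  · set Δ := ‖(waves i ε).y k - (waves i ε).y l‖
    have hΔ0 : 0 ≤ Δ := norm_nonneg _
    refine (pi_norm_le_iff_of_nonneg (by positivity)).2 fun j => ?_
    have hΔ : |k (i.succAbove j) - l (i.succAbove j)| ≤ Δ :=
      norm_le_pi_norm ((waves i ε).y k - (waves i ε).y l) j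
    have h1 := abs_height_sub_le hε (hs hk) (hs hl)
    have hk0 := height_pos (hs hk)
    have hl0 := height_pos (hs hl)
    have e : ((waves i ε).p k - (waves i ε).p l) j =
        (k (i.succAbove j) - l (i.succAbove j)) / (ε * k i) -
          (l (i.succAbove j) * (ε * (k i - l i)) / (ε * k i)) / (ε * l i) := by
      simp only [waves, Pi.sub_apply]
      rw [eq_comm, sub_eq_iff_eq_add, div_sub_div _ _ hk0.ne' hl0.ne', div_div,
        ← add_div, div_eq_div_iff hk0.ne' (mul_pos hk0 hl0).ne']
      ring
    rw [e, Real.norm_eq_abs]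
    refine (abs_sub _ _).trans ?_
    have h2 := abs_div_height_le (hs hk) (k (i.succAbove j) - l (i.succAbove j))
    have h3 := abs_div_height_le (hs hl) (l (i.succAbove j) * (ε * (k i - l i)) / (ε * k i))
    have h4 := abs_div_height_le (hs hk) (l (i.succAbove j) * (ε * (k i - l i)))
    rw [abs_mul, abs_mul, hε1, one_mul] at h4
    have h5 := abs_apply_le (hs hl).1 (i.succAbove j)
    have h6 : |l (i.succAbove j)| * |k i - l i| ≤ n * (n + 1) * Δ := by
      calc _ ≤ 1 * |k i - l i| := mul_le_mul_of_nonneg_right h5 (abs_nonneg _)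
        _ ≤ _ := by rw [one_mul]; exact h1
    have hN0 : (0 : ℝ) ≤ n + 1 := by linarith
    calc _ ≤ (n + 1) * Δ + (n + 1) * ((n + 1) * (n * (n + 1) * Δ)) := by
            refine add_le_add (h2.trans (mul_le_mul_of_nonneg_left hΔ hN0))
              (h3.trans (mul_le_mul_of_nonneg_left (h4.trans ?_) hN0))
            exact mul_le_mul_of_nonneg_left h6 hN0
      _ ≤ (n + 1 : ℝ) ^ 5 * Δ + (n + 1 : ℝ) ^ 5 * Δ := by
            have h7 := mul_le_mul_of_nonneg_right (hp 1 5 (by norm_num)) hΔ0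
            have h8 := mul_le_mul_of_nonneg_right (hp 4 5 (by norm_num)) hΔ0
            have h9 : (n : ℝ) * ((n + 1) ^ 3 * Δ) ≤ (n + 1) * ((n + 1) ^ 3 * Δ) :=
              mul_le_mul_of_nonneg_right (by linarith) (by positivity)
            nlinarith
      _ = _ := by unfold chartConst; ring
  · set Δ := ‖(waves i ε).y k - (waves i ε).y l‖
    rw [waves_convex hε (hs hk) (hs hl)]
    have hl0 := height_pos (hs hl)
    have h1 : Δ ^ 2 ≤ (k i - l i) ^ 2 +
        ∑ j, (k (i.succAbove j) - l (i.succAbove j)) ^ 2 := by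
      have h2 : Δ ≤ √((k i - l i) ^ 2 +
          ∑ j, (k (i.succAbove j) - l (i.succAbove j)) ^ 2) := by
        refine (pi_norm_le_iff_of_nonneg (Real.sqrt_nonneg _)).2 fun j => ?_
        refine Real.abs_le_sqrt ?_
        refine (Finset.single_le_sum (f := fun j => (k (i.succAbove j) - l (i.succAbove j)) ^ 2)
          (fun _ _ => sq_nonneg _) (Finset.mem_univ j)).trans ?_
        linarith [sq_nonneg (k i - l i)]
      have := pow_le_pow_left₀ (norm_nonneg _) h2 2
      rwa [Real.sq_sqrt (by positivity)] at this
    rw [le_div_iff₀ (by positivity), inv_mul_eq_div, div_mul_eq_mul_div, div_le_iff₀ (by linarith)]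
    have h3 : 2 * (ε * l i) ≤ chartConst n := by
      have := hh l hl
      have := one_le_pow₀ hN (n := 5)
      unfold chartConst
      linarith
    nlinarith [sq_nonneg Δ]
  · set Δ := ‖(waves i ε).y k - (waves i ε).y l‖
    have hΔ0 : 0 ≤ Δ := norm_nonneg _
    rw [waves_convex hε (hs hk) (hs hl)]
    have hl0 := height_pos (hs hl)
    have h1 : (k i - l i) ^ 2 ≤ (n * (n + 1) * Δ) ^ 2 := by
      rw [← sq_abs]
      exact pow_le_pow_left₀ (abs_nonneg _) (abs_height_sub_le hε (hs hk) (hs hl)) 2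
    have h2 : ∑ j, (k (i.succAbove j) - l (i.succAbove j)) ^ 2 ≤ n * Δ ^ 2 := by
      refine (Finset.sum_le_card_nsmul _ _ (Δ ^ 2) fun j _ => ?_).trans_eq (by simp)
      rw [← sq_abs]
      exact pow_le_pow_left₀ (abs_nonneg _)
        (norm_le_pi_norm ((waves i ε).y k - (waves i ε).y l) j) 2
    rw [div_le_iff₀ (by positivity)]
    have h3 := (hs hl).2
    rw [div_le_iff₀ (by positivity)] at h3
    have h4 : 2 * (n + 1 : ℝ) ^ 4 * Δ ^ 2 ≤ chartConst n * Δ ^ 2 * (2 * (ε * l i)) := by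
      have h5 := mul_le_mul_of_nonneg_left h3
        (by positivity : 0 ≤ 4 * (n + 1 : ℝ) ^ 4 * Δ ^ 2)
      have h6 : 0 ≤ (n + 1 : ℝ) ^ 4 * Δ ^ 2 := by positivity
      calc _ ≤ 4 * (n + 1 : ℝ) ^ 4 * Δ ^ 2 * 1 := by linarith
        _ ≤ _ := h5.trans_eq (by unfold chartConst; ring)
    have h5 : (n * (n + 1) * Δ) ^ 2 ≤ (n + 1 : ℝ) ^ 4 * Δ ^ 2 := by
      have : (n * (n + 1) : ℝ) ≤ (n + 1) ^ 2 := by nlinarith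
      calc (n * (n + 1) * Δ) ^ 2 = (n * (n + 1) : ℝ) ^ 2 * Δ ^ 2 := by ring
        _ ≤ ((n + 1 : ℝ) ^ 2) ^ 2 * Δ ^ 2 := by gcongr
        _ = _ := by ring
    have h6 : n * Δ ^ 2 ≤ (n + 1 : ℝ) ^ 4 * Δ ^ 2 := by
      have := hp 1 4 (by norm_num)
      exact mul_le_mul_of_nonneg_right (by linarith) (sq_nonneg _)
    linarith

/-- The affine hyperplane parametrised by the gnomonic coordinates. -/
noncomputable def lift (i : Fin (n + 1)) (ε : ℝ) (z : Fin n → ℝ) :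
    EuclideanSpace ℝ (Fin (n + 1)) :=
  WithLp.toLp 2 (i.insertNth ε z)

lemma norm_lift_sub_le (z w : Fin n → ℝ) : ‖lift i ε z - lift i ε w‖ ≤ √n * ‖z - w‖ := by
  rw [EuclideanSpace.norm_eq, Fin.sum_univ_succAbove _ i]
  rw [← Real.sqrt_sq (norm_nonneg (z - w)), ← Real.sqrt_mul (Nat.cast_nonneg n)]
  refine Real.sqrt_le_sqrt ?_
  simp only [lift, PiLp.sub_apply, Fin.insertNth_apply_same, Fin.insertNth_apply_succAbove,
    sub_self, norm_zero]
  rw [zero_pow two_ne_zero, zero_add]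
  refine (Finset.sum_le_card_nsmul _ _ (‖z - w‖ ^ 2) fun j _ => ?_).trans_eq (by simp)
  exact pow_le_pow_left₀ (norm_nonneg _) (norm_le_pi_norm (z - w) j) 2

lemma one_le_norm_lift (hε : ε ^ 2 = 1) (z : Fin n → ℝ) : 1 ≤ ‖lift i ε z‖ := by
  have h := PiLp.norm_apply_le (lift i ε z) i
  have hε1 : |ε| = 1 := by
    rw [← abs_one, ← sq_eq_sq_iff_abs_eq_abs, hε, one_pow]
  simpa [lift, hε1] using h

lemma eq_smul_lift (hε : ε ^ 2 = 1) {ω : EuclideanSpace ℝ (Fin (n + 1))} (hω : ω ∈ chart i ε) :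
    ω = (ε * ω i) • lift i ε ((waves i ε).p ω) := by
  have h0 := height_pos hω
  ext j
  rcases Fin.eq_self_or_eq_succAbove i j with rfl | ⟨j, rfl⟩
  · simp only [lift, PiLp.smul_apply, Fin.insertNth_apply_same, smul_eq_mul]
    linear_combination -(ω j) * hε
  · simp only [lift, PiLp.smul_apply, Fin.insertNth_apply_succAbove, smul_eq_mul, waves]
    rw [mul_div_cancel₀ _ h0.ne']

lemma height_eq (hε : ε ^ 2 = 1) {ω : EuclideanSpace ℝ (Fin (n + 1))} (hω : ω ∈ chart i ε) :
    ε * ω i = ‖lift i ε ((waves i ε).p ω)‖⁻¹ := by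
  have h := congrArg norm (eq_smul_lift hε hω)
  rw [norm_smul, hω.1, Real.norm_eq_abs, abs_of_pos (height_pos hω)] at h
  exact eq_inv_of_mul_eq_one_left h.symm

lemma lipschitzWith_normalize (hε : ε ^ 2 = 1) :
    LipschitzWith (2 * NNReal.sqrt n) fun z => ‖lift i ε z‖⁻¹ • lift i ε z := by
  refine LipschitzWith.of_dist_le_mul fun z w => ?_
  rw [dist_eq_norm, dist_eq_norm]
  set a := lift i ε z
  set b := lift i ε w
  have ha : 1 ≤ ‖a‖ := one_le_norm_lift hε z
  have hb : 1 ≤ ‖b‖ := one_le_norm_lift hε w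
  have e : ‖a‖⁻¹ • a - ‖b‖⁻¹ • b = ‖a‖⁻¹ • ((a - b) + ((‖b‖ - ‖a‖) * ‖b‖⁻¹) • b) := by
    rw [smul_add, smul_smul, smul_sub, sub_add_eq_add_sub, ← sub_eq_zero]
    have : ‖a‖⁻¹ * ((‖b‖ - ‖a‖) * ‖b‖⁻¹) = ‖a‖⁻¹ - ‖b‖⁻¹ := by
      field_simp
    rw [this, sub_smul]
    abel
  have h1 : ‖((‖b‖ - ‖a‖) * ‖b‖⁻¹) • b‖ ≤ ‖a - b‖ := by
    rw [norm_smul, norm_mul, norm_inv, norm_norm, mul_assoc, inv_mul_cancel₀ (by linarith),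
      mul_one, Real.norm_eq_abs, abs_sub_comm]
    exact abs_norm_sub_norm_le a b
  have h2 : ‖a - b‖ ≤ √n * ‖z - w‖ := norm_lift_sub_le z w
  rw [e, norm_smul, norm_inv, norm_norm]
  have h3 : ‖a‖⁻¹ ≤ 1 := inv_le_one_of_one_le₀ ha
  calc ‖a‖⁻¹ * _ ≤ 1 * (‖a - b‖ + ‖a - b‖) :=
        mul_le_mul h3 ((norm_add_le _ _).trans (by linarith)) (norm_nonneg _) one_pos.le
    _ ≤ 2 * √n * ‖z - w‖ := by linarith
    _ = _ := by simp

/-- The surface measure is controlled by the Lebesgue measure in gnomonic coordinates. -/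
lemma hausdorffMeasure_le (hε : ε ^ 2 = 1) {S : Set (EuclideanSpace ℝ (Fin (n + 1)))}
    (hS : S ⊆ chart i ε) :
    μH[(n : ℝ)] S ≤ (2 * NNReal.sqrt n : NNReal) ^ (n : ℝ) * volume ((waves i ε).p '' S) := by
  have h1 : S ⊆ (fun z => ‖lift i ε z‖⁻¹ • lift i ε z) '' ((waves i ε).p '' S) := by
    intro ω hω
    refine ⟨_, ⟨ω, hω, rfl⟩, ?_⟩
    dsimp only
    rw [← height_eq hε (hS hω)]
    exact (eq_smul_lift hε (hS hω)).symm
  refine (measure_mono h1).trans ?_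
  refine ((lipschitzWith_normalize hε).hausdorffMeasure_image_le (Nat.cast_nonneg n) _).trans_eq ?_
  have h2 : (μH[(n : ℝ)] : Measure (Fin n → ℝ)) = volume := by
    have := hausdorffMeasure_pi_real (ι := Fin n)
    rwa [Fintype.card_fin] at this
  rw [h2]

/-- The comparison constant between the surface measure and gnomonic coordinates. -/
noncomputable def surfConst (n : ℕ) : ℝ := (2 * √n) ^ n

lemma hausdorffMeasure_le_ofReal (hε : ε ^ 2 = 1) {S : Set (EuclideanSpace ℝ (Fin (n + 1)))}
    (hS : S ⊆ chart i ε) {a : Fin n → ℝ} {r : ℝ} (hr : 0 ≤ r)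
    (h : ∀ ω ∈ S, ‖(waves i ε).p ω - a‖ ≤ r) :
    μH[(n : ℝ)] S ≤ ENNReal.ofReal (surfConst n * (2 * r) ^ n) := by
  refine (hausdorffMeasure_le hε hS).trans ?_
  have h1 : volume ((waves i ε).p '' S) ≤ ENNReal.ofReal ((2 * r) ^ n) := by
    have := Real.volume_pi_closedBall a hr
    rw [Fintype.card_fin] at this
    rw [← this]
    refine measure_mono ?_
    rintro _ ⟨ω, hω, rfl⟩
    rw [mem_closedBall, dist_eq_norm]
    exact h ω hω
  have h2 : ((2 * NNReal.sqrt n : NNReal) : ℝ≥0∞) ^ (n : ℝ) = ENNReal.ofReal (surfConst n) := by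
    rw [ENNReal.rpow_natCast, ← ENNReal.ofReal_coe_nnreal, ← ENNReal.ofReal_pow (NNReal.coe_nonneg _)]
    simp [surfConst]
  rw [h2, ENNReal.ofReal_mul (by unfold surfConst; positivity)]
  exact mul_le_mul_right h1 _

lemma surfConst_nonneg (n : ℕ) : 0 ≤ surfConst n := by unfold surfConst; positivity

lemma norm_p_le {ω : EuclideanSpace ℝ (Fin (n + 1))} (hω : ω ∈ chart i ε) :
    ‖(waves i ε).p ω‖ ≤ n + 1 := by
  refine (pi_norm_le_iff_of_nonneg (by positivity)).2 fun j => ?_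
  refine (abs_div_height_le hω _).trans ?_
  have := abs_apply_le hω.1 (i.succAbove j)
  have : (0 : ℝ) ≤ n + 1 := by positivity
  nlinarith

lemma hausdorffMeasure_chart_lt_top (hε : ε ^ 2 = 1) : μH[(n : ℝ)] (chart i ε) < ⊤ :=
  (hausdorffMeasure_le_ofReal (a := 0) (r := n + 1) hε subset_rfl (by positivity) fun ω hω => by
    rw [sub_zero]; exact norm_p_le hω).trans_lt ENNReal.ofReal_lt_top

lemma sq_eq_one_of_mem {a : Fin (n + 1) × ℝ}
    (ha : a ∈ (Finset.univ : Finset (Fin (n + 1))) ×ˢ ({1, -1} : Finset ℝ)) : a.2 ^ 2 = 1 := by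
  have := (Finset.mem_product.1 ha).2
  rcases Finset.mem_insert.1 this with h | h
  · rw [h, one_pow]
  · rw [Finset.mem_singleton.1 h]; norm_num

lemma hausdorffMeasure_sphere_lt_top (n : ℕ) :
    μH[(n : ℝ)] (sphere (0 : EuclideanSpace ℝ (Fin (n + 1))) 1) < ⊤ := by
  refine (measure_mono (sphere_subset n)).trans_lt ?_
  refine (measure_biUnion_finset_le _ _).trans_lt ?_
  exact ENNReal.sum_lt_top.2 fun a ha => hausdorffMeasure_chart_lt_top (sq_eq_one_of_mem ha)

lemma sphereMeasure_succ (n : ℕ) : sphereMeasure (n + 1) =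
    (μH[(n : ℝ)]).restrict (sphere (0 : EuclideanSpace ℝ (Fin (n + 1))) 1) := by
  unfold sphereMeasure
  congr 2
  push_cast
  ring

instance isFiniteMeasure_sphereMeasure (n : ℕ) : IsFiniteMeasure (sphereMeasure (n + 1)) := by
  rw [sphereMeasure_succ]
  exact ⟨by rw [Measure.restrict_apply_univ]; exact hausdorffMeasure_sphere_lt_top n⟩

/-- An integral over the sphere is controlled by the integrals over the charts. -/
lemma integral_sphere_le {f : EuclideanSpace ℝ (Fin (n + 1)) → ℝ} (hf0 : ∀ ω, 0 ≤ f ω)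
    (hf : Integrable f (sphereMeasure (n + 1))) {M : ℝ}
    (h : ∀ i ε, ε ^ 2 = 1 → ∫ ω in chart i ε, f ω ∂(μH[(n : ℝ)]) ≤ M) :
    ∫ ω, f ω ∂(sphereMeasure (n + 1)) ≤ 2 * (n + 1) * M := by
  rw [sphereMeasure_succ] at hf ⊢
  set K := (Finset.univ : Finset (Fin (n + 1))) ×ˢ ({1, -1} : Finset ℝ)
  have h1 : (μH[(n : ℝ)]).restrict (sphere (0 : EuclideanSpace ℝ (Fin (n + 1))) 1) ≤
      ∑ a ∈ K, (μH[(n : ℝ)]).restrict (chart a.1 a.2) := by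
    refine (Measure.restrict_mono (sphere_subset n) le_rfl).trans ?_
    refine Measure.le_iff.2 fun S hS => ?_
    rw [Measure.restrict_apply hS, Measure.finsetSum_apply]
    simp only [Measure.restrict_apply hS, inter_iUnion]
    exact measure_biUnion_finset_le _ _
  have hi : ∀ a ∈ K, Integrable f ((μH[(n : ℝ)]).restrict (chart a.1 a.2)) := fun a _ =>
    hf.mono_measure (Measure.restrict_mono (chart_subset _ _) le_rfl)
  refine (integral_mono_measure h1 (Eventually.of_forall hf0)
    (integrable_finsetSum_measure.2 hi)).trans ?_
  rw [integral_finsetSum_measure hi]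
  refine (Finset.sum_le_card_nsmul _ _ M fun a ha => h _ _ (sq_eq_one_of_mem ha)).trans_eq ?_
  have : K.card = (n + 1) * 2 := by
    rw [Finset.card_product, Finset.card_univ, Fintype.card_fin, Finset.card_pair (by norm_num)]
  rw [this, nsmul_eq_mul]
  push_cast
  ring

end SphereChart

namespace IsAlphaDimensional

variable {d : ℕ} {α : ℝ} {μ : Measure (EuclideanSpace ℝ (Fin d))}

lemma measure_ball_le (h : IsAlphaDimensional d α μ) (x : EuclideanSpace ℝ (Fin d)) {r : ℝ}
    (hr : 0 < r) : μ (ball x r) ≤ ENNReal.ofReal ((cAlpha d α μ).toReal * r ^ α) := by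
  have hrα : 0 < r ^ α := Real.rpow_pos_of_pos hr α
  have h1 : μ (ball x r) / ENNReal.ofReal (r ^ α) ≤ cAlpha d α μ :=
    le_iSup_of_le x (le_iSup_of_le r (le_iSup_of_le hr le_rfl))
  rw [ENNReal.div_le_iff (by simpa using hrα) ENNReal.ofReal_ne_top] at h1
  rwa [ENNReal.ofReal_mul ENNReal.toReal_nonneg, ENNReal.ofReal_toReal h.2]

lemma measureReal_ball_le (h : IsAlphaDimensional d α μ) (x : EuclideanSpace ℝ (Fin d)) {r : ℝ}
    (hr : 0 < r) : μ.real (ball x r) ≤ (cAlpha d α μ).toReal * r ^ α := by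
  refine ENNReal.toReal_le_of_le_ofReal ?_ (h.measure_ball_le x hr)
  exact mul_nonneg ENNReal.toReal_nonneg (Real.rpow_nonneg hr.le α)

lemma measure_univ_le (h : IsAlphaDimensional d α μ) : μ univ ≤ μ (ball 0 2) := by
  rw [← union_compl_self (closedBall (0 : EuclideanSpace ℝ (Fin d)) 1)]
  refine (measure_union_le _ _).trans ?_
  rw [h.1, add_zero]
  exact measure_mono (closedBall_subset_ball (by norm_num))

lemma isFiniteMeasure (h : IsAlphaDimensional d α μ) : IsFiniteMeasure μ :=
  ⟨(h.measure_univ_le.trans (h.measure_ball_le 0 two_pos)).trans_lt ENNReal.ofReal_lt_top⟩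

lemma eq_zero (h : IsAlphaDimensional d α μ) (h0 : (cAlpha d α μ).toReal = 0) : μ = 0 := by
  rw [← Measure.measure_univ_eq_zero]
  have := h.measure_univ_le.trans (h.measure_ball_le 0 two_pos)
  rw [h0, zero_mul, ENNReal.ofReal_zero] at this
  exact nonpos_iff_eq_zero.1 this

end IsAlphaDimensional

namespace SphereChart

variable {n : ℕ} {i : Fin (n + 1)} {ε : ℝ}

lemma norm_place_fst_le (x : EuclideanSpace ℝ (Fin (n + 1))) : ‖(place i ε x).1‖ ≤ ‖x‖ := by
  refine (pi_norm_le_iff_of_nonneg (norm_nonneg _)).2 fun j => ?_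
  simpa [place] using PiLp.norm_apply_le x (i.succAbove j)

lemma abs_eq_one (hε : ε ^ 2 = 1) : |ε| = 1 := by
  rw [← abs_one, ← sq_eq_sq_iff_abs_eq_abs, hε, one_pow]

lemma abs_place_snd_le (hε : ε ^ 2 = 1) (x : EuclideanSpace ℝ (Fin (n + 1))) :
    |(place i ε x).2| ≤ ‖x‖ := by
  simpa [place, abs_mul, abs_eq_one hε] using PiLp.norm_apply_le x i

lemma abs_apply_sub_le (hε : ε ^ 2 = 1) (x x' : EuclideanSpace ℝ (Fin (n + 1)))
    (j : Fin (n + 1)) : |x j - x' j| ≤ ‖place i ε x - place i ε x'‖ := by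
  rcases Fin.eq_self_or_eq_succAbove i j with rfl | ⟨j, rfl⟩
  · have := norm_snd_le (place j ε x - place j ε x')
    refine le_trans (le_of_eq ?_) this
    simp only [place, Prod.snd_sub, Real.norm_eq_abs]
    rw [← mul_sub, abs_mul, abs_eq_one hε, one_mul]
  · refine le_trans ?_ (norm_fst_le (place i ε x - place i ε x'))
    refine le_trans (le_of_eq ?_) (norm_le_pi_norm _ j)
    simp only [place, Prod.fst_sub, Pi.sub_apply, Real.norm_eq_abs]
    rw [← abs_neg]
    congr 1
    ring

lemma norm_lt_of_apply {x : EuclideanSpace ℝ (Fin (n + 1))} {r : ℝ} (hr : 0 < r)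
    (h : ∀ j, |x j| ≤ r) : ‖x‖ < (n + 2) * r := by
  have h1 : ‖x‖ ^ 2 ≤ (n + 1) * r ^ 2 := by
    rw [EuclideanSpace.norm_sq_eq]
    refine (Finset.sum_le_card_nsmul _ _ (r ^ 2) fun j _ => ?_).trans_eq (by simp)
    exact pow_le_pow_left₀ (norm_nonneg _) (h j) 2
  have hn : (0 : ℝ) ≤ n := Nat.cast_nonneg n
  refine lt_of_pow_lt_pow_left₀ 2 (by positivity) (h1.trans_lt ?_)
  have : (0 : ℝ) < r ^ 2 := by positivity
  nlinarith

/-- The index of the cube of side `1 / R` containing a point. -/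
noncomputable def cube (R : ℝ) (x : EuclideanSpace ℝ (Fin (n + 1))) : Fin (n + 1) → ℤ :=
  fun j => ⌊R * x j⌋

lemma measurable_cube (R : ℝ) : Measurable (cube (n := n) R) := by
  refine measurable_pi_lambda _ fun j => ?_
  exact Int.measurable_floor.comp (by fun_prop)

lemma abs_sub_le_of_cube_eq {R : ℝ} (hR : 0 < R) {x x' : EuclideanSpace ℝ (Fin (n + 1))}
    (h : cube R x = cube R x') (j : Fin (n + 1)) : |x j - x' j| ≤ 1 / R := by
  have h1 : ⌊R * x j⌋ = ⌊R * x' j⌋ := congrFun h j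
  have := (Int.abs_sub_lt_one_of_floor_eq_floor h1).le
  rw [← mul_sub, abs_mul, abs_of_pos hR] at this
  rwa [le_div_iff₀ hR, mul_comm]

/-- The multiplicity constant of the charts. -/
noncomputable def multConst (n : ℕ) : ℝ := (2 * chartConst n + 2) ^ n

/-- The Frostman property of the discretised measure. -/
lemma sum_measureReal_le {α : ℝ} (hε : ε ^ 2 = 1)
    {μ : Measure (EuclideanSpace ℝ (Fin (n + 1)))} (hμ : IsAlphaDimensional (n + 1) α μ)
    {R : ℝ} (hR : 1 ≤ R) {J : Finset (EuclideanSpace ℝ (Fin (n + 1)))}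
    (hJ : Set.InjOn (cube R) (J : Set (EuclideanSpace ℝ (Fin (n + 1)))))
    (G : Set (EuclideanSpace ℝ (Fin (n + 1)))) (hG : MeasurableSet G) {r : ℝ} (hr : 1 ≤ r)
    (y : SpaceTime n) (hy : ∀ x ∈ J, ‖place i ε (R • x) - y‖ ≤ r) :
    ∑ x ∈ J, μ.real (cube R ⁻¹' {cube R x} ∩ G) ≤
      (cAlpha (n + 1) α μ).toReal * ((3 * (n + 2)) ^ α * R ^ (-α) * r ^ α) := by
  have := hμ.isFiniteMeasure
  have hR0 : 0 < R := by linarith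
  rcases J.eq_empty_or_nonempty with rfl | ⟨x₀, hx₀⟩
  · simp only [Finset.sum_empty]
    positivity
  rw [← measureReal_biUnion_finset ?_ fun x _ => (measurable_cube R (measurableSet_singleton _)).inter hG]
  · have h1 : (⋃ x ∈ J, cube R ⁻¹' {cube R x} ∩ G) ⊆ ball x₀ ((n + 2) * (3 * r / R)) := by
      simp only [iUnion_subset_iff]
      rintro x hx z ⟨hz, -⟩
      rw [mem_ball, dist_eq_norm]
      refine norm_lt_of_apply (by positivity) fun j => ?_
      have h2 := abs_sub_le_of_cube_eq hR0 (mem_singleton_iff.1 hz) j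
      have h3 : |x j - x₀ j| ≤ 2 * r / R := by
        have h4 := abs_apply_sub_le (i := i) hε (R • x) (R • x₀) j
        have h5 : ‖place i ε (R • x) - place i ε (R • x₀)‖ ≤ 2 * r := by
          rw [← sub_sub_sub_cancel_right _ _ y]
          refine (norm_sub_le _ _).trans ?_
          linarith [hy x hx, hy x₀ hx₀]
        simp only [PiLp.smul_apply, smul_eq_mul] at h4
        rw [← mul_sub, abs_mul, abs_of_pos hR0] at h4
        rw [le_div_iff₀ hR0]
        linarith
      rw [PiLp.sub_apply]
      refine (abs_sub_le _ (x j) _).trans ((add_le_add h2 h3).trans ?_)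
      rw [← add_div]
      exact div_le_div_of_nonneg_right (by linarith) hR0.le
    refine (measureReal_mono h1).trans ((hμ.measureReal_ball_le _ (by positivity)).trans_eq ?_)
    rw [Real.rpow_neg hR0.le, ← Real.inv_rpow hR0.le, ← Real.mul_rpow (by positivity) (by positivity),
      ← Real.mul_rpow (by positivity) (by positivity)]
    congr 2
    ring
  · intro a ha b hb hab
    refine Set.disjoint_left.2 fun z hz hz' => hab (hJ ha hb ?_)
    exact hz.1.symm.trans hz'.1

/-- The mean square of a superposition of plane waves with respect to a measure. -/
lemma integral_wave_sq_le {α θ T M R : ℝ} (hε : ε ^ 2 = 1)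
    (hB : Cfg.Bound n (chartConst n) (multConst n) α θ T M) (hR : 1 ≤ R) (hRT : R ≤ T)
    {μ : Measure (EuclideanSpace ℝ (Fin (n + 1)))} (hμ : IsAlphaDimensional (n + 1) α μ)
    {s : Finset (EuclideanSpace ℝ (Fin (n + 1)))} (hs : ↑s ⊆ chart i ε)
    (hinj : Set.InjOn (fun ω j => ⌊T * (waves i ε).p ω j⌋) (s : Set (EuclideanSpace ℝ (Fin (n + 1)))))
    (c : EuclideanSpace ℝ (Fin (n + 1)) → ℂ) :
    ∫ x, ‖(waves i ε).wave c s (place i ε (R • x))‖ ^ 2 ∂μ ≤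
      (3 * (n + 2)) ^ α * R ^ (-α) * (cAlpha (n + 1) α μ).toReal *
        (M * T ^ n * ∑ ω ∈ s, ‖c ω‖ ^ 2) := by
  classical
  have := hμ.isFiniteMeasure
  have hR0 : 0 < R := by linarith
  have hT0 : 0 < T := by linarith
  rcases ENNReal.toReal_nonneg.eq_or_lt (a := 0) (b := (cAlpha (n + 1) α μ).toReal) with h0 | h0
  · rw [hμ.eq_zero h0.symm, integral_zero_measure]
    have : (cAlpha (n + 1) α μ).toReal = 0 := h0.symm
    rw [hμ.eq_zero h0.symm] at this
    rw [this, mul_zero, zero_mul]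
  set a := (cAlpha (n + 1) α μ).toReal
  set f : EuclideanSpace ℝ (Fin (n + 1)) → ℝ :=
    fun x => ‖(waves i ε).wave c s (place i ε (R • x))‖ ^ 2
  set G := closedBall (0 : EuclideanSpace ℝ (Fin (n + 1))) 1
  have hf : Integrable f μ := by
    refine Integrable.of_bound (C := (∑ ω ∈ s, ‖c ω‖) ^ 2) ?_ (Eventually.of_forall fun x => ?_)
    · refine Continuous.aestronglyMeasurable ?_
      have h1 : Continuous fun x : EuclideanSpace ℝ (Fin (n + 1)) => place i ε (R • x) := by
        unfold place
        fun_prop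
      have h2 : Continuous fun y => (waves i ε).wave c s y := by
        unfold WaveFamily.wave expChar
        fun_prop
      exact ((h2.comp h1).norm.pow 2)
    · rw [Real.norm_of_nonneg (by positivity)]
      refine pow_le_pow_left₀ (norm_nonneg _) ?_ 2
      refine (norm_sum_le _ _).trans (Finset.sum_le_sum fun ω _ => ?_)
      rw [norm_mul, norm_expChar, mul_one]
  obtain ⟨P, hPG, hPinj, hP⟩ := exists_integral_le_sum (ν := μ) (φ := cube R)
    (fun q => measurable_cube R (measurableSet_singleton q)) (G := G) isClosed_closedBall.measurableSet
    hμ.1 (Fintype.piFinset fun _ => Finset.Icc ⌊-R⌋ ⌊R⌋) (fun x hx => by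
      refine Fintype.mem_piFinset.2 fun j => ?_
      have h1 : |x j| ≤ 1 := (PiLp.norm_apply_le x j).trans (by simpa [G] using hx)
      rw [abs_le] at h1
      exact Finset.mem_Icc.2 ⟨Int.floor_le_floor (by nlinarith), Int.floor_le_floor (by nlinarith)⟩) hf
  have hK : 0 < (3 * (n + 2) : ℝ) ^ α := by positivity
  have hRα : 0 < R ^ α := by positivity
  let X : Cfg n :=
    { κ := EuclideanSpace ℝ (Fin (n + 1))
      π := EuclideanSpace ℝ (Fin (n + 1))
      W := waves i ε
      s := s
      c := c
      P := P
      pos := fun x => place i ε (R • x)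
      wt := fun x => μ.real (cube R ⁻¹' {cube R x} ∩ G) / (a * ((3 * (n + 2)) ^ α * R ^ (-α))) }
  have hden : 0 < a * ((3 * (n + 2)) ^ α * R ^ (-α)) := by positivity
  have hfr : ∀ y r, 1 ≤ r → ∀ J ⊆ X.P, (∀ x ∈ J, ‖X.pos x - y‖ ≤ r) → ∑ x ∈ J, X.wt x ≤ r ^ α := by
    intro y r hr J hJ hy
    change ∑ x ∈ J, μ.real (cube R ⁻¹' {cube R x} ∩ G) / (a * ((3 * (n + 2)) ^ α * R ^ (-α))) ≤ _
    rw [← Finset.sum_div, div_le_iff₀ hden]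
    refine (sum_measureReal_le hε hμ hR (hPinj.mono hJ) G isClosed_closedBall.measurableSet hr y
      hy).trans_eq ?_
    ring
  have hRx : ∀ x ∈ P, ‖R • x‖ ≤ R := fun x hx => by
    rw [norm_smul, Real.norm_of_nonneg hR0.le]
    have : ‖x‖ ≤ 1 := by simpa [G] using hPG hx
    nlinarith
  have hX : X.Adm (chartConst n) (multConst n) α 1 T T :=
    { conv := isConv_waves hε hs
      mult := by
        intro k hk J hJ hJy
        have h1 := card_le_of_floor_pi
          (J := J.image fun ω j => ⌊T * (waves i ε).p ω j⌋)
          (a := fun j => T * (waves i ε).p k j) (b := chartConst n)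
          (by linarith [one_le_chartConst n]) (by
            intro t ht j
            obtain ⟨ω, hω, rfl⟩ := Finset.mem_image.1 ht
            refine ⟨T * (waves i ε).p ω j, ?_, rfl⟩
            rw [← mul_sub, abs_mul, abs_of_pos hT0]
            have h2 := (isConv_waves hε hs).norm_p_sub_le ω (hJ hω) k hk
            have h3 : |(waves i ε).p ω j - (waves i ε).p k j| ≤ chartConst n * (1 / T) :=
              (norm_le_pi_norm ((waves i ε).p ω - (waves i ε).p k) j).trans (h2.trans
                (mul_le_mul_of_nonneg_left (hJy ω hω) (by linarith [one_le_chartConst n])))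
            calc T * _ ≤ T * (chartConst n * (1 / T)) := mul_le_mul_of_nonneg_left h3 hT0.le
              _ = chartConst n := by field_simp)
        rwa [Finset.card_image_of_injOn (hinj.mono (Finset.coe_subset.2 hJ))] at h1
      one_le := hR.trans hRT
      wt_nonneg := fun x _ => div_nonneg measureReal_nonneg hden.le
      pos_fst := fun x hx => (norm_place_fst_le _).trans ((hRx x hx).trans hRT)
      pos_snd := fun x hx => (abs_place_snd_le hε _).trans ((hRx x hx).trans hRT)
      unit := fun y J hJ hy => (hfr y 1 le_rfl J hJ hy).trans_eq (Real.one_rpow α)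
      le := le_rfl
      one_le_c := le_rfl
      frost := fun y r hr J hJ hy => (hfr y r hr J hJ hy).trans_eq (one_mul _).symm }
  have h1 := hB X 1 T hX
  rw [Real.one_rpow, mul_one] at h1
  refine hP.trans ?_
  have h2 : ∑ x ∈ P, μ.real (cube R ⁻¹' {cube R x} ∩ G) * f x =
      (a * ((3 * (n + 2)) ^ α * R ^ (-α))) * X.total := by
    rw [Cfg.total, Finset.mul_sum]
    refine Finset.sum_congr rfl fun x _ => ?_
    change _ = _ * (_ / _ * f x)
    field_simp
  rw [h2]
  refine (mul_le_mul_of_nonneg_left h1 hden.le).trans_eq ?_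
  change _ * (M * T ^ n * ∑ ω ∈ s, ‖c ω‖ ^ 2) = _
  ring

end SphereChart

/-- The Cauchy–Schwarz inequality against the constant function. -/
lemma sq_integral_le_measure_mul {X : Type*} [MeasurableSpace X] {μ : Measure X} [IsFiniteMeasure μ]
    {f : X → ℝ} (hf : Integrable f μ) (hf2 : Integrable (fun x => f x ^ 2) μ) :
    (∫ x, f x ∂μ) ^ 2 ≤ μ.real univ * ∫ x, f x ^ 2 ∂μ := by
  have h : ∀ t : ℝ, 0 ≤ μ.real univ * (t * t) + (-2 * ∫ x, f x ∂μ) * t + ∫ x, f x ^ 2 ∂μ := by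
    intro t
    have h1 : 0 ≤ ∫ x, (f x - t) ^ 2 ∂μ := integral_nonneg fun x => sq_nonneg _
    have h2 : ∫ x, (f x - t) ^ 2 ∂μ = ∫ x, (f x ^ 2 - 2 * t * f x) + t ^ 2 ∂μ := by
      congr 1
      ext x
      ring
    have h3 : Integrable (fun x => f x ^ 2 - 2 * t * f x) μ := hf2.sub (hf.const_mul _)
    rw [h2, integral_add h3 (integrable_const _), integral_sub hf2 (hf.const_mul _), integral_const_mul, integral_const, smul_eq_mul] at h1
    linarith
  have := discrim_le_zero h
  rw [discrim] at this
  linarith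

/-- The unnormalised Fourier transform of a measure. -/
noncomputable def charInt {d : ℕ} (μ : Measure (EuclideanSpace ℝ (Fin d)))
    (ξ : EuclideanSpace ℝ (Fin d)) : ℂ :=
  ∫ x, Complex.exp (-Complex.I * ((⟪x, ξ⟫_ℝ : ℝ) : ℂ)) ∂μ

lemma norm_charInt_integrand {d : ℕ} (x ξ : EuclideanSpace ℝ (Fin d)) :
    ‖Complex.exp (-Complex.I * ((⟪x, ξ⟫_ℝ : ℝ) : ℂ))‖ = 1 := by
  rw [neg_mul, mul_comm, ← neg_mul, ← Complex.ofReal_neg, Complex.norm_exp_ofReal_mul_I]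

lemma integrable_charInt {d : ℕ} (μ : Measure (EuclideanSpace ℝ (Fin d))) [IsFiniteMeasure μ]
    (ξ : EuclideanSpace ℝ (Fin d)) :
    Integrable (fun x => Complex.exp (-Complex.I * ((⟪x, ξ⟫_ℝ : ℝ) : ℂ))) μ :=
  Integrable.of_bound (C := 1) (Continuous.aestronglyMeasurable (by fun_prop))
    (Eventually.of_forall fun x => (norm_charInt_integrand x ξ).le)

lemma continuous_charInt {d : ℕ} (μ : Measure (EuclideanSpace ℝ (Fin d))) [IsFiniteMeasure μ] :
    Continuous (charInt μ) := by
  refine continuous_of_dominated (bound := fun _ => 1) (fun ξ => ?_) (fun ξ => ?_)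
    (integrable_const _) (Eventually.of_forall fun x => ?_)
  · exact Continuous.aestronglyMeasurable (by fun_prop)
  · exact Eventually.of_forall fun x => (norm_charInt_integrand x ξ).le
  · fun_prop

lemma norm_charInt_le {d : ℕ} (μ : Measure (EuclideanSpace ℝ (Fin d))) [IsFiniteMeasure μ]
    (ξ : EuclideanSpace ℝ (Fin d)) : ‖charInt μ ξ‖ ≤ μ.real univ := by
  refine (norm_integral_le_of_norm_le_const (C := 1)
    (Eventually.of_forall fun x => (norm_charInt_integrand x ξ).le)).trans_eq ?_
  rw [one_mul]

lemma norm_fourierMeasure_le {d : ℕ} (μ : Measure (EuclideanSpace ℝ (Fin d)))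
    (ξ : EuclideanSpace ℝ (Fin d)) : ‖fourierMeasure μ ξ‖ ≤ ‖charInt μ ξ‖ := by
  have h2 : (1 : ℝ) ≤ 2 * Real.pi := by linarith [Real.pi_gt_three]
  have h1 : (2 * Real.pi) ^ (-(d : ℝ) / 2) ≤ 1 :=
    Real.rpow_le_one_of_one_le_of_nonpos h2 (by
      have : (0 : ℝ) ≤ d := Nat.cast_nonneg d
      linarith)
  rw [fourierMeasure, norm_mul, Complex.norm_real, Real.norm_of_nonneg (by positivity)]
  exact mul_le_of_le_one_left (norm_nonneg _) h1

/-- Decay of order `δ` of the spherical means of Fourier transforms of `α`-dimensional measures. -/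
def HasDecay (d : ℕ) (α δ : ℝ) : Prop :=
  ∃ C : ℝ, 0 ≤ C ∧ ∀ μ : Measure (EuclideanSpace ℝ (Fin d)), IsAlphaDimensional d α μ →
    ∀ R : ℝ, 1 < R → ∫ ω, ‖charInt μ (R • ω)‖ ^ 2 ∂(sphereMeasure d) ≤
      C * (cAlpha d α μ).toReal * μ.real univ * R ^ (-δ)

namespace SphereChart

variable {n : ℕ} {i : Fin (n + 1)} {ε : ℝ}

lemma measurable_floor_p (i : Fin (n + 1)) (ε T : ℝ) :
    Measurable fun (ω : EuclideanSpace ℝ (Fin (n + 1))) j => ⌊T * (waves i ε).p ω j⌋ := by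
  refine measurable_pi_lambda _ fun j => ?_
  refine Int.measurable_floor.comp ?_
  simp only [waves]
  fun_prop

lemma integral_chart_le {α θ T M R : ℝ} (hε : ε ^ 2 = 1)
    (hB : Cfg.Bound n (chartConst n) (multConst n) α θ T M) (hM : 0 ≤ M) (hR : 1 ≤ R) (hRT : R ≤ T)
    {μ : Measure (EuclideanSpace ℝ (Fin (n + 1)))} (hμ : IsAlphaDimensional (n + 1) α μ) :
    ∫ ω in chart i ε, ‖charInt μ (R • ω)‖ ^ 2 ∂(μH[(n : ℝ)]) ≤
      surfConst n * 2 ^ n * (3 * (n + 2)) ^ α * M * (cAlpha (n + 1) α μ).toReal * μ.real univ *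
        R ^ (-α) := by
  have := hμ.isFiniteMeasure
  have hT0 : 0 < T := by linarith
  have hR0 : 0 < R := by linarith
  set φ : EuclideanSpace ℝ (Fin (n + 1)) → Fin n → ℤ := fun ω j => ⌊T * (waves i ε).p ω j⌋
  set ν : Measure (EuclideanSpace ℝ (Fin (n + 1))) := (μH[(n : ℝ)]).restrict (chart i ε)
  have hν : IsFiniteMeasure ν :=
    ⟨by rw [Measure.restrict_apply_univ]; exact hausdorffMeasure_chart_lt_top hε⟩
  set u : EuclideanSpace ℝ (Fin (n + 1)) → ℂ := fun ω => charInt μ (R • ω)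
  have hu : Continuous u := (continuous_charInt μ).comp (continuous_const_smul R)
  have hf : Integrable (fun ω => ‖u ω‖ ^ 2) ν := by
    refine Integrable.of_bound (C := μ.real univ ^ 2)
      (hu.norm.pow 2).aestronglyMeasurable (Eventually.of_forall fun ω => ?_)
    rw [Real.norm_of_nonneg (by positivity)]
    exact pow_le_pow_left₀ (norm_nonneg _) (norm_charInt_le μ _) 2
  obtain ⟨s, hs, hinj, hsum⟩ := exists_integral_le_sum (ν := ν) (φ := φ)
    (fun q => measurable_floor_p i ε T (measurableSet_singleton q)) (G := chart i ε)
    (isClosed_chart i ε).measurableSet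
    (by rw [Measure.restrict_apply (isClosed_chart i ε).measurableSet.compl]; simp)
    (Fintype.piFinset fun _ => Finset.Icc ⌊-(T * (n + 1))⌋ ⌊T * (n + 1)⌋) (fun ω hω => by
      refine Fintype.mem_piFinset.2 fun j => ?_
      have h1 : |(waves i ε).p ω j| ≤ n + 1 := (norm_le_pi_norm _ j).trans (norm_p_le hω)
      rw [abs_le] at h1
      exact Finset.mem_Icc.2 ⟨Int.floor_le_floor (by nlinarith), Int.floor_le_floor (by nlinarith)⟩) hf
  set E := ∑ ω ∈ s, ‖u ω‖ ^ 2
  have hE0 : 0 ≤ E := Finset.sum_nonneg fun _ _ => by positivity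
  have hcell : ∀ ω ∈ s, ν.real (φ ⁻¹' {φ ω} ∩ chart i ε) ≤ surfConst n * (2 * (1 / T)) ^ n := by
    intro ω hω
    have h0 : 0 ≤ surfConst n * (2 * (1 / T)) ^ n :=
      mul_nonneg (surfConst_nonneg n) (by positivity)
    refine ENNReal.toReal_le_of_le_ofReal h0 ?_
    refine (Measure.restrict_apply_le _ _).trans ?_
    refine hausdorffMeasure_le_ofReal hε inter_subset_right (a := (waves i ε).p ω) (by positivity) ?_
    rintro η ⟨hη, -⟩
    refine (pi_norm_le_iff_of_nonneg (by positivity)).2 fun j => ?_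
    have h1 : ⌊T * (waves i ε).p η j⌋ = ⌊T * (waves i ε).p ω j⌋ := congrFun hη j
    have := (Int.abs_sub_lt_one_of_floor_eq_floor h1).le
    rw [← mul_sub, abs_mul, abs_of_pos hT0] at this
    rwa [Pi.sub_apply, Real.norm_eq_abs, le_div_iff₀ hT0, mul_comm]
  have h1 : ∫ ω, ‖u ω‖ ^ 2 ∂ν ≤ surfConst n * (2 * (1 / T)) ^ n * E := by
    refine hsum.trans ?_
    rw [Finset.mul_sum]
    exact Finset.sum_le_sum fun ω hω => mul_le_mul_of_nonneg_right (hcell ω hω) (by positivity)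
  set c : EuclideanSpace ℝ (Fin (n + 1)) → ℂ := fun ω => (starRingEnd ℂ) (u ω)
  set F : EuclideanSpace ℝ (Fin (n + 1)) → ℂ := fun x => (waves i ε).wave c s (place i ε (R • x))
  have hF : Continuous F := by
    have h1 : Continuous fun x : EuclideanSpace ℝ (Fin (n + 1)) => place i ε (R • x) := by
      unfold place
      fun_prop
    have h2 : Continuous fun y => (waves i ε).wave c s y := by
      unfold WaveFamily.wave expChar
      fun_prop
    exact h2.comp h1
  have hFb : ∀ x, ‖F x‖ ≤ ∑ ω ∈ s, ‖c ω‖ := fun x => by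
    refine (norm_sum_le _ _).trans (Finset.sum_le_sum fun ω _ => ?_)
    rw [norm_mul, norm_expChar, mul_one]
  have h2 : (E : ℂ) = ∫ x, F x ∂μ := by
    have h3 : ∀ x, F x = ∑ ω ∈ s, c ω *
        Complex.exp (-Complex.I * ((⟪x, R • ω⟫_ℝ : ℝ) : ℂ)) := by
      intro x
      refine Finset.sum_congr rfl fun ω _ => ?_
      rw [expChar, freq_place hε, real_inner_smul_left, real_inner_smul_right]
      congr 2
      push_cast
      ring
    simp_rw [h3]
    rw [integral_finsetSum _ fun ω _ => (integrable_charInt μ _).const_mul _]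
    simp_rw [integral_const_mul]
    rw [Complex.ofReal_sum]
    refine Finset.sum_congr rfl fun ω _ => ?_
    exact (Complex.conj_mul' (u ω)).symm ▸ by push_cast; rfl
  have h3 : E ^ 2 ≤ μ.real univ * ∫ x, ‖F x‖ ^ 2 ∂μ := by
    have h4 : E ≤ ∫ x, ‖F x‖ ∂μ := by
      have := norm_integral_le_integral_norm (μ := μ) F
      rwa [← h2, Complex.norm_real, Real.norm_of_nonneg hE0] at this
    refine (pow_le_pow_left₀ hE0 h4 2).trans (sq_integral_le_measure_mul ?_ ?_)
    · exact Integrable.of_bound hF.norm.aestronglyMeasurable _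
        (Eventually.of_forall fun x => (norm_norm _).trans_le (hFb x))
    · refine Integrable.of_bound (C := (∑ ω ∈ s, ‖c ω‖) ^ 2) (hF.norm.pow 2).aestronglyMeasurable
        (Eventually.of_forall fun x => ?_)
      rw [Real.norm_of_nonneg (by positivity)]
      exact pow_le_pow_left₀ (norm_nonneg _) (hFb x) 2
  have h4 := integral_wave_sq_le hε hB hR hRT hμ hs hinj c
  have h5 : ∑ ω ∈ s, ‖c ω‖ ^ 2 = E := Finset.sum_congr rfl fun ω _ => by rw [RCLike.norm_conj]
  rw [h5] at h4
  set Q := (3 * (n + 2)) ^ α * R ^ (-α) * (cAlpha (n + 1) α μ).toReal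
  have hQ : 0 ≤ Q := by positivity
  have h6 : E ≤ μ.real univ * (Q * (M * T ^ n)) := by
    rcases hE0.eq_or_lt with h0 | h0
    · rw [← h0]
      positivity
    · have h7 := h3.trans (mul_le_mul_of_nonneg_left h4 measureReal_nonneg)
      rw [sq] at h7
      exact le_of_mul_le_mul_right (h7.trans_eq (by ring)) h0
  refine h1.trans ((mul_le_mul_of_nonneg_left h6
    (mul_nonneg (surfConst_nonneg n) (by positivity))).trans_eq ?_)
  have h8 : (2 * (1 / T)) ^ n * T ^ n = 2 ^ n := by
    rw [← mul_pow]
    congr 1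
    field_simp
  calc _ = surfConst n * ((2 * (1 / T)) ^ n * T ^ n) * (μ.real univ * (Q * M)) := by ring
    _ = _ := by rw [h8]; ring

end SphereChart

/-- Spherical decay from the multilinear estimate. -/
lemma hasDecay_of_multilinear {n : ℕ} (hn : 1 ≤ n) {α θ γ : ℝ} (hα : 0 ≤ α) (hγ : 0 ≤ γ)
    (hθ : 1 / (n + 1 : ℝ) ≤ θ) (hθn : θ < 1 / n) (hγ1 : 2 - θ * (n + 1 - α) < 2 * γ)
    (hγ2 : α / (n + 1) < γ) : HasDecay (n + 1) α (α - γ) := by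
  obtain ⟨D, hD, C, hC, hB⟩ := Cfg.exists_bound (A := SphereChart.chartConst n)
    (A₀ := SphereChart.multConst n) hn (SphereChart.one_le_chartConst n)
    (by have := SphereChart.one_le_chartConst n; unfold SphereChart.multConst; positivity)
    hα hγ hθ hθn hγ1 hγ2
  have hD1 : (1 : ℝ) < D := by exact_mod_cast hD
  have hK := SphereChart.surfConst_nonneg n
  refine ⟨2 * (n + 1) * (SphereChart.surfConst n * 2 ^ n * (3 * (n + 2)) ^ α * (C * (D : ℝ) ^ γ)),
    by positivity, fun μ hμ R hR => ?_⟩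
  have := hμ.isFiniteMeasure
  obtain ⟨t, ht1, ht2⟩ := exists_nat_pow_near hR.le hD1
  have hR0 : 0 < R := by linarith
  have hT : (D : ℝ) ^ (t + 1) ≤ D * R := by
    rw [pow_succ']
    exact mul_le_mul_of_nonneg_left ht1 (by positivity)
  have hfin : Integrable (fun ω => ‖charInt μ (R • ω)‖ ^ 2) (sphereMeasure (n + 1)) := by
    refine Integrable.of_bound (C := μ.real univ ^ 2) ?_ (Eventually.of_forall fun ω => ?_)
    · exact (((continuous_charInt μ).comp (continuous_const_smul R)).norm.pow 2).aestronglyMeasurable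
    · rw [Real.norm_of_nonneg (by positivity)]
      exact pow_le_pow_left₀ (norm_nonneg _) (norm_charInt_le μ _) 2
  refine (SphereChart.integral_sphere_le (fun ω => by positivity) hfin fun i ε hε =>
    (SphereChart.integral_chart_le hε (hB (t + 1)) (by positivity) hR.le ht2.le hμ).trans
      (?_ : _ ≤ SphereChart.surfConst n * 2 ^ n * (3 * (n + 2)) ^ α * (C * (D * R : ℝ) ^ γ) *
        (cAlpha (n + 1) α μ).toReal * μ.real univ * R ^ (-α))).trans_eq ?_
  · gcongr
  · rw [Real.mul_rpow (by positivity) hR0.le, neg_sub, sub_eq_add_neg, Real.rpow_add hR0]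
    ring

namespace Oscillatory

open intervalIntegral

/-- The phase of a plane wave on the sphere as a function of the polar angle. -/
noncomputable def phase (l θ : ℝ) : ℂ := Complex.exp (((-(l * Real.cos θ) : ℝ) : ℂ) * Complex.I)

lemma norm_phase (l θ : ℝ) : ‖phase l θ‖ = 1 := Complex.norm_exp_ofReal_mul_I _

lemma hasDerivAt_phase (l θ : ℝ) :
    HasDerivAt (phase l) (((l * Real.sin θ : ℝ) : ℂ) * Complex.I * phase l θ) θ := by
  have h1 : HasDerivAt (fun θ : ℝ => -(l * Real.cos θ)) (l * Real.sin θ) θ :=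
    ((Real.hasDerivAt_cos θ).const_mul l).fun_neg.congr_deriv (by ring)
  have h2 : HasDerivAt (phase l) _ θ := (h1.ofReal_comp.mul_const Complex.I).cexp
  convert h2 using 1
  exact mul_comm _ _

@[fun_prop]
lemma continuous_phase (l : ℝ) : Continuous (phase l) :=
  continuous_iff_continuousAt.2 fun θ => (hasDerivAt_phase l θ).continuousAt

/-- Integration by parts against the phase. -/
lemma integral_mul_sin_phase {l a b : ℝ} {g g' : ℝ → ℝ} (hl : l ≠ 0)
    (hg : ∀ θ ∈ uIcc a b, HasDerivAt g (g' θ) θ) (hg' : ContinuousOn g' (uIcc a b)) :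
    ∫ θ in a..b, ((g θ * Real.sin θ : ℝ) : ℂ) * phase l θ =
      ((l : ℂ) * Complex.I)⁻¹ * (g b * phase l b - g a * phase l a -
        ∫ θ in a..b, (g' θ : ℂ) * phase l θ) := by
  have hl' : (l : ℂ) * Complex.I ≠ 0 := mul_ne_zero (by exact_mod_cast hl) Complex.I_ne_zero
  have h := integral_mul_deriv_eq_deriv_mul (u := fun θ => (g θ : ℂ)) (v := phase l)
    (u' := fun θ => (g' θ : ℂ)) (v' := fun θ => ((l * Real.sin θ : ℝ) : ℂ) * Complex.I * phase l θ)
    (a := a) (b := b) (fun θ hθ => (hg θ hθ).ofReal_comp) (fun θ _ => hasDerivAt_phase l θ)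
    ((Complex.continuous_ofReal.comp_continuousOn hg').intervalIntegrable)
    (Continuous.intervalIntegrable (by fun_prop) _ _)
  rw [← h, ← intervalIntegral.integral_const_mul]
  refine integral_congr fun θ _ => ?_
  have hl2 : (l : ℂ) ≠ 0 := by exact_mod_cast hl
  push_cast
  field_simp

/-- The integrals occurring in the Fourier transform of the surface measure. -/
noncomputable def sinInt (k : ℕ) (l : ℝ) : ℂ :=
  ∫ θ in (0 : ℝ)..Real.pi, ((Real.sin θ ^ k : ℝ) : ℂ) * phase l θ

/-- Auxiliary oscillatory integrals with an extra cosine. -/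
noncomputable def cosInt (k : ℕ) (l : ℝ) : ℂ :=
  ∫ θ in (0 : ℝ)..Real.pi, ((Real.sin θ ^ k * Real.cos θ : ℝ) : ℂ) * phase l θ

lemma sinInt_add_two (k : ℕ) {l : ℝ} (hl : l ≠ 0) :
    sinInt (k + 2) l = -(((l : ℂ) * Complex.I)⁻¹ * ((k + 1) * cosInt k l)) := by
  have h := integral_mul_sin_phase (a := 0) (b := Real.pi) (g := fun θ => Real.sin θ ^ (k + 1))
    (g' := fun θ => (k + 1) * (Real.sin θ ^ k * Real.cos θ)) hl
    (fun θ _ => ((Real.hasDerivAt_sin θ).fun_pow (k + 1)).congr_deriv (by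
      rw [Nat.add_sub_cancel]
      push_cast
      ring)) (by fun_prop)
  have e : sinInt (k + 2) l = ∫ θ in (0 : ℝ)..Real.pi,
      ((Real.sin θ ^ (k + 1) * Real.sin θ : ℝ) : ℂ) * phase l θ := by
    simp only [sinInt, ← pow_succ]
  have e2 : ∫ θ in (0 : ℝ)..Real.pi,
      (((k + 1) * (Real.sin θ ^ k * Real.cos θ) : ℝ) : ℂ) * phase l θ = (k + 1) * cosInt k l := by
    rw [cosInt, ← intervalIntegral.integral_const_mul]
    refine integral_congr fun θ _ => ?_
    push_cast
    ring
  rw [e, h, e2]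
  simp

lemma cosInt_add_two (k : ℕ) {l : ℝ} (hl : l ≠ 0) :
    cosInt (k + 2) l = -(((l : ℂ) * Complex.I)⁻¹ *
      ((k + 1) * sinInt k l - (k + 2) * sinInt (k + 2) l)) := by
  have h := integral_mul_sin_phase (a := 0) (b := Real.pi)
    (g := fun θ => Real.sin θ ^ (k + 1) * Real.cos θ)
    (g' := fun θ => (k + 1) * Real.sin θ ^ k - (k + 2) * Real.sin θ ^ (k + 2)) hl
    (fun θ _ => (((Real.hasDerivAt_sin θ).fun_pow (k + 1)).fun_mul
      (Real.hasDerivAt_cos θ)).congr_deriv (by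
      rw [Nat.add_sub_cancel]
      push_cast
      have := Real.sin_sq_add_cos_sq θ
      linear_combination ((k + 1) * Real.sin θ ^ k) * this)) (by fun_prop)
  have e : cosInt (k + 2) l = ∫ θ in (0 : ℝ)..Real.pi,
      ((Real.sin θ ^ (k + 1) * Real.cos θ * Real.sin θ : ℝ) : ℂ) * phase l θ := by
    refine integral_congr fun θ _ => ?_
    congr 2
    ring
  have e2 : ∫ θ in (0 : ℝ)..Real.pi,
      (((k + 1) * Real.sin θ ^ k - (k + 2) * Real.sin θ ^ (k + 2) : ℝ) : ℂ) * phase l θ =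
      (k + 1) * sinInt k l - (k + 2) * sinInt (k + 2) l := by
    rw [sinInt, sinInt, ← intervalIntegral.integral_const_mul,
      ← intervalIntegral.integral_const_mul,
      ← intervalIntegral.integral_sub (Continuous.intervalIntegrable (by fun_prop) _ _)
        (Continuous.intervalIntegrable (by fun_prop) _ _)]
    refine integral_congr fun θ _ => ?_
    push_cast
    ring
  rw [e, h, e2]
  simp
  ring

lemma norm_inv_mul_le {l : ℝ} (hl : 0 < l) (z : ℂ) : ‖((l : ℂ) * Complex.I)⁻¹ * z‖ = ‖z‖ / l := by
  rw [norm_mul, norm_inv, norm_mul, Complex.norm_I, mul_one, Complex.norm_real,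
    Real.norm_of_nonneg hl.le, inv_mul_eq_div]

lemma norm_sinInt_one_le {l : ℝ} (hl : 0 < l) : ‖sinInt 1 l‖ ≤ 2 / l := by
  have h := integral_mul_sin_phase (a := 0) (b := Real.pi) (g := fun _ => 1) (g' := fun _ => 0)
    hl.ne' (fun θ _ => hasDerivAt_const _ _) continuousOn_const
  simp only [one_mul, Complex.ofReal_zero, zero_mul, intervalIntegral.integral_zero, sub_zero,
    Complex.ofReal_one] at h
  rw [sinInt]
  simp only [pow_one]
  rw [h, norm_inv_mul_le hl]
  refine div_le_div_of_nonneg_right ((norm_sub_le _ _).trans ?_) hl.le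
  rw [norm_phase, norm_phase]
  norm_num

lemma norm_cosInt_one_le {l : ℝ} (hl : 1 ≤ l) : ‖cosInt 1 l‖ ≤ 4 / l := by
  have hl0 : 0 < l := by linarith
  have h := integral_mul_sin_phase (a := 0) (b := Real.pi) (g := Real.cos)
    (g' := fun θ => -Real.sin θ) hl0.ne' (fun θ _ => Real.hasDerivAt_cos θ) (by fun_prop)
  have e : cosInt 1 l = ∫ θ in (0 : ℝ)..Real.pi, ((Real.cos θ * Real.sin θ : ℝ) : ℂ) * phase l θ := by
    simp only [cosInt, pow_one, mul_comm (Real.cos _)]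
  have e2 : ∫ θ in (0 : ℝ)..Real.pi, ((-Real.sin θ : ℝ) : ℂ) * phase l θ = -sinInt 1 l := by
    simp only [sinInt, pow_one, Complex.ofReal_neg, neg_mul, intervalIntegral.integral_neg]
  rw [e, h, e2, norm_inv_mul_le hl0]
  refine div_le_div_of_nonneg_right ((norm_sub_le _ _).trans ?_) hl0.le
  have h2 := norm_sinInt_one_le hl0
  have h3 : 2 / l ≤ 2 := div_le_self (by norm_num) hl
  have h4 := norm_sub_le ((Real.cos Real.pi : ℂ) * phase l Real.pi) ((Real.cos 0 : ℂ) * phase l 0)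
  rw [norm_mul, norm_mul, norm_phase, norm_phase, Real.cos_pi, Real.cos_zero] at h4
  rw [Real.cos_pi, Real.cos_zero, norm_neg]
  norm_num at h4 ⊢
  linarith

end Oscillatory

namespace Oscillatory

open intervalIntegral

lemma integral_inv_sin_sq {δ : ℝ} (hδ : 0 < δ) (hδ2 : δ ≤ Real.pi / 2) :
    ∫ θ in δ..(Real.pi / 2), (Real.sin θ ^ 2)⁻¹ = Real.cos δ / Real.sin δ := by
  have hs : ∀ θ ∈ uIcc δ (Real.pi / 2), Real.sin θ ≠ 0 := fun θ hθ => by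
    rw [uIcc_of_le hδ2] at hθ
    exact (Real.sin_pos_of_pos_of_lt_pi (by linarith [hθ.1]) (by linarith [hθ.2, Real.pi_pos])).ne'
  have h := integral_eq_sub_of_hasDerivAt (a := δ) (b := Real.pi / 2)
    (f := fun θ => -(Real.cos θ / Real.sin θ)) (f' := fun θ => (Real.sin θ ^ 2)⁻¹)
    (fun θ hθ => ((Real.hasDerivAt_cos θ).fun_div (Real.hasDerivAt_sin θ) (hs θ hθ)).fun_neg.congr_deriv
      (by
        have := hs θ hθ
        field_simp
        linarith [Real.sin_sq_add_cos_sq θ]))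
    (ContinuousOn.intervalIntegrable (ContinuousOn.inv₀ (by fun_prop) fun θ hθ =>
      pow_ne_zero 2 (hs θ hθ)))
  rw [h, Real.cos_pi_div_two]
  ring

lemma norm_integral_quarter_le {l : ℝ} (hl : 1 ≤ |l|) {g u u' : ℝ → ℝ} (hg : ∀ θ, |g θ| ≤ 1)
    (hgc : Continuous g) (hgu : ∀ θ, Real.sin θ ≠ 0 → g θ = u θ * Real.sin θ)
    (hu : ∀ θ, Real.sin θ ≠ 0 → HasDerivAt u (u' θ) θ)
    (hu' : ContinuousOn u' {θ | Real.sin θ ≠ 0})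
    (hub : ∀ θ, 0 < Real.sin θ → |u θ| ≤ (Real.sin θ)⁻¹)
    (hub' : ∀ θ, 0 < Real.sin θ → |u' θ| ≤ (Real.sin θ ^ 2)⁻¹) :
    ‖∫ θ in (0 : ℝ)..(Real.pi / 2), (g θ : ℂ) * phase l θ‖ ≤ 6 / √|l| := by
  have hl0 : 0 < |l| := by linarith
  have hr : 1 ≤ √|l| := Real.one_le_sqrt.2 hl
  have hr2 : √|l| ^ 2 = |l| := Real.sq_sqrt hl0.le
  set r := √|l|
  have hr0 : 0 < r := by linarith
  have hδ : 0 < r⁻¹ := inv_pos.2 hr0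
  have hδ1 : r⁻¹ ≤ 1 := inv_le_one_of_one_le₀ hr
  have hpi := Real.pi_gt_three
  have hpi2 := Real.pi_le_four
  have hδ2 : r⁻¹ ≤ Real.pi / 2 := by linarith
  have hpos : ∀ θ ∈ Icc r⁻¹ (Real.pi / 2), 0 < Real.sin θ := fun θ hθ =>
    Real.sin_pos_of_pos_of_lt_pi (by linarith [hθ.1]) (by linarith [hθ.2])
  have hne : ∀ θ ∈ uIcc r⁻¹ (Real.pi / 2), Real.sin θ ≠ 0 := fun θ hθ => by
    rw [uIcc_of_le hδ2] at hθ
    exact (hpos θ hθ).ne'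
  have hc : Continuous fun θ => (g θ : ℂ) * phase l θ := by fun_prop
  rw [← integral_add_adjacent_intervals (b := r⁻¹) (hc.intervalIntegrable _ _)
    (hc.intervalIntegrable _ _)]
  have h1 : ‖∫ θ in (0 : ℝ)..r⁻¹, (g θ : ℂ) * phase l θ‖ ≤ 1 * |r⁻¹ - 0| :=
    norm_integral_le_of_norm_le_const fun θ _ => by
      rw [norm_mul, norm_phase, mul_one, Complex.norm_real]
      exact hg θ
  rw [sub_zero, abs_of_pos hδ, one_mul] at h1
  have h2 : ∫ θ in r⁻¹..(Real.pi / 2), (g θ : ℂ) * phase l θ =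
      ∫ θ in r⁻¹..(Real.pi / 2), ((u θ * Real.sin θ : ℝ) : ℂ) * phase l θ :=
    integral_congr fun θ hθ => by
      simp only [hgu θ (hne θ hθ)]
  have hu2 : ContinuousOn u' (uIcc r⁻¹ (Real.pi / 2)) := hu'.mono hne
  rw [integral_mul_sin_phase (abs_pos.1 hl0) (fun θ hθ => hu θ (hne θ hθ)) hu2] at h2
  have h3 : ‖∫ θ in r⁻¹..(Real.pi / 2), (u' θ : ℂ) * phase l θ‖ ≤
      Real.cos r⁻¹ / Real.sin r⁻¹ := by
    rw [← integral_inv_sin_sq hδ hδ2]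
    refine norm_integral_le_of_norm_le hδ2 (Eventually.of_forall fun θ hθ => ?_)
      (ContinuousOn.intervalIntegrable (ContinuousOn.inv₀ (by fun_prop) fun θ hθ =>
        pow_ne_zero 2 (hne θ hθ)))
    rw [norm_mul, norm_phase, mul_one, Complex.norm_real]
    exact hub' θ (hpos θ ⟨hθ.1.le, hθ.2⟩)
  have hsin := hpos r⁻¹ ⟨le_rfl, hδ2⟩
  have h4 : 2 / Real.pi * r⁻¹ ≤ Real.sin r⁻¹ := Real.mul_le_sin hδ.le hδ2
  have h5 : (Real.sin r⁻¹)⁻¹ ≤ 5 / 3 * r := by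
    rw [inv_le_comm₀ hsin (by positivity)]
    refine le_trans ?_ h4
    rw [mul_inv]
    refine mul_le_mul_of_nonneg_right ?_ hδ.le
    rw [le_div_iff₀ Real.pi_pos]
    linarith [Real.pi_lt_d2]
  have h6 : Real.cos r⁻¹ / Real.sin r⁻¹ ≤ 5 / 3 * r := by
    refine le_trans ?_ h5
    rw [div_eq_mul_inv]
    exact mul_le_of_le_one_left (inv_pos.2 hsin).le (Real.cos_le_one _)
  have h7 := (hub _ hsin).trans h5
  have h8 : |u (Real.pi / 2)| ≤ 5 / 3 * r := by
    have := hub (Real.pi / 2) (by rw [Real.sin_pi_div_two]; norm_num)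
    rw [Real.sin_pi_div_two, inv_one] at this
    linarith
  have h9 : ‖(u (Real.pi / 2) : ℂ) * phase l (Real.pi / 2) - u r⁻¹ * phase l r⁻¹ -
      ∫ θ in r⁻¹..(Real.pi / 2), (u' θ : ℂ) * phase l θ‖ ≤ 5 * r := by
    refine (norm_sub_le _ _).trans ((add_le_add_left (norm_sub_le _ _) _).trans ?_)
    rw [norm_mul, norm_mul, norm_phase, norm_phase, Complex.norm_real, Complex.norm_real,
      Real.norm_eq_abs, Real.norm_eq_abs]
    linarith
  have h10 : ‖∫ θ in r⁻¹..(Real.pi / 2), (g θ : ℂ) * phase l θ‖ ≤ 5 / r := by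
    rw [h2, norm_mul, norm_inv, norm_mul, Complex.norm_I, mul_one, Complex.norm_real,
      Real.norm_eq_abs, inv_mul_eq_div, div_le_div_iff₀ hl0 hr0, ← hr2]
    nlinarith
  refine (norm_add_le _ _).trans ((add_le_add h1 h10).trans_eq ?_)
  field_simp
  norm_num

lemma phase_pi_sub (l θ : ℝ) : phase l (Real.pi - θ) = phase (-l) θ := by
  simp [phase, Real.cos_pi_sub]

lemma norm_integral_phase_quarter_le {l : ℝ} (hl : 1 ≤ |l|) :
    ‖∫ θ in (0 : ℝ)..(Real.pi / 2), phase l θ‖ ≤ 6 / √|l| := by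
  have h := norm_integral_quarter_le hl (g := fun _ => 1) (u := fun θ => (Real.sin θ)⁻¹)
    (u' := fun θ => -Real.cos θ / Real.sin θ ^ 2) (fun _ => by simp) continuous_const
    (fun θ h => (inv_mul_cancel₀ h).symm) (fun θ h => (Real.hasDerivAt_sin θ).fun_inv h)
    (ContinuousOn.div (by fun_prop) (by fun_prop) fun θ h => pow_ne_zero 2 h)
    (fun θ h => by rw [abs_of_pos (inv_pos.2 h)])
    (fun θ h => by
      rw [abs_div, abs_neg, abs_of_nonneg (sq_nonneg (Real.sin θ)), div_eq_mul_inv]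
      exact mul_le_of_le_one_left (by positivity) (Real.abs_cos_le_one θ))
  simpa only [Complex.ofReal_one, one_mul] using h

lemma norm_integral_cos_phase_quarter_le {l : ℝ} (hl : 1 ≤ |l|) :
    ‖∫ θ in (0 : ℝ)..(Real.pi / 2), (Real.cos θ : ℂ) * phase l θ‖ ≤ 6 / √|l| := by
  refine norm_integral_quarter_le hl (u := fun θ => Real.cos θ / Real.sin θ)
    (u' := fun θ => -(Real.sin θ ^ 2)⁻¹) Real.abs_cos_le_one Real.continuous_cos
    (fun θ h => (div_mul_cancel₀ _ h).symm)
    (fun θ h => ((Real.hasDerivAt_cos θ).fun_div (Real.hasDerivAt_sin θ) h).congr_deriv (by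
      field_simp
      linarith [Real.sin_sq_add_cos_sq θ]))
    (ContinuousOn.neg (ContinuousOn.inv₀ (by fun_prop) fun θ h => pow_ne_zero 2 h))
    (fun θ h => ?_) (fun θ h => ?_)
  · rw [abs_div, abs_of_pos h, div_eq_mul_inv]
    exact mul_le_of_le_one_left (by positivity) (Real.abs_cos_le_one θ)
  · rw [abs_neg, abs_of_nonneg (by positivity)]

lemma norm_sinInt_zero_le {l : ℝ} (hl : 1 ≤ l) : ‖sinInt 0 l‖ ≤ 12 / √l := by
  have hc := continuous_phase l
  have h2 : ∫ θ in (Real.pi / 2)..Real.pi, phase l θ =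
      ∫ θ in (0 : ℝ)..(Real.pi / 2), phase (-l) θ := by
    have := integral_comp_sub_left (a := 0) (b := Real.pi / 2) (phase l) Real.pi
    rw [sub_zero, sub_half] at this
    simp only [phase_pi_sub] at this
    exact this.symm
  have h1 := norm_integral_phase_quarter_le (l := l) (by rwa [abs_of_pos (by linarith)])
  have h3 := norm_integral_phase_quarter_le (l := -l) (by rwa [abs_neg, abs_of_pos (by linarith)])
  rw [abs_neg] at h3
  rw [abs_of_pos (by linarith)] at h1 h3
  simp only [sinInt, pow_zero, Complex.ofReal_one, one_mul]
  rw [← integral_add_adjacent_intervals (b := Real.pi / 2) (hc.intervalIntegrable _ _)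
    (hc.intervalIntegrable _ _), h2]
  refine (norm_add_le _ _).trans ((add_le_add h1 h3).trans_eq ?_)
  ring

lemma norm_cosInt_zero_le {l : ℝ} (hl : 1 ≤ l) : ‖cosInt 0 l‖ ≤ 12 / √l := by
  have hc : Continuous fun θ => (Real.cos θ : ℂ) * phase l θ := by fun_prop
  have h2 : ∫ θ in (Real.pi / 2)..Real.pi, (Real.cos θ : ℂ) * phase l θ =
      -∫ θ in (0 : ℝ)..(Real.pi / 2), (Real.cos θ : ℂ) * phase (-l) θ := by
    have := integral_comp_sub_left (a := 0) (b := Real.pi / 2)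
      (fun θ => (Real.cos θ : ℂ) * phase l θ) Real.pi
    rw [sub_zero, sub_half] at this
    simp only [phase_pi_sub, Real.cos_pi_sub, Complex.ofReal_neg, neg_mul,
      intervalIntegral.integral_neg] at this
    exact this.symm
  have h1 := norm_integral_cos_phase_quarter_le (l := l) (by rwa [abs_of_pos (by linarith)])
  have h3 := norm_integral_cos_phase_quarter_le (l := -l)
    (by rwa [abs_neg, abs_of_pos (by linarith)])
  rw [abs_neg] at h3
  rw [abs_of_pos (by linarith)] at h1 h3
  simp only [cosInt, pow_zero, one_mul]
  rw [← integral_add_adjacent_intervals (b := Real.pi / 2) (hc.intervalIntegrable _ _)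
    (hc.intervalIntegrable _ _), h2, ← sub_eq_add_neg]
  refine (norm_sub_le _ _).trans ((add_le_add h1 h3).trans_eq ?_)
  ring

/-- Decay of the oscillatory integrals, of the order given by stationary phase. -/
lemma exists_norm_sinInt_le (k : ℕ) : ∃ C : ℝ, 0 ≤ C ∧ ∀ l : ℝ, 1 ≤ l →
    ‖sinInt k l‖ ≤ C / √l ^ (k + 1) ∧ ‖cosInt k l‖ ≤ C / √l ^ (k + 1) := by
  induction k using Nat.twoStepInduction with
  | zero =>
    refine ⟨12, by norm_num, fun l hl => ?_⟩
    rw [zero_add, pow_one]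
    exact ⟨norm_sinInt_zero_le hl, norm_cosInt_zero_le hl⟩
  | one =>
    refine ⟨4, by norm_num, fun l hl => ?_⟩
    rw [one_add_one_eq_two, Real.sq_sqrt (by linarith)]
    refine ⟨(norm_sinInt_one_le (by linarith)).trans ?_, norm_cosInt_one_le hl⟩
    exact div_le_div_of_nonneg_right (by norm_num) (by linarith)
  | more k ih _ =>
    obtain ⟨C, hC, h⟩ := ih
    refine ⟨(k + 1) * C + (k + 2) * ((k + 1) * C), by positivity, fun l hl => ?_⟩
    have hl0 : 0 < l := by linarith
    obtain ⟨h1, h2⟩ := h l hl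
    have hs : √l ^ (k + 2 + 1) = √l ^ (k + 1) * l := by
      rw [show k + 2 + 1 = k + 1 + 2 by ring, pow_add, Real.sq_sqrt hl0.le]
    have hs0 : 0 < √l ^ (k + 1) := by positivity
    have e1 : ‖((k : ℂ) + 1)‖ = k + 1 := by exact_mod_cast Complex.norm_natCast (k + 1)
    have e2 : ‖((k : ℂ) + 2)‖ = k + 2 := by exact_mod_cast Complex.norm_natCast (k + 2)
    have h3 : ‖sinInt (k + 2) l‖ ≤ (k + 1) * C / √l ^ (k + 2 + 1) := by
      rw [sinInt_add_two k hl0.ne', norm_neg, norm_inv_mul_le hl0, norm_mul, e1, hs,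
        ← div_div]
      refine div_le_div_of_nonneg_right ?_ hl0.le
      rw [mul_div_assoc]
      exact mul_le_mul_of_nonneg_left h2 (by positivity)
    refine ⟨h3.trans ?_, ?_⟩
    · gcongr
      exact le_add_of_nonneg_right (by positivity)
    · rw [cosInt_add_two k hl0.ne', norm_neg, norm_inv_mul_le hl0, hs, ← div_div]
      refine div_le_div_of_nonneg_right ((norm_sub_le _ _).trans ?_) hl0.le
      rw [norm_mul, norm_mul, e1, e2, add_div, mul_div_assoc, mul_div_assoc]
      refine add_le_add (by gcongr) (mul_le_mul_of_nonneg_left (h3.trans ?_) (by positivity))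
      rw [hs, ← div_div]
      exact div_le_self (by positivity) hl

end Oscillatory

/-- Splitting off one coordinate preserves the volume. -/
lemma measurePreserving_insertNth {n : ℕ} (i : Fin (n + 1)) :
    MeasurePreserving (fun q : ℝ × (Fin n → ℝ) =>
      (WithLp.toLp 2 (i.insertNth q.1 q.2) : EuclideanSpace ℝ (Fin (n + 1)))) :=
  (PiLp.volume_preserving_toLp (Fin (n + 1))).comp
    (volume_preserving_piFinSuccAbove (fun _ : Fin (n + 1) => ℝ) i).symm

namespace SphereChart

variable {n : ℕ} {i : Fin (n + 1)} {ε : ℝ}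

/-- The radial projection onto the unit sphere. -/
noncomputable def normalize (x : EuclideanSpace ℝ (Fin (n + 1))) : EuclideanSpace ℝ (Fin (n + 1)) :=
  ‖x‖⁻¹ • x

@[fun_prop]
lemma measurable_normalize :
    Measurable (normalize : EuclideanSpace ℝ (Fin (n + 1)) → _) := by
  unfold normalize
  fun_prop

lemma normalize_smul {t : ℝ} (ht : 0 < t) (x : EuclideanSpace ℝ (Fin (n + 1))) :
    normalize (t • x) = normalize x := by
  rw [normalize, normalize, norm_smul, Real.norm_of_nonneg ht.le, smul_smul, mul_inv, mul_right_comm,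
    inv_mul_cancel₀ ht.ne', one_mul]

lemma normalize_lift (hε : ε ^ 2 = 1) {ω : EuclideanSpace ℝ (Fin (n + 1))} (hω : ω ∈ chart i ε) :
    normalize (lift i ε ((waves i ε).p ω)) = ω := by
  rw [normalize, ← height_eq hε hω]
  exact (eq_smul_lift hε hω).symm

/-- The image of the Lebesgue measure of the unit ball under radial projection. -/
noncomputable def coneMeasure (n : ℕ) : Measure (EuclideanSpace ℝ (Fin (n + 1))) :=
  (volume.restrict (ball 0 1)).map normalize

instance : IsFiniteMeasure (coneMeasure n) := by
  have : IsFiniteMeasure (volume.restrict (ball (0 : EuclideanSpace ℝ (Fin (n + 1))) 1)) :=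
    ⟨by rw [Measure.restrict_apply_univ]; exact measure_ball_lt_top⟩
  rw [coneMeasure]
  infer_instance

lemma smul_lift_mem {S : Set (EuclideanSpace ℝ (Fin (n + 1)))} (hε : ε ^ 2 = 1)
    (hS : S ⊆ chart i ε) {s : ℝ} (hs0 : 0 < s) (hs : s < (n + 1 : ℝ)⁻¹ ^ 2) {z : Fin n → ℝ}
    (hz : z ∈ (waves i ε).p '' S) : s • lift i ε z ∈ ball 0 1 ∩ normalize ⁻¹' S := by
  obtain ⟨ω, hω, rfl⟩ := hz
  refine ⟨?_, ?_⟩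
  · have h1 := height_eq hε (hS hω)
    have h2 := (hS hω).2
    have h3 : 0 < ‖lift i ε ((waves i ε).p ω)‖ := by linarith [one_le_norm_lift (i := i) hε ((waves i ε).p ω)]
    rw [mem_ball_zero_iff, norm_smul, Real.norm_of_nonneg hs0.le]
    rw [h1, one_div] at h2
    have h4 : ‖lift i ε ((waves i ε).p ω)‖ ≤ n + 1 := (inv_le_inv₀ (by positivity) h3).1 h2
    have hn : (1 : ℝ) ≤ n + 1 := by linarith [(Nat.cast_nonneg n : (0 : ℝ) ≤ n)]
    calc s * ‖lift i ε ((waves i ε).p ω)‖ ≤ s * (n + 1) := by gcongr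
      _ < (n + 1 : ℝ)⁻¹ ^ 2 * (n + 1) := by gcongr
      _ = (n + 1 : ℝ)⁻¹ := by field_simp
      _ ≤ 1 := inv_le_one_of_one_le₀ hn
  · rw [mem_preimage, normalize_smul hs0, normalize_lift hε (hS hω)]
    exact hω

lemma toLp_insertNth_eq {t : ℝ} (hε : ε ^ 2 = 1) (ht : 0 < ε * t) (w : Fin n → ℝ) :
    (WithLp.toLp 2 (i.insertNth t w) : EuclideanSpace ℝ (Fin (n + 1))) =
      (ε * t) • lift i ε ((ε * t)⁻¹ • w) := by
  ext j
  rcases Fin.eq_self_or_eq_succAbove i j with rfl | ⟨j, rfl⟩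
  · simp only [lift, PiLp.smul_apply, Fin.insertNth_apply_same, smul_eq_mul]
    linear_combination -t * hε
  · simp only [lift, PiLp.smul_apply, Fin.insertNth_apply_succAbove, smul_eq_mul, Pi.smul_apply]
    rw [mul_inv_cancel_left₀ ht.ne']

/-- Constant in the comparison of surface measure and cone measure. -/
noncomputable def coneConst (n : ℕ) : ℝ := ((n + 1 : ℝ)⁻¹ ^ 2 / 2) ^ (n + 1)

lemma coneConst_pos (n : ℕ) : 0 < coneConst n := by
  unfold coneConst
  positivity

lemma volume_image_le (hε : ε ^ 2 = 1) {S : Set (EuclideanSpace ℝ (Fin (n + 1)))}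
    (hS : S ⊆ chart i ε) (hSm : MeasurableSet S) :
    ENNReal.ofReal (coneConst n) * volume ((waves i ε).p '' S) ≤ coneMeasure n S := by
  set a : ℝ := (n + 1 : ℝ)⁻¹ ^ 2 / 2
  have ha : 0 < a := by positivity
  set Z := (waves i ε).p '' S
  have hm : MeasurableSet (ball 0 1 ∩ normalize ⁻¹' S : Set (EuclideanSpace ℝ (Fin (n + 1)))) :=
    measurableSet_ball.inter (measurable_normalize hSm)
  have hmp := measurePreserving_insertNth i
  rw [coneMeasure, Measure.map_apply measurable_normalize hSm,
    Measure.restrict_apply (measurable_normalize hSm), inter_comm,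
    ← hmp.measure_preimage hm.nullMeasurableSet, Measure.volume_eq_prod,
    Measure.prod_apply (hmp.measurable hm)]
  set I : Set ℝ := (fun t => ε * t) ⁻¹' Ioo a (2 * a)
  have hI : volume I = ENNReal.ofReal a := by
    have he : |ε| = 1 := abs_eq_one hε
    have hε0 : ε ≠ 0 := by
      rintro rfl
      norm_num at hε
    rw [Real.volume_preimage_mul_left hε0, abs_inv, he, Real.volume_Ioo]
    simp only [inv_one, ENNReal.ofReal_one, one_mul]
    congr 1
    ring
  have hIm : MeasurableSet I := measurableSet_Ioo.preimage (by fun_prop)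
  calc ENNReal.ofReal (coneConst n) * volume Z
      = ∫⁻ _ in I, ENNReal.ofReal (a ^ n) * volume Z := by
        rw [setLIntegral_const, hI, coneConst, pow_succ, ENNReal.ofReal_mul (by positivity)]
        ring
    _ ≤ ∫⁻ t in I, volume (Prod.mk t ⁻¹' ((fun q : ℝ × (Fin n → ℝ) =>
          (WithLp.toLp 2 (i.insertNth q.1 q.2) : EuclideanSpace ℝ (Fin (n + 1)))) ⁻¹'
            (ball 0 1 ∩ normalize ⁻¹' S))) := by
        refine setLIntegral_mono' hIm fun t ht => ?_
        have ht0 : 0 < ε * t := ha.trans ht.1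
        calc ENNReal.ofReal (a ^ n) * volume Z
            ≤ ENNReal.ofReal |(((ε * t)⁻¹) ^ Module.finrank ℝ (Fin n → ℝ))⁻¹| * volume Z := by
              rw [Module.finrank_fin_fun, ← inv_pow, inv_inv, abs_of_pos (by positivity)]
              gcongr
              exact ht.1.le
          _ = volume ((fun w => (ε * t)⁻¹ • w) ⁻¹' Z) :=
              (Measure.addHaar_preimage_smul volume (inv_ne_zero ht0.ne') Z).symm
          _ ≤ _ := by
              refine measure_mono fun w hw => ?_
              rw [mem_preimage, mem_preimage, toLp_insertNth_eq hε ht0]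
              refine smul_lift_mem hε hS ht0 (ht.2.trans_eq ?_) hw
              simp only [a]
              ring
    _ ≤ _ := setLIntegral_le_lintegral _ _

lemma sphereMeasure_chart_le (hε : ε ^ 2 = 1) {S : Set (EuclideanSpace ℝ (Fin (n + 1)))}
    (hS : S ⊆ chart i ε) (hSm : MeasurableSet S) :
    μH[(n : ℝ)] S ≤ ENNReal.ofReal (surfConst n / coneConst n) * coneMeasure n S := by
  have h0 := coneConst_pos n
  have h1 : volume ((waves i ε).p '' S) ≤ ENNReal.ofReal (coneConst n)⁻¹ * coneMeasure n S := by
    calc volume ((waves i ε).p '' S)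
        = ENNReal.ofReal (coneConst n)⁻¹ *
          (ENNReal.ofReal (coneConst n) * volume ((waves i ε).p '' S)) := by
          rw [← mul_assoc, ← ENNReal.ofReal_mul (by positivity), inv_mul_cancel₀ h0.ne',
            ENNReal.ofReal_one, one_mul]
      _ ≤ _ := by
          gcongr
          exact volume_image_le hε hS hSm
  refine (hausdorffMeasure_le hε hS).trans ?_
  have h2 : (((2 * NNReal.sqrt n : NNReal) : ℝ≥0∞)) ^ (n : ℝ) = ENNReal.ofReal (surfConst n) := by
    rw [ENNReal.rpow_natCast, ← ENNReal.ofReal_coe_nnreal, ← ENNReal.ofReal_pow (NNReal.coe_nonneg _)]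
    simp [surfConst]
  rw [h2, div_eq_mul_inv, ENNReal.ofReal_mul (surfConst_nonneg n), mul_assoc]
  gcongr

/-- Integrals over the sphere are controlled by integrals over the ball. -/
lemma integral_sphere_le_ball {f : EuclideanSpace ℝ (Fin (n + 1)) → ℝ} (hf0 : ∀ x, 0 ≤ f x)
    (hf : Continuous f) {B : ℝ} (hB : ∀ x, f x ≤ B) :
    ∫ ω, f ω ∂sphereMeasure (n + 1) ≤ 2 * (n + 1) * (surfConst n / coneConst n) *
      ∫ x in ball 0 1, f (normalize x) := by
  have hb : ∀ x, ‖f x‖ ≤ B := fun x => by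
    rw [Real.norm_of_nonneg (hf0 x)]
    exact hB x
  rw [mul_assoc]
  refine integral_sphere_le hf0 (Integrable.of_bound (C := B) hf.aestronglyMeasurable
    (Eventually.of_forall hb)) fun i ε hε => ?_
  have h1 : (μH[(n : ℝ)]).restrict (chart i ε) ≤
      ENNReal.ofReal (surfConst n / coneConst n) • coneMeasure n := by
    refine Measure.le_iff.2 fun S hS => ?_
    rw [Measure.restrict_apply hS, Measure.smul_apply, smul_eq_mul]
    refine (sphereMeasure_chart_le hε inter_subset_right
      (hS.inter (isClosed_chart i ε).measurableSet)).trans ?_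
    gcongr
    exact inter_subset_left
  have h2 : Integrable f (ENNReal.ofReal (surfConst n / coneConst n) • coneMeasure n) :=
    (Integrable.of_bound (C := B) hf.aestronglyMeasurable (Eventually.of_forall hb)).smul_measure
      ENNReal.ofReal_ne_top
  refine (integral_mono_measure h1 (Eventually.of_forall hf0) h2).trans_eq ?_
  have h3 : 0 ≤ surfConst n / coneConst n :=
    div_nonneg (surfConst_nonneg n) (coneConst_pos n).le
  rw [integral_smul_measure, ENNReal.toReal_ofReal h3, smul_eq_mul, coneMeasure,
    integral_map measurable_normalize.aemeasurable hf.aestronglyMeasurable]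

end SphereChart

namespace SphereChart

open Oscillatory

/-- The integrand of the kernel as a function of the distances along and from an axis. -/
noncomputable def axial (l t r : ℝ) : ℂ :=
  if √(t ^ 2 + r ^ 2) < 1 then
    Complex.exp (((-(l * (t / √(t ^ 2 + r ^ 2))) : ℝ) : ℂ) * Complex.I) else 0

lemma norm_axial_le (l t r : ℝ) : ‖axial l t r‖ ≤ 1 := by
  unfold axial
  split_ifs
  · exact (Complex.norm_exp_ofReal_mul_I _).le
  · simp

lemma axial_eq_zero {l t r : ℝ} (h : ¬(|t| < 1 ∧ |r| < 1)) : axial l t r = 0 := by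
  refine if_neg fun h1 => h ?_
  have h2 : √(t ^ 2 + r ^ 2) ^ 2 < 1 := pow_lt_one₀ (Real.sqrt_nonneg _) h1 two_ne_zero
  rw [Real.sq_sqrt (by positivity)] at h2
  exact ⟨(sq_lt_one_iff_abs_lt_one t).1 (by nlinarith [sq_nonneg r]),
    (sq_lt_one_iff_abs_lt_one r).1 (by nlinarith [sq_nonneg t])⟩

lemma measurable_axial (l : ℝ) : Measurable fun q : ℝ × ℝ => axial l q.1 q.2 := by
  unfold axial
  refine Measurable.ite (measurableSet_lt (by fun_prop) (by fun_prop)) (by fun_prop) (by fun_prop)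

/-- The two-dimensional integral obtained from the kernel by rotational symmetry. -/
lemma integral_halfPlane (k : ℕ) (l : ℝ) :
    ∫ q : ℝ × ℝ, (Ioi (0 : ℝ)).indicator (fun r => ((r ^ k : ℝ) : ℂ) * axial l q.1 r) q.2 =
      (∫ ρ in Ioi (0 : ℝ), (Iio (1 : ℝ)).indicator (fun ρ => ((ρ ^ (k + 1) : ℝ) : ℂ)) ρ) *
        sinInt k l := by
  have hs : sinInt k l = ∫ θ in Ioo (-Real.pi) Real.pi,
      (Ioi (0 : ℝ)).indicator (fun θ => ((Real.sin θ ^ k : ℝ) : ℂ) * phase l θ) θ := by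
    rw [sinInt, intervalIntegral.integral_of_le Real.pi_pos.le, integral_Ioc_eq_integral_Ioo,
      setIntegral_indicator measurableSet_Ioi, Ioo_inter_Ioi, max_eq_right (by linarith [Real.pi_pos])]
  rw [hs, ← setIntegral_prod_mul, ← Measure.volume_eq_prod, ← integral_comp_polarCoord_symm,
    polarCoord_target]
  refine setIntegral_congr_fun (measurableSet_Ioi.prod measurableSet_Ioo) ?_
  rintro ⟨ρ, θ⟩ ⟨hρ, hθ⟩
  simp only [mem_Ioi, mem_Ioo] at hρ hθ
  have h1 : √((ρ * Real.cos θ) ^ 2 + (ρ * Real.sin θ) ^ 2) = ρ := by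
    rw [mul_pow, mul_pow, ← mul_add, Real.cos_sq_add_sin_sq, mul_one, Real.sqrt_sq hρ.le]
  simp only [polarCoord_symm_apply, axial]
  by_cases hθ0 : 0 < θ
  · have hsin : 0 < Real.sin θ := Real.sin_pos_of_pos_of_lt_pi hθ0 hθ.2
    rw [indicator_of_mem (mem_Ioi.2 (mul_pos hρ hsin)), indicator_of_mem (mem_Ioi.2 hθ0), h1]
    by_cases hρ1 : ρ < 1
    · rw [indicator_of_mem (mem_Iio.2 hρ1), if_pos hρ1, mul_div_cancel_left₀ _ hρ.ne', phase]
      simp only [Complex.real_smul]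
      push_cast
      ring
    · rw [indicator_of_notMem (s := Iio (1 : ℝ)) (a := ρ) (fun h => hρ1 h), if_neg hρ1]
      simp
  · have hsin : Real.sin θ ≤ 0 := Real.sin_nonpos_of_nonpos_of_neg_pi_le (not_lt.1 hθ0) hθ.1.le
    rw [indicator_of_notMem (s := Ioi (0 : ℝ)) (a := ρ * Real.sin θ)
      (fun h => absurd (mem_Ioi.1 h) (not_lt.2 (mul_nonpos_of_nonneg_of_nonpos hρ.le hsin))),
      indicator_of_notMem (s := Ioi (0 : ℝ)) (a := θ) (fun h => hθ0 h), smul_zero, mul_zero]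

lemma norm_radial_le (k : ℕ) :
    ‖∫ ρ in Ioi (0 : ℝ), (Iio (1 : ℝ)).indicator (fun ρ => ((ρ ^ (k + 1) : ℝ) : ℂ)) ρ‖ ≤ 1 := by
  rw [setIntegral_indicator measurableSet_Iio]
  refine (norm_setIntegral_le_of_norm_le_const (C := 1) ?_ ?_).trans_eq ?_
  · rw [Ioi_inter_Iio, Real.volume_Ioo]
    exact ENNReal.ofReal_lt_top
  · rintro ρ ⟨h0, h1⟩
    rw [Complex.norm_real, Real.norm_of_nonneg (pow_nonneg (le_of_lt h0) _)]
    exact pow_le_one₀ (le_of_lt h0) (le_of_lt h1)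
  · simp [Ioi_inter_Iio]

variable {n : ℕ}

/-- The Fourier transform of the cone measure. -/
noncomputable def kernel (v : EuclideanSpace ℝ (Fin (n + 1))) : ℂ :=
  ∫ x in ball 0 1, Complex.exp (((-⟪v, normalize x⟫_ℝ : ℝ) : ℂ) * Complex.I)

lemma norm_kernel_le (v : EuclideanSpace ℝ (Fin (n + 1))) :
    ‖kernel v‖ ≤ volume.real (ball (0 : EuclideanSpace ℝ (Fin (n + 1))) 1) := by
  refine (norm_setIntegral_le_of_norm_le_const (C := 1) measure_ball_lt_top
    fun x _ => (Complex.norm_exp_ofReal_mul_I _).le).trans_eq (one_mul _)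

lemma kernel_map (L : EuclideanSpace ℝ (Fin (n + 1)) ≃ₗᵢ[ℝ] EuclideanSpace ℝ (Fin (n + 1)))
    (v : EuclideanSpace ℝ (Fin (n + 1))) : kernel (L v) = kernel v := by
  rw [kernel, kernel, ← L.measurePreserving.setIntegral_preimage_emb
    L.toHomeomorph.measurableEmbedding]
  have : L ⁻¹' ball 0 1 = ball 0 1 := by
    ext x
    simp
  rw [this]
  congr 1
  ext x
  rw [normalize, L.norm_map, ← L.map_smul, L.inner_map_map, ← normalize]

lemma kernel_eq_of_norm_eq {v w : EuclideanSpace ℝ (Fin (n + 1))} (h : ‖v‖ = ‖w‖) :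
    kernel v = kernel w := by
  have := kernel_map ((ℝ ∙ (v - w))ᗮ.reflection) v
  rw [Submodule.reflection_sub h] at this
  exact this.symm

lemma integrable_axial (k : ℕ) (l : ℝ) :
    Integrable fun q : ℝ × ℝ => (Ioi (0 : ℝ)).indicator (fun r => ((r ^ k : ℝ) : ℂ) * axial l q.1 r) q.2 := by
  have hm : Measurable fun q : ℝ × ℝ =>
      (Ioi (0 : ℝ)).indicator (fun r => ((r ^ k : ℝ) : ℂ) * axial l q.1 r) q.2 := by
    have : (fun q : ℝ × ℝ => (Ioi (0 : ℝ)).indicator (fun r => ((r ^ k : ℝ) : ℂ) * axial l q.1 r) q.2) =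
        (Prod.snd ⁻¹' Ioi (0 : ℝ)).indicator fun q : ℝ × ℝ => ((q.2 ^ k : ℝ) : ℂ) * axial l q.1 q.2 := by
      ext q
      simp only [indicator, mem_preimage]
    rw [this]
    exact (Measurable.mul (by fun_prop) (measurable_axial l)).indicator (measurable_snd measurableSet_Ioi)
  rw [← integrableOn_iff_integrable_of_support_subset (s := Ioo (-1) 1 ×ˢ Ioo (-1) 1)]
  · refine IntegrableOn.of_bound (C := 1) ?_ hm.aestronglyMeasurable ?_
    · rw [Measure.volume_eq_prod, Measure.prod_prod, Real.volume_Ioo]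
      exact ENNReal.mul_lt_top ENNReal.ofReal_lt_top ENNReal.ofReal_lt_top
    · refine Eventually.of_forall fun q => ?_
      rw [indicator]
      split_ifs with h
      · by_cases h2 : |q.1| < 1 ∧ |q.2| < 1
        · rw [norm_mul, Complex.norm_real, norm_pow, Real.norm_eq_abs]
          exact mul_le_one₀ (pow_le_one₀ (abs_nonneg _) h2.2.le) (norm_nonneg _) (norm_axial_le _ _ _)
        · simp [axial_eq_zero h2]
      · simp
  · intro q hq
    by_contra h
    refine hq ?_
    have h2 : ¬(|q.1| < 1 ∧ |q.2| < 1) := by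
      rw [abs_lt, abs_lt]
      exact h
    simp [axial_eq_zero h2]

lemma kernel_single (k : ℕ) (l : ℝ) :
    kernel (EuclideanSpace.single (0 : Fin (k + 1 + 1)) l) =
      ((k + 1) * volume.real (ball (0 : EuclideanSpace ℝ (Fin (k + 1))) 1) : ℝ) *
      ((∫ ρ in Ioi (0 : ℝ), (Iio (1 : ℝ)).indicator (fun ρ => ((ρ ^ (k + 1) : ℝ) : ℂ)) ρ) *
        sinInt k l) := by
  have hmp := (measurePreserving_insertNth (0 : Fin (k + 1 + 1))).comp
    ((MeasurePreserving.id (volume : Measure ℝ)).prod (PiLp.volume_preserving_ofLp (Fin (k + 1))))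
  set Φ := _ ∘ Prod.map id (WithLp.ofLp (p := 2) (V := Fin (k + 1) → ℝ))
  have hn : ∀ q, ‖Φ q‖ = √(q.1 ^ 2 + ‖q.2‖ ^ 2) := fun q => by
    rw [EuclideanSpace.norm_eq, Fin.sum_univ_succAbove _ 0, EuclideanSpace.norm_sq_eq]
    simp [Φ]
  have h0 : ∀ q, Φ q 0 = q.1 := fun q => by simp [Φ]
  set F : EuclideanSpace ℝ (Fin (k + 1 + 1)) → ℂ := (ball 0 1).indicator fun x =>
    Complex.exp (((-⟪EuclideanSpace.single (0 : Fin (k + 1 + 1)) l, normalize x⟫_ℝ : ℝ) : ℂ) * Complex.I)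
  have hFm : Measurable F := Measurable.indicator (by fun_prop) measurableSet_ball
  have hFΦ : ∀ q, F (Φ q) = axial l q.1 ‖q.2‖ := fun q => by
    simp only [F, indicator, axial, mem_ball_zero_iff, hn, normalize, inner_smul_right,
      EuclideanSpace.inner_single_left, h0]
    congr 5
    simp
    ring
  have hFi : Integrable F := by
    refine (integrable_indicator_iff measurableSet_ball).2 ?_
    refine IntegrableOn.of_bound (C := 1) measure_ball_lt_top ?_ (Eventually.of_forall fun x =>
      (Complex.norm_exp_ofReal_mul_I _).le)
    exact Measurable.aestronglyMeasurable (by fun_prop)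
  have h1 : kernel (EuclideanSpace.single (0 : Fin (k + 1 + 1)) l) =
      ∫ q : ℝ × EuclideanSpace ℝ (Fin (k + 1)), axial l q.1 ‖q.2‖ := by
    rw [kernel, ← integral_indicator measurableSet_ball]
    simp only [← hFΦ]
    rw [Measure.volume_eq_prod, ← integral_map hmp.measurable.aemeasurable hFm.aestronglyMeasurable,
      hmp.map_eq]
  have hi : Integrable (fun q : ℝ × EuclideanSpace ℝ (Fin (k + 1)) => axial l q.1 ‖q.2‖)
      (volume.prod volume) := by
    simp only [← hFΦ]
    exact hmp.integrable_comp_of_integrable hFi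
  rw [h1, Measure.volume_eq_prod, integral_prod _ hi, ← integral_halfPlane, Measure.volume_eq_prod,
    integral_prod _ (integrable_axial k l), ← integral_const_mul]
  congr 1
  ext t
  dsimp only
  rw [integral_fun_norm_addHaar volume (axial l t), integral_indicator measurableSet_Ioi,
    finrank_euclideanSpace_fin, Nat.add_sub_cancel]
  simp only [nsmul_eq_mul, Complex.real_smul]
  push_cast
  ring

lemma exists_norm_kernel_le (k : ℕ) : ∃ C : ℝ, 0 ≤ C ∧
    ∀ v : EuclideanSpace ℝ (Fin (k + 1 + 1)), 1 ≤ ‖v‖ → ‖kernel v‖ ≤ C / √‖v‖ ^ (k + 1) := by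
  obtain ⟨C, hC, h⟩ := exists_norm_sinInt_le k
  refine ⟨(k + 1) * volume.real (ball (0 : EuclideanSpace ℝ (Fin (k + 1))) 1) * C, by positivity,
    fun v hv => ?_⟩
  rw [kernel_eq_of_norm_eq (w := EuclideanSpace.single (0 : Fin (k + 1 + 1)) ‖v‖) (by simp),
    kernel_single, norm_mul, norm_mul, Complex.norm_real, Real.norm_of_nonneg (by positivity),
    mul_div_assoc]
  refine mul_le_mul_of_nonneg_left ?_ (by positivity)
  exact (mul_le_of_le_one_left (norm_nonneg _) (norm_radial_le k)).trans (h _ hv).1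

end SphereChart

/-- A dyadic bound for a truncated power. -/
lemma max_rpow_neg_le_sum {s β : ℝ} (hβ : 0 ≤ β) {K : ℕ} (hs : s < 2 ^ K) :
    (max 1 s) ^ (-β) ≤ 2 ^ β * ∑ j ∈ Finset.range (K + 1),
      ((2 : ℝ) ^ j) ^ (-β) * (Iio ((2 : ℝ) ^ j)).indicator 1 s := by
  classical
  have hex : ∃ j : ℕ, s < 2 ^ j := ⟨K, hs⟩
  set j := Nat.find hex
  have hj : s < 2 ^ j := Nat.find_spec hex
  have hjK : j ∈ Finset.range (K + 1) := Finset.mem_range.2 (Nat.lt_succ_of_le (Nat.find_min' hex hs))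
  have h1 : ((2 : ℝ) ^ j) ^ (-β) ≤ ∑ j ∈ Finset.range (K + 1),
      ((2 : ℝ) ^ j) ^ (-β) * (Iio ((2 : ℝ) ^ j)).indicator 1 s := by
    refine le_trans ?_ (Finset.single_le_sum (f := fun j : ℕ =>
      ((2 : ℝ) ^ j) ^ (-β) * (Iio ((2 : ℝ) ^ j)).indicator 1 s)
      (fun i _ => mul_nonneg (by positivity) (indicator_nonneg (fun _ _ => zero_le_one) _)) hjK)
    simp only [indicator_of_mem (mem_Iio.2 hj), Pi.one_apply, mul_one]
    exact le_rfl
  refine le_trans ?_ (mul_le_mul_of_nonneg_left h1 (by positivity))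
  have h2 : (2 : ℝ) ^ j ≤ 2 * max 1 s := by
    rcases Nat.eq_zero_or_pos j with h0 | h0
    · rw [h0, pow_zero]
      linarith [le_max_left 1 s]
    · have := Nat.find_min hex (m := j - 1) (by omega)
      rw [not_lt] at this
      calc (2 : ℝ) ^ j = 2 * 2 ^ (j - 1) := by rw [← pow_succ', Nat.sub_add_cancel h0]
        _ ≤ _ := by linarith [le_max_right 1 s]
  have hm : 0 < max 1 s := lt_max_of_lt_left one_pos
  calc (max 1 s) ^ (-β) = 2 ^ β * (2 * max 1 s) ^ (-β) := by
        rw [Real.mul_rpow (by norm_num) hm.le, ← mul_assoc, ← Real.rpow_add (by norm_num)]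
        simp
    _ ≤ _ := by
        refine mul_le_mul_of_nonneg_left ?_ (by positivity)
        exact Real.rpow_le_rpow_of_nonpos (by positivity) h2 (by linarith)

/-- Truncated energy integrals of a Frostman measure. -/
lemma exists_integral_max_rpow_le {α β : ℝ} (hβ : 0 ≤ β) (hβα : β < α) : ∃ C : ℝ, 0 ≤ C ∧
    ∀ (d : ℕ) (μ : Measure (EuclideanSpace ℝ (Fin d))), IsAlphaDimensional d α μ →
    ∀ R : ℝ, 1 < R → ∀ x, ‖x‖ ≤ 1 →
      ∫ y, (max 1 (R * ‖x - y‖)) ^ (-β) ∂μ ≤ C * (cAlpha d α μ).toReal * R ^ (-β) := by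
  set q : ℝ := 2 ^ (α - β)
  have hq : 1 < q := Real.one_lt_rpow (by norm_num) (by linarith)
  have hq1 : 0 < q - 1 := by linarith
  refine ⟨2 ^ β * (q * 4 ^ (α - β) / (q - 1)), by positivity, fun d μ hμ R hR x hx => ?_⟩
  have hR0 : 0 < R := by linarith
  have := hμ.isFiniteMeasure
  set c := (cAlpha d α μ).toReal
  have hc : 0 ≤ c := ENNReal.toReal_nonneg
  obtain ⟨k, hk1, hk2⟩ := exists_nat_pow_near (x := 2 * R) (y := 2) (by linarith) one_lt_two
  set K := k + 1
  have hK : (2 : ℝ) ^ K ≤ 4 * R := by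
    rw [pow_succ]
    linarith
  have hball : ∀ j : ℕ, (fun y => (Iio ((2 : ℝ) ^ j)).indicator (1 : ℝ → ℝ) (R * ‖x - y‖)) =
      (ball x (2 ^ j / R)).indicator 1 := fun j => by
    ext y
    have : R * ‖x - y‖ ∈ Iio ((2 : ℝ) ^ j) ↔ y ∈ ball x (2 ^ j / R) := by
      rw [mem_ball, dist_comm, dist_eq_norm, mem_Iio, lt_div_iff₀ hR0, mul_comm]
    by_cases h : y ∈ ball x (2 ^ j / R)
    · rw [indicator_of_mem h, indicator_of_mem (this.2 h)]
      rfl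
    · rw [indicator_of_notMem h, indicator_of_notMem (fun h' => h (this.1 h'))]
  have hint : ∀ j ∈ Finset.range (K + 1), Integrable (fun y => ((2 : ℝ) ^ j) ^ (-β) *
      (Iio ((2 : ℝ) ^ j)).indicator 1 (R * ‖x - y‖)) μ := fun j _ => by
    refine Integrable.const_mul ?_ _
    rw [hball]
    exact (integrable_const (1 : ℝ)).indicator measurableSet_ball
  have hae : ∀ᵐ y ∂μ, ‖y‖ ≤ 1 := by
    refine mem_ae_iff.2 ?_
    convert hμ.1 using 2
    ext y
    simp
  calc ∫ y, (max 1 (R * ‖x - y‖)) ^ (-β) ∂μ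
      ≤ ∫ y, 2 ^ β * ∑ j ∈ Finset.range (K + 1), ((2 : ℝ) ^ j) ^ (-β) *
          (Iio ((2 : ℝ) ^ j)).indicator 1 (R * ‖x - y‖) ∂μ := by
        refine integral_mono_of_nonneg (Eventually.of_forall fun y => by positivity)
          ((integrable_finsetSum _ hint).const_mul _) ?_
        filter_upwards [hae] with y hy
        refine max_rpow_neg_le_sum hβ (lt_of_le_of_lt ?_ hk2)
        have := norm_sub_le x y
        nlinarith
    _ = 2 ^ β * ∑ j ∈ Finset.range (K + 1), ((2 : ℝ) ^ j) ^ (-β) * μ.real (ball x (2 ^ j / R)) := by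
        rw [integral_const_mul, integral_finsetSum _ hint]
        congr 1
        refine Finset.sum_congr rfl fun j _ => ?_
        rw [integral_const_mul, hball, integral_indicator_one measurableSet_ball]
    _ ≤ 2 ^ β * ∑ j ∈ Finset.range (K + 1), c * R ^ (-α) * q ^ j := by
        refine mul_le_mul_of_nonneg_left (Finset.sum_le_sum fun j _ => ?_) (by positivity)
        refine (mul_le_mul_of_nonneg_left (hμ.measureReal_ball_le x (r := 2 ^ j / R) (by positivity))
          (by positivity)).trans_eq ?_
        have h1 : q ^ j = ((2 : ℝ) ^ j) ^ α * ((2 : ℝ) ^ j) ^ (-β) := by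
          rw [← Real.rpow_add (by positivity), ← sub_eq_add_neg, ← Real.rpow_natCast,
            ← Real.rpow_natCast, ← Real.rpow_mul (by norm_num), ← Real.rpow_mul (by norm_num), mul_comm]
        rw [h1, Real.div_rpow (by positivity) hR0.le, Real.rpow_neg hR0.le]
        ring
    _ ≤ 2 ^ β * (c * R ^ (-α) * (q * (4 * R) ^ (α - β) / (q - 1))) := by
        rw [← Finset.mul_sum, geom_sum_eq hq.ne']
        gcongr
        have h2 : q ^ K ≤ (4 * R) ^ (α - β) := by
          have : q ^ K = ((2 : ℝ) ^ K) ^ (α - β) := by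
            rw [← Real.rpow_natCast, ← Real.rpow_natCast, ← Real.rpow_mul (by norm_num),
              ← Real.rpow_mul (by norm_num), mul_comm]
          rw [this]
          exact Real.rpow_le_rpow (by positivity) hK (by linarith)
        rw [pow_succ']
        nlinarith
    _ = _ := by
        rw [Real.mul_rpow (by norm_num) hR0.le]
        have : R ^ (-β) = R ^ (-α) * R ^ (α - β) := by
          rw [← Real.rpow_add hR0]
          ring_nf
        rw [this]
        ring

namespace SphereChart

variable {n : ℕ}

lemma norm_sq_charInt (μ : Measure (EuclideanSpace ℝ (Fin (n + 1)))) [IsFiniteMeasure μ]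
    (ξ : EuclideanSpace ℝ (Fin (n + 1))) :
    ((‖charInt μ ξ‖ ^ 2 : ℝ) : ℂ) =
      ∫ q, Complex.exp (((-⟪q.1 - q.2, ξ⟫_ℝ : ℝ) : ℂ) * Complex.I) ∂(μ.prod μ) := by
  rw [Complex.ofReal_pow, ← Complex.mul_conj', charInt, ← integral_conj, ← integral_prod_mul]
  congr 1
  ext q
  rw [← Complex.exp_conj, ← Complex.exp_add, inner_sub_left]
  congr 1
  simp only [map_mul, map_neg, Complex.conj_I, Complex.conj_ofReal]
  push_cast
  ring

lemma integral_ball_le (μ : Measure (EuclideanSpace ℝ (Fin (n + 1)))) [IsFiniteMeasure μ] (R : ℝ) :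
    ∫ x in ball 0 1, ‖charInt μ (R • normalize x)‖ ^ 2 ≤
      ∫ q, ‖kernel (R • (q.1 - q.2))‖ ∂(μ.prod μ) := by
  have hfin : IsFiniteMeasure (volume.restrict (ball (0 : EuclideanSpace ℝ (Fin (n + 1))) 1)) :=
    ⟨by rw [Measure.restrict_apply_univ]; exact measure_ball_lt_top⟩
  have hnonneg : 0 ≤ ∫ x in ball 0 1, ‖charInt μ (R • normalize x)‖ ^ 2 :=
    integral_nonneg fun x => sq_nonneg _
  have h1 : ((∫ x in ball 0 1, ‖charInt μ (R • normalize x)‖ ^ 2 : ℝ) : ℂ) =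
      ∫ q, kernel (R • (q.1 - q.2)) ∂(μ.prod μ) := by
    rw [← integral_complex_ofReal]
    simp only [norm_sq_charInt, kernel]
    rw [integral_integral_swap]
    · simp only [inner_smul_left, inner_smul_right]
      rfl
    · refine Integrable.of_bound (C := 1) ?_ (Eventually.of_forall fun x =>
        (Complex.norm_exp_ofReal_mul_I _).le)
      refine Measurable.aestronglyMeasurable ?_
      simp only [Function.uncurry_def]
      have : Measurable fun p : EuclideanSpace ℝ (Fin (n + 1)) ×
          (EuclideanSpace ℝ (Fin (n + 1)) × EuclideanSpace ℝ (Fin (n + 1))) =>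
            R • normalize p.1 := by fun_prop
      fun_prop
  have h2 := norm_integral_le_integral_norm (μ := μ.prod μ)
    fun q : EuclideanSpace ℝ (Fin (n + 1)) × EuclideanSpace ℝ (Fin (n + 1)) =>
      kernel (R • (q.1 - q.2))
  rwa [← h1, Complex.norm_real, Real.norm_of_nonneg hnonneg] at h2

lemma exists_norm_kernel_le_rpow (k : ℕ) {β : ℝ} (hβk : β ≤ (k + 1 : ℝ) / 2) :
    ∃ D : ℝ, 0 ≤ D ∧ ∀ v : EuclideanSpace ℝ (Fin (k + 1 + 1)),
      ‖kernel v‖ ≤ D * (max 1 ‖v‖) ^ (-β) := by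
  obtain ⟨C, hC, h⟩ := exists_norm_kernel_le k
  set V := volume.real (ball (0 : EuclideanSpace ℝ (Fin (k + 1 + 1))) 1)
  have hV : 0 ≤ V := measureReal_nonneg
  refine ⟨C + V, by positivity, fun v => ?_⟩
  rcases le_total ‖v‖ 1 with hv | hv
  · rw [max_eq_left hv, Real.one_rpow, mul_one]
    linarith [norm_kernel_le v]
  · have hv0 : 0 < ‖v‖ := by linarith
    rw [max_eq_right hv]
    refine (h v hv).trans ?_
    have e : √‖v‖ ^ (k + 1) = ‖v‖ ^ ((k + 1 : ℝ) / 2) := by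
      rw [Real.sqrt_eq_rpow, ← Real.rpow_natCast, ← Real.rpow_mul hv0.le]
      congr 1
      push_cast
      ring
    rw [e, div_eq_mul_inv, ← Real.rpow_neg hv0.le]
    refine mul_le_mul (by linarith) (Real.rpow_le_rpow_of_exponent_le hv (by linarith))
      (by positivity) (by positivity)

end SphereChart

/-- Decay from the stationary phase bound for the sphere. -/
lemma hasDecay_of_kernel (k : ℕ) {α β : ℝ} (hβ : 0 ≤ β) (hβα : β < α)
    (hβk : β ≤ (k + 1 : ℝ) / 2) : HasDecay (k + 1 + 1) α β := by
  obtain ⟨D, hD, hK⟩ := SphereChart.exists_norm_kernel_le_rpow k hβk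
  obtain ⟨C, hC, hE⟩ := exists_integral_max_rpow_le hβ hβα
  set A : ℝ := 2 * ((k + 1 : ℕ) + 1) * (SphereChart.surfConst (k + 1) / SphereChart.coneConst (k + 1))
  have hA : 0 ≤ A := by
    have := SphereChart.coneConst_pos (k + 1)
    have := SphereChart.surfConst_nonneg (k + 1)
    simp only [A]
    positivity
  refine ⟨A * (D * C), by positivity, fun μ hμ R hR => ?_⟩
  have := hμ.isFiniteMeasure
  have hR0 : 0 < R := by linarith
  have h1 := SphereChart.integral_sphere_le_ball (n := k + 1)
    (f := fun ω => ‖charInt μ (R • ω)‖ ^ 2) (fun ω => sq_nonneg _)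
    (((continuous_charInt μ).comp (continuous_const_smul R)).norm.pow 2)
    (fun ω => pow_le_pow_left₀ (norm_nonneg _) (norm_charInt_le μ (R • ω)) 2)
  refine h1.trans ?_
  have hm : Continuous fun q : EuclideanSpace ℝ (Fin (k + 1 + 1)) ×
      EuclideanSpace ℝ (Fin (k + 1 + 1)) => D * (max 1 (R * ‖q.1 - q.2‖)) ^ (-β) := by
    refine continuous_const.mul (Continuous.rpow_const (by fun_prop) fun q => Or.inl ?_)
    exact (lt_max_of_lt_left one_pos).ne'
  have hi : Integrable (fun q : EuclideanSpace ℝ (Fin (k + 1 + 1)) ×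
      EuclideanSpace ℝ (Fin (k + 1 + 1)) => D * (max 1 (R * ‖q.1 - q.2‖)) ^ (-β)) (μ.prod μ) := by
    refine Integrable.of_bound (C := D) hm.aestronglyMeasurable (Eventually.of_forall fun q => ?_)
    rw [Real.norm_of_nonneg (by positivity)]
    exact mul_le_of_le_one_right hD
      (Real.rpow_le_one_of_one_le_of_nonpos (le_max_left _ _) (by linarith))
  have hae : ∀ᵐ x ∂μ, ‖x‖ ≤ 1 := by
    refine mem_ae_iff.2 ?_
    convert hμ.1 using 2
    ext y
    simp
  have h2 : ∫ x in ball 0 1, ‖charInt μ (R • SphereChart.normalize x)‖ ^ 2 ≤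
      D * (C * (cAlpha (k + 1 + 1) α μ).toReal * R ^ (-β)) * μ.real univ := by
    calc _ ≤ _ := SphereChart.integral_ball_le μ R
      _ ≤ ∫ q, D * (max 1 (R * ‖q.1 - q.2‖)) ^ (-β) ∂(μ.prod μ) := by
          refine integral_mono_of_nonneg (Eventually.of_forall fun q => norm_nonneg _) hi
            (Eventually.of_forall fun q => ?_)
          refine (hK _).trans_eq ?_
          rw [norm_smul, Real.norm_of_nonneg hR0.le]
      _ = ∫ x, D * ∫ y, (max 1 (R * ‖x - y‖)) ^ (-β) ∂μ ∂μ := by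
          rw [integral_prod _ hi]
          simp only [integral_const_mul]
      _ ≤ ∫ _, D * (C * (cAlpha (k + 1 + 1) α μ).toReal * R ^ (-β)) ∂μ := by
          refine integral_mono_of_nonneg (Eventually.of_forall fun x => ?_) (integrable_const _) ?_
          · exact mul_nonneg hD (integral_nonneg fun y => by positivity)
          · filter_upwards [hae] with x hx
            exact mul_le_mul_of_nonneg_left (hE _ μ hμ R hR x hx) hD
      _ = _ := by rw [integral_const, smul_eq_mul, mul_comm]
  refine (mul_le_mul_of_nonneg_left h2 hA).trans_eq ?_
  ring

lemma HasDecay.mono {d : ℕ} {α δ δ' : ℝ} (h : HasDecay d α δ) (hδ : δ' ≤ δ) : HasDecay d α δ' := by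
  obtain ⟨C, hC, h⟩ := h
  refine ⟨C, hC, fun μ hμ R hR => (h μ hμ R hR).trans ?_⟩
  refine mul_le_mul_of_nonneg_left ?_ (by positivity)
  exact Real.rpow_le_rpow_of_exponent_le hR.le (by linarith)

/-- The decay exponents resulting from the multilinear estimate of full order. -/
lemma hasDecay_of_lt {n : ℕ} (hn : 1 ≤ n) {α β : ℝ} (hα : 0 ≤ α) (hαn : α ≤ n + 1)
    (h1 : β < α - 1 + (n + 1 - α) / (2 * n)) (h2 : β < α - α / (n + 1)) :
    HasDecay (n + 1) α β := by
  have hn0 : (0 : ℝ) < n := by exact_mod_cast hn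
  have hγ2 : α / (n + 1) < α - β := by linarith
  have hγ0 : 0 ≤ α / ((n : ℝ) + 1) := by positivity
  have hθ : ∃ θ : ℝ, 1 / (n + 1 : ℝ) ≤ θ ∧ θ < 1 / n ∧ 2 - θ * (n + 1 - α) < 2 * (α - β) := by
    have h3 : 1 / (n + 1 : ℝ) < 1 / n := one_div_lt_one_div_of_lt hn0 (by linarith)
    rcases hαn.eq_or_lt with rfl | hlt
    · rw [div_self (by positivity)] at hγ2
      exact ⟨1 / (n + 1), le_rfl, h3, by rw [sub_self, mul_zero]; linarith⟩
    · have hpos : 0 < n + 1 - α := by linarith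
      have h4 : (2 - 2 * (α - β)) / (n + 1 - α) < 1 / n := by
        rw [div_lt_div_iff₀ hpos hn0]
        have : β - (α - 1) < (n + 1 - α) / (2 * n) := by linarith
        rw [lt_div_iff₀ (by positivity)] at this
        linarith
      obtain ⟨θ, hθ1, hθ2⟩ := exists_between (max_lt h3 h4)
      refine ⟨θ, (le_max_left _ _).trans hθ1.le, hθ2, ?_⟩
      have := (le_max_right _ _).trans_lt hθ1
      rw [div_lt_iff₀ hpos] at this
      linarith
  obtain ⟨θ, hθ1, hθ2, hθ3⟩ := hθ
  have := hasDecay_of_multilinear hn hα (by linarith : 0 ≤ α - β) hθ1 hθ2 hθ3 hγ2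
  rwa [sub_sub_cancel] at this

lemma two_mul_le_of_lt {n m α : ℝ} (hm : 3 ≤ m) (hmn : m ≤ n)
    (h : (m - 1) * (2 * m - α - 1) < 2 * n * (m - α)) : 2 * α * (m - 1) ≤ n * m := by
  have hP : 0 < 2 * n - m + 1 := by linarith
  have h1 : α * (2 * n - m + 1) ≤ 2 * n * m - (m - 1) * (2 * m - 1) := by linarith
  have h2 : 0 ≤ m * (n * m * (2 * n - m + 1) -
      2 * (m - 1) * (2 * n * m - (m - 1) * (2 * m - 1))) := by
    have h3 : 0 ≤ m * (m - 1) ^ 2 * (7 * m - 16) :=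
      mul_nonneg (by positivity) (by linarith)
    linarith [sq_nonneg (4 * m * n - 5 * m * (m - 1))]
  have h4 := nonneg_of_mul_nonneg_right h2 (by linarith)
  have h5 := mul_le_mul_of_nonneg_left h1 (by linarith : 0 ≤ 2 * (m - 1))
  refine le_of_mul_le_mul_right ?_ hP
  linarith

lemma hasDecay_of_partial {n m : ℕ} (hm : 3 ≤ m) (hmn : m ≤ n) {α β : ℝ} (hα0 : 0 < α)
    (hαn : α ≤ n + 1)
    (hT : β < α - 1 + (n + 1 - α) * (m - α) / ((m - 1) * (2 * m - α - 1)))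
    (hB : β < α - α / m) : HasDecay (n + 1) α β := by
  have hm' : (3 : ℝ) ≤ m := by exact_mod_cast hm
  have hmn' : (m : ℝ) ≤ n := by exact_mod_cast hmn
  have hn0 : (0 : ℝ) < n := by linarith
  have hBn : β < α - α / (n + 1) := by
    refine hB.trans_le (sub_le_sub_left ?_ _)
    exact div_le_div_of_nonneg_left hα0.le (by linarith) (by linarith)
  have hnα : 0 ≤ n + 1 - α := by linarith
  rcases le_or_gt (m : ℝ) α with hmα | hαm
  · refine hasDecay_of_lt (by omega) hα0.le hαn ?_ hBn
    have h1 : 1 ≤ α / m := (one_le_div (by linarith)).2 hmα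
    have h2 : 0 ≤ (n + 1 - α) / (2 * n) := by positivity
    linarith
  have hden : 0 < (m - 1) * (2 * m - α - 1) := mul_pos (by linarith) (by linarith)
  rcases le_or_gt (2 * n * (m - α)) ((m - 1) * (2 * m - α - 1)) with h | h
  · refine hasDecay_of_lt (by omega) hα0.le hαn (hT.trans_le ?_) hBn
    gcongr α - 1 + ?_
    rw [div_le_div_iff₀ hden (by positivity)]
    calc (n + 1 - α) * (m - α) * (2 * n) = (n + 1 - α) * (2 * n * (m - α)) := by ring
      _ ≤ _ := by gcongr
  · have h1 := two_mul_le_of_lt hm' hmn' h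
    have hβα : max β 0 < α := max_lt (hB.trans_le (sub_le_self _ (by positivity))) hα0
    obtain ⟨k, rfl⟩ : ∃ k, n = k + 1 := ⟨n - 1, by omega⟩
    refine (hasDecay_of_kernel k (le_max_right β 0) hβα (max_le (hB.le.trans ?_)
      (by positivity))).mono (le_max_left _ _)
    push_cast at h1
    have h2 : α - α / m = 2 * α * (m - 1) / (2 * m) := by
      field_simp
    rw [h2, div_le_div_iff₀ (by positivity) (by positivity)]
    linarith

lemma exists_of_hasDecay {n : ℕ} {α β : ℝ} (h : HasDecay (n + 1) α β) :
    ∃ C : ℝ, 0 < C ∧ ∀ μ : Measure (EuclideanSpace ℝ (Fin (n + 1))),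
      IsAlphaDimensional (n + 1) α μ → ∀ R : ℝ, 1 < R →
        ∫ ω, ‖fourierMeasure μ (R • ω)‖ ^ 2 ∂(sphereMeasure (n + 1)) ≤
          C * (cAlpha (n + 1) α μ).toReal * (μ univ).toReal * R ^ (-β) := by
  obtain ⟨C, hC, h⟩ := h
  refine ⟨C + 1, by positivity, fun μ hμ R hR => ?_⟩
  have := hμ.isFiniteMeasure
  have hc : 0 ≤ (cAlpha (n + 1) α μ).toReal := ENNReal.toReal_nonneg
  have hcont : Continuous fun ω => ‖charInt μ (R • ω)‖ ^ 2 :=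
    ((continuous_charInt μ).comp (continuous_const_smul R)).norm.pow 2
  calc ∫ ω, ‖fourierMeasure μ (R • ω)‖ ^ 2 ∂(sphereMeasure (n + 1))
      ≤ ∫ ω, ‖charInt μ (R • ω)‖ ^ 2 ∂(sphereMeasure (n + 1)) := by
        refine integral_mono_of_nonneg (Eventually.of_forall fun ω => sq_nonneg _)
          (Integrable.of_bound (C := μ.real univ ^ 2) hcont.aestronglyMeasurable
            (Eventually.of_forall fun ω => ?_)) (Eventually.of_forall fun ω =>
              pow_le_pow_left₀ (norm_nonneg _) (norm_fourierMeasure_le μ _) 2)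
        rw [norm_pow, norm_norm]
        exact pow_le_pow_left₀ (norm_nonneg _) (norm_charInt_le μ _) 2
    _ ≤ _ := h μ hμ R hR
    _ ≤ _ := by
        rw [measureReal_def]
        have : 0 < R ^ (-β) := Real.rpow_pos_of_pos (by linarith) _
        gcongr
        linarith

theorem stmt17 (d m : ℕ) (hd : 4 ≤ d) (hm3 : 3 ≤ m) (hmd : m ≤ d - 1)
    (α : ℝ) (hα0 : 0 < α) (hαd : α ≤ d) (β : ℝ)
    (hβ : β < min (α - 1 + ((d : ℝ) - α) * ((m : ℝ) - α) /
        (((m : ℝ) - 1) * (2 * m - α - 1))) (α - α / m)) :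
    ∃ C : ℝ, 0 < C ∧ ∀ μ : Measure (EuclideanSpace ℝ (Fin d)), IsAlphaDimensional d α μ →
      ∀ R : ℝ, 1 < R →
        ∫ ω, ‖fourierMeasure μ (R • ω)‖ ^ 2 ∂(sphereMeasure d)
          ≤ C * (cAlpha d α μ).toReal * (μ univ).toReal * R ^ (-β) := by
  obtain ⟨n, rfl⟩ : ∃ n, d = n + 1 := ⟨d - 1, by omega⟩
  obtain ⟨hT, hB⟩ := lt_min_iff.1 hβ
  push_cast at hT hαd
  exact exists_of_hasDecay (hasDecay_of_partial hm3 (by omega) hα0 hαd hT hB)
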